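/- A comparison-type result for approximated classical solutions: let A satisfy (A1)–(A4), H satisfy (H3)–(H4), and let g¹, g² ∈ C^∞(ℝ^d) ∩ W^{2,∞}(ℝ^d). Then there exists a pair u¹, u² ∈ C^{1,2}((0,T)×ℝ^d) ∩ C_b([0,T]×ℝ^d) of classical solutions of ∂_t u − tr(A(x) D_x² u) + H(x, D_x u) = 0 in (0,T)×ℝ^d with u^i(0,·) = g^i on ℝ^d for i ∈ {1,2}, satisfying ‖u¹ − u²‖_{L^∞([0,T]×ℝ^d)} ≤ ‖g¹ − g²‖_{L^∞(ℝ^d)}. -/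

import Mathlib

open Set Metric Filter
open scoped ENNReal NNReal RealInnerProductSpace

noncomputable section

abbrev Euc (d : ℕ) := EuclideanSpace ℝ (Fin d)

/-- Time partial derivative `∂_t u (t,x)`. -/
def timeDeriv (d : ℕ) (u : ℝ × Euc d → ℝ) (t : ℝ) (x : Euc d) : ℝ :=
  deriv (fun s => u (s, x)) t

/-- Spatial partial derivative `∂_{x_i} u (t,x)`. -/
def spacePartial (d : ℕ) (i : Fin d) (u : ℝ × Euc d → ℝ) (t : ℝ) (x : Euc d) : ℝ :=
  fderiv ℝ (fun y => u (t, y)) x (EuclideanSpace.single i 1)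

/-- Spatial gradient `D_x u (t,x)`. -/
def spaceGrad (d : ℕ) (u : ℝ × Euc d → ℝ) (t : ℝ) (x : Euc d) : Euc d :=
  (EuclideanSpace.equiv (Fin d) ℝ).symm (fun i => spacePartial d i u t x)

/-- Spatial Hessian matrix `D_x² u (t,x)`. -/
def spaceHessian (d : ℕ) (u : ℝ × Euc d → ℝ) (t : ℝ) (x : Euc d) :
    Matrix (Fin d) (Fin d) ℝ :=
  Matrix.of fun i j => spacePartial d i (fun p => spacePartial d j u p.1 p.2) t x

/-- The quasilinear parabolic operator `∂_t u - tr(A(x) D_x² u) + H(x, D_x u)`. -/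
def parabolicOp (d : ℕ) (A : Euc d → Matrix (Fin d) (Fin d) ℝ) (H : Euc d → Euc d → ℝ)
    (u : ℝ × Euc d → ℝ) (t : ℝ) (x : Euc d) : ℝ :=
  timeDeriv d u t x - Matrix.trace (A x * spaceHessian d u t x) + H x (spaceGrad d u t x)

/-- Viscosity subsolution of `∂_t u - tr(A(x) D_x² u) + H(x, D_x u) = 0` in `(0,T) × U`. -/
def IsViscSubsolution (d : ℕ) (A : Euc d → Matrix (Fin d) (Fin d) ℝ)
    (H : Euc d → Euc d → ℝ) (T : ℝ) (U : Set (Euc d)) (v : ℝ × Euc d → ℝ) : Prop :=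
  ∀ φ : ℝ × Euc d → ℝ, ContDiff ℝ 2 φ → ∀ t₀ ∈ Ioo (0 : ℝ) T, ∀ x₀ ∈ U,
    IsLocalMaxOn (fun p => v p - φ p) (Ioo 0 T ×ˢ U) (t₀, x₀) →
    parabolicOp d A H φ t₀ x₀ ≤ 0

/-- Viscosity supersolution of `∂_t u - tr(A(x) D_x² u) + H(x, D_x u) = 0` in `(0,T) × U`. -/
def IsViscSupersolution (d : ℕ) (A : Euc d → Matrix (Fin d) (Fin d) ℝ)
    (H : Euc d → Euc d → ℝ) (T : ℝ) (U : Set (Euc d)) (w : ℝ × Euc d → ℝ) : Prop :=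
  ∀ φ : ℝ × Euc d → ℝ, ContDiff ℝ 2 φ → ∀ t₀ ∈ Ioo (0 : ℝ) T, ∀ x₀ ∈ U,
    IsLocalMinOn (fun p => w p - φ p) (Ioo 0 T ×ˢ U) (t₀, x₀) →
    0 ≤ parabolicOp d A H φ t₀ x₀

/-- Frobenius norm of a real matrix. -/
def matFrobNorm {k l : ℕ} (Mm : Matrix (Fin k) (Fin l) ℝ) : ℝ :=
  Real.sqrt (∑ i, ∑ j, (Mm i j) ^ 2)

/-- Conditions (A1)–(A2): `A = σ σᵀ` with `σ` bounded and Lipschitz with constant `Λ_A`. -/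
def CondA (d : ℕ) (ΛA : ℝ) (A : Euc d → Matrix (Fin d) (Fin d) ℝ) : Prop :=
  ∃ n : ℕ, ∃ σ : Euc d → Matrix (Fin d) (Fin n) ℝ,
    (∀ x, A x = σ x * (σ x).transpose) ∧
    (∀ x, matFrobNorm (σ x) ≤ ΛA) ∧
    (∀ x y, matFrobNorm (σ x - σ y) ≤ ΛA * ‖x - y‖)

/-- Condition (A3): entries of `A` are `C¹`. -/
def CondA3 (d : ℕ) (A : Euc d → Matrix (Fin d) (Fin d) ℝ) : Prop :=
  ∀ i j, ContDiff ℝ 1 (fun x : Euc d => A x i j)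

/-- Condition (A4): uniform ellipticity `⟨A(x)ξ, ξ⟩ ≥ λ|ξ|²`. -/
def CondA4 (d : ℕ) (lam : ℝ) (A : Euc d → Matrix (Fin d) (Fin d) ℝ) : Prop :=
  ∀ x ξ : Euc d, lam * ‖ξ‖ ^ 2 ≤ ∑ i, ∑ j, A x i j * ξ j * ξ i

/-- Condition (H3). -/
def CondH3 (d : ℕ) (m Λ : ℝ) (H : Euc d → Euc d → ℝ) : Prop :=
  ∀ x p q : Euc d, |H x p - H x q| ≤ Λ * (‖p‖ + ‖q‖ + 1) ^ (m - 1) * ‖p - q‖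

/-- Condition (H4) with parameter `μ`. -/
def CondH4 (d : ℕ) (m Λ μ : ℝ) (a M : ℝ → ℝ) (H : Euc d → Euc d → ℝ) : Prop :=
  ∀ r : ℝ, 0 < r →
    (a r ∈ Ioc (0 : ℝ) 1 ∧ 1 ≤ M r) ∧
    (∀ x ∈ ball (0 : Euc d) r, ∀ p : Euc d,
      max (-μ) (a r * ‖p‖ ^ m - M r) ≤ H x p ∧ H x p ≤ Λ * (‖p‖ ^ m + 1)) ∧
    (∀ x ∈ ball (0 : Euc d) r, ∀ y ∈ ball (0 : Euc d) r, ∀ p : Euc d,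
      |H x p - H y p| ≤ (Λ * ‖p‖ ^ m + M r) * ‖x - y‖)

/-- Condition (H4) with `μ = +∞`. -/
def CondH4top (d : ℕ) (m Λ : ℝ) (a M : ℝ → ℝ) (H : Euc d → Euc d → ℝ) : Prop :=
  ∀ r : ℝ, 0 < r →
    (a r ∈ Ioc (0 : ℝ) 1 ∧ 1 ≤ M r) ∧
    (∀ x ∈ ball (0 : Euc d) r, ∀ p : Euc d,
      a r * ‖p‖ ^ m - M r ≤ H x p ∧ H x p ≤ Λ * (‖p‖ ^ m + 1)) ∧
    (∀ x ∈ ball (0 : Euc d) r, ∀ y ∈ ball (0 : Euc d) r, ∀ p : Euc d,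
      |H x p - H y p| ≤ (Λ * ‖p‖ ^ m + M r) * ‖x - y‖)

/-- `limsup_{|x|→∞, x∈U} sup_{t∈[0,T]} v(t,x)/(1+|x|) ≤ 0`. -/
def SublinearAbove (d : ℕ) (T : ℝ) (U : Set (Euc d)) (v : ℝ × Euc d → ℝ) : Prop :=
  ∀ ε : ℝ, 0 < ε → ∃ R : ℝ, ∀ x ∈ U, R ≤ ‖x‖ → ∀ t ∈ Icc (0 : ℝ) T, v (t, x) ≤ ε * (1 + ‖x‖)

/-- `liminf_{|x|→∞, x∈U} inf_{t∈[0,T]} w(t,x)/(1+|x|) ≥ 0`. -/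
def SublinearBelow (d : ℕ) (T : ℝ) (U : Set (Euc d)) (w : ℝ × Euc d → ℝ) : Prop :=
  ∀ ε : ℝ, 0 < ε → ∃ R : ℝ, ∀ x ∈ U, R ≤ ‖x‖ → ∀ t ∈ Icc (0 : ℝ) T, -(ε * (1 + ‖x‖)) ≤ w (t, x)

/-- Parabolic boundary `({0} × U) ∪ ([0,T) × ∂U)`. -/
def parabolicBoundary (d : ℕ) (T : ℝ) (U : Set (Euc d)) : Set (ℝ × Euc d) :=
  ({0} ×ˢ U) ∪ (Ico 0 T ×ˢ frontier U)

/-- `u` is a classical solution on `(0,T) × ℝ^d`: it belongs to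
`C^{1,2}((0,T)×ℝ^d) ∩ C([0,T]×ℝ^d)` and solves the equation pointwise. -/
def IsClassicalSolution (d : ℕ) (A : Euc d → Matrix (Fin d) (Fin d) ℝ)
    (H : Euc d → Euc d → ℝ) (T : ℝ) (u : ℝ × Euc d → ℝ) : Prop :=
  ContinuousOn u (Icc 0 T ×ˢ (univ : Set (Euc d))) ∧
  (∀ t ∈ Ioo (0 : ℝ) T, ∀ x : Euc d,
    DifferentiableAt ℝ (fun s => u (s, x)) t ∧
    DifferentiableAt ℝ (fun y => u (t, y)) x ∧
    (∀ j, DifferentiableAt ℝ (fun y => spacePartial d j u t y) x) ∧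
    parabolicOp d A H u t x = 0) ∧
  ContinuousOn (fun p : ℝ × Euc d => timeDeriv d u p.1 p.2)
    (Ioo 0 T ×ˢ (univ : Set (Euc d))) ∧
  (∀ i, ContinuousOn (fun p : ℝ × Euc d => spacePartial d i u p.1 p.2)
    (Ioo 0 T ×ˢ (univ : Set (Euc d)))) ∧
  (∀ i j, ContinuousOn (fun p : ℝ × Euc d => spaceHessian d u p.1 p.2 i j)
    (Ioo 0 T ×ˢ (univ : Set (Euc d))))

/-- coefficient data used throughout -/
structure Coef (d : ℕ) (A B : Euc d → Matrix (Fin d) (Fin d) ℝ) (K c0 : ℝ) : Prop where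
  K1 : 1 ≤ K
  c0pos : 0 < c0
  Asymm : ∀ x i j, A x i j = A x j i
  Abd : ∀ x i j, |A x i j| ≤ K
  Alip : ∀ x y i j, |A x i j - A y i j| ≤ K * ‖x - y‖
  AC1 : ∀ i j, ContDiff ℝ 1 (fun x => A x i j)
  AB : ∀ x, A x * B x = 1
  Bsymm : ∀ x i j, B x i j = B x j i
  Bbd : ∀ x i j, |B x i j| ≤ K
  Blip : ∀ x y i j, |B x i j - B y i j| ≤ K * ‖x - y‖
  Bq : ∀ x (z : Euc d), c0 * ‖z‖ ^ 2 ≤ ∑ i, ∑ j, B x i j * z i * z j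
  Aq : ∀ x (z : Fin d → ℝ), 0 ≤ ∑ i, ∑ j, A x i j * z i * z j

lemma abs_coord_le {d : ℕ} (z : Euc d) (i : Fin d) : |z i| ≤ ‖z‖ := by
  simpa using PiLp.norm_apply_le z i

lemma matFrob_entry {k l : ℕ} (S : Matrix (Fin k) (Fin l) ℝ) (i : Fin k) (j : Fin l) :
    |S i j| ≤ matFrobNorm S := by
  unfold matFrobNorm
  apply Real.le_sqrt_of_sq_le
  rw [sq_abs]
  calc S i j ^ 2 ≤ ∑ j', S i j' ^ 2 :=
        Finset.single_le_sum (f := fun j' => S i j' ^ 2) (fun _ _ => sq_nonneg _) (Finset.mem_univ j)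
    _ ≤ _ := Finset.single_le_sum (f := fun i' => ∑ j', S i' j' ^ 2)
        (fun _ _ => Finset.sum_nonneg fun _ _ => sq_nonneg _) (Finset.mem_univ i)

lemma abs_sum_le_card {n : ℕ} (f : Fin n → ℝ) (b : ℝ) (h : ∀ i, |f i| ≤ b) :
    |∑ i, f i| ≤ n * b := by
  calc |∑ i, f i| ≤ ∑ i, |f i| := Finset.abs_sum_le_sum_abs _ _
    _ ≤ ∑ _i : Fin n, b := Finset.sum_le_sum fun i _ => h i
    _ = n * b := by simp

lemma quad_comm {d : ℕ} (M : Matrix (Fin d) (Fin d) ℝ) (z : Fin d → ℝ) :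
    ∑ i, ∑ j, M i j * z i * z j = z ⬝ᵥ (M.mulVec z) := by
  simp only [dotProduct, Matrix.mulVec, Finset.mul_sum]
  refine Finset.sum_congr rfl fun i _ => Finset.sum_congr rfl fun j _ => by ring

lemma exists_coef {d : ℕ} (hd : 0 < d) {ΛA lam : ℝ} (hΛA : 0 < ΛA) (hlam : 0 < lam)
    {A : Euc d → Matrix (Fin d) (Fin d) ℝ}
    (hA : CondA d ΛA A) (hA3 : CondA3 d A) (hA4 : CondA4 d lam A) :
    ∃ B K c0, Coef d A B K c0 := by
  obtain ⟨n, σ, hσ, hb, hl⟩ := hA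
  have hA4' : ∀ x (z : Fin d → ℝ), lam * ∑ i, z i ^ 2 ≤ z ⬝ᵥ ((A x).mulVec z) := by
    intro x z
    have := hA4 x (WithLp.toLp 2 z)
    rw [EuclideanSpace.real_norm_sq_eq] at this
    rw [← quad_comm]
    refine this.trans (le_of_eq ?_)
    refine Finset.sum_congr rfl fun i _ => Finset.sum_congr rfl fun j _ => by simp; ring
  have hAij : ∀ x i j, A x i j = ∑ k, σ x i k * σ x j k := by
    intro x i j; rw [hσ x]; simp [Matrix.mul_apply]
  have hs : ∀ x i k, |σ x i k| ≤ ΛA := fun x i k => (matFrob_entry _ i k).trans (hb x)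
  have hsl : ∀ x y i k, |σ x i k - σ y i k| ≤ ΛA * ‖x - y‖ := fun x y i k =>
    (matFrob_entry (σ x - σ y) i k).trans (hl x y)
  have hAbd : ∀ x i j, |A x i j| ≤ n * (ΛA * ΛA) := by
    intro x i j
    rw [hAij]
    refine abs_sum_le_card _ _ fun k => ?_
    rw [abs_mul]
    exact mul_le_mul (hs _ _ _) (hs _ _ _) (abs_nonneg _) hΛA.le
  have hAlip : ∀ x y i j, |A x i j - A y i j| ≤ n * (2 * ΛA * ΛA) * ‖x - y‖ := by
    intro x y i j
    rw [hAij, hAij, ← Finset.sum_sub_distrib, mul_assoc]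
    refine abs_sum_le_card _ _ fun k => ?_
    have e : σ x i k * σ x j k - σ y i k * σ y j k
      = (σ x i k - σ y i k) * σ x j k + σ y i k * (σ x j k - σ y j k) := by ring
    rw [e]
    refine (abs_add_le _ _).trans ?_
    rw [abs_mul, abs_mul]
    have h1 := mul_le_mul (hsl x y i k) (hs x j k) (abs_nonneg _) (by positivity)
    have h2 := mul_le_mul (hs y i k) (hsl x y j k) (abs_nonneg _) hΛA.le
    nlinarith
  have hdet : ∀ x, IsUnit (A x).det := by
    intro x
    rw [isUnit_iff_ne_zero]
    intro h0
    obtain ⟨v, hv, hv0⟩ := Matrix.exists_mulVec_eq_zero_iff.mpr h0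
    have := hA4' x v
    rw [hv0, dotProduct_zero] at this
    apply hv
    have h2 : ∑ i, v i ^ 2 ≤ 0 := by
      by_contra h; push Not at h; nlinarith
    have h3 := (Finset.sum_eq_zero_iff_of_nonneg (fun i _ => sq_nonneg (v i))).1
      (le_antisymm h2 (Finset.sum_nonneg fun i _ => sq_nonneg (v i)))
    funext i
    simpa using h3 i (Finset.mem_univ i)
  have hAB : ∀ x, A x * (A x)⁻¹ = 1 := fun x => Matrix.mul_nonsing_inv _ (hdet x)
  have hBA : ∀ x, (A x)⁻¹ * A x = 1 := fun x => Matrix.nonsing_inv_mul _ (hdet x)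
  have hAs : ∀ x i j, A x i j = A x j i := by
    intro x i j; rw [hAij, hAij]; exact Finset.sum_congr rfl fun k _ => mul_comm _ _
  have hAt : ∀ x, (A x).transpose = A x := fun x => by ext i j; exact hAs x j i
  have hBs : ∀ x i j, (A x)⁻¹ i j = (A x)⁻¹ j i := by
    intro x i j
    have : ((A x)⁻¹).transpose = (A x)⁻¹ := by rw [Matrix.transpose_nonsing_inv, hAt]
    exact (congrFun (congrFun this i) j).symm
  have hBbd : ∀ x i j, |(A x)⁻¹ i j| ≤ 1 / lam := by
    intro x i j
    set v : Fin d → ℝ := fun i => (A x)⁻¹ i j with hv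
    have hAv : (A x).mulVec v = fun i => if i = j then 1 else 0 := by
      funext i
      have := congrFun (congrFun (hAB x) i) j
      rw [Matrix.mul_apply, Matrix.one_apply] at this
      simpa [Matrix.mulVec, dotProduct, hv] using this
    have h1 := hA4' x v
    rw [hAv] at h1
    have h2 : (v ⬝ᵥ fun i => if i = j then (1:ℝ) else 0) = v j := by simp [dotProduct]
    rw [h2] at h1
    have h3 : ∀ k, v k ^ 2 ≤ ∑ i, v i ^ 2 := fun k =>
      Finset.single_le_sum (f := fun i => v i ^ 2) (fun _ _ => sq_nonneg _) (Finset.mem_univ k)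
    have hj : v j ≤ 1 / lam := by
      rw [le_div_iff₀ hlam]
      by_contra hh; push Not at hh
      have : 0 < v j := by nlinarith
      nlinarith [h3 j, mul_le_mul_of_nonneg_left (h3 j) hlam.le]
    show |v i| ≤ 1 / lam
    apply abs_le_of_sq_le_sq _ (by positivity)
    have := mul_le_mul_of_nonneg_left (h3 i) hlam.le
    have h5 : lam * v i ^ 2 ≤ 1 / lam := by linarith
    calc v i ^ 2 = (lam * v i ^ 2) / lam := by field_simp
      _ ≤ (1 / lam) / lam := by gcongr
      _ = (1 / lam) ^ 2 := by field_simp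
  have hBlip : ∀ x y i j, |(A x)⁻¹ i j - (A y)⁻¹ i j| ≤
      d * (d * (1 / lam * (n * (2 * ΛA * ΛA)) * (1 / lam))) * ‖x - y‖ := by
    intro x y i j
    have e : (A x)⁻¹ - (A y)⁻¹ = (A x)⁻¹ * (A y - A x) * (A y)⁻¹ := by
      rw [mul_sub, sub_mul, hBA, mul_assoc, hAB, one_mul, mul_one]
    have e2 := congrFun (congrFun e i) j
    rw [Matrix.sub_apply] at e2
    rw [e2, Matrix.mul_apply, mul_assoc]
    refine abs_sum_le_card _ _ fun k => ?_
    rw [Matrix.mul_apply, Finset.sum_mul, mul_assoc]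
    refine abs_sum_le_card _ _ fun l => ?_
    rw [abs_mul, abs_mul, Matrix.sub_apply, abs_sub_comm]
    calc |(A x)⁻¹ i l| * |A x l k - A y l k| * |(A y)⁻¹ k j|
        ≤ 1 / lam * (n * (2 * ΛA * ΛA) * ‖x - y‖) * (1 / lam) := by
          gcongr
          · exact hBbd _ _ _
          · exact hAlip _ _ _ _
          · exact hBbd _ _ _
      _ = _ := by ring
  set KA : ℝ := n * (ΛA * ΛA) with hKA
  have hKA0 : 0 ≤ KA := by positivity
  set C2 : ℝ := (d:ℝ) * (d * (KA + 1)) ^ 2 with hC2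
  have hdpos : (0:ℝ) < d := by exact_mod_cast hd
  have hC2pos : 0 < C2 := by positivity
  have hBq : ∀ x (z : Euc d), lam / C2 * ‖z‖ ^ 2 ≤ ∑ i, ∑ j, (A x)⁻¹ i j * z i * z j := by
    intro x z
    rw [quad_comm (A x)⁻¹ (fun i => z i)]
    set v := (A x)⁻¹.mulVec (fun i => z i) with hv
    have hz : (A x).mulVec v = fun i => z i := by rw [hv, Matrix.mulVec_mulVec, hAB, Matrix.one_mulVec]
    have h1 := hA4' x v
    rw [hz, dotProduct_comm] at h1
    have h3 : ∀ k, v k ^ 2 ≤ ∑ i, v i ^ 2 := fun k =>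
      Finset.single_le_sum (f := fun i => v i ^ 2) (fun _ _ => sq_nonneg _) (Finset.mem_univ k)
    set s := ∑ i, v i ^ 2 with hs'
    have hs0 : 0 ≤ s := Finset.sum_nonneg fun i _ => sq_nonneg _
    have hzi : ∀ i, z i ^ 2 ≤ (d * (KA + 1)) ^ 2 * s := by
      intro i
      have e : z i = ∑ j, A x i j * v j := by
        have := congrFun hz i
        simpa [Matrix.mulVec, dotProduct] using this.symm
      have : |z i| ≤ d * ((KA + 1) * Real.sqrt s) := by
        rw [e]
        refine abs_sum_le_card _ _ fun j => ?_
        rw [abs_mul]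
        gcongr
        · linarith [hAbd x i j]
        · exact Real.abs_le_sqrt (h3 j)
      calc z i ^ 2 = |z i| ^ 2 := (sq_abs _).symm
        _ ≤ (d * ((KA + 1) * Real.sqrt s)) ^ 2 := by gcongr
        _ = (d * (KA + 1)) ^ 2 * (Real.sqrt s) ^ 2 := by ring
        _ = _ := by rw [Real.sq_sqrt hs0]
    have hn : ‖z‖ ^ 2 ≤ C2 * s := by
      rw [EuclideanSpace.real_norm_sq_eq]
      calc ∑ i, z i ^ 2 ≤ ∑ _i : Fin d, (d * (KA + 1)) ^ 2 * s := Finset.sum_le_sum fun i _ => hzi i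
        _ = C2 * s := by simp [hC2]; ring
    calc lam / C2 * ‖z‖ ^ 2 ≤ lam / C2 * (C2 * s) := by gcongr
      _ = lam * s := by field_simp
      _ ≤ _ := h1
  refine ⟨fun x => (A x)⁻¹, 1 + n * (ΛA * ΛA) + n * (2 * ΛA * ΛA) + 1 / lam +
    d * (d * (1 / lam * (n * (2 * ΛA * ΛA)) * (1 / lam))), lam / C2, ?_⟩
  have q1 : 0 ≤ (n:ℝ) * (ΛA * ΛA) := by positivity
  have q2 : 0 ≤ (n:ℝ) * (2 * ΛA * ΛA) := by positivity
  have q3 : 0 ≤ 1 / lam := by positivity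
  have q4 : 0 ≤ (d:ℝ) * (d * (1 / lam * (n * (2 * ΛA * ΛA)) * (1 / lam))) := by positivity
  refine ⟨by linarith, by positivity, hAs, fun x i j => (hAbd x i j).trans (by linarith),
    fun x y i j => (hAlip x y i j).trans ?_, hA3, hAB, hBs,
    fun x i j => (hBbd x i j).trans (by linarith), fun x y i j => (hBlip x y i j).trans ?_, hBq, ?_⟩
  · exact mul_le_mul_of_nonneg_right (by linarith) (norm_nonneg _)
  · exact mul_le_mul_of_nonneg_right (by linarith) (norm_nonneg _)
  · intro x z
    rw [quad_comm]
    refine le_trans ?_ (hA4' x z)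
    have : 0 ≤ ∑ i, z i ^ 2 := Finset.sum_nonneg fun i _ => sq_nonneg _
    positivity

/-- linear form with coordinates `c` -/
def gr {d : ℕ} (c : Fin d → ℝ) : Euc d →L[ℝ] ℝ := ∑ i, c i • EuclideanSpace.proj i

lemma gr_apply {d : ℕ} (c : Fin d → ℝ) (v : Euc d) : gr c v = ∑ i, c i * v i := by
  simp [gr, ContinuousLinearMap.sum_apply]

lemma gr_single {d : ℕ} (c : Fin d → ℝ) (i : Fin d) : gr c (EuclideanSpace.single i 1) = c i := by
  rw [gr_apply]; simp [Pi.single_apply]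

lemma gr_norm_le {d : ℕ} (c : Fin d → ℝ) (b : ℝ) (hb : ∀ i, |c i| ≤ b) : ‖gr c‖ ≤ d * b := by
  rcases Nat.eq_zero_or_pos d with h | h
  · subst h; simp [gr]
  have hb0 : 0 ≤ b := (abs_nonneg _).trans (hb ⟨0, h⟩)
  refine ContinuousLinearMap.opNorm_le_bound _ (by positivity) fun v => ?_
  rw [gr_apply, Real.norm_eq_abs, mul_assoc]
  refine abs_sum_le_card _ _ fun i => ?_
  rw [abs_mul]
  exact mul_le_mul (hb i) (abs_coord_le v i) (abs_nonneg _) hb0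

lemma gr_continuous {d : ℕ} {X : Type*} [TopologicalSpace X] {f : X → Fin d → ℝ}
    (h : ∀ i, Continuous fun x => f x i) : Continuous fun x => gr (f x) := by
  unfold gr
  exact continuous_finsetSum _ fun i _ => (h i).smul continuous_const

def bz {d : ℕ} (B : Matrix (Fin d) (Fin d) ℝ) (z : Euc d) (i : Fin d) : ℝ := ∑ j, B i j * z j
def qf {d : ℕ} (B : Matrix (Fin d) (Fin d) ℝ) (z : Euc d) : ℝ := ∑ i, ∑ j, B i j * z i * z j
def ez {d : ℕ} (B : Matrix (Fin d) (Fin d) ℝ) (τ : ℝ) (z : Euc d) : ℝ :=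
  τ ^ (-(d:ℝ) / 2) * Real.exp (-(qf B z) / (4 * τ))
def ez1 {d : ℕ} (B : Matrix (Fin d) (Fin d) ℝ) (τ : ℝ) (z : Euc d) (i : Fin d) : ℝ :=
  -(bz B z i / (2 * τ)) * ez B τ z
def ez2 {d : ℕ} (B : Matrix (Fin d) (Fin d) ℝ) (τ : ℝ) (z : Euc d) (i j : Fin d) : ℝ :=
  (bz B z i * bz B z j / (4 * τ ^ 2) - B i j / (2 * τ)) * ez B τ z
def ez3 {d : ℕ} (B : Matrix (Fin d) (Fin d) ℝ) (τ : ℝ) (z : Euc d) (i j k : Fin d) : ℝ :=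
  ((B i k * bz B z j + bz B z i * B j k) / (4 * τ ^ 2) -
    (bz B z i * bz B z j / (4 * τ ^ 2) - B i j / (2 * τ)) * (bz B z k / (2 * τ))) * ez B τ z
/-- Gaussian majorant -/
def ga {d : ℕ} (c τ : ℝ) (z : Euc d) : ℝ := τ ^ (-(d:ℝ) / 2) * Real.exp (-c * ‖z‖ ^ 2 / τ)

lemma bz_deriv {d : ℕ} (B : Matrix (Fin d) (Fin d) ℝ) (z : Euc d) (i : Fin d) :
    HasFDerivAt (fun z => bz B z i) (gr fun k => B i k) z := by
  have : (fun z => bz B z i) = fun z => gr (fun k => B i k) z := by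
    funext z; rw [gr_apply]; rfl
  rw [this]
  exact (gr fun k => B i k).hasFDerivAt

lemma qf_eq {d : ℕ} (B : Matrix (Fin d) (Fin d) ℝ) (z : Euc d) : qf B z = ∑ i, z i * bz B z i := by
  unfold qf bz
  refine Finset.sum_congr rfl fun i _ => ?_
  rw [Finset.mul_sum]
  exact Finset.sum_congr rfl fun j _ => by ring

lemma qf_deriv {d : ℕ} {B : Matrix (Fin d) (Fin d) ℝ} (hB : ∀ i j, B i j = B j i) (z : Euc d) :
    HasFDerivAt (fun z => qf B z) (gr fun k => 2 * bz B z k) z := by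
  have h : HasFDerivAt (fun z : Euc d => ∑ i, z i * bz B z i)
      (∑ i, (z i • (gr fun k => B i k) + bz B z i • (EuclideanSpace.proj i : Euc d →L[ℝ] ℝ))) z := by
    refine HasFDerivAt.fun_sum fun i _ => ?_
    exact (EuclideanSpace.proj (𝕜 := ℝ) i).hasFDerivAt.mul (bz_deriv B z i)
  have e : (fun z => qf B z) = fun z : Euc d => ∑ i, z i * bz B z i := funext (qf_eq B)
  rw [e]
  convert h using 1
  ext v
  simp only [gr_apply, ContinuousLinearMap.sum_apply, ContinuousLinearMap.add_apply,
    ContinuousLinearMap.smul_apply, smul_eq_mul, Finset.sum_add_distrib]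
  have e1 : ∑ i, z i * ∑ k, B i k * v k = ∑ k, bz B z k * v k := by
    simp only [Finset.mul_sum, bz, Finset.sum_mul]
    rw [Finset.sum_comm]
    refine Finset.sum_congr rfl fun i _ => Finset.sum_congr rfl fun j _ => ?_
    rw [hB i j]; ring
  rw [e1, ← Finset.sum_add_distrib]
  refine Finset.sum_congr rfl fun i _ => ?_
  simp
  ring

lemma ez_deriv {d : ℕ} {B : Matrix (Fin d) (Fin d) ℝ} (hB : ∀ i j, B i j = B j i) (τ : ℝ) (z : Euc d) :
    HasFDerivAt (fun z => ez B τ z) (gr (ez1 B τ z)) z := by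
  unfold ez
  have h := (((qf_deriv hB z).neg.mul_const (4 * τ)⁻¹).exp).const_mul (τ ^ (-(d:ℝ) / 2))
  simp only [← div_eq_mul_inv] at h
  refine HasFDerivAt.congr_fderiv h ?_
  ext v
  simp only [gr_apply, ContinuousLinearMap.smul_apply, ContinuousLinearMap.neg_apply, smul_eq_mul,
    Finset.mul_sum, ← Finset.sum_neg_distrib, ez1, ez, Pi.neg_apply]
  refine Finset.sum_congr rfl fun i _ => ?_
  by_cases ht : τ = 0
  · subst ht; simp
  field_simp
  ring

lemma ez1_deriv {d : ℕ} {B : Matrix (Fin d) (Fin d) ℝ} (hB : ∀ i j, B i j = B j i) {τ : ℝ} (hτ : 0 < τ)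
    (z : Euc d) (i : Fin d) :
    HasFDerivAt (fun z => ez1 B τ z i) (gr (ez2 B τ z i)) z := by
  unfold ez1
  have h := (((bz_deriv B z i).mul_const (2 * τ)⁻¹).neg).mul (ez_deriv hB τ z)
  simp only [← div_eq_mul_inv] at h
  refine HasFDerivAt.congr_fderiv h ?_
  ext v
  simp only [gr_apply, ContinuousLinearMap.smul_apply, ContinuousLinearMap.neg_apply, smul_eq_mul,
    Finset.mul_sum, ← Finset.sum_neg_distrib, ez1, ez2, Pi.neg_apply, ContinuousLinearMap.add_apply,
    ← Finset.sum_add_distrib]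
  refine Finset.sum_congr rfl fun i _ => ?_
  field_simp
  ring

lemma ez2_deriv {d : ℕ} {B : Matrix (Fin d) (Fin d) ℝ} (hB : ∀ i j, B i j = B j i) {τ : ℝ} (hτ : 0 < τ)
    (z : Euc d) (i j : Fin d) :
    HasFDerivAt (fun z => ez2 B τ z i j) (gr (ez3 B τ z i j)) z := by
  unfold ez2
  have h := ((((bz_deriv B z i).mul (bz_deriv B z j)).mul_const (4 * τ ^ 2)⁻¹).sub_const
    (B i j / (2 * τ))).mul (ez_deriv hB τ z)
  simp only [← div_eq_mul_inv] at h
  refine HasFDerivAt.congr_fderiv h ?_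
  ext v
  simp only [gr_apply, ContinuousLinearMap.smul_apply, smul_eq_mul,
    Finset.mul_sum, ez1, ez3, ContinuousLinearMap.add_apply, Pi.mul_apply,
    ← Finset.sum_add_distrib]
  refine Finset.sum_congr rfl fun k _ => ?_
  field_simp
  ring

/-- time derivative -/
lemma ez_time {d : ℕ} {A B : Matrix (Fin d) (Fin d) ℝ} (hAB : A * B = 1) (hB : ∀ i j, B i j = B j i)
    {τ : ℝ} (hτ : 0 < τ) (z : Euc d) :
    HasDerivAt (fun τ => ez B τ z) (∑ i, ∑ j, A i j * ez2 B τ z i j) τ := by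
  have hb : ∀ i, ∑ j, A i j * bz B z j = z i := by
    intro i
    have : ∑ j, A i j * bz B z j = ∑ k, (A * B) i k * z k := by
      simp only [bz, Matrix.mul_apply, Finset.mul_sum, Finset.sum_mul]
      rw [Finset.sum_comm]
      refine Finset.sum_congr rfl fun i _ => Finset.sum_congr rfl fun j _ => by ring
    rw [this, hAB]
    simp [Matrix.one_apply]
  have htr : ∑ i, ∑ j, A i j * B i j = d := by
    have : ∀ i, ∑ j, A i j * B i j = 1 := by
      intro i
      have := congrFun (congrFun hAB i) i
      rw [Matrix.mul_apply, Matrix.one_apply_eq] at this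
      rw [← this]
      exact Finset.sum_congr rfl fun j _ => by rw [hB i j]
    simp [this]
  have hq : ∑ i, ∑ j, A i j * (bz B z i * bz B z j) = qf B z := by
    rw [qf_eq]
    refine Finset.sum_congr rfl fun i _ => ?_
    rw [← hb i, Finset.sum_mul]
    refine Finset.sum_congr rfl fun j _ => by ring
  have hs : ∑ i, ∑ j, A i j * ez2 B τ z i j = (qf B z / (4 * τ ^ 2) - d / (2 * τ)) * ez B τ z := by
    rw [← hq, ← htr, Finset.sum_div, Finset.sum_div, ← Finset.sum_sub_distrib, Finset.sum_mul]
    refine Finset.sum_congr rfl fun i _ => ?_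
    rw [Finset.sum_div, Finset.sum_div, ← Finset.sum_sub_distrib, Finset.sum_mul]
    refine Finset.sum_congr rfl fun j _ => ?_
    unfold ez2; ring
  rw [hs]
  unfold ez
  have h1 : HasDerivAt (fun τ : ℝ => τ ^ (-(d:ℝ) / 2)) (-(d:ℝ) / 2 * τ ^ (-(d:ℝ) / 2 - 1)) τ :=
    Real.hasDerivAt_rpow_const (Or.inl hτ.ne')
  have h2 : HasDerivAt (fun τ : ℝ => -(qf B z) / (4 * τ)) (qf B z / (4 * τ ^ 2)) τ := by
    have := ((hasDerivAt_inv hτ.ne').const_mul (-(qf B z) / 4))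
    have e : (fun τ : ℝ => -(qf B z) / (4 * τ)) = fun y => -(qf B z) / 4 * y⁻¹ := by
      funext y; by_cases hy : y = 0
      · simp [hy]
      · field_simp
    rw [e]
    refine this.congr_deriv ?_
    field_simp
  have h := h1.mul h2.exp
  refine HasDerivAt.congr_deriv h ?_
  rw [Real.rpow_sub_one hτ.ne']
  field_simp
  ring

lemma ga_nonneg {d : ℕ} (c : ℝ) {τ : ℝ} (hτ : 0 < τ) (z : Euc d) : 0 ≤ ga c τ z := by
  unfold ga; positivity

lemma ga_mono {d : ℕ} {c c' : ℝ} (h : c' ≤ c) {τ : ℝ} (hτ : 0 < τ) (z : Euc d) : ga c τ z ≤ ga c' τ z := by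
  unfold ga
  gcongr

lemma ga_absorb {d : ℕ} {c : ℝ} (hc : 0 < c) (k j : ℕ) : ∃ C : ℝ, 0 ≤ C ∧ ∀ τ : ℝ, 0 < τ → ∀ z : Euc d,
    ‖z‖ ^ k / τ ^ j * ga (2 * c) τ z ≤ C * τ ^ ((k:ℝ) / 2 - j) * ga c τ z := by
  refine ⟨1 + k.factorial / c ^ k, by positivity, fun τ hτ z => ?_⟩
  set X := ‖z‖ / Real.sqrt τ with hX
  have hs : 0 < Real.sqrt τ := Real.sqrt_pos.2 hτ
  have hX0 : 0 ≤ X := by positivity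
  have hzX : ‖z‖ = X * Real.sqrt τ := by rw [hX]; field_simp
  have hX2 : ‖z‖ ^ 2 / τ = X ^ 2 := by rw [hzX, mul_pow, Real.sq_sqrt hτ.le]; field_simp
  have h1 : X ^ k ≤ (1 + k.factorial / c ^ k) * Real.exp (c * X ^ 2) := by
    have h2 : (c * X ^ 2) ^ k / k.factorial ≤ Real.exp (c * X ^ 2) :=
      Real.pow_div_factorial_le_exp _ (by positivity) k
    have h3 : X ^ k ≤ 1 + (X ^ 2) ^ k := by
      have : (X ^ 2) ^ k = (X ^ k) ^ 2 := by rw [← pow_mul, ← pow_mul, mul_comm]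
      rw [this]; nlinarith [sq_nonneg (X ^ k - 1), sq_nonneg (X^k)]
    have h4 : (X ^ 2) ^ k ≤ k.factorial / c ^ k * Real.exp (c * X ^ 2) := by
      calc (X ^ 2) ^ k = k.factorial / c ^ k * ((c * X ^ 2) ^ k / k.factorial) := by
            rw [mul_pow]; field_simp
        _ ≤ _ := by gcongr
    have h5 : 1 ≤ Real.exp (c * X ^ 2) := Real.one_le_exp (by positivity)
    nlinarith
  have e1 : Real.exp (-(2 * c) * ‖z‖ ^ 2 / τ) = Real.exp (-(c * X ^ 2)) * Real.exp (-c * ‖z‖ ^ 2 / τ) := by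
    rw [← Real.exp_add]; congr 1; rw [mul_div_assoc, mul_div_assoc, hX2]; ring
  have e2 : ‖z‖ ^ k / τ ^ j = X ^ k * τ ^ ((k:ℝ) / 2 - j) := by
    rw [hzX, mul_pow, Real.rpow_sub hτ, Real.rpow_natCast, Real.sqrt_eq_rpow, ← Real.rpow_natCast,
      ← Real.rpow_natCast, ← Real.rpow_mul hτ.le, Real.rpow_natCast]
    rw [mul_div_assoc, show (1:ℝ) / 2 * k = k / 2 by ring]
  unfold ga
  rw [e1, e2]
  have h6 : X ^ k * Real.exp (-(c * X ^ 2)) ≤ 1 + k.factorial / c ^ k := by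
    rw [Real.exp_neg, ← div_eq_mul_inv, div_le_iff₀ (Real.exp_pos _)]; exact h1
  calc _ = (X ^ k * Real.exp (-(c * X ^ 2))) * (τ ^ ((k:ℝ) / 2 - j) *
        (τ ^ (-(d:ℝ) / 2) * Real.exp (-c * ‖z‖ ^ 2 / τ))) := by ring
    _ ≤ (1 + k.factorial / c ^ k) * (τ ^ ((k:ℝ) / 2 - j) *
        (τ ^ (-(d:ℝ) / 2) * Real.exp (-c * ‖z‖ ^ 2 / τ))) := by gcongr
    _ = _ := by ring

lemma ga_integral {d : ℕ} {c : ℝ} (hc : 0 < c) {τ : ℝ} (hτ : 0 < τ) :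
    ∫ z : Euc d, ga c τ z = (Real.pi / c) ^ ((d:ℝ) / 2) := by
  unfold ga
  rw [MeasureTheory.integral_const_mul]
  have : ∫ z : Euc d, Real.exp (-c * ‖z‖ ^ 2 / τ) = (Real.pi / (c / τ)) ^ ((d:ℝ) / 2) := by
    have := GaussianFourier.integral_rexp_neg_mul_sq_norm (V := Euc d) (b := c / τ) (by positivity)
    rw [finrank_euclideanSpace_fin] at this
    rw [← this]
    congr 1; funext z; congr 1; ring
  rw [this, show Real.pi / (c / τ) = τ * (Real.pi / c) by field_simp, Real.mul_rpow hτ.le (by positivity),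
    ← mul_assoc, ← Real.rpow_add hτ]
  rw [show -(d:ℝ) / 2 + d / 2 = 0 by ring]; simp

lemma ga_integrable {d : ℕ} {c : ℝ} (hc : 0 < c) {τ : ℝ} (hτ : 0 < τ) :
    MeasureTheory.Integrable (fun z : Euc d => ga c τ z) := by
  apply MeasureTheory.Integrable.of_integral_ne_zero
  rw [ga_integral hc hτ]
  positivity

/-- a matrix in the admissible class -/
structure BOK {d : ℕ} (K c0 : ℝ) (B : Matrix (Fin d) (Fin d) ℝ) : Prop where
  symm : ∀ i j, B i j = B j i
  bd : ∀ i j, |B i j| ≤ K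
  q : ∀ z : Euc d, c0 * ‖z‖ ^ 2 ≤ qf B z

lemma Coef.bok {d : ℕ} {A B : Euc d → Matrix (Fin d) (Fin d) ℝ} {K c0 : ℝ} (h : Coef d A B K c0)
    (x : Euc d) : BOK K c0 (B x) := ⟨h.Bsymm x, h.Bbd x, h.Bq x⟩

lemma ga_absorb' {d : ℕ} {c : ℝ} (hc : 0 < c) : ∃ C : ℝ, 1 ≤ C ∧ ∀ k j : ℕ, k ≤ 6 → j ≤ 6 →
    ∀ τ : ℝ, 0 < τ → ∀ z : Euc d,
    ‖z‖ ^ k / τ ^ j * ga (2 * c) τ z ≤ C * τ ^ ((k:ℝ) / 2 - j) * ga c τ z := by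
  choose f hf0 hf using fun k j => ga_absorb (d := d) hc k j
  refine ⟨1 + ∑ k ∈ Finset.range 7, ∑ j ∈ Finset.range 7, f k j, ?_, ?_⟩
  · have := Finset.sum_nonneg fun k (_ : k ∈ Finset.range 7) =>
      Finset.sum_nonneg fun j (_ : j ∈ Finset.range 7) => hf0 k j
    linarith
  intro k j hk hj τ hτ z
  refine (hf k j τ hτ z).trans ?_
  have h1 : f k j ≤ ∑ j ∈ Finset.range 7, f k j :=
    Finset.single_le_sum (f := fun j => f k j) (fun j _ => hf0 k j) (Finset.mem_range.2 (by omega))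
  have h2 : ∑ j ∈ Finset.range 7, f k j ≤ ∑ k ∈ Finset.range 7, ∑ j ∈ Finset.range 7, f k j :=
    Finset.single_le_sum (f := fun k => ∑ j ∈ Finset.range 7, f k j)
      (fun k _ => Finset.sum_nonneg fun j _ => hf0 k j) (Finset.mem_range.2 (by omega))
  have := ga_nonneg c hτ z
  gcongr
  linarith

lemma bz_bd {d : ℕ} {K c0 : ℝ} {B : Matrix (Fin d) (Fin d) ℝ} (h : BOK K c0 B) (z : Euc d) (i : Fin d) :
    |bz B z i| ≤ d * K * ‖z‖ := by
  unfold bz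
  rw [mul_assoc]
  refine abs_sum_le_card _ _ fun j => ?_
  rw [abs_mul]
  exact mul_le_mul (h.bd i j) (abs_coord_le z j) (abs_nonneg _) ((abs_nonneg _).trans (h.bd i j))

lemma ez_pos {d : ℕ} (B : Matrix (Fin d) (Fin d) ℝ) {τ : ℝ} (hτ : 0 < τ) (z : Euc d) : 0 < ez B τ z := by
  unfold ez; positivity

lemma ez_le {d : ℕ} {K c0 : ℝ} {B : Matrix (Fin d) (Fin d) ℝ} (h : BOK K c0 B) {τ : ℝ} (hτ : 0 < τ)
    (z : Euc d) : ez B τ z ≤ ga (2 * (c0 / 8)) τ z := by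
  unfold ez ga
  have := h.q z
  gcongr ?_ * Real.exp ?_
  rw [div_le_div_iff₀ (by positivity) hτ]
  nlinarith

lemma exp_diff (a b m : ℝ) (ha : m ≤ a) (hb : m ≤ b) : |Real.exp (-a) - Real.exp (-b)| ≤ |a - b| * Real.exp (-m) := by
  wlog hab : a ≤ b generalizing a b
  · rw [abs_sub_comm, abs_sub_comm a b]; exact this b a hb ha (by linarith)
  have h1 : Real.exp (-b) ≤ Real.exp (-a) := Real.exp_le_exp.2 (by linarith)
  rw [abs_of_nonneg (by linarith), abs_of_nonpos (by linarith)]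
  have h2 : Real.exp (-b) = Real.exp (-a) * Real.exp (a - b) := by rw [← Real.exp_add]; congr 1; ring
  have h3 := Real.add_one_le_exp (a - b)
  have h4 : Real.exp (-a) ≤ Real.exp (-m) := Real.exp_le_exp.2 (by linarith)
  have h5 := Real.exp_pos (-a)
  rw [h2]
  nlinarith

lemma qf_diff {d : ℕ} {B B' : Matrix (Fin d) (Fin d) ℝ} {δ : ℝ} (h : ∀ i j, |B i j - B' i j| ≤ δ) (z : Euc d) :
    |qf B z - qf B' z| ≤ d * (d * (δ * ‖z‖ ^ 2)) := by
  unfold qf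
  rw [← Finset.sum_sub_distrib]
  refine abs_sum_le_card _ _ fun i => ?_
  rw [← Finset.sum_sub_distrib]
  refine abs_sum_le_card _ _ fun j => ?_
  have : B i j * z i * z j - B' i j * z i * z j = (B i j - B' i j) * (z i * z j) := by ring
  rw [this, abs_mul, abs_mul, pow_two]
  have := abs_coord_le z i
  have := abs_coord_le z j
  have := h i j
  have : 0 ≤ δ := (abs_nonneg _).trans this
  gcongr

lemma bz_diff {d : ℕ} {B B' : Matrix (Fin d) (Fin d) ℝ} {δ : ℝ} (h : ∀ i j, |B i j - B' i j| ≤ δ) (z : Euc d)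
    (i : Fin d) : |bz B z i - bz B' z i| ≤ d * (δ * ‖z‖) := by
  unfold bz
  rw [← Finset.sum_sub_distrib]
  refine abs_sum_le_card _ _ fun j => ?_
  have : B i j * z j - B' i j * z j = (B i j - B' i j) * z j := by ring
  rw [this, abs_mul]
  have := abs_coord_le z j
  have := h i j
  have : 0 ≤ δ := (abs_nonneg _).trans this
  gcongr

lemma ez_diff {d : ℕ} {K c0 : ℝ} {B B' : Matrix (Fin d) (Fin d) ℝ} (hB : BOK K c0 B) (hB' : BOK K c0 B')
    {δ : ℝ} (h : ∀ i j, |B i j - B' i j| ≤ δ) {τ : ℝ} (hτ : 0 < τ) (z : Euc d) :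
    |ez B τ z - ez B' τ z| ≤ d ^ 2 * δ * (‖z‖ ^ 2 / τ) * ga (2 * (c0 / 8)) τ z := by
  unfold ez ga
  have h1 := exp_diff (qf B z / (4 * τ)) (qf B' z / (4 * τ)) (c0 * ‖z‖ ^ 2 / (4 * τ))
    (by have := hB.q z; gcongr) (by have := hB'.q z; gcongr)
  have h2 := qf_diff h z
  have h3 : |qf B z / (4 * τ) - qf B' z / (4 * τ)| ≤ d ^ 2 * δ * (‖z‖ ^ 2 / τ) := by
    rw [← sub_div, abs_div, abs_of_pos (show 0 < 4 * τ by positivity), div_le_iff₀ (by positivity)]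
    refine h2.trans ?_
    have h0 : 0 ≤ (d:ℝ) * (d * (δ * ‖z‖ ^ 2)) := (abs_nonneg _).trans h2
    calc _ ≤ 4 * ((d:ℝ) * (d * (δ * ‖z‖ ^ 2))) := by linarith
      _ = _ := by field_simp
  rw [← mul_sub, abs_mul, abs_of_pos (show 0 < τ ^ (-(d:ℝ)/2) by positivity)]
  rw [neg_div (4 * τ) (qf B z), neg_div (4 * τ) (qf B' z)]
  have e : Real.exp (-(2 * (c0 / 8)) * ‖z‖ ^ 2 / τ) = Real.exp (-(c0 * ‖z‖ ^ 2 / (4 * τ))) := by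
    congr 1; field_simp; ring
  rw [e]
  calc _ ≤ τ ^ (-(d:ℝ)/2) * (d ^ 2 * δ * (‖z‖ ^ 2 / τ) * Real.exp (-(c0 * ‖z‖ ^ 2 / (4 * τ)))) := by
        exact mul_le_mul_of_nonneg_left (h1.trans (mul_le_mul_of_nonneg_right h3 (Real.exp_pos _).le))
          (by positivity)
    _ = _ := by ring

lemma ez1_bd {d : ℕ} {K c0 : ℝ} {B : Matrix (Fin d) (Fin d) ℝ} (h : BOK K c0 B) {τ : ℝ} (hτ : 0 < τ)
    (z : Euc d) (i : Fin d) : |ez1 B τ z i| ≤ d * K * (‖z‖ ^ 1 / τ ^ 1 * ga (2 * (c0 / 8)) τ z) := by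
  unfold ez1
  rw [abs_mul, abs_neg, abs_div, abs_of_pos (show 0 < 2 * τ by positivity), abs_of_pos (ez_pos B hτ z)]
  have h1 := bz_bd h z i
  have h2 := ez_le h hτ z
  have h0 := (ez_pos B hτ z).le
  have h3 : |bz B z i| / (2 * τ) ≤ d * K * (‖z‖ ^ 1 / τ ^ 1) := by
    rw [div_le_iff₀ (by positivity)]
    calc _ ≤ 2 * (d * K * ‖z‖) := by linarith [abs_nonneg (bz B z i)]
      _ = _ := by field_simp
  calc _ ≤ d * K * (‖z‖ ^ 1 / τ ^ 1) * ga (2 * (c0 / 8)) τ z :=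
        mul_le_mul h3 h2 h0 ((by positivity : (0:ℝ) ≤ _).trans h3)
    _ = _ := by ring

/-- polynomial factor bound of second derivative kernel -/
lemma ez2_poly {d : ℕ} {K c0 : ℝ} (hK : 1 ≤ K) {B : Matrix (Fin d) (Fin d) ℝ} (h : BOK K c0 B) {τ : ℝ} (hτ : 0 < τ)
    (z : Euc d) (i j : Fin d) :
    |bz B z i * bz B z j / (4 * τ ^ 2) - B i j / (2 * τ)| ≤
      d ^ 2 * K ^ 2 * (‖z‖ ^ 2 / τ ^ 2) + K * (‖z‖ ^ 0 / τ ^ 1) := by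
  refine (abs_sub _ _).trans ?_
  rw [abs_div, abs_div, abs_mul, abs_of_pos (show 0 < 2 * τ by positivity),
    abs_of_pos (show 0 < 4 * τ ^ 2 by positivity)]
  have h1 := bz_bd h z i
  have h2 := bz_bd h z j
  have h3 := h.bd i j
  have h4 : |bz B z i| * |bz B z j| ≤ (d * K * ‖z‖) * (d * K * ‖z‖) := by gcongr
  apply add_le_add
  · rw [div_le_iff₀ (by positivity)]
    refine h4.trans ?_
    calc _ ≤ 4 * ((d * K * ‖z‖) * (d * K * ‖z‖)) := by
          have : 0 ≤ (d * K * ‖z‖) * (d * K * ‖z‖) := by positivity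
          linarith
      _ = _ := by field_simp
  · rw [div_le_iff₀ (by positivity)]
    refine h3.trans ?_
    calc _ ≤ 2 * K := by linarith
      _ = _ := by field_simp

lemma ez2_bd {d : ℕ} {K c0 : ℝ} (hK : 1 ≤ K) {B : Matrix (Fin d) (Fin d) ℝ} (h : BOK K c0 B) {τ : ℝ} (hτ : 0 < τ)
    (z : Euc d) (i j : Fin d) :
    |ez2 B τ z i j| ≤ (d ^ 2 * K ^ 2 * (‖z‖ ^ 2 / τ ^ 2) + K * (‖z‖ ^ 0 / τ ^ 1)) * ga (2 * (c0 / 8)) τ z := by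
  unfold ez2
  rw [abs_mul, abs_of_pos (ez_pos B hτ z)]
  exact mul_le_mul (ez2_poly hK h hτ z i j) (ez_le h hτ z) (ez_pos B hτ z).le (by positivity)

lemma ez3_bd {d : ℕ} {K c0 : ℝ} (hK : 1 ≤ K) {B : Matrix (Fin d) (Fin d) ℝ} (h : BOK K c0 B) {τ : ℝ} (hτ : 0 < τ)
    (z : Euc d) (i j k : Fin d) :
    |ez3 B τ z i j k| ≤ ((2 * d * K ^ 2 + d * K ^ 2) * (‖z‖ ^ 1 / τ ^ 2) + d ^ 3 * K ^ 3 * (‖z‖ ^ 3 / τ ^ 3)) *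
      ga (2 * (c0 / 8)) τ z := by
  unfold ez3
  rw [abs_mul, abs_of_pos (ez_pos B hτ z)]
  refine mul_le_mul ?_ (ez_le h hτ z) (ez_pos B hτ z).le (by positivity)
  refine (abs_sub _ _).trans ?_
  have hp := ez2_poly hK h hτ z i j
  have h1 := bz_bd h z i
  have h2 := bz_bd h z j
  have h3 := bz_bd h z k
  have h4 := h.bd i k
  have h5 := h.bd j k
  rw [abs_mul _ (bz B z k / (2 * τ))]
  have e1 : |(B i k * bz B z j + bz B z i * B j k) / (4 * τ ^ 2)| ≤ 2 * d * K ^ 2 * (‖z‖ ^ 1 / τ ^ 2) := by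
    rw [abs_div, abs_of_pos (show 0 < 4 * τ ^ 2 by positivity), div_le_iff₀ (by positivity)]
    refine (abs_add_le _ _).trans ?_
    rw [abs_mul, abs_mul]
    calc _ ≤ K * (d * K * ‖z‖) + (d * K * ‖z‖) * K := by gcongr
      _ ≤ 4 * (2 * d * K ^ 2 * ‖z‖) := by
          have : 0 ≤ d * K ^ 2 * ‖z‖ := by positivity
          nlinarith
      _ = _ := by field_simp
  have e2 : |bz B z k / (2 * τ)| ≤ d * K * (‖z‖ / τ) := by
    rw [abs_div, abs_of_pos (show 0 < 2 * τ by positivity), div_le_iff₀ (by positivity)]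
    refine h3.trans ?_
    calc _ ≤ 2 * (d * K * ‖z‖) := by
          have : 0 ≤ d * K * ‖z‖ := by positivity
          linarith
      _ = _ := by field_simp
  calc _ ≤ 2 * d * K ^ 2 * (‖z‖ ^ 1 / τ ^ 2) +
        (d ^ 2 * K ^ 2 * (‖z‖ ^ 2 / τ ^ 2) + K * (‖z‖ ^ 0 / τ ^ 1)) * (d * K * (‖z‖ / τ)) := by gcongr
    _ = _ := by field_simp; ring

lemma ez2_diff {d : ℕ} {K c0 : ℝ} (hK : 1 ≤ K) {B B' : Matrix (Fin d) (Fin d) ℝ} (hB : BOK K c0 B) (hB' : BOK K c0 B')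
    {δ : ℝ} (h : ∀ i j, |B i j - B' i j| ≤ δ) {τ : ℝ} (hτ : 0 < τ) (z : Euc d) (i j : Fin d) :
    |ez2 B τ z i j - ez2 B' τ z i j| ≤ δ * (2 * d ^ 2 * K * (‖z‖ ^ 2 / τ ^ 2) + 1 / τ +
      (d ^ 2 * K ^ 2 * (‖z‖ ^ 2 / τ ^ 2) + K * (‖z‖ ^ 0 / τ ^ 1)) * (d ^ 2 * (‖z‖ ^ 2 / τ))) *
        ga (2 * (c0 / 8)) τ z := by
  have hδ : 0 ≤ δ := (abs_nonneg _).trans (h i j)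
  unfold ez2
  set P := bz B z i * bz B z j / (4 * τ ^ 2) - B i j / (2 * τ) with hP
  set P' := bz B' z i * bz B' z j / (4 * τ ^ 2) - B' i j / (2 * τ) with hP'
  have e : P * ez B τ z - P' * ez B' τ z = (P - P') * ez B τ z + P' * (ez B τ z - ez B' τ z) := by ring
  rw [e]
  refine (abs_add_le _ _).trans ?_
  rw [abs_mul, abs_mul, abs_of_pos (ez_pos B hτ z)]
  have g0 : 0 ≤ ga (2 * (c0 / 8)) τ z := ga_nonneg _ hτ z
  have hPP : |P - P'| ≤ δ * (2 * d ^ 2 * K * (‖z‖ ^ 2 / τ ^ 2) + 1 / τ) := by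
    have e : P - P' = ((bz B z i - bz B' z i) * bz B z j + bz B' z i * (bz B z j - bz B' z j)) / (4 * τ ^ 2)
        - (B i j - B' i j) / (2 * τ) := by rw [hP, hP']; ring
    rw [e]
    refine (abs_sub _ _).trans ?_
    rw [abs_div, abs_div, abs_of_pos (show 0 < 2 * τ by positivity),
      abs_of_pos (show 0 < 4 * τ ^ 2 by positivity), mul_add]
    apply add_le_add
    · rw [div_le_iff₀ (by positivity)]
      refine (abs_add_le _ _).trans ?_
      rw [abs_mul, abs_mul]
      have := bz_diff h z i
      have := bz_diff h z j
      have := bz_bd hB z j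
      have := bz_bd hB' z i
      calc _ ≤ (d * (δ * ‖z‖)) * (d * K * ‖z‖) + (d * K * ‖z‖) * (d * (δ * ‖z‖)) := by gcongr
        _ ≤ 4 * ((d * (δ * ‖z‖)) * (d * K * ‖z‖) + (d * K * ‖z‖) * (d * (δ * ‖z‖))) := by
            have : 0 ≤ (d * (δ * ‖z‖)) * (d * K * ‖z‖) + (d * K * ‖z‖) * (d * (δ * ‖z‖)) := by positivity
            linarith
        _ = _ := by field_simp; ring
    · rw [div_le_iff₀ (by positivity)]
      refine (h i j).trans ?_
      calc δ ≤ 2 * δ := by linarith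
        _ = _ := by field_simp
  calc _ ≤ δ * (2 * d ^ 2 * K * (‖z‖ ^ 2 / τ ^ 2) + 1 / τ) * ga (2 * (c0 / 8)) τ z +
      (d ^ 2 * K ^ 2 * (‖z‖ ^ 2 / τ ^ 2) + K * (‖z‖ ^ 0 / τ ^ 1)) *
        (d ^ 2 * δ * (‖z‖ ^ 2 / τ) * ga (2 * (c0 / 8)) τ z) := by
        apply add_le_add
        · exact mul_le_mul hPP (ez_le hB hτ z) (ez_pos B hτ z).le (by positivity)
        · exact mul_le_mul (ez2_poly hK hB' hτ z i j) (ez_diff hB hB' h hτ z) (abs_nonneg _) (by positivity)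
    _ = _ := by ring

lemma ga_sub_integrable {d : ℕ} {c : ℝ} (hc : 0 < c) {τ : ℝ} (hτ : 0 < τ) (x : Euc d) :
    MeasureTheory.Integrable (fun y : Euc d => ga c τ (x - y)) :=
  (ga_integrable hc hτ).comp_sub_left x

lemma ga_sub_integral {d : ℕ} {c : ℝ} (hc : 0 < c) {τ : ℝ} (hτ : 0 < τ) (x : Euc d) :
    ∫ y : Euc d, ga c τ (x - y) = (Real.pi / c) ^ ((d:ℝ) / 2) := by
  rw [MeasureTheory.integral_sub_left_eq_self (fun y => ga c τ y)]
  exact ga_integral hc hτ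

/-- Gaussian kernels -/
structure Kern {d : ℕ} (κ : ℝ → Euc d → Euc d → ℝ) (C θ c : ℝ) : Prop where
  cont : ContinuousOn (fun p : ℝ × Euc d × Euc d => κ p.1 p.2.1 p.2.2) (Ioi 0 ×ˢ univ)
  bd : ∀ τ, 0 < τ → ∀ x y, |κ τ x y| ≤ C * τ ^ (-θ) * ga c τ (x - y)

def inn {d : ℕ} (κ : ℝ → Euc d → Euc d → ℝ) (G : ℝ × Euc d → ℝ) (τ s : ℝ) (x : Euc d) : ℝ :=
  ∫ y, κ τ x y * G (s, y)

/-- bounded continuous function -/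
structure BC {d : ℕ} (G : ℝ × Euc d → ℝ) (N : ℝ) : Prop where
  cont : Continuous G
  bd : ∀ p, |G p| ≤ N

lemma BC.nonneg {d : ℕ} {G : ℝ × Euc d → ℝ} {N : ℝ} (h : BC G N) : 0 ≤ N :=
  (abs_nonneg _).trans (h.bd 0)

lemma Kern.cont_y {d : ℕ} {κ : ℝ → Euc d → Euc d → ℝ} {C θ c : ℝ} (h : Kern κ C θ c) {τ : ℝ} (hτ : 0 < τ)
    (x : Euc d) : Continuous (κ τ x) := by
  have : Continuous fun y : Euc d => (τ, x, y) := by fun_prop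
  exact h.cont.comp_continuous this (fun y => ⟨hτ, trivial⟩)

lemma inn_integrable {d : ℕ} {κ : ℝ → Euc d → Euc d → ℝ} {C θ c : ℝ} (h : Kern κ C θ c) (hc : 0 < c)
    {G : ℝ × Euc d → ℝ} {N : ℝ} (hG : BC G N) {τ : ℝ} (hτ : 0 < τ) (s : ℝ) (x : Euc d) :
    MeasureTheory.Integrable (fun y => κ τ x y * G (s, y)) := by
  refine MeasureTheory.Integrable.mono' (((ga_sub_integrable hc hτ x).const_mul (C * τ ^ (-θ))).mul_const N)
    ?_ (Eventually.of_forall fun y => ?_)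
  · have h1 := h.cont_y hτ x
    have h2 := hG.cont
    exact Continuous.aestronglyMeasurable (by fun_prop)
  · rw [Real.norm_eq_abs, abs_mul]
    exact mul_le_mul (h.bd τ hτ x y) (hG.bd _) (abs_nonneg _) ((abs_nonneg _).trans (h.bd τ hτ x y))

lemma inn_bd {d : ℕ} {κ : ℝ → Euc d → Euc d → ℝ} {C θ c : ℝ} (h : Kern κ C θ c) (hc : 0 < c)
    {G : ℝ × Euc d → ℝ} {N : ℝ} {τ : ℝ} (hτ : 0 < τ) (s : ℝ) (hG : ∀ y, |G (s, y)| ≤ N) (x : Euc d) :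
    |inn κ G τ s x| ≤ C * (Real.pi / c) ^ ((d:ℝ) / 2) * N * τ ^ (-θ) := by
  unfold inn
  have := MeasureTheory.norm_integral_le_of_norm_le (μ := MeasureTheory.volume)
    (((ga_sub_integrable hc hτ x).const_mul (C * τ ^ (-θ))).mul_const N)
    (f := fun y => κ τ x y * G (s, y)) (Eventually.of_forall fun y => by
      rw [Real.norm_eq_abs, abs_mul]
      exact mul_le_mul (h.bd τ hτ x y) (hG _) (abs_nonneg _) ((abs_nonneg _).trans (h.bd τ hτ x y)))
  rw [Real.norm_eq_abs, MeasureTheory.integral_mul_const, MeasureTheory.integral_const_mul,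
    ga_sub_integral hc hτ x] at this
  linarith

lemma ga_dom {d : ℕ} {c : ℝ} (hc : 0 < c) {τ0 : ℝ} (hτ0 : 0 < τ0) (x0 : Euc d) :
    ∃ D : Euc d → ℝ, MeasureTheory.Integrable D ∧ (∀ y, 0 ≤ D y) ∧ ∀ τ ∈ Icc (τ0 / 2) (2 * τ0), ∀ x ∈ ball x0 1,
      ∀ y, ga c τ (x - y) ≤ D y := by
  refine ⟨fun y => (τ0 / 2) ^ (-(d:ℝ) / 2) * Real.exp (c / (2 * τ0)) * (τ0 ^ ((d:ℝ)/2) * ga (c / 4) τ0 (x0 - y)), ?_, ?_, ?_⟩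
  · exact ((ga_sub_integrable (by positivity) hτ0 x0).const_mul _).const_mul _
  · intro y
    have := ga_nonneg (c / 4) hτ0 (x0 - y)
    positivity
  intro τ hτ x hx y
  have hτp : 0 < τ := by linarith [hτ.1]
  unfold ga
  beta_reduce
  have e : (τ0 / 2) ^ (-(d:ℝ) / 2) * Real.exp (c / (2 * τ0)) * (τ0 ^ ((d:ℝ)/2) *
    (τ0 ^ (-(d:ℝ)/2) * Real.exp (-(c / 4) * ‖x0 - y‖ ^ 2 / τ0))) =
    (τ0 / 2) ^ (-(d:ℝ) / 2) * (Real.exp (c / (2 * τ0)) * Real.exp (-(c / 4) * ‖x0 - y‖ ^ 2 / τ0)) *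
      (τ0 ^ ((d:ℝ)/2) * τ0 ^ (-(d:ℝ)/2)) := by ring
  rw [e, ← Real.rpow_add hτ0, show (d:ℝ)/2 + -(d:ℝ)/2 = 0 by ring, Real.rpow_zero, mul_one, ← Real.exp_add]
  have h1 : τ ^ (-(d:ℝ) / 2) ≤ (τ0 / 2) ^ (-(d:ℝ) / 2) :=
    Real.rpow_le_rpow_of_nonpos (by positivity) hτ.1 (by
      have : (0:ℝ) ≤ d := by positivity
      linarith)
  have h2 : ‖x0 - y‖ ^ 2 ≤ 2 * ‖x - y‖ ^ 2 + 2 := by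
    have h3 : ‖x0 - y‖ ≤ ‖x - y‖ + 1 := by
      have : x0 - y = (x - y) - (x - x0) := by abel
      rw [this]
      refine (norm_sub_le _ _).trans ?_
      rw [mem_ball, dist_eq_norm] at hx
      linarith
    have := norm_nonneg (x0 - y)
    nlinarith [sq_nonneg (‖x - y‖ - 1)]
  refine mul_le_mul h1 (Real.exp_le_exp.2 ?_) (Real.exp_pos _).le (by positivity)
  have h4 : c * ‖x - y‖ ^ 2 / (2 * τ0) ≤ c * ‖x - y‖ ^ 2 / τ :=
    div_le_div_of_nonneg_left (by positivity) hτp hτ.2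
  have h5 : (c / 4) * ‖x0 - y‖ ^ 2 / τ0 ≤ c * ‖x - y‖ ^ 2 / (2 * τ0) + c / (2 * τ0) := by
    rw [← add_div, div_le_div_iff₀ hτ0 (by positivity)]
    nlinarith [mul_le_mul_of_nonneg_left h2 (by positivity : 0 ≤ c * τ0)]
  rw [neg_mul, neg_div, neg_mul, neg_div]
  linarith

/-- local domination of kernels -/
lemma Kern.dom {d : ℕ} {κ : ℝ → Euc d → Euc d → ℝ} {C θ c : ℝ} (h : Kern κ C θ c) (hc : 0 < c) {τ0 : ℝ}
    (hτ0 : 0 < τ0) (x0 : Euc d) : ∃ D : Euc d → ℝ, MeasureTheory.Integrable D ∧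
      ∀ τ ∈ Icc (τ0 / 2) (2 * τ0), ∀ x ∈ ball x0 1, ∀ y, |κ τ x y| ≤ D y := by
  obtain ⟨D, hD, hD0, hb⟩ := ga_dom hc hτ0 x0
  have hcont : ContinuousOn (fun τ : ℝ => τ ^ (-θ)) (Icc (τ0 / 2) (2 * τ0)) := by
    intro τ hτ
    exact (Real.continuousAt_rpow_const _ _ (Or.inl (by linarith [hτ.1]))).continuousWithinAt
  obtain ⟨M, hM⟩ := isCompact_Icc.exists_bound_of_continuousOn hcont
  refine ⟨fun y => |C| * M * D y, hD.const_mul _, fun τ hτ x hx y => ?_⟩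
  have hτp : 0 < τ := by linarith [hτ.1]
  have h1 := hM τ hτ
  have h2 := hb τ hτ x hx y
  have h3 := ga_nonneg c hτp (x - y)
  rw [Real.norm_eq_abs] at h1
  have h1' : τ ^ (-θ) ≤ M := (le_abs_self _).trans h1
  have h4 : 0 ≤ τ ^ (-θ) := by positivity
  calc _ ≤ C * τ ^ (-θ) * ga c τ (x - y) := h.bd τ hτp x y
    _ ≤ |C| * τ ^ (-θ) * ga c τ (x - y) := by gcongr; exact le_abs_self _
    _ ≤ _ := mul_le_mul (mul_le_mul_of_nonneg_left h1' (abs_nonneg _)) h2 h3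
        (mul_nonneg (abs_nonneg _) (h4.trans h1'))

lemma near_tau {τ0 : ℝ} (hτ0 : 0 < τ0) : Icc (τ0 / 2) (2 * τ0) ∈ nhds τ0 :=
  Icc_mem_nhds (by linarith) (by linarith)

lemma inn_cont {d : ℕ} {κ : ℝ → Euc d → Euc d → ℝ} {C θ c : ℝ} (h : Kern κ C θ c) (hc : 0 < c)
    {G : ℝ × Euc d → ℝ} {N : ℝ} (hG : BC G N) :
    ContinuousOn (fun p : ℝ × ℝ × Euc d => inn κ G p.1 p.2.1 p.2.2) (Ioi 0 ×ˢ univ) := by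
  rintro ⟨τ0, s0, x0⟩ ⟨hτ0, -⟩
  have hτ0 : 0 < τ0 := hτ0
  apply ContinuousAt.continuousWithinAt
  obtain ⟨D, hD, hb⟩ := h.dom hc hτ0 x0
  have hev : ∀ᶠ p : ℝ × ℝ × Euc d in nhds (τ0, s0, x0), p.1 ∈ Icc (τ0 / 2) (2 * τ0) ∧ p.2.2 ∈ ball x0 1 := by
    refine Filter.Eventually.and ?_ ?_
    · exact (continuous_fst.tendsto (τ0, s0, x0)).eventually (near_tau hτ0)
    · exact ((continuous_snd.comp continuous_snd).tendsto (τ0, s0, x0)).eventually (ball_mem_nhds x0 one_pos)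
  unfold inn
  refine MeasureTheory.continuousAt_of_dominated (bound := fun y => D y * N) ?_ ?_ (hD.mul_const N) ?_
  · filter_upwards [hev] with p hp
    exact (inn_integrable h hc hG (by linarith [hp.1.1]) _ _).aestronglyMeasurable
  · filter_upwards [hev] with p hp
    refine Eventually.of_forall fun y => ?_
    rw [Real.norm_eq_abs, abs_mul]
    exact mul_le_mul (hb _ hp.1 _ hp.2 y) (hG.bd _) (abs_nonneg _) ((abs_nonneg _).trans (hb _ hp.1 _ hp.2 y))
  · refine Eventually.of_forall fun y => ?_
    have h1 : ContinuousAt (fun p : ℝ × Euc d × Euc d => κ p.1 p.2.1 p.2.2) (τ0, x0, y) :=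
      h.cont.continuousAt ((isOpen_Ioi.prod isOpen_univ).mem_nhds ⟨hτ0, trivial⟩)
    have h2 : ContinuousAt (fun p : ℝ × ℝ × Euc d => ((p.1, p.2.2, y) : ℝ × Euc d × Euc d)) (τ0, s0, x0) := by
      fun_prop
    have h3 : ContinuousAt (fun p : ℝ × ℝ × Euc d => κ p.1 p.2.2 y) (τ0, s0, x0) :=
      ContinuousAt.comp (g := fun p : ℝ × Euc d × Euc d => κ p.1 p.2.1 p.2.2)
        (f := fun p : ℝ × ℝ × Euc d => ((p.1, p.2.2, y) : ℝ × Euc d × Euc d)) (x := (τ0, s0, x0)) h1 h2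
    have h4 := hG.cont
    refine h3.mul ?_
    fun_prop

lemma inn_deriv {d : ℕ} {κ : ℝ → Euc d → Euc d → ℝ} {κ' : Fin d → ℝ → Euc d → Euc d → ℝ} {C θ C' θ' c : ℝ}
    (h : Kern κ C θ c) (h' : ∀ i, Kern (κ' i) C' θ' c) (hc : 0 < c)
    (hd : ∀ τ, 0 < τ → ∀ x y, HasFDerivAt (fun x => κ τ x y) (gr fun i => κ' i τ x y) x)
    {G : ℝ × Euc d → ℝ} {N : ℝ} (hG : BC G N) {τ : ℝ} (hτ : 0 < τ) (s : ℝ) (x0 : Euc d) :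
    HasFDerivAt (fun x => inn κ G τ s x) (gr fun i => inn (κ' i) G τ s x0) x0 := by
  choose D hD hb using fun i => (h' i).dom hc hτ x0
  have e : (gr fun i => inn (κ' i) G τ s x0) = ∫ y, gr (fun i => κ' i τ x0 y * G (s, y)) := by
    unfold gr
    rw [MeasureTheory.integral_finsetSum]
    · refine Finset.sum_congr rfl fun i _ => ?_
      rw [integral_smul_const]; rfl
    · intro i _
      exact (inn_integrable (h' i) hc hG hτ s x0).smul_const _
  rw [e]
  unfold inn
  refine hasFDerivAt_integral_of_dominated_of_fderiv_le (F := fun x y => κ τ x y * G (s, y))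
    (F' := fun x y => gr (fun i => κ' i τ x y * G (s, y)))
    (bound := fun y => d * ((∑ i, |D i y|) * N)) (ball_mem_nhds x0 one_pos) ?_ ?_ ?_ ?_ ?_ ?_
  · exact Eventually.of_forall fun x => (inn_integrable h hc hG hτ s x).aestronglyMeasurable
  · exact inn_integrable h hc hG hτ s x0
  · refine Continuous.aestronglyMeasurable ?_
    refine gr_continuous fun i => ?_
    have h1 := (h' i).cont_y hτ x0
    have h2 := hG.cont
    fun_prop
  · refine Eventually.of_forall fun y x hx => ?_
    refine gr_norm_le _ _ fun i => ?_
    rw [abs_mul]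
    refine mul_le_mul ?_ (hG.bd _) (abs_nonneg _) (Finset.sum_nonneg fun _ _ => abs_nonneg _)
    refine (hb i τ ⟨by linarith, by linarith⟩ x hx y).trans ((le_abs_self _).trans ?_)
    exact Finset.single_le_sum (f := fun i => |D i y|) (fun _ _ => abs_nonneg _) (Finset.mem_univ i)
  · exact (((MeasureTheory.integrable_finsetSum _ fun i _ => (hD i).abs).mul_const N).const_mul _)
  · refine Eventually.of_forall fun y x _ => ?_
    refine ((hd τ hτ x y).mul_const (G (s, y))).congr_fderiv ?_
    ext v
    simp only [gr_apply, smul_apply, smul_eq_mul, Finset.mul_sum]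
    exact Finset.sum_congr rfl fun i _ => by ring

structure PotOK {d : ℕ} (f : ℝ → ℝ → Euc d → ℝ) (θ : ℝ) : Prop where
  cont : ContinuousOn (fun p : ℝ × ℝ × Euc d => f p.1 p.2.1 p.2.2) (Ioi 0 ×ˢ univ)
  bd : ∀ r : ℝ, ∃ C, ∀ τ ∈ Ioc 0 r, ∀ s x, ‖x‖ ≤ r → |f τ s x| ≤ C * τ ^ (-θ)

def Pot {d : ℕ} (f : ℝ → ℝ → Euc d → ℝ) (t : ℝ) (x : Euc d) : ℝ :=
  ∫ τ in Ioo 0 t, f τ (t - τ) x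

lemma rpow_intOn {θ : ℝ} (hθ : θ < 1) (r : ℝ) : MeasureTheory.IntegrableOn (fun τ : ℝ => τ ^ (-θ)) (Ioo 0 r) := by
  rcases le_or_gt r 0 with h | h
  · rw [Ioo_eq_empty (by linarith)]; simp
  · exact (intervalIntegral.integrableOn_Ioo_rpow_iff h).2 (by linarith)

lemma PotOK.comp {d : ℕ} {f : ℝ → ℝ → Euc d → ℝ} {θ : ℝ} (h : PotOK f θ) {X : Type*} [TopologicalSpace X]
    {a s : X → ℝ} {x : X → Euc d} {S : Set X} (ha : ContinuousOn a S) (hs : ContinuousOn s S) (hx : ContinuousOn x S)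
    (h0 : ∀ p ∈ S, 0 < a p) : ContinuousOn (fun p => f (a p) (s p) (x p)) S :=
  ContinuousOn.comp (g := fun p : ℝ × ℝ × Euc d => f p.1 p.2.1 p.2.2) (f := fun p => (a p, s p, x p)) h.cont
    (ha.prodMk (hs.prodMk hx)) (fun p hp => ⟨h0 p hp, trivial⟩)

lemma PotOK.intOn {d : ℕ} {f : ℝ → ℝ → Euc d → ℝ} {θ : ℝ} (h : PotOK f θ) (hθ : θ < 1) (t : ℝ) (x : Euc d) :
    MeasureTheory.IntegrableOn (fun τ => f τ (t - τ) x) (Ioo 0 t) := by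
  obtain ⟨C, hC⟩ := h.bd (max t ‖x‖)
  refine MeasureTheory.Integrable.mono' ((rpow_intOn hθ t).const_mul C) ?_ ?_
  · exact (h.comp (by fun_prop) (by fun_prop) (by fun_prop) (fun p hp => hp.1)).aestronglyMeasurable measurableSet_Ioo
  · refine MeasureTheory.ae_restrict_of_forall_mem measurableSet_Ioo fun τ hτ => ?_
    exact hC τ ⟨hτ.1, hτ.2.le.trans (le_max_left _ _)⟩ _ _ (le_max_right _ _)

lemma Pot_eq_ind {d : ℕ} (f : ℝ → ℝ → Euc d → ℝ) {t R : ℝ} (h : t ≤ R) (x : Euc d) :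
    Pot f t x = ∫ τ in Ioo 0 R, (Iio t).indicator (fun τ => f τ (t - τ) x) τ := by
  rw [MeasureTheory.setIntegral_indicator measurableSet_Iio]
  unfold Pot
  congr 2
  ext τ
  simp only [mem_Ioo, mem_inter_iff, mem_Iio]
  constructor
  · rintro ⟨a, b⟩; exact ⟨⟨a, by linarith⟩, b⟩
  · rintro ⟨⟨a, _⟩, b⟩; exact ⟨a, b⟩

lemma Pot_cont {d : ℕ} {f : ℝ → ℝ → Euc d → ℝ} {θ : ℝ} (h : PotOK f θ) (hθ : θ < 1) :
    Continuous (fun p : ℝ × Euc d => Pot f p.1 p.2) := by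
  rw [continuous_iff_continuousAt]
  rintro ⟨t0, x0⟩
  set R := max t0 ‖x0‖ + 1 with hR
  obtain ⟨C, hC⟩ := h.bd R
  have hev : ∀ᶠ p : ℝ × Euc d in nhds (t0, x0), p.1 < R ∧ ‖p.2‖ < R := by
    refine Filter.Eventually.and ?_ ?_
    · exact continuousAt_fst.eventually_lt continuousAt_const (by simp [hR]; linarith [le_max_left t0 ‖x0‖])
    · exact ContinuousAt.eventually_lt (by fun_prop) continuousAt_const
        (by simp [hR]; linarith [le_max_right t0 ‖x0‖])
  have hev2 : (fun p : ℝ × Euc d => Pot f p.1 p.2) =ᶠ[nhds (t0, x0)]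
      fun p => ∫ τ in Ioo 0 R, (Iio p.1).indicator (fun τ => f τ (p.1 - τ) p.2) τ := by
    filter_upwards [hev] with p hp
    exact Pot_eq_ind f hp.1.le p.2
  refine ContinuousAt.congr ?_ hev2.symm
  refine MeasureTheory.continuousAt_of_dominated (bound := fun τ => |C| * τ ^ (-θ)) ?_ ?_
    ((rpow_intOn hθ R).const_mul _) ?_
  · refine Eventually.of_forall fun p => ?_
    refine MeasureTheory.AEStronglyMeasurable.indicator ?_ measurableSet_Iio
    exact (h.comp (by fun_prop) (by fun_prop) (by fun_prop) (fun p hp => hp.1)).aestronglyMeasurable measurableSet_Ioo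
  · filter_upwards [hev] with p hp
    refine MeasureTheory.ae_restrict_of_forall_mem measurableSet_Ioo fun τ hτ => ?_
    refine (norm_indicator_le_norm_self _ _).trans ?_
    refine (hC τ ⟨hτ.1, hτ.2.le⟩ _ _ hp.2.le).trans ?_
    have : 0 ≤ τ ^ (-θ) := Real.rpow_nonneg hτ.1.le _
    gcongr
    exact le_abs_self _
  · have hne : ∀ᵐ τ : ℝ ∂(MeasureTheory.volume.restrict (Ioo 0 R)), τ ≠ t0 :=
      MeasureTheory.ae_restrict_of_ae (MeasureTheory.Measure.ae_ne _ t0)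
    filter_upwards [hne, MeasureTheory.ae_restrict_mem measurableSet_Ioo] with τ hτ hτ'
    rcases lt_or_gt_of_ne hτ with h1 | h1
    · have e : (fun p : ℝ × Euc d => (Iio p.1).indicator (fun τ => f τ (p.1 - τ) p.2) τ) =ᶠ[nhds (t0, x0)]
          fun p => f τ (p.1 - τ) p.2 := by
        have : ∀ᶠ p : ℝ × Euc d in nhds (t0, x0), τ < p.1 :=
          continuousAt_const.eventually_lt continuousAt_fst h1
        filter_upwards [this] with p hp
        rw [indicator_of_mem]; exact hp
      refine ContinuousAt.congr ?_ e.symm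
      have := h.comp (X := ℝ × Euc d) (S := univ) (a := fun _ => τ) (s := fun p => p.1 - τ) (x := fun p => p.2)
        (by fun_prop) (by fun_prop) (by fun_prop) (fun _ _ => hτ'.1)
      exact (continuousOn_univ.1 this).continuousAt
    · have e : (fun p : ℝ × Euc d => (Iio p.1).indicator (fun τ => f τ (p.1 - τ) p.2) τ) =ᶠ[nhds (t0, x0)]
          fun p => 0 := by
        have : ∀ᶠ p : ℝ × Euc d in nhds (t0, x0), p.1 < τ :=
          continuousAt_fst.eventually_lt continuousAt_const h1
        filter_upwards [this] with p hp
        rw [indicator_of_notMem]; simp only [mem_Iio]; linarith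
      exact ContinuousAt.congr continuousAt_const e.symm

lemma Pot_le {d : ℕ} (f : ℝ → ℝ → Euc d → ℝ) (t : ℝ) (x : Euc d) (b : ℝ → ℝ)
    (hb : MeasureTheory.IntegrableOn b (Ioo 0 t)) (h : ∀ τ ∈ Ioo 0 t, |f τ (t - τ) x| ≤ b τ) :
    |Pot f t x| ≤ ∫ τ in Ioo 0 t, b τ := by
  unfold Pot
  rw [← Real.norm_eq_abs]
  refine MeasureTheory.norm_integral_le_of_norm_le hb ?_
  exact MeasureTheory.ae_restrict_of_forall_mem measurableSet_Ioo fun τ hτ => h τ hτ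

lemma Pot_deriv {d : ℕ} {f : ℝ → ℝ → Euc d → ℝ} {f' : Fin d → ℝ → ℝ → Euc d → ℝ} {θ θ' : ℝ} (h : PotOK f θ)
    (hθ : θ < 1) (h' : ∀ i, PotOK (f' i) θ') (hθ' : θ' < 1)
    (hd : ∀ τ, 0 < τ → ∀ s x, HasFDerivAt (fun x => f τ s x) (gr fun i => f' i τ s x) x) (t : ℝ) (x0 : Euc d) :
    HasFDerivAt (fun x => Pot f t x) (gr fun i => Pot (f' i) t x0) x0 := by
  set R := max t (‖x0‖ + 1) with hR
  choose C hC using fun i => (h' i).bd R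
  have e : (gr fun i => Pot (f' i) t x0) = ∫ τ in Ioo 0 t, gr (fun i => f' i τ (t - τ) x0) := by
    unfold gr
    rw [MeasureTheory.integral_finsetSum]
    · refine Finset.sum_congr rfl fun i _ => ?_
      rw [integral_smul_const]; rfl
    · intro i _
      exact MeasureTheory.Integrable.smul_const ((h' i).intOn hθ' t x0) _
  rw [e]
  unfold Pot
  refine hasFDerivAt_integral_of_dominated_of_fderiv_le (F := fun x τ => f τ (t - τ) x)
    (F' := fun x τ => gr (fun i => f' i τ (t - τ) x))
    (bound := fun τ => d * ((∑ i, |C i|) * τ ^ (-θ'))) (ball_mem_nhds x0 one_pos) ?_ ?_ ?_ ?_ ?_ ?_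
  · exact Eventually.of_forall fun x => (h.intOn hθ t x).aestronglyMeasurable
  · exact h.intOn hθ t x0
  · refine ContinuousOn.aestronglyMeasurable ?_ measurableSet_Ioo
    unfold gr
    refine continuousOn_finsetSum _ fun i _ => ContinuousOn.fun_smul ?_ continuousOn_const
    exact (h' i).comp (by fun_prop) (by fun_prop) (by fun_prop) (fun p hp => hp.1)
  · refine MeasureTheory.ae_restrict_of_forall_mem measurableSet_Ioo fun τ hτ x hx => ?_
    refine gr_norm_le _ _ fun i => ?_
    have hxR : ‖x‖ ≤ R := by
      rw [mem_ball, dist_eq_norm] at hx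
      have : ‖x‖ ≤ ‖x - x0‖ + ‖x0‖ := by simpa using norm_add_le (x - x0) x0
      have := le_max_right t (‖x0‖ + 1)
      linarith
    refine (hC i τ ⟨hτ.1, hτ.2.le.trans (le_max_left _ _)⟩ _ _ hxR).trans ?_
    have : 0 ≤ τ ^ (-θ') := Real.rpow_nonneg hτ.1.le _
    gcongr
    exact (le_abs_self _).trans
      (Finset.single_le_sum (f := fun i => |C i|) (fun _ _ => abs_nonneg _) (Finset.mem_univ i))
  · exact ((rpow_intOn hθ' t).const_mul _).const_mul _
  · exact MeasureTheory.ae_restrict_of_forall_mem measurableSet_Ioo fun τ hτ x _ => hd τ hτ.1 _ _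

/-- Fubini on a triangle -/
lemma triangle {θ C t : ℝ} (hθ : θ < 1) (φ : ℝ → ℝ → ℝ)
    (hc : ContinuousOn (fun p : ℝ × ℝ => φ p.1 p.2) (Ioi 0 ×ˢ univ))
    (hb : ∀ a ∈ Ioo 0 t, ∀ r, |φ a r| ≤ C * a ^ (-θ)) :
    ∫ r in Ioo 0 t, ∫ a in Ioo 0 r, φ a r = ∫ a in Ioo 0 t, ∫ r in Ioo a t, φ a r := by
  have hmeas : MeasurableSet {p : ℝ × ℝ | p.2 < p.1} := measurableSet_lt measurable_snd measurable_fst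
  have e1 : ∀ r ∈ Ioo 0 t, ∫ a in Ioo 0 r, φ a r =
      ∫ a in Ioo 0 t, {p : ℝ × ℝ | p.2 < p.1}.indicator (fun p => φ p.2 p.1) (r, a) := by
    intro r hr
    have : ∀ a, {p : ℝ × ℝ | p.2 < p.1}.indicator (fun p => φ p.2 p.1) (r, a) =
        (Iio r).indicator (fun a => φ a r) a := by
      intro a; simp only [indicator, mem_setOf_eq, mem_Iio]
    simp only [this]
    rw [MeasureTheory.setIntegral_indicator measurableSet_Iio]
    congr 2
    ext a
    simp only [mem_Ioo, mem_inter_iff, mem_Iio]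
    exact ⟨fun h => ⟨⟨h.1, h.2.trans hr.2⟩, h.2⟩, fun h => ⟨h.1.1, h.2⟩⟩
  have e2 : ∀ a ∈ Ioo 0 t, ∫ r in Ioo a t, φ a r =
      ∫ r in Ioo 0 t, {p : ℝ × ℝ | p.2 < p.1}.indicator (fun p => φ p.2 p.1) (r, a) := by
    intro a ha
    have : ∀ r, {p : ℝ × ℝ | p.2 < p.1}.indicator (fun p => φ p.2 p.1) (r, a) =
        (Ioi a).indicator (fun r => φ a r) r := by
      intro a; simp only [indicator, mem_setOf_eq, mem_Ioi]
    simp only [this]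
    rw [MeasureTheory.setIntegral_indicator measurableSet_Ioi]
    congr 2
    ext r
    simp only [mem_Ioo, mem_inter_iff, mem_Ioi]
    exact ⟨fun h => ⟨⟨ha.1.trans h.1, h.2⟩, h.1⟩, fun h => ⟨h.2, h.1.2⟩⟩
  rw [MeasureTheory.setIntegral_congr_fun measurableSet_Ioo e1,
    MeasureTheory.setIntegral_congr_fun measurableSet_Ioo e2]
  refine MeasureTheory.integral_integral_swap
    (f := fun r a => {p : ℝ × ℝ | p.2 < p.1}.indicator (fun p => φ p.2 p.1) (r, a)) ?_
  have hI : MeasureTheory.Integrable (fun p : ℝ × ℝ => (1:ℝ) * (|C| * p.2 ^ (-θ)))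
      ((MeasureTheory.volume.restrict (Ioo 0 t)).prod (MeasureTheory.volume.restrict (Ioo 0 t))) :=
    MeasureTheory.Integrable.mul_prod (f := fun _ : ℝ => (1:ℝ)) (g := fun a : ℝ => |C| * a ^ (-θ))
      (MeasureTheory.integrable_const _) ((rpow_intOn hθ t).const_mul _)
  refine hI.mono' ?_ ?_
  · change MeasureTheory.AEStronglyMeasurable ({p : ℝ × ℝ | p.2 < p.1}.indicator (fun p => φ p.2 p.1)) _
    refine MeasureTheory.AEStronglyMeasurable.indicator ?_ hmeas
    rw [MeasureTheory.Measure.prod_restrict]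
    refine ContinuousOn.aestronglyMeasurable ?_ (measurableSet_Ioo.prod measurableSet_Ioo)
    exact ContinuousOn.comp (g := fun p : ℝ × ℝ => φ p.1 p.2) (f := fun p : ℝ × ℝ => (p.2, p.1)) hc
      (by fun_prop) (fun p hp => ⟨hp.2.1, trivial⟩)
  · rw [MeasureTheory.Measure.prod_restrict]
    refine MeasureTheory.ae_restrict_of_forall_mem (measurableSet_Ioo.prod measurableSet_Ioo) fun p hp => ?_
    refine (norm_indicator_le_norm_self (fun p : ℝ × ℝ => φ p.2 p.1) _).trans ?_
    refine (hb p.2 hp.2 p.1).trans ?_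
    have : 0 ≤ p.2 ^ (-θ) := Real.rpow_nonneg hp.2.1.le _
    rw [one_mul]
    gcongr
    exact le_abs_self _

lemma Ioo_int {a b : ℝ} (h : a ≤ b) (f : ℝ → ℝ) : ∫ τ in Ioo a b, f τ = ∫ τ in a..b, f τ := by
  rw [intervalIntegral.integral_of_le h, MeasureTheory.integral_Ioc_eq_integral_Ioo]

lemma Pot_time_formula {d : ℕ} {f h : ℝ → ℝ → Euc d → ℝ} {g : ℝ → Euc d → ℝ} {θ : ℝ} (hθ : θ < 1)
    (hh : PotOK h θ) (x : Euc d) (hg : Continuous fun s => g s x)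
    (hd : ∀ τ, 0 < τ → ∀ s, HasDerivAt (fun τ => f τ s x) (h τ s x) τ)
    (hl : ∀ s, Tendsto (fun τ => f τ s x) (nhdsWithin 0 (Ioi 0)) (nhds (g s x))) {t : ℝ} (ht : 0 ≤ t) :
    Pot f t x = ∫ r in (0:ℝ)..t, (g r x + Pot h r x) := by
  obtain ⟨C, hC⟩ := hh.bd (max t ‖x‖)
  have hIntg : ∀ τ s, τ ≤ t → MeasureTheory.IntegrableOn (fun a => h a s x) (Ioo 0 τ) := by
    intro τ s hτ
    refine MeasureTheory.Integrable.mono' ((rpow_intOn hθ τ).const_mul C) ?_ ?_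
    · exact (hh.comp (by fun_prop) (by fun_prop) (by fun_prop) (fun p hp => hp.1)).aestronglyMeasurable
        measurableSet_Ioo
    · refine MeasureTheory.ae_restrict_of_forall_mem measurableSet_Ioo fun a ha => ?_
      exact hC a ⟨ha.1, (ha.2.le.trans hτ).trans (le_max_left _ _)⟩ _ _ (le_max_right _ _)
  have hf : ∀ τ ∈ Ioo 0 t, ∀ s, f τ s x = g s x + ∫ a in Ioo 0 τ, h a s x := by
    intro τ hτ s
    have := intervalIntegral.integral_eq_sub_of_hasDerivAt_of_tendsto (f := fun τ => f τ s x)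
      (f' := fun τ => h τ s x) (a := 0) (b := τ) (fa := g s x) (fb := f τ s x) hτ.1
      (fun a ha => hd a ha.1 s)
      ((intervalIntegrable_iff_integrableOn_Ioo_of_le hτ.1.le).2 (hIntg τ s hτ.2.le))
      (hl s) ((hd τ hτ.1 s).continuousAt.tendsto.mono_left nhdsWithin_le_nhds)
    rw [Ioo_int hτ.1.le, this]; ring
  have hPc : Continuous fun r => Pot h r x := (Pot_cont hh hθ).comp (by fun_prop : Continuous fun r : ℝ => (r, x))
  have hgc : Continuous fun τ => g (t - τ) x := hg.comp (by fun_prop : Continuous fun τ : ℝ => t - τ)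
  have hb1 : ∀ a ∈ Ioo 0 t, ∀ r, |h a (t - r) x| ≤ C * a ^ (-θ) := fun a ha r =>
    hC a ⟨ha.1, ha.2.le.trans (le_max_left _ _)⟩ _ _ (le_max_right _ _)
  have hb2 : ∀ a ∈ Ioo 0 t, ∀ r, |h a (r - a) x| ≤ C * a ^ (-θ) := fun a ha r =>
    hC a ⟨ha.1, ha.2.le.trans (le_max_left _ _)⟩ _ _ (le_max_right _ _)
  have T1 := triangle hθ (fun a r => h a (t - r) x)
    (hh.comp (by fun_prop) (by fun_prop) (by fun_prop) (fun p hp => hp.1)) hb1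
  have T2 := triangle hθ (fun a r => h a (r - a) x)
    (hh.comp (by fun_prop) (by fun_prop) (by fun_prop) (fun p hp => hp.1)) hb2
  have E : ∀ a ∈ Ioo 0 t, ∫ r in Ioo a t, h a (t - r) x = ∫ r in Ioo a t, h a (r - a) x := by
    intro a ha
    rw [Ioo_int ha.2.le, Ioo_int ha.2.le, intervalIntegral.integral_comp_sub_left (fun s => h a s x),
      intervalIntegral.integral_comp_sub_right (fun s => h a s x)]
    simp
  have T3 : ∫ r in Ioo 0 t, ∫ a in Ioo 0 r, h a (t - r) x = ∫ r in Ioo 0 t, Pot h r x := by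
    rw [T1, MeasureTheory.setIntegral_congr_fun measurableSet_Ioo E, ← T2]
    rfl
  have hfint : MeasureTheory.IntegrableOn (fun τ => ∫ a in Ioo 0 τ, h a (t - τ) x) (Ioo 0 t) := by
    have hA : MeasureTheory.IntegrableOn (fun τ => ∫ a in Ioo 0 t, |C| * a ^ (-θ)) (Ioo 0 t) :=
      MeasureTheory.integrable_const _
    refine hA.mono' ?_ ?_
    · have e : ∀ τ, ∫ a in Ioo 0 τ, h a (t - τ) x = Pot (fun a s x => h a (s + a + (t - 2 * (s + a))) x) τ x := by
        intro τ; unfold Pot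
        refine MeasureTheory.setIntegral_congr_fun measurableSet_Ioo fun a _ => ?_
        beta_reduce; congr 1; ring
      simp only [e]
      have : PotOK (fun a s x => h a (s + a + (t - 2 * (s + a))) x) θ := by
        refine ⟨hh.comp (by fun_prop) (by fun_prop) (by fun_prop) (fun p hp => hp.1), fun r => ?_⟩
        obtain ⟨C, hC⟩ := hh.bd r
        exact ⟨C, fun τ hτ s x hx => hC τ hτ _ x hx⟩
      exact ((Pot_cont this hθ).comp (by fun_prop : Continuous fun r : ℝ => (r, x))).aestronglyMeasurable
    · refine MeasureTheory.ae_restrict_of_forall_mem measurableSet_Ioo fun τ hτ => ?_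
      have h1 : ‖∫ a in Ioo 0 τ, h a (t - τ) x‖ ≤ ∫ a in Ioo 0 τ, |C| * a ^ (-θ) := by
        refine MeasureTheory.norm_integral_le_of_norm_le ((rpow_intOn hθ τ).const_mul _)
          (MeasureTheory.ae_restrict_of_forall_mem measurableSet_Ioo fun a ha => ?_)
        refine (hb1 a ⟨ha.1, ha.2.trans hτ.2⟩ τ).trans ?_
        have : 0 ≤ a ^ (-θ) := Real.rpow_nonneg ha.1.le _
        gcongr
        exact le_abs_self _
      refine h1.trans (MeasureTheory.setIntegral_mono_set ((rpow_intOn hθ t).const_mul _) ?_ ?_)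
      · refine MeasureTheory.ae_restrict_of_forall_mem measurableSet_Ioo fun a ha => ?_
        have : 0 ≤ a ^ (-θ) := Real.rpow_nonneg ha.1.le _
        show 0 ≤ |C| * a ^ (-θ)
        positivity
      · exact (Ioo_subset_Ioo_right hτ.2.le).eventuallyLE
  rw [intervalIntegral.integral_add (hg.intervalIntegrable _ _) (hPc.intervalIntegrable _ _), ← Ioo_int ht, ← Ioo_int ht,
    ← T3]
  unfold Pot
  rw [MeasureTheory.setIntegral_congr_fun measurableSet_Ioo fun τ hτ => hf τ hτ (t - τ)]
  have hgi : MeasureTheory.IntegrableOn (fun τ => g (t - τ) x) (Ioo 0 t) :=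
    (hgc.integrableOn_Icc (a := 0) (b := t)).mono_set Ioo_subset_Icc_self
  rw [MeasureTheory.integral_add hgi hfint]
  congr 1
  rw [Ioo_int ht, Ioo_int ht, intervalIntegral.integral_comp_sub_left (fun s => g s x)]
  simp

lemma Pot_time {d : ℕ} {f h : ℝ → ℝ → Euc d → ℝ} {g : ℝ → Euc d → ℝ} {θ : ℝ} (hθ : θ < 1)
    (hh : PotOK h θ) (x : Euc d) (hg : Continuous fun s => g s x)
    (hd : ∀ τ, 0 < τ → ∀ s, HasDerivAt (fun τ => f τ s x) (h τ s x) τ)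
    (hl : ∀ s, Tendsto (fun τ => f τ s x) (nhdsWithin 0 (Ioi 0)) (nhds (g s x))) {t : ℝ} (ht : 0 < t) :
    HasDerivAt (fun t => Pot f t x) (g t x + Pot h t x) t := by
  have hPc : Continuous fun r => Pot h r x := (Pot_cont hh hθ).comp (by fun_prop : Continuous fun r : ℝ => (r, x))
  have h1 := ((hg.add hPc).integral_hasStrictDerivAt 0 t).hasDerivAt
  refine h1.congr_of_eventuallyEq ?_
  filter_upwards [lt_mem_nhds ht] with r hr
  exact Pot_time_formula hθ hh x hg hd hl (le_of_lt hr)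

section
variable {d : ℕ} {A B : Euc d → Matrix (Fin d) (Fin d) ℝ} {K c0 : ℝ}

def kZ (B : Euc d → Matrix (Fin d) (Fin d) ℝ) (τ : ℝ) (x y : Euc d) : ℝ := ez (B y) τ (x - y)
def kZ1 (B : Euc d → Matrix (Fin d) (Fin d) ℝ) (i : Fin d) (τ : ℝ) (x y : Euc d) : ℝ := ez1 (B y) τ (x - y) i
def kZ2 (B : Euc d → Matrix (Fin d) (Fin d) ℝ) (i j : Fin d) (τ : ℝ) (x y : Euc d) : ℝ := ez2 (B y) τ (x - y) i j
def dA (A : Euc d → Matrix (Fin d) (Fin d) ℝ) (i j l : Fin d) (x : Euc d) : ℝ :=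
  fderiv ℝ (fun x => A x i j) x (EuclideanSpace.single l 1)
def kK (A B : Euc d → Matrix (Fin d) (Fin d) ℝ) (τ : ℝ) (x y : Euc d) : ℝ :=
  ∑ i, ∑ j, (A x i j - A y i j) * ez2 (B y) τ (x - y) i j
def kK1 (A B : Euc d → Matrix (Fin d) (Fin d) ℝ) (l : Fin d) (τ : ℝ) (x y : Euc d) : ℝ :=
  ∑ i, ∑ j, (dA A i j l x * ez2 (B y) τ (x - y) i j + (A x i j - A y i j) * ez3 (B y) τ (x - y) i j l)

lemma lip_cont {f : Euc d → ℝ} {K : ℝ} (h : ∀ x y, |f x - f y| ≤ K * ‖x - y‖) : Continuous f := by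
  have : LipschitzWith K.toNNReal f := LipschitzWith.of_dist_le_mul fun x y => by
    rw [Real.dist_eq, dist_eq_norm]
    refine (h x y).trans ?_
    gcongr
    exact Real.le_coe_toNNReal K
  exact this.continuous

lemma Coef.Bcont (h : Coef d A B K c0) (i j : Fin d) : Continuous fun x => B x i j :=
  lip_cont fun x y => h.Blip x y i j
lemma Coef.Acont (h : Coef d A B K c0) (i j : Fin d) : Continuous fun x => A x i j :=
  lip_cont fun x y => h.Alip x y i j

lemma gr_fderiv {f : Euc d → ℝ} {f' : Euc d →L[ℝ] ℝ} {x : Euc d} (h : HasFDerivAt f f' x) :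
    HasFDerivAt f (gr fun l => f' (EuclideanSpace.single l 1)) x := by
  refine h.congr_fderiv ?_
  ext v
  rw [gr_apply]
  conv_lhs => rw [← (EuclideanSpace.basisFun (Fin d) ℝ).sum_repr v]
  simp only [map_sum, map_smul, smul_eq_mul, EuclideanSpace.basisFun_repr, EuclideanSpace.basisFun_apply]
  exact Finset.sum_congr rfl fun i _ => by ring

lemma Coef.dA_deriv (h : Coef d A B K c0) (i j : Fin d) (x : Euc d) :
    HasFDerivAt (fun x => A x i j) (gr fun l => dA A i j l x) x :=
  gr_fderiv (((h.AC1 i j).differentiable one_ne_zero) x).hasFDerivAt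

lemma Coef.dA_cont (h : Coef d A B K c0) (i j l : Fin d) : Continuous (dA A i j l) := by
  unfold dA
  have := (h.AC1 i j).continuous_fderiv one_ne_zero
  fun_prop

lemma Coef.dA_bd (h : Coef d A B K c0) (i j l : Fin d) (x : Euc d) : |dA A i j l x| ≤ K := by
  unfold dA
  have hK := h.K1
  have h1 : ‖fderiv ℝ (fun x => A x i j) x‖ ≤ K := by
    refine HasFDerivAt.le_of_lip' (((h.AC1 i j).differentiable one_ne_zero) x).hasFDerivAt (by linarith) ?_
    exact Eventually.of_forall fun y => h.Alip y x i j
  have h2 := (fderiv ℝ (fun x => A x i j) x).le_opNorm (EuclideanSpace.single l 1)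
  rw [Real.norm_eq_abs] at h2
  simp at h2
  linarith

lemma comp_sub_gr {f : Euc d → ℝ} {c : Fin d → ℝ} {x y : Euc d} (h : HasFDerivAt f (gr c) (x - y)) :
    HasFDerivAt (fun x => f (x - y)) (gr c) x := by
  have := HasFDerivAt.comp (g := f) (f := fun x => x - y) x h ((hasFDerivAt_id x).sub_const y)
  rw [ContinuousLinearMap.comp_id] at this
  exact this

lemma kZ_deriv (h : Coef d A B K c0) (τ : ℝ) (x y : Euc d) :
    HasFDerivAt (fun x => kZ B τ x y) (gr fun i => kZ1 B i τ x y) x :=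
  comp_sub_gr (ez_deriv (h.Bsymm y) τ (x - y))

lemma kZ1_deriv (h : Coef d A B K c0) (i : Fin d) {τ : ℝ} (hτ : 0 < τ) (x y : Euc d) :
    HasFDerivAt (fun x => kZ1 B i τ x y) (gr fun j => kZ2 B i j τ x y) x :=
  comp_sub_gr (ez1_deriv (h.Bsymm y) hτ (x - y) i)

lemma kZ2_deriv (h : Coef d A B K c0) (i j : Fin d) {τ : ℝ} (hτ : 0 < τ) (x y : Euc d) :
    HasFDerivAt (fun x => kZ2 B i j τ x y) (gr fun l => ez3 (B y) τ (x - y) i j l) x :=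
  comp_sub_gr (ez2_deriv (h.Bsymm y) hτ (x - y) i j)

lemma kK_deriv (h : Coef d A B K c0) {τ : ℝ} (hτ : 0 < τ) (x y : Euc d) :
    HasFDerivAt (fun x => kK A B τ x y) (gr fun l => kK1 A B l τ x y) x := by
  unfold kK
  have h1 : HasFDerivAt (fun x => ∑ i, ∑ j, (A x i j - A y i j) * ez2 (B y) τ (x - y) i j)
    (∑ i, ∑ j, ((A x i j - A y i j) • (gr fun l => ez3 (B y) τ (x - y) i j l) +
      ez2 (B y) τ (x - y) i j • (gr fun l => dA A i j l x))) x :=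
    HasFDerivAt.fun_sum fun i _ => HasFDerivAt.fun_sum fun j _ =>
      ((h.dA_deriv i j x).sub_const _).mul (kZ2_deriv h i j hτ x y)
  refine h1.congr_fderiv ?_
  ext v
  simp only [gr_apply, sum_apply, add_apply, smul_apply, smul_eq_mul, kK1]
  simp only [Finset.mul_sum, ← Finset.sum_add_distrib, Finset.sum_mul]
  conv_rhs => rw [Finset.sum_comm]
  refine Finset.sum_congr rfl fun i _ => ?_
  conv_rhs => rw [Finset.sum_comm]
  refine Finset.sum_congr rfl fun j _ => ?_
  refine Finset.sum_congr rfl fun l _ => ?_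
  ring

lemma kcont (h : Coef d A B K c0) : ContinuousOn (fun p : ℝ × Euc d × Euc d => kZ B p.1 p.2.1 p.2.2) (Ioi 0 ×ˢ univ) ∧
    ∀ i, Continuous (fun p : ℝ × Euc d × Euc d => bz (B p.2.2) (p.2.1 - p.2.2) i) := by
  constructor
  · unfold kZ ez qf
    refine ContinuousOn.mul ?_ ?_
    · refine ContinuousOn.rpow_const (by fun_prop) fun p hp => Or.inl ?_
      exact ne_of_gt hp.1
    · refine ContinuousOn.rexp (ContinuousOn.div ?_ (by fun_prop) fun p hp => ?_)
      · refine Continuous.continuousOn (Continuous.neg ?_)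
        refine continuous_finsetSum _ fun i _ => continuous_finsetSum _ fun j _ => ?_
        have := h.Bcont i j
        fun_prop
      · have : 0 < p.1 := hp.1
        positivity
  · intro i
    unfold bz
    refine continuous_finsetSum _ fun j _ => ?_
    have := h.Bcont i j
    fun_prop

lemma kZ1_cont (h : Coef d A B K c0) (i : Fin d) :
    ContinuousOn (fun p : ℝ × Euc d × Euc d => kZ1 B i p.1 p.2.1 p.2.2) (Ioi 0 ×ˢ univ) := by
  obtain ⟨h1, h2⟩ := kcont h
  unfold kZ1 ez1
  refine ContinuousOn.mul (ContinuousOn.neg (ContinuousOn.div (h2 i).continuousOn (by fun_prop) fun p hp => ?_)) h1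
  have : 0 < p.1 := hp.1
  positivity

lemma kZ2_cont (h : Coef d A B K c0) (i j : Fin d) :
    ContinuousOn (fun p : ℝ × Euc d × Euc d => kZ2 B i j p.1 p.2.1 p.2.2) (Ioi 0 ×ˢ univ) := by
  obtain ⟨h1, h2⟩ := kcont h
  have h3 := h.Bcont i j
  unfold kZ2 ez2
  refine ContinuousOn.mul (ContinuousOn.sub (ContinuousOn.div ((h2 i).mul (h2 j)).continuousOn (by fun_prop) fun p hp => ?_)
    (ContinuousOn.div (by fun_prop) (by fun_prop) fun p hp => ?_)) h1
  · have : 0 < p.1 := hp.1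
    positivity
  · have : 0 < p.1 := hp.1
    positivity

lemma ez3_cont (h : Coef d A B K c0) (i j k : Fin d) :
    ContinuousOn (fun p : ℝ × Euc d × Euc d => ez3 (B p.2.2) p.1 (p.2.1 - p.2.2) i j k) (Ioi 0 ×ˢ univ) := by
  obtain ⟨h1, h2⟩ := kcont h
  have h3 := h.Bcont i j
  have h4 := h.Bcont i k
  have h5 := h.Bcont j k
  have h6 := h2 i
  have h7 := h2 j
  unfold ez3
  refine ContinuousOn.mul (ContinuousOn.sub (ContinuousOn.div (by fun_prop) (by fun_prop) fun p hp => ?_)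
    (ContinuousOn.mul (ContinuousOn.sub (ContinuousOn.div ((h2 i).mul (h2 j)).continuousOn (by fun_prop) fun p hp => ?_)
    (ContinuousOn.div (by fun_prop) (by fun_prop) fun p hp => ?_))
      (ContinuousOn.div (h2 k).continuousOn (by fun_prop) fun p hp => ?_))) h1
  all_goals
    have : 0 < p.1 := hp.1
    positivity

lemma kK_cont (h : Coef d A B K c0) :
    ContinuousOn (fun p : ℝ × Euc d × Euc d => kK A B p.1 p.2.1 p.2.2) (Ioi 0 ×ˢ univ) := by
  unfold kK
  refine continuousOn_finsetSum _ fun i _ => continuousOn_finsetSum _ fun j _ => ?_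
  have := h.Acont i j
  exact ContinuousOn.mul (by fun_prop) (kZ2_cont h i j)

lemma kK1_cont (h : Coef d A B K c0) (l : Fin d) :
    ContinuousOn (fun p : ℝ × Euc d × Euc d => kK1 A B l p.1 p.2.1 p.2.2) (Ioi 0 ×ˢ univ) := by
  unfold kK1
  refine continuousOn_finsetSum _ fun i _ => continuousOn_finsetSum _ fun j _ => ?_
  have := h.Acont i j
  have := h.dA_cont i j l
  exact ContinuousOn.add (ContinuousOn.mul (by fun_prop) (kZ2_cont h i j)) (ContinuousOn.mul (by fun_prop) (ez3_cont h i j l))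

/-- all kernel bounds -/
structure KB (A B : Euc d → Matrix (Fin d) (Fin d) ℝ) (C c : ℝ) : Prop where
  C1 : 1 ≤ C
  cpos : 0 < c
  z : Kern (kZ B) C 0 c
  z1 : ∀ i, Kern (kZ1 B i) C (1/2) c
  z2 : ∀ i j, Kern (kZ2 B i j) C 1 c
  k : Kern (kK A B) C (1/2) c
  k1 : ∀ l, Kern (kK1 A B l) C 1 c
  hol : ∀ i j, ∀ τ, 0 < τ → ∀ x y, |kZ2 B i j τ x y| * Real.sqrt ‖y - x‖ ≤ C * τ ^ (-(3/4) : ℝ) * ga c τ (x - y)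
  frz : ∀ i j, ∀ τ, 0 < τ → ∀ x y, |kZ2 B i j τ x y - ez2 (B x) τ (x - y) i j| ≤ C * τ ^ (-(1/2) : ℝ) * ga c τ (x - y)
  az2 : ∀ i j i' j', Kern (fun τ x y => (A x i j - A y i j) * kZ2 B i' j' τ x y) C (1/2) c
  i0 : ∀ x y, |∫ z, (ez (B x) 1 z - ez (B y) 1 z)| ≤ C * ‖x - y‖

set_option maxHeartbeats 2000000 in
lemma exists_KB (h : Coef d A B K c0) : ∃ C, KB A B C (c0 / 8) := by
  have hc : 0 < c0 / 8 := by have := h.c0pos; positivity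
  have hK := h.K1
  obtain ⟨S, hS1, hS⟩ := ga_absorb' (d := d) hc
  have abs : ∀ (k j : ℕ) (e : ℝ), k ≤ 6 → j ≤ 6 → (k:ℝ) / 2 - j = e → ∀ τ : ℝ, 0 < τ → ∀ z : Euc d,
      ‖z‖ ^ k / τ ^ j * ga (2 * (c0 / 8)) τ z ≤ S * τ ^ e * ga (c0 / 8) τ z := by
    intro k j e hk hj he τ hτ z
    rw [← he]; exact hS k j hk hj τ hτ z
  have D0 : (0:ℝ) ≤ d := by positivity
  -- master constant
  set Q : ℝ := (1 + d) ^ 4 * K ^ 4 * S with hQ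
  have hQ1 : 1 ≤ Q := by
    have h1 : (1:ℝ) ≤ (1 + d) ^ 4 := one_le_pow₀ (by linarith)
    have h2 : (1:ℝ) ≤ K ^ 4 := one_le_pow₀ hK
    rw [hQ]
    exact one_le_mul_of_one_le_of_one_le (one_le_mul_of_one_le_of_one_le h1 h2) hS1
  have hpoly : ∀ (a b : ℕ), a ≤ 4 → b ≤ 4 → (d:ℝ) ^ a * K ^ b * S ≤ Q := by
    intro a b ha hb
    have h1 : (d:ℝ) ^ a ≤ (1 + d) ^ 4 :=
      (pow_le_pow_left₀ D0 (by linarith) a).trans (pow_le_pow_right₀ (by linarith) ha)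
    have h2 : K ^ b ≤ K ^ 4 := pow_le_pow_right₀ hK hb
    rw [hQ]
    gcongr
  have gn : ∀ τ : ℝ, 0 < τ → ∀ z : Euc d, 0 ≤ ga (c0/8) τ z := fun τ hτ z => ga_nonneg _ hτ z
  have tn : ∀ (τ : ℝ) (e : ℝ), 0 < τ → 0 ≤ τ ^ e := fun τ e hτ => Real.rpow_nonneg hτ.le _
  -- term bound
  have term : ∀ (a b k j : ℕ) (e : ℝ), a ≤ 4 → b ≤ 4 → k ≤ 6 → j ≤ 6 → (k:ℝ) / 2 - j = e → ∀ τ : ℝ, 0 < τ → ∀ z : Euc d,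
      (d:ℝ) ^ a * K ^ b * (‖z‖ ^ k / τ ^ j * ga (2 * (c0 / 8)) τ z) ≤ Q * τ ^ e * ga (c0 / 8) τ z := by
    intro a b k j e ha hb hk hj he τ hτ z
    have h1 := abs k j e hk hj he τ hτ z
    have := gn τ hτ z
    have := tn τ e hτ
    calc _ ≤ (d:ℝ) ^ a * K ^ b * (S * τ ^ e * ga (c0 / 8) τ z) := by gcongr
      _ = ((d:ℝ) ^ a * K ^ b * S) * (τ ^ e * ga (c0 / 8) τ z) := by ring
      _ ≤ Q * (τ ^ e * ga (c0 / 8) τ z) := by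
          have := hpoly a b ha hb
          gcongr
      _ = _ := by ring
  have b2 : ∀ τ, 0 < τ → ∀ (x y : Euc d) i j, |kZ2 B i j τ x y| ≤ 2 * Q * τ ^ (-1 : ℝ) * ga (c0 / 8) τ (x - y) := by
    intro τ hτ x y i j
    refine (ez2_bd hK (h.bok y) hτ (x - y) i j).trans ?_
    have t1 := term 2 2 2 2 (-1) (by norm_num) (by norm_num) (by norm_num) (by norm_num) (by norm_num) τ hτ (x - y)
    have t2 := term 0 1 0 1 (-1) (by norm_num) (by norm_num) (by norm_num) (by norm_num) (by norm_num) τ hτ (x - y)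
    rw [add_mul]
    simp only [pow_zero, one_mul, pow_one] at t1 t2 ⊢
    linarith
  have b2z : ∀ τ, 0 < τ → ∀ (x y : Euc d) i j, |kZ2 B i j τ x y| * ‖x - y‖ ≤
      2 * Q * τ ^ (-(1/2) : ℝ) * ga (c0 / 8) τ (x - y) := by
    intro τ hτ x y i j
    refine (mul_le_mul_of_nonneg_right (ez2_bd hK (h.bok y) hτ (x - y) i j) (norm_nonneg _)).trans ?_
    have t1 := term 2 2 3 2 (-(1/2)) (by norm_num) (by norm_num) (by norm_num) (by norm_num) (by norm_num) τ hτ (x - y)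
    have t2 := term 0 1 1 1 (-(1/2)) (by norm_num) (by norm_num) (by norm_num) (by norm_num) (by norm_num) τ hτ (x - y)
    calc _ = (d:ℝ) ^ 2 * K ^ 2 * (‖x - y‖ ^ 3 / τ ^ 2 * ga (2 * (c0 / 8)) τ (x - y)) +
      (d:ℝ) ^ 0 * K ^ 1 * (‖x - y‖ ^ 1 / τ ^ 1 * ga (2 * (c0 / 8)) τ (x - y)) := by ring
      _ ≤ _ := by linarith
  have b3z : ∀ τ, 0 < τ → ∀ (x y : Euc d) i j k, |ez3 (B y) τ (x - y) i j k| * ‖x - y‖ ≤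
      4 * Q * τ ^ (-1 : ℝ) * ga (c0 / 8) τ (x - y) := by
    intro τ hτ x y i j k
    refine (mul_le_mul_of_nonneg_right (ez3_bd hK (h.bok y) hτ (x - y) i j k) (norm_nonneg _)).trans ?_
    have t1 := term 1 2 2 2 (-1) (by norm_num) (by norm_num) (by norm_num) (by norm_num) (by norm_num) τ hτ (x - y)
    have t2 := term 3 3 4 3 (-1) (by norm_num) (by norm_num) (by norm_num) (by norm_num) (by norm_num) τ hτ (x - y)
    calc _ = 3 * ((d:ℝ) ^ 1 * K ^ 2 * (‖x - y‖ ^ 2 / τ ^ 2 * ga (2 * (c0 / 8)) τ (x - y))) +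
      (d:ℝ) ^ 3 * K ^ 3 * (‖x - y‖ ^ 4 / τ ^ 3 * ga (2 * (c0 / 8)) τ (x - y)) := by ring
      _ ≤ _ := by linarith
  have haz : ∀ i j i' j', ∀ τ, 0 < τ → ∀ x y : Euc d, |(A x i j - A y i j) * kZ2 B i' j' τ x y| ≤
      2 * K * Q * τ ^ (-(1/2) : ℝ) * ga (c0 / 8) τ (x - y) := by
    intro i j i' j' τ hτ x y
    rw [abs_mul]
    calc _ ≤ K * ‖x - y‖ * |kZ2 B i' j' τ x y| := by gcongr; exact h.Alip x y i j
      _ = K * (|kZ2 B i' j' τ x y| * ‖x - y‖) := by ring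
      _ ≤ K * (2 * Q * τ ^ (-(1/2) : ℝ) * ga (c0 / 8) τ (x - y)) :=
        mul_le_mul_of_nonneg_left (b2z τ hτ x y i' j') (by linarith)
      _ = _ := by ring
  obtain ⟨Ig, hIg⟩ : ∃ Ig : ℝ, ∫ z : Euc d, ga (c0/8) 1 z = Ig := ⟨_, rfl⟩
  have hIg0 : 0 ≤ Ig := by rw [← hIg]; exact MeasureTheory.integral_nonneg fun z => gn 1 one_pos z
  have hQ0 : 0 ≤ Q := by linarith
  set C : ℝ := 100 * (1 + d) ^ 4 * K * Q * (1 + Ig) with hC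
  have P : ∀ a : ℝ, a ≤ 100 * (1 + d) ^ 4 * K * Q → a ≤ C := by
    intro a ha
    refine ha.trans ?_
    rw [hC]
    have : 0 ≤ 100 * (1 + (d:ℝ)) ^ 4 * K * Q := by positivity
    nlinarith
  have hd1 : (1:ℝ) ≤ (1 + d) ^ 4 := one_le_pow₀ (by linarith)
  have hd2 : (d:ℝ) ^ 2 ≤ (1 + d) ^ 4 :=
    (pow_le_pow_left₀ D0 (by linarith) 2).trans (pow_le_pow_right₀ (by linarith) (by norm_num))
  have hKQ : Q ≤ K * Q := by nlinarith
  have hKQ1 : K * Q ≤ (1 + d) ^ 4 * (K * Q) := by nlinarith [mul_nonneg (by linarith : 0 ≤ K) hQ0]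
  have hKQ2 : (d:ℝ) ^ 2 * (K * Q) ≤ (1 + d) ^ 4 * (K * Q) := by gcongr
  have up : ∀ (v a e : ℝ) (τ : ℝ) (z : Euc d), 0 < τ → v ≤ a * τ ^ e * ga (c0 / 8) τ z →
      a ≤ 100 * (1 + d) ^ 4 * K * Q → v ≤ C * τ ^ e * ga (c0 / 8) τ z := by
    intro v a e τ z hτ hv ha
    refine hv.trans ?_
    have := gn τ hτ z
    have := tn τ e hτ
    have := P a ha
    gcongr
  refine ⟨C, P 1 (by nlinarith), hc, ⟨(kcont h).1, ?_⟩, fun i => ⟨kZ1_cont h i, ?_⟩, fun i j => ⟨kZ2_cont h i j, ?_⟩,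
    ⟨kK_cont h, ?_⟩, fun l => ⟨kK1_cont h l, ?_⟩, ?_, ?_, fun i j i' j' => ⟨?_, ?_⟩, ?_⟩
  · intro τ hτ x y
    unfold kZ
    rw [abs_of_pos (ez_pos _ hτ _), neg_zero]
    have t1 := term 0 0 0 0 0 (by norm_num) (by norm_num) (by norm_num) (by norm_num) (by norm_num) τ hτ (x - y)
    have := ez_le (h.bok y) hτ (x - y)
    refine up _ Q _ τ _ hτ (le_trans ?_ t1) (by nlinarith)
    simpa using this
  · intro τ hτ x y
    unfold kZ1
    have t1 := term 1 1 1 1 (-(1/2)) (by norm_num) (by norm_num) (by norm_num) (by norm_num) (by norm_num) τ hτ (x - y)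
    refine up _ Q _ τ _ hτ (le_trans ?_ t1) (by nlinarith)
    rw [pow_one, pow_one K]
    exact ez1_bd (h.bok y) hτ (x - y) i
  · intro τ hτ x y
    exact up _ _ _ τ _ hτ (b2 τ hτ x y i j) (by nlinarith)
  · intro τ hτ x y
    refine up _ (d * (d * (2 * K * Q))) _ τ _ hτ ?_ (by nlinarith)
    unfold kK
    have := abs_sum_le_card (fun i => ∑ j, (A x i j - A y i j) * ez2 (B y) τ (x - y) i j) _ fun i =>
      abs_sum_le_card (fun j => (A x i j - A y i j) * ez2 (B y) τ (x - y) i j) _ fun j => haz i j i j τ hτ x y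
    refine this.trans (le_of_eq (by ring))
  · intro τ hτ x y
    refine up _ (d * (d * (K * (2 * Q) + K * (4 * Q)))) _ τ _ hτ ?_ (by nlinarith)
    unfold kK1
    have := abs_sum_le_card (fun i => ∑ j, (dA A i j l x * ez2 (B y) τ (x - y) i j +
      (A x i j - A y i j) * ez3 (B y) τ (x - y) i j l)) (d * ((K * (2 * Q) + K * (4 * Q)) * (τ ^ (-1:ℝ) * ga (c0 / 8) τ (x - y)))) fun i =>
      abs_sum_le_card (fun j => (dA A i j l x * ez2 (B y) τ (x - y) i j +
      (A x i j - A y i j) * ez3 (B y) τ (x - y) i j l)) _ fun j => by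
        refine (abs_add_le _ _).trans ?_
        rw [abs_mul, abs_mul]
        have h1 := h.dA_bd i j l x
        have h2 := h.Alip x y i j
        have h3 := b2 τ hτ x y i j
        have h4 := b3z τ hτ x y i j l
        have := gn τ hτ (x - y)
        have := tn τ (-1) hτ
        calc _ ≤ K * (2 * Q * τ ^ (-1 : ℝ) * ga (c0 / 8) τ (x - y)) + K * ‖x - y‖ * |ez3 (B y) τ (x - y) i j l| := by
              gcongr
              exact h3
          _ = K * (2 * Q * τ ^ (-1 : ℝ) * ga (c0 / 8) τ (x - y)) + K * (|ez3 (B y) τ (x - y) i j l| * ‖x - y‖) := by ring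
          _ ≤ K * (2 * Q * τ ^ (-1 : ℝ) * ga (c0 / 8) τ (x - y)) + K * (4 * Q * τ ^ (-1 : ℝ) * ga (c0 / 8) τ (x - y)) := by
              gcongr
          _ = _ := by ring
    refine this.trans (le_of_eq (by ring))
  · intro i j τ hτ x y
    refine up _ (4 * Q) _ τ _ hτ ?_ (by nlinarith)
    rw [norm_sub_rev]
    have h1 := b2 τ hτ x y i j
    have h2 := b2z τ hτ x y i j
    set n := ‖x - y‖
    have hn : 0 ≤ n := norm_nonneg _
    have h3 : Real.sqrt n ≤ n * τ ^ (-(1/4) : ℝ) + τ ^ (1/4 : ℝ) := by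
      have e1 : τ ^ (-(1/4) : ℝ) * τ ^ (1/4 : ℝ) = 1 := by rw [← Real.rpow_add hτ]; norm_num
      have p1 : 0 < τ ^ (-(1/4) : ℝ) := Real.rpow_pos_of_pos hτ _
      have p2 : 0 < τ ^ (1/4 : ℝ) := Real.rpow_pos_of_pos hτ _
      rw [Real.sqrt_le_left (by positivity)]
      nlinarith [sq_nonneg (n * τ ^ (-(1/4) : ℝ)), sq_nonneg (τ ^ (1/4 : ℝ))]
    have e1 : τ ^ (-(1/2) : ℝ) * τ ^ (-(1/4) : ℝ) = τ ^ (-(3/4) : ℝ) := by rw [← Real.rpow_add hτ]; norm_num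
    have e2 : τ ^ (-1 : ℝ) * τ ^ (1/4 : ℝ) = τ ^ (-(3/4) : ℝ) := by rw [← Real.rpow_add hτ]; norm_num
    have p1 := tn τ (-(1/4)) hτ
    have p2 := tn τ (1/4) hτ
    calc _ ≤ |kZ2 B i j τ x y| * (n * τ ^ (-(1/4) : ℝ) + τ ^ (1/4 : ℝ)) := by gcongr
      _ = (|kZ2 B i j τ x y| * n) * τ ^ (-(1/4) : ℝ) + |kZ2 B i j τ x y| * τ ^ (1/4 : ℝ) := by ring
      _ ≤ (2 * Q * τ ^ (-(1/2) : ℝ) * ga (c0 / 8) τ (x - y)) * τ ^ (-(1/4) : ℝ) +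
        (2 * Q * τ ^ (-1 : ℝ) * ga (c0 / 8) τ (x - y)) * τ ^ (1/4 : ℝ) := by gcongr
      _ = 2 * Q * (τ ^ (-(1/2) : ℝ) * τ ^ (-(1/4) : ℝ)) * ga (c0 / 8) τ (x - y) +
        2 * Q * (τ ^ (-1 : ℝ) * τ ^ (1/4 : ℝ)) * ga (c0 / 8) τ (x - y) := by ring
      _ = _ := by rw [e1, e2]; ring
  · intro i j τ hτ x y
    refine up _ (5 * K * Q) _ τ _ hτ ?_ (by nlinarith)
    have h1 := ez2_diff hK (h.bok y) (h.bok x) (δ := K * ‖x - y‖)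
      (fun i j => by rw [norm_sub_rev]; exact h.Blip y x i j) hτ (x - y) i j
    refine h1.trans ?_
    have t1 := term 2 1 3 2 (-(1/2)) (by norm_num) (by norm_num) (by norm_num) (by norm_num) (by norm_num) τ hτ (x - y)
    have t2 := term 0 0 1 1 (-(1/2)) (by norm_num) (by norm_num) (by norm_num) (by norm_num) (by norm_num) τ hτ (x - y)
    have t3 := term 4 2 5 3 (-(1/2)) (by norm_num) (by norm_num) (by norm_num) (by norm_num) (by norm_num) τ hτ (x - y)
    have t4 := term 2 1 3 2 (-(1/2)) (by norm_num) (by norm_num) (by norm_num) (by norm_num) (by norm_num) τ hτ (x - y)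
    calc _ = K * (2 * ((d:ℝ) ^ 2 * K ^ 1 * (‖x - y‖ ^ 3 / τ ^ 2 * ga (2 * (c0 / 8)) τ (x - y))) +
        (d:ℝ) ^ 0 * K ^ 0 * (‖x - y‖ ^ 1 / τ ^ 1 * ga (2 * (c0 / 8)) τ (x - y)) +
        (d:ℝ) ^ 4 * K ^ 2 * (‖x - y‖ ^ 5 / τ ^ 3 * ga (2 * (c0 / 8)) τ (x - y)) +
        (d:ℝ) ^ 2 * K ^ 1 * (‖x - y‖ ^ 3 / τ ^ 2 * ga (2 * (c0 / 8)) τ (x - y))) := by ring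
      _ ≤ K * (2 * (Q * τ ^ (-(1/2) : ℝ) * ga (c0 / 8) τ (x - y)) + Q * τ ^ (-(1/2) : ℝ) * ga (c0 / 8) τ (x - y) +
          Q * τ ^ (-(1/2) : ℝ) * ga (c0 / 8) τ (x - y) + Q * τ ^ (-(1/2) : ℝ) * ga (c0 / 8) τ (x - y)) := by
          gcongr
      _ = _ := by ring
  · have := h.Acont i j
    exact ContinuousOn.mul (by fun_prop) (kZ2_cont h i' j')
  · intro τ hτ x y
    exact up _ _ _ τ _ hτ (haz i j i' j' τ hτ x y) (by nlinarith)
  · intro x y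
    have h1 : ∀ z, ‖ez (B x) 1 z - ez (B y) 1 z‖ ≤ K * ‖x - y‖ * Q * ga (c0 / 8) 1 z := by
      intro z
      have h1 := ez_diff (h.bok x) (h.bok y) (h.Blip x y) one_pos z
      have t1 := term 2 0 2 1 0 (by norm_num) (by norm_num) (by norm_num) (by norm_num) (by norm_num) 1 one_pos z
      rw [Real.norm_eq_abs]
      calc _ ≤ _ := h1
        _ = K * ‖x - y‖ * ((d:ℝ) ^ 2 * K ^ 0 * (‖z‖ ^ 2 / 1 ^ 1 * ga (2 * (c0 / 8)) 1 z)) := by ring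
        _ ≤ K * ‖x - y‖ * (Q * 1 ^ (0:ℝ) * ga (c0 / 8) 1 z) := by gcongr
        _ = _ := by rw [Real.rpow_zero]; ring
    have h2 := MeasureTheory.norm_integral_le_of_norm_le ((ga_integrable (d := d) hc one_pos).const_mul (K * ‖x - y‖ * Q))
      (Eventually.of_forall h1)
    rw [MeasureTheory.integral_const_mul, hIg] at h2
    rw [← Real.norm_eq_abs]
    refine h2.trans ?_
    have e : K * Q * Ig ≤ C := by
      rw [hC]
      have : K * Q * Ig ≤ K * Q * (1 + Ig) := by
        have : 0 ≤ K * Q := by positivity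
        nlinarith
      have h3 : K * Q ≤ 100 * (1 + d) ^ 4 * K * Q := by nlinarith
      have : K * Q * (1 + Ig) ≤ 100 * (1 + d) ^ 4 * K * Q * (1 + Ig) := by gcongr
      linarith
    calc _ = K * Q * Ig * ‖x - y‖ := by ring
      _ ≤ _ := by gcongr
end

section
variable {d : ℕ} {A B : Euc d → Matrix (Fin d) (Fin d) ℝ} {K c0 C c : ℝ}

def II (B : Euc d → Matrix (Fin d) (Fin d) ℝ) (x : Euc d) : ℝ := ∫ z, ez (B x) 1 z

def LH (G : ℝ × Euc d → ℝ) : Prop := ∀ r : ℝ, ∃ C, ∀ s x y, ‖x‖ ≤ r → |G (s, y) - G (s, x)| ≤ C * Real.sqrt ‖y - x‖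

lemma ez_cont {B : Matrix (Fin d) (Fin d) ℝ} (h : BOK K c0 B) (τ : ℝ) : Continuous (ez B τ) :=
  continuous_iff_continuousAt.2 fun z => (ez_deriv h.symm τ z).continuousAt

lemma ez_int {B : Matrix (Fin d) (Fin d) ℝ} (h0 : 0 < c0) (h : BOK K c0 B) {τ : ℝ} (hτ : 0 < τ) :
    MeasureTheory.Integrable (ez B τ) := by
  refine MeasureTheory.Integrable.mono' (ga_integrable (c := 2 * (c0 / 8)) (by positivity) hτ)
    (ez_cont h τ).aestronglyMeasurable (Eventually.of_forall fun z => ?_)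
  rw [Real.norm_eq_abs, abs_of_pos (ez_pos _ hτ _)]
  exact ez_le h hτ z

lemma II_low (h : Coef d A B K c0) : ∃ c1 : ℝ, 0 < c1 ∧ ∀ x, c1 ≤ II B x := by
  have hK := h.K1
  have hc : 0 < (d * (d * K) + 1 : ℝ) := by positivity
  refine ⟨(Real.pi / (d * (d * K) + 1)) ^ ((d:ℝ) / 2), by positivity, fun x => ?_⟩
  rw [← ga_integral hc one_pos]
  refine MeasureTheory.integral_mono (ga_integrable hc one_pos) (ez_int h.c0pos (h.bok x) one_pos) fun z => ?_
  have h1 := qf_diff (B := B x) (B' := 0) (δ := K) (fun i j => by simpa using h.Bbd x i j) z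
  have h2 : qf (0 : Matrix (Fin d) (Fin d) ℝ) z = 0 := by simp [qf]
  rw [h2, sub_zero] at h1
  have h3 := le_abs_self (qf (B x) z)
  simp only [ga, ez, Real.one_rpow, one_mul, mul_one]
  refine Real.exp_le_exp.2 ?_
  have h4 : 0 ≤ ↑d * (↑d * (K * ‖z‖ ^ 2)) := by positivity
  have h5 := sq_nonneg ‖z‖
  simp only [div_one]
  have h6 : qf (B x) z / 4 ≤ ↑d * (↑d * (K * ‖z‖ ^ 2)) := by linarith
  rw [neg_div]
  nlinarith

lemma II_lip (h : Coef d A B K c0) (hk : KB A B C c) (x y : Euc d) : |II B x - II B y| ≤ C * ‖x - y‖ := by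
  unfold II
  rw [← MeasureTheory.integral_sub (ez_int h.c0pos (h.bok x) one_pos) (ez_int h.c0pos (h.bok y) one_pos)]
  exact hk.i0 x y

lemma ez_scale (B : Matrix (Fin d) (Fin d) ℝ) {τ : ℝ} (hτ : 0 < τ) (z : Euc d) :
    ez B τ (Real.sqrt τ • z) = τ ^ (-(d:ℝ) / 2) * ez B 1 z := by
  have : qf B (Real.sqrt τ • z) = τ * qf B z := by
    simp only [qf, Finset.mul_sum]
    refine Finset.sum_congr rfl fun i _ => Finset.sum_congr rfl fun j _ => ?_
    simp only [PiLp.smul_apply, smul_eq_mul]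
    have := Real.mul_self_sqrt hτ.le
    calc _ = (Real.sqrt τ * Real.sqrt τ) * (B i j * z i * z j) := by ring
      _ = _ := by rw [this]
  simp only [ez, this, Real.one_rpow, one_mul, mul_one]
  congr 2
  field_simp

lemma inn_scale (G : ℝ × Euc d → ℝ) {τ : ℝ} (hτ : 0 < τ) (s : ℝ) (x : Euc d) :
    inn (kZ B) G τ s x = ∫ z, ez (B (x - Real.sqrt τ • z)) 1 z * G (s, x - Real.sqrt τ • z) := by
  unfold inn kZ
  set f : Euc d → ℝ := fun w => ez (B (x - w)) τ w * G (s, x - w) with hf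
  have e1 : ∫ y, ez (B y) τ (x - y) * G (s, y) = ∫ w, f w := by
    rw [← MeasureTheory.integral_sub_left_eq_self f MeasureTheory.volume x]
    simp [hf]
  have e2 := MeasureTheory.Measure.integral_comp_smul MeasureTheory.volume f (Real.sqrt τ)
  have hs : 0 < Real.sqrt τ := Real.sqrt_pos.2 hτ
  rw [finrank_euclideanSpace, Fintype.card_fin, abs_of_pos (by positivity), smul_eq_mul] at e2
  rw [e1]
  have e3 : (Real.sqrt τ ^ d)⁻¹ = τ ^ (-(d:ℝ) / 2) := by
    rw [Real.sqrt_eq_rpow, ← Real.rpow_natCast, ← Real.rpow_mul hτ.le, ← Real.rpow_neg hτ.le]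
    congr 1; ring
  rw [e3] at e2
  have hp : 0 < τ ^ (-(d:ℝ) / 2) := Real.rpow_pos_of_pos hτ _
  have e4 : ∫ z, f (Real.sqrt τ • z) = τ ^ (-(d:ℝ) / 2) * ∫ z, ez (B (x - Real.sqrt τ • z)) 1 z * G (s, x - Real.sqrt τ • z) := by
    rw [← MeasureTheory.integral_const_mul]
    congr 1
    ext z
    simp only [hf, ez_scale _ hτ]
    ring
  rw [e4] at e2
  exact (mul_left_cancel₀ hp.ne' e2).symm

lemma ez_cont_x (h : Coef d A B K c0) : Continuous fun p : Euc d × Euc d => ez (B p.1) 1 p.2 := by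
  unfold ez qf
  have := h.Bcont
  fun_prop

lemma inn_Z_lim (h : Coef d A B K c0) {G : ℝ × Euc d → ℝ} {N : ℝ} (hG : BC G N) (s : ℝ) (x : Euc d) :
    Tendsto (fun τ => inn (kZ B) G τ s x) (nhdsWithin 0 (Ioi 0)) (nhds (II B x * G (s, x))) := by
  have h1 : Tendsto (fun τ : ℝ => ∫ z, ez (B (x - Real.sqrt τ • z)) 1 z * G (s, x - Real.sqrt τ • z))
      (nhdsWithin 0 (Ioi 0)) (nhds (∫ z, ez (B x) 1 z * G (s, x))) := by
    have hc := ez_cont_x h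
    have hGc := hG.cont
    refine MeasureTheory.tendsto_integral_filter_of_dominated_convergence
      (fun z => ga (2 * (c0 / 8)) 1 z * N) ?_ ?_ ?_ ?_
    · refine Eventually.of_forall fun τ => Continuous.aestronglyMeasurable (Continuous.mul ?_ ?_)
      · exact hc.comp (f := fun z => (x - Real.sqrt τ • z, z)) (by fun_prop)
      · fun_prop
    · refine Eventually.of_forall fun τ => Eventually.of_forall fun z => ?_
      rw [Real.norm_eq_abs, abs_mul]
      refine mul_le_mul ?_ (hG.bd _) (abs_nonneg _) (ga_nonneg _ one_pos _)
      rw [abs_of_pos (ez_pos _ one_pos _)]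
      exact ez_le (h.bok _) one_pos z
    · have := h.c0pos
      exact (ga_integrable (by positivity) one_pos).mul_const _
    · refine Eventually.of_forall fun z => ?_
      have h2 : Continuous fun τ : ℝ => ez (B (x - Real.sqrt τ • z)) 1 z * G (s, x - Real.sqrt τ • z) := by
        refine Continuous.mul ?_ (by fun_prop)
        exact hc.comp (f := fun τ : ℝ => (x - Real.sqrt τ • z, z)) (by fun_prop)
      have h3 := h2.tendsto 0
      simp only [Real.sqrt_zero, zero_smul, sub_zero] at h3
      exact h3.mono_left nhdsWithin_le_nhds
  rw [MeasureTheory.integral_mul_const] at h1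
  refine h1.congr' ?_
  filter_upwards [self_mem_nhdsWithin] with τ hτ
  exact (inn_scale G hτ s x).symm

lemma BC.one : BC (fun _ : ℝ × Euc d => (1:ℝ)) 1 := ⟨continuous_const, fun _ => by simp⟩

lemma frozen_zero (h : Coef d A B K c0) (x : Euc d) {τ : ℝ} (hτ : 0 < τ) (i j : Fin d) :
    ∫ y, ez2 (B x) τ (x - y) i j = 0 := by
  have hf : Coef d (fun _ => A x) (fun _ => B x) K c0 :=
    ⟨h.K1, h.c0pos, fun _ => h.Asymm x, fun _ => h.Abd x, fun y z i j => by simpa using mul_nonneg (by linarith [h.K1]) (norm_nonneg _),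
      fun i j => contDiff_const, fun _ => h.AB x, fun _ => h.Bsymm x, fun _ => h.Bbd x,
      fun y z i j => by simpa using mul_nonneg (by linarith [h.K1]) (norm_nonneg _), fun _ => h.Bq x, fun _ => h.Aq x⟩
  obtain ⟨C, hk⟩ := exists_KB hf
  have h1 := inn_deriv (hk.z1 i) (fun j => hk.z2 i j) hk.cpos (fun τ hτ x y => kZ1_deriv hf i hτ x y) BC.one hτ 0 x
  have h2 : (fun y => inn (kZ1 (fun _ => B x) i) (fun _ => 1) τ 0 y) = fun _ => ∫ w, ez1 (B x) τ w i := by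
    ext y
    simp only [inn, kZ1, mul_one]
    exact MeasureTheory.integral_sub_left_eq_self (fun w => ez1 (B x) τ w i) MeasureTheory.volume y
  rw [h2] at h1
  have h3 := h1.unique (hasFDerivAt_const _ x)
  have h4 : gr (fun j => inn (kZ2 (fun _ => B x) i j) (fun _ => 1) τ 0 x) (EuclideanSpace.single j 1) = 0 := by
    rw [h3]; simp
  rw [gr_single] at h4
  simpa [inn, kZ2] using h4

lemma z2_int (h : Coef d A B K c0) (hk : KB A B C c) (x : Euc d) {τ : ℝ} (hτ : 0 < τ) (i j : Fin d) :
    |∫ y, kZ2 B i j τ x y| ≤ C * (Real.pi / c) ^ ((d:ℝ) / 2) * τ ^ (-(1/2) : ℝ) := by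
  have hi : MeasureTheory.Integrable (fun y => kZ2 B i j τ x y) := by
    simpa using inn_integrable (hk.z2 i j) hk.cpos BC.one hτ 0 x
  have hb := MeasureTheory.norm_integral_le_of_norm_le (f := fun y => kZ2 B i j τ x y - ez2 (B x) τ (x - y) i j)
    (((ga_sub_integrable hk.cpos hτ x).const_mul (C * τ ^ (-(1/2) : ℝ))))
    (Eventually.of_forall (hk.frz i j τ hτ x))
  rw [MeasureTheory.integral_const_mul, ga_sub_integral hk.cpos hτ x] at hb
  have hi2 : MeasureTheory.Integrable (fun y => ez2 (B x) τ (x - y) i j) := by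
    have h2 : MeasureTheory.Integrable (fun y => kZ2 B i j τ x y - (kZ2 B i j τ x y - ez2 (B x) τ (x - y) i j)) := by
      refine hi.sub ?_
      refine MeasureTheory.Integrable.mono' ((ga_sub_integrable hk.cpos hτ x).const_mul (C * τ ^ (-(1/2) : ℝ))) ?_
        (Eventually.of_forall (hk.frz i j τ hτ x))
      refine (hi.aestronglyMeasurable).sub ?_
      refine Continuous.aestronglyMeasurable ?_
      have hc : Continuous (fun z => ez2 (B x) τ z i j) := continuous_iff_continuousAt.2 fun z =>
        (ez2_deriv (h.Bsymm x) hτ z i j).continuousAt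
      fun_prop
    simpa using h2
  rw [MeasureTheory.integral_sub hi hi2, frozen_zero h x hτ i j, sub_zero, Real.norm_eq_abs] at hb
  refine hb.trans (le_of_eq (by ring))

lemma PotOK_kern {κ : ℝ → Euc d → Euc d → ℝ} {θ : ℝ} (hk : Kern κ C θ c) (hc : 0 < c) {G : ℝ × Euc d → ℝ} {N : ℝ}
    (hG : BC G N) : PotOK (inn κ G) θ :=
  ⟨inn_cont hk hc hG, fun _ => ⟨_, fun _ hτ s x _ => inn_bd hk hc hτ.1 s (fun y => hG.bd _) x⟩⟩

lemma PotOK_z2 (h : Coef d A B K c0) (hk : KB A B C c) {G : ℝ × Euc d → ℝ} {N : ℝ}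
    (hG : BC G N) (hL : LH G) (i j : Fin d) : PotOK (inn (kZ2 B i j) G) (3/4) := by
  refine ⟨inn_cont (hk.z2 i j) hk.cpos hG, fun r => ?_⟩
  obtain ⟨CG, hCG⟩ := hL r
  set W := (Real.pi / c) ^ ((d:ℝ) / 2) with hW
  have hW0 : 0 ≤ W := by have := hk.cpos; positivity
  have hN := hG.nonneg
  have hC := hk.C1
  refine ⟨|CG| * C * W + N * (C * W * r ^ (1/4 : ℝ)), fun τ hτ s x hx => ?_⟩
  have hτ0 := hτ.1
  have hi := inn_integrable (hk.z2 i j) hk.cpos hG hτ0 s x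
  have hi1 : MeasureTheory.Integrable (fun y => kZ2 B i j τ x y) := by
    simpa using inn_integrable (hk.z2 i j) hk.cpos BC.one hτ0 0 x
  have e : inn (kZ2 B i j) G τ s x = (∫ y, kZ2 B i j τ x y * (G (s, y) - G (s, x))) + (∫ y, kZ2 B i j τ x y) * G (s, x) := by
    rw [← MeasureTheory.integral_mul_const, ← MeasureTheory.integral_add]
    · unfold inn; congr 1; ext y; ring
    · simp only [mul_sub]
      exact hi.sub (hi1.mul_const _)
    · exact hi1.mul_const _
  have b1 : |∫ y, kZ2 B i j τ x y * (G (s, y) - G (s, x))| ≤ |CG| * C * τ ^ (-(3/4) : ℝ) * W := by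
    have := MeasureTheory.norm_integral_le_of_norm_le (f := fun y => kZ2 B i j τ x y * (G (s, y) - G (s, x)))
      (((ga_sub_integrable hk.cpos hτ0 x).const_mul (|CG| * C * τ ^ (-(3/4) : ℝ)))) (Eventually.of_forall fun y => ?_)
    · rw [MeasureTheory.integral_const_mul, ga_sub_integral hk.cpos hτ0 x] at this
      exact this
    · rw [Real.norm_eq_abs, abs_mul]
      calc _ ≤ |kZ2 B i j τ x y| * (|CG| * Real.sqrt ‖y - x‖) := by
            refine mul_le_mul_of_nonneg_left ((hCG s x y hx).trans ?_) (abs_nonneg _)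
            exact mul_le_mul_of_nonneg_right (le_abs_self _) (Real.sqrt_nonneg _)
        _ = |CG| * (|kZ2 B i j τ x y| * Real.sqrt ‖y - x‖) := by ring
        _ ≤ |CG| * (C * τ ^ (-(3/4) : ℝ) * ga c τ (x - y)) :=
            mul_le_mul_of_nonneg_left (hk.hol i j τ hτ0 x y) (abs_nonneg _)
        _ = _ := by ring
  have b2 := z2_int h hk x hτ0 i j
  have e2 : τ ^ (-(1/2) : ℝ) ≤ r ^ (1/4 : ℝ) * τ ^ (-(3/4) : ℝ) := by
    have : τ ^ (-(1/2) : ℝ) = τ ^ (1/4 : ℝ) * τ ^ (-(3/4) : ℝ) := by rw [← Real.rpow_add hτ0]; norm_num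
    rw [this]
    exact mul_le_mul_of_nonneg_right (Real.rpow_le_rpow hτ0.le hτ.2 (by norm_num)) (Real.rpow_nonneg hτ0.le _)
  rw [e]
  refine (abs_add_le _ _).trans ?_
  rw [abs_mul]
  have b3 : |∫ y, kZ2 B i j τ x y| * |G (s, x)| ≤ C * W * (r ^ (1/4 : ℝ) * τ ^ (-(3/4) : ℝ)) * N := by
    refine mul_le_mul (b2.trans ?_) (hG.bd _) (abs_nonneg _) ?_
    · exact mul_le_mul_of_nonneg_left e2 (by positivity)
    · have : 0 ≤ r := hτ0.le.trans hτ.2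
      positivity
  refine (add_le_add b1 b3).trans (le_of_eq (by ring))

def kT (A B : Euc d → Matrix (Fin d) (Fin d) ℝ) (τ : ℝ) (x y : Euc d) : ℝ := ∑ i, ∑ j, A y i j * kZ2 B i j τ x y

lemma kT_kern (h : Coef d A B K c0) (hk : KB A B C c) : Kern (kT A B) (d * (d * (K * C))) 1 c := by
  constructor
  · unfold kT
    refine continuousOn_finsetSum _ fun i _ => continuousOn_finsetSum _ fun j _ => ?_
    have := h.Acont i j
    exact ContinuousOn.mul (by fun_prop) (kZ2_cont h i j)
  · intro τ hτ x y
    have := abs_sum_le_card (fun i => ∑ j, A y i j * kZ2 B i j τ x y) _ fun i =>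
      abs_sum_le_card (fun j => A y i j * kZ2 B i j τ x y) (K * (C * τ ^ (-1:ℝ) * ga c τ (x - y))) fun j => by
        rw [abs_mul]
        exact mul_le_mul (h.Abd y i j) ((hk.z2 i j).bd τ hτ x y) (abs_nonneg _) (by linarith [h.K1])
    exact this.trans (le_of_eq (by ring))

def fT (A B : Euc d → Matrix (Fin d) (Fin d) ℝ) (G : ℝ × Euc d → ℝ) (τ s : ℝ) (x : Euc d) : ℝ :=
  ∑ i, ∑ j, A x i j * inn (kZ2 B i j) G τ s x - inn (kK A B) G τ s x

lemma fT_eq (hk : KB A B C c) {G : ℝ × Euc d → ℝ} {N : ℝ} (hG : BC G N) {τ : ℝ} (hτ : 0 < τ) (s : ℝ) (x : Euc d) :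
    fT A B G τ s x = inn (kT A B) G τ s x := by
  unfold fT inn
  simp only [← MeasureTheory.integral_const_mul]
  have hi : ∀ i j, MeasureTheory.Integrable (fun y => A x i j * (kZ2 B i j τ x y * G (s, y))) := fun i j =>
    (inn_integrable (hk.z2 i j) hk.cpos hG hτ s x).const_mul _
  have e1 : ∀ i, ∑ j, ∫ y, A x i j * (kZ2 B i j τ x y * G (s, y)) = ∫ y, ∑ j, A x i j * (kZ2 B i j τ x y * G (s, y)) :=
    fun i => (MeasureTheory.integral_finsetSum _ fun j _ => hi i j).symm
  simp only [e1]
  rw [← MeasureTheory.integral_finsetSum _ fun i _ => MeasureTheory.integrable_finsetSum _ fun j _ => hi i j]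
  rw [← MeasureTheory.integral_sub (MeasureTheory.integrable_finsetSum _ fun i _ => MeasureTheory.integrable_finsetSum _ fun j _ => hi i j)
    (inn_integrable hk.k hk.cpos hG hτ s x)]
  congr 1
  ext y
  simp only [kK, kT, kZ2, Finset.sum_mul, ← Finset.sum_sub_distrib]
  refine Finset.sum_congr rfl fun i _ => Finset.sum_congr rfl fun j _ => ?_
  ring

lemma inn_time (h : Coef d A B K c0) (hk : KB A B C c) {G : ℝ × Euc d → ℝ} {N : ℝ} (hG : BC G N) {τ : ℝ} (hτ : 0 < τ)
    (s : ℝ) (x : Euc d) : HasDerivAt (fun τ => inn (kZ B) G τ s x) (fT A B G τ s x) τ := by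
  rw [fT_eq hk hG hτ]
  have hT := kT_kern h hk
  obtain ⟨D, hD, hDb⟩ := hT.dom hk.cpos hτ x
  have hN := hG.nonneg
  refine (hasDerivAt_integral_of_dominated_loc_of_deriv_le (F := fun τ y => kZ B τ x y * G (s, y))
    (F' := fun τ y => kT A B τ x y * G (s, y)) (bound := fun y => D y * N) (near_tau hτ) ?_
    (inn_integrable hk.z hk.cpos hG hτ s x) ?_ ?_ (hD.mul_const _) ?_).2
  · filter_upwards [near_tau hτ] with τ' hτ'
    exact (inn_integrable hk.z hk.cpos hG (by linarith [hτ'.1]) s x).aestronglyMeasurable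
  · exact (inn_integrable hT hk.cpos hG hτ s x).aestronglyMeasurable
  · refine Eventually.of_forall fun y τ' hτ' => ?_
    rw [Real.norm_eq_abs, abs_mul]
    have := hDb τ' hτ' x (mem_ball_self one_pos) y
    exact mul_le_mul this (hG.bd _) (abs_nonneg _) ((abs_nonneg _).trans this)
  · refine Eventually.of_forall fun y τ' hτ' => ?_
    have : 0 < τ' := by linarith [hτ'.1]
    exact (ez_time (h.AB y) (h.Bsymm y) this (x - y)).mul_const _

lemma PotOK_fT (h : Coef d A B K c0) (hk : KB A B C c) {G : ℝ × Euc d → ℝ} {N : ℝ}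
    (hG : BC G N) (hL : LH G) : PotOK (fT A B G) (3/4) := by
  constructor
  · unfold fT
    refine ContinuousOn.sub ?_ (inn_cont hk.k hk.cpos hG)
    refine continuousOn_finsetSum _ fun i _ => continuousOn_finsetSum _ fun j _ => ?_
    have := h.Acont i j
    exact ContinuousOn.mul (by fun_prop) (inn_cont (hk.z2 i j) hk.cpos hG)
  · intro r
    have hz := fun i j => (PotOK_z2 h hk hG hL i j).bd r
    choose Cz hCz using hz
    obtain ⟨Ck, hCk⟩ := (PotOK_kern hk.k hk.cpos hG).bd r
    refine ⟨∑ i, ∑ j, K * Cz i j + |Ck| * r ^ (1/4 : ℝ), fun τ hτ s x hx => ?_⟩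
    have hτ0 := hτ.1
    have hr : 0 ≤ r := hτ0.le.trans hτ.2
    have e2 : τ ^ (-(1/2) : ℝ) ≤ r ^ (1/4 : ℝ) * τ ^ (-(3/4) : ℝ) := by
      have : τ ^ (-(1/2) : ℝ) = τ ^ (1/4 : ℝ) * τ ^ (-(3/4) : ℝ) := by rw [← Real.rpow_add hτ0]; norm_num
      rw [this]
      exact mul_le_mul_of_nonneg_right (Real.rpow_le_rpow hτ0.le hτ.2 (by norm_num)) (Real.rpow_nonneg hτ0.le _)
    have b1 : |inn (kK A B) G τ s x| ≤ |Ck| * r ^ (1/4 : ℝ) * τ ^ (-(3/4) : ℝ) := by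
      refine (hCk τ hτ s x hx).trans ?_
      calc _ ≤ |Ck| * τ ^ (-(1/2) : ℝ) := mul_le_mul_of_nonneg_right (le_abs_self _) (Real.rpow_nonneg hτ0.le _)
        _ ≤ |Ck| * (r ^ (1/4 : ℝ) * τ ^ (-(3/4) : ℝ)) := mul_le_mul_of_nonneg_left e2 (abs_nonneg _)
        _ = _ := by ring
    have b2 : |∑ i, ∑ j, A x i j * inn (kZ2 B i j) G τ s x| ≤ ∑ i, ∑ j, K * (Cz i j * τ ^ (-(3/4) : ℝ)) := by
      refine (Finset.abs_sum_le_sum_abs _ _).trans (Finset.sum_le_sum fun i _ => ?_)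
      refine (Finset.abs_sum_le_sum_abs _ _).trans (Finset.sum_le_sum fun j _ => ?_)
      rw [abs_mul]
      exact mul_le_mul (h.Abd x i j) (hCz i j τ hτ s x hx) (abs_nonneg _) (by linarith [h.K1])
    unfold fT
    refine (abs_sub _ _).trans ((add_le_add b2 b1).trans (le_of_eq ?_))
    simp only [add_mul, Finset.sum_mul, mul_assoc]

lemma Pot_fT (h : Coef d A B K c0) (hk : KB A B C c) {G : ℝ × Euc d → ℝ} {N : ℝ}
    (hG : BC G N) (hL : LH G) (t : ℝ) (x : Euc d) :
    Pot (fT A B G) t x = ∑ i, ∑ j, A x i j * Pot (inn (kZ2 B i j) G) t x - Pot (inn (kK A B) G) t x := by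
  unfold Pot fT
  have hi : ∀ i j, MeasureTheory.Integrable (fun τ => A x i j * inn (kZ2 B i j) G τ (t - τ) x)
      (MeasureTheory.volume.restrict (Ioo 0 t)) := fun i j =>
    ((PotOK_z2 h hk hG hL i j).intOn (by norm_num) t x).const_mul _
  rw [MeasureTheory.integral_sub (MeasureTheory.integrable_finsetSum _ fun i _ => MeasureTheory.integrable_finsetSum _ fun j _ => hi i j)
    ((PotOK_kern hk.k hk.cpos hG).intOn (by norm_num) t x)]
  rw [MeasureTheory.integral_finsetSum _ fun i _ => MeasureTheory.integrable_finsetSum _ fun j _ => hi i j]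
  congr 1
  refine Finset.sum_congr rfl fun i _ => ?_
  rw [MeasureTheory.integral_finsetSum _ fun j _ => hi i j]
  refine Finset.sum_congr rfl fun j _ => ?_
  rw [MeasureTheory.integral_const_mul]

/-- first and second order potential -/
lemma Pot_d1 (h : Coef d A B K c0) (hk : KB A B C c) {G : ℝ × Euc d → ℝ} {N : ℝ} (hG : BC G N) (t : ℝ) (x : Euc d) :
    HasFDerivAt (fun x => Pot (inn (kZ B) G) t x) (gr fun i => Pot (inn (kZ1 B i) G) t x) x :=
  Pot_deriv (PotOK_kern hk.z hk.cpos hG) (by norm_num) (fun i => PotOK_kern (hk.z1 i) hk.cpos hG) (by norm_num)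
    (fun _ hτ s x => inn_deriv hk.z hk.z1 hk.cpos (fun τ _ x y => kZ_deriv h τ x y) hG hτ s x) t x

lemma Pot_d2 (h : Coef d A B K c0) (hk : KB A B C c) {G : ℝ × Euc d → ℝ} {N : ℝ} (hG : BC G N) (hL : LH G)
    (t : ℝ) (x : Euc d) (i : Fin d) :
    HasFDerivAt (fun x => Pot (inn (kZ1 B i) G) t x) (gr fun j => Pot (inn (kZ2 B i j) G) t x) x :=
  Pot_deriv (PotOK_kern (hk.z1 i) hk.cpos hG) (by norm_num) (fun j => PotOK_z2 h hk hG hL i j) (by norm_num)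
    (fun _ hτ s x => inn_deriv (hk.z1 i) (hk.z2 i) hk.cpos (fun _ hτ x y => kZ1_deriv h i hτ x y) hG hτ s x) t x

lemma Pot_t (h : Coef d A B K c0) (hk : KB A B C c) {G : ℝ × Euc d → ℝ} {N : ℝ} (hG : BC G N) (hL : LH G)
    {t : ℝ} (ht : 0 < t) (x : Euc d) :
    HasDerivAt (fun t => Pot (inn (kZ B) G) t x) (II B x * G (t, x) +
      (∑ i, ∑ j, A x i j * Pot (inn (kZ2 B i j) G) t x - Pot (inn (kK A B) G) t x)) t := by
  rw [← Pot_fT h hk hG hL]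
  refine Pot_time (f := inn (kZ B) G) (h := fT A B G) (g := fun t x => II B x * G (t, x)) (θ := 3/4) (by norm_num)
    (PotOK_fT h hk hG hL) x ?_ (fun τ hτ s => inn_time h hk hG hτ s x) (fun s => inn_Z_lim h hG s x) ht
  have := hG.cont
  fun_prop

end

section
variable {d : ℕ} {A B : Euc d → Matrix (Fin d) (Fin d) ℝ} {K c0 C c : ℝ}

def vec (c : Fin d → ℝ) : Euc d := WithLp.toLp 2 c

lemma vec_apply (c : Fin d → ℝ) (i : Fin d) : vec c i = c i := rfl

lemma norm_le_sum (z : Euc d) : ‖z‖ ≤ ∑ i, |z i| := by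
  rw [EuclideanSpace.norm_eq]
  refine (Real.sqrt_le_left (Finset.sum_nonneg fun i _ => abs_nonneg _)).2 ?_
  simp only [Real.norm_eq_abs]
  exact Finset.sum_sq_le_sq_sum_of_nonneg fun i _ => abs_nonneg _

lemma vec_norm_le (z : Euc d) {b : ℝ} (h : ∀ i, |z i| ≤ b) : ‖z‖ ≤ d * b := by
  refine (norm_le_sum z).trans ((Finset.sum_le_sum fun i _ => h i).trans ?_)
  simp

lemma vec_cont {X : Type*} [TopologicalSpace X] {f : X → Fin d → ℝ}
    (h : ∀ i, Continuous fun x => f x i) : Continuous fun x => vec (f x) :=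
  (PiLp.continuous_toLp 2 _).comp (continuous_pi h)

lemma vec_contOn {X : Type*} [TopologicalSpace X] {f : X → Fin d → ℝ} {S : Set X}
    (h : ∀ i, ContinuousOn (fun x => f x i) S) : ContinuousOn (fun x => vec (f x)) S :=
  (PiLp.continuous_toLp 2 _).comp_continuousOn (continuousOn_pi.2 h)

/-- regular functions on the strip -/
structure Reg (T : ℝ) (v : ℝ → Euc d → ℝ) (p : ℝ → Euc d → Fin d → ℝ) (X : ℝ → Euc d → Fin d → Fin d → ℝ)
    (q : ℝ → Euc d → ℝ) : Prop where
  cont : ContinuousOn (fun z : ℝ × Euc d => v z.1 z.2) (Icc 0 T ×ˢ univ)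
  pcont : ∀ i, ContinuousOn (fun z : ℝ × Euc d => p z.1 z.2 i) (Icc 0 T ×ˢ univ)
  Xcont : ∀ i j, ContinuousOn (fun z : ℝ × Euc d => X z.1 z.2 i j) (Ioo 0 T ×ˢ univ)
  qcont : ContinuousOn (fun z : ℝ × Euc d => q z.1 z.2) (Ioo 0 T ×ˢ univ)
  d1 : ∀ t ∈ Icc 0 T, ∀ x, HasFDerivAt (fun x => v t x) (gr (p t x)) x
  d2 : ∀ t ∈ Ioo 0 T, ∀ x i, HasFDerivAt (fun x => p t x i) (gr (X t x i)) x
  dt : ∀ t ∈ Ioo 0 T, ∀ x, HasDerivAt (fun t => v t x) (q t x) t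

structure FOK (F : ℝ → Euc d → Euc d → ℝ) (N ℓ : ℝ) : Prop where
  cont : Continuous fun z : ℝ × Euc d × Euc d => F z.1 z.2.1 z.2.2
  bd : ∀ t x p, |F t x p| ≤ N
  lip : ∀ t x p q, |F t x p - F t x q| ≤ ℓ * ‖p - q‖
  hol : ∀ r : ℝ, ∃ C, ∀ t x y p, ‖x‖ ≤ r → |F t y p - F t x p| ≤ C * Real.sqrt ‖y - x‖

lemma Pot_inn_sub {κ : ℝ → Euc d → Euc d → ℝ} {θ : ℝ} (hk : Kern κ C θ c) (hc : 0 < c) (hθ : θ < 1)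
    {G G' : ℝ × Euc d → ℝ} {N N' : ℝ} (hG : BC G N) (hG' : BC G' N') (t : ℝ) (x : Euc d) :
    Pot (inn κ G) t x - Pot (inn κ G') t x = Pot (inn κ (fun z => G z - G' z)) t x := by
  unfold Pot
  rw [← MeasureTheory.integral_sub ((PotOK_kern hk hc hG).intOn hθ t x) ((PotOK_kern hk hc hG').intOn hθ t x)]
  refine MeasureTheory.setIntegral_congr_fun measurableSet_Ioo fun τ hτ => ?_
  simp only [inn]
  rw [← MeasureTheory.integral_sub (inn_integrable hk hc hG hτ.1 _ x) (inn_integrable hk hc hG' hτ.1 _ x)]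
  simp only [mul_sub]

lemma gauss_J {β : ℝ} (hβ : 0 < β) :
    MeasureTheory.IntegrableOn (fun τ : ℝ => τ ^ (-(1/2) : ℝ) * Real.exp (-(β * τ))) (Ioi 0) ∧
    ∫ τ in Ioi (0:ℝ), τ ^ (-(1/2) : ℝ) * Real.exp (-(β * τ)) = (1 / β) ^ (1/2 : ℝ) * Real.Gamma (1/2) := by
  have h := Real.integral_rpow_mul_exp_neg_mul_Ioi (a := 1/2) (r := β) (by norm_num) hβ
  have e : (1/2 - 1 : ℝ) = -(1/2) := by norm_num
  rw [e] at h
  refine ⟨?_, h⟩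
  refine MeasureTheory.Integrable.of_integral_ne_zero ?_
  rw [h]
  have : 0 < Real.Gamma (1/2) := Real.Gamma_pos_of_pos (by norm_num)
  positivity

lemma Pot_wt {κ : ℝ → Euc d → Euc d → ℝ} (hk : Kern κ C (1/2) c) (hc : 0 < c) (hC : 0 ≤ C) {β : ℝ} (hβ : 0 < β)
    {G : ℝ × Euc d → ℝ} {M T : ℝ} (hM : 0 ≤ M) (hG : ∀ s ∈ Icc 0 T, ∀ y, |G (s, y)| ≤ M * Real.exp (β * s)) {t : ℝ}
    (ht : t ∈ Icc 0 T) (x : Euc d) :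
    |Pot (inn κ G) t x| ≤ C * (Real.pi / c) ^ ((d:ℝ) / 2) * ((1 / β) ^ (1/2 : ℝ) * Real.Gamma (1/2)) * M * Real.exp (β * t) := by
  obtain ⟨h1, h2⟩ := gauss_J hβ
  set W := (Real.pi / c) ^ ((d:ℝ) / 2) with hW
  have hW0 : 0 ≤ W := by positivity
  have h3 := Pot_le (inn κ G) t x (fun τ => C * W * M * Real.exp (β * t) * (τ ^ (-(1/2) : ℝ) * Real.exp (-(β * τ))))
    ((h1.mono_set Ioo_subset_Ioi_self).const_mul _) (fun τ hτ => ?_)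
  · rw [MeasureTheory.integral_const_mul] at h3
    refine h3.trans ?_
    have h4 : ∫ τ in Ioo 0 t, τ ^ (-(1/2) : ℝ) * Real.exp (-(β * τ)) ≤ (1 / β) ^ (1/2 : ℝ) * Real.Gamma (1/2) := by
      rw [← h2]
      refine MeasureTheory.setIntegral_mono_set h1 ?_ (Ioo_subset_Ioi_self.eventuallyLE)
      filter_upwards [MeasureTheory.self_mem_ae_restrict measurableSet_Ioi] with τ hτ
      have : (0:ℝ) < τ := hτ
      simp only [Pi.zero_apply]
      positivity
    calc _ ≤ C * W * M * Real.exp (β * t) * ((1 / β) ^ (1/2 : ℝ) * Real.Gamma (1/2)) :=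
          mul_le_mul_of_nonneg_left h4 (by positivity)
      _ = _ := by ring
  · have h5 := inn_bd hk hc hτ.1 (t - τ) (hG (t - τ) ⟨by linarith [hτ.2], by linarith [hτ.1, ht.2]⟩) x
    refine h5.trans (le_of_eq ?_)
    have : Real.exp (β * (t - τ)) = Real.exp (β * t) * Real.exp (-(β * τ)) := by
      rw [← Real.exp_add]; congr 1; ring
    rw [this]; ring

lemma inn_hol {κ : ℝ → Euc d → Euc d → ℝ} {κ' : Fin d → ℝ → Euc d → Euc d → ℝ}
    (h : Kern κ C (1/2) c) (h' : ∀ i, Kern (κ' i) C 1 c) (hc : 0 < c) (hC : 0 ≤ C)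
    (hd : ∀ τ, 0 < τ → ∀ x y, HasFDerivAt (fun x => κ τ x y) (gr fun i => κ' i τ x y) x)
    {G : ℝ × Euc d → ℝ} {N : ℝ} (hG : BC G N) {τ : ℝ} (hτ : 0 < τ) (s : ℝ) (x x' : Euc d) :
    |inn κ G τ s x - inn κ G τ s x'| ≤
      (2 + d) * (C * (Real.pi / c) ^ ((d:ℝ) / 2) * N) * Real.sqrt ‖x - x'‖ * τ ^ (-(3/4) : ℝ) := by
  set M := C * (Real.pi / c) ^ ((d:ℝ) / 2) * N with hM
  have hN := hG.nonneg
  have hM0 : 0 ≤ M := by positivity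
  have a1 := inn_bd h hc hτ s (fun y => hG.bd (s, y)) x
  have a2 := inn_bd h hc hτ s (fun y => hG.bd (s, y)) x'
  have b1 : |inn κ G τ s x - inn κ G τ s x'| ≤ d * (M * τ ^ (-1:ℝ)) * ‖x - x'‖ := by
    refine Convex.norm_image_sub_le_of_norm_hasFDerivWithin_le (f := fun x => inn κ G τ s x)
      (f' := fun x => gr fun i => inn (κ' i) G τ s x) (s := univ)
      (fun y _ => (inn_deriv h h' hc hd hG hτ s y).hasFDerivWithinAt) (fun y _ => ?_) convex_univ (mem_univ _) (mem_univ _)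
    exact gr_norm_le _ _ fun i => inn_bd (h' i) hc hτ s (fun y => hG.bd (s, y)) y
  have hs := Real.sqrt_nonneg ‖x - x'‖
  have hss := Real.mul_self_sqrt (norm_nonneg (x - x'))
  set n := Real.sqrt ‖x - x'‖
  have e1 : τ ^ (-1:ℝ) * τ ^ (1/4:ℝ) = τ ^ (-(3/4) : ℝ) := by rw [← Real.rpow_add hτ]; norm_num
  have e2 : τ ^ (-(1/2):ℝ) = τ ^ (-(3/4):ℝ) * τ ^ (1/4:ℝ) := by rw [← Real.rpow_add hτ]; norm_num
  have p1 : 0 ≤ τ ^ (-(3/4) : ℝ) := Real.rpow_nonneg hτ.le _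
  have p2 : 0 ≤ τ ^ (-1 : ℝ) := Real.rpow_nonneg hτ.le _
  rcases le_total n (τ ^ (1/4:ℝ)) with hn | hn
  · refine b1.trans ?_
    rw [← hss]
    calc _ = d * M * n * (τ ^ (-1:ℝ) * n) := by ring
      _ ≤ d * M * n * (τ ^ (-1:ℝ) * τ ^ (1/4:ℝ)) := by gcongr
      _ = d * M * n * τ ^ (-(3/4) : ℝ) := by rw [e1]
      _ ≤ (2 + d) * M * n * τ ^ (-(3/4) : ℝ) := by gcongr; linarith
  · calc _ ≤ |inn κ G τ s x| + |inn κ G τ s x'| := abs_sub _ _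
      _ ≤ M * τ ^ (-(1/2):ℝ) + M * τ ^ (-(1/2):ℝ) := add_le_add a1 a2
      _ = 2 * M * (τ ^ (-(3/4) : ℝ) * τ ^ (1/4:ℝ)) := by rw [e2]; ring
      _ ≤ 2 * M * (τ ^ (-(3/4) : ℝ) * n) := by gcongr
      _ = 2 * M * n * τ ^ (-(3/4) : ℝ) := by ring
      _ ≤ (2 + d) * M * n * τ ^ (-(3/4) : ℝ) := by
        gcongr
        have : (0:ℝ) ≤ d := by positivity
        linarith

lemma Pot_hol {κ : ℝ → Euc d → Euc d → ℝ} {κ' : Fin d → ℝ → Euc d → Euc d → ℝ}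
    (h : Kern κ C (1/2) c) (h' : ∀ i, Kern (κ' i) C 1 c) (hc : 0 < c) (hC : 0 ≤ C)
    (hd : ∀ τ, 0 < τ → ∀ x y, HasFDerivAt (fun x => κ τ x y) (gr fun i => κ' i τ x y) x)
    {G : ℝ × Euc d → ℝ} {N : ℝ} (hG : BC G N) {t T : ℝ} (ht : t ≤ T) (x x' : Euc d) :
    |Pot (inn κ G) t x - Pot (inn κ G) t x'| ≤
      (2 + d) * (C * (Real.pi / c) ^ ((d:ℝ) / 2)) * (∫ τ in Ioo 0 T, τ ^ (-(3/4) : ℝ)) * N * Real.sqrt ‖x - x'‖ := by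
  have hi := rpow_intOn (θ := 3/4) (by norm_num) T
  have hN := hG.nonneg
  have hP := PotOK_kern h hc hG
  unfold Pot
  rw [← MeasureTheory.integral_sub (hP.intOn (by norm_num) t x) (hP.intOn (by norm_num) t x')]
  have h1 := MeasureTheory.norm_integral_le_of_norm_le (μ := MeasureTheory.volume.restrict (Ioo 0 t))
    (f := fun τ => inn κ G τ (t - τ) x - inn κ G τ (t - τ) x')
    ((rpow_intOn (θ := 3/4) (by norm_num) t).const_mul ((2 + d) * (C * (Real.pi / c) ^ ((d:ℝ) / 2) * N) * Real.sqrt ‖x - x'‖))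
    (by
      filter_upwards [MeasureTheory.self_mem_ae_restrict measurableSet_Ioo] with τ hτ
      exact inn_hol h h' hc hC hd hG hτ.1 (t - τ) x x')
  rw [MeasureTheory.integral_const_mul] at h1
  refine h1.trans ?_
  have h2 : ∫ τ in Ioo 0 t, τ ^ (-(3/4) : ℝ) ≤ ∫ τ in Ioo 0 T, τ ^ (-(3/4) : ℝ) := by
    refine MeasureTheory.setIntegral_mono_set hi ?_ ((Ioo_subset_Ioo_right ht).eventuallyLE)
    filter_upwards [MeasureTheory.self_mem_ae_restrict measurableSet_Ioo] with τ hτ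
    exact Real.rpow_nonneg hτ.1.le _
  refine (mul_le_mul_of_nonneg_left h2 (by positivity)).trans (le_of_eq (by ring))

lemma Pot_bd {κ : ℝ → Euc d → Euc d → ℝ} {θ : ℝ} (h : Kern κ C θ c) (hc : 0 < c) (hC : 0 ≤ C) (hθ : θ < 1)
    {G : ℝ × Euc d → ℝ} {N : ℝ} (hG : BC G N) {t T : ℝ} (ht : t ≤ T) (x : Euc d) :
    |Pot (inn κ G) t x| ≤ (C * (Real.pi / c) ^ ((d:ℝ) / 2)) * (∫ τ in Ioo 0 T, τ ^ (-θ)) * N := by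
  have hN := hG.nonneg
  have h1 := Pot_le (inn κ G) t x (fun τ => C * (Real.pi / c) ^ ((d:ℝ) / 2) * N * τ ^ (-θ)) ((rpow_intOn hθ t).const_mul _)
    (fun τ hτ => inn_bd h hc hτ.1 _ (fun y => hG.bd _) x)
  rw [MeasureTheory.integral_const_mul] at h1
  refine h1.trans ?_
  have h2 : ∫ τ in Ioo 0 t, τ ^ (-θ) ≤ ∫ τ in Ioo 0 T, τ ^ (-θ) := by
    refine MeasureTheory.setIntegral_mono_set (rpow_intOn hθ T) ?_ ((Ioo_subset_Ioo_right ht).eventuallyLE)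
    filter_upwards [MeasureTheory.self_mem_ae_restrict measurableSet_Ioo] with τ hτ
    exact Real.rpow_nonneg hτ.1.le _
  refine (mul_le_mul_of_nonneg_left h2 (by positivity)).trans (le_of_eq (by ring))

end

section
variable {d : ℕ} {A B : Euc d → Matrix (Fin d) (Fin d) ℝ} {K c0 C c : ℝ}

def ct (T t : ℝ) : ℝ := max 0 (min t T)

lemma ct_mem {T : ℝ} (hT : 0 ≤ T) (t : ℝ) : ct T t ∈ Icc 0 T :=
  ⟨le_max_left _ _, max_le hT (min_le_right _ _)⟩
lemma ct_eq {T t : ℝ} (ht : t ∈ Icc 0 T) : ct T t = t := by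
  unfold ct; rw [min_eq_left ht.2, max_eq_right ht.1]
lemma ct_cont (T : ℝ) : Continuous (ct T) := by unfold ct; fun_prop

def wG (β T : ℝ) (g : BoundedContinuousFunction (ℝ × Euc d) ℝ) (z : ℝ × Euc d) : ℝ := Real.exp (β * ct T z.1) * g z

lemma wG_BC {β T : ℝ} (hβ : 0 < β) (hT : 0 ≤ T) (g : BoundedContinuousFunction (ℝ × Euc d) ℝ) :
    BC (wG β T g) (Real.exp (β * T) * ‖g‖) := by
  constructor
  · unfold wG
    have := ct_cont T
    have := g.continuous
    fun_prop
  · intro z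
    unfold wG
    rw [abs_mul, abs_of_pos (Real.exp_pos _)]
    refine mul_le_mul (Real.exp_le_exp.2 ?_) (g.norm_coe_le_norm z) (abs_nonneg _) (Real.exp_pos _).le
    exact mul_le_mul_of_nonneg_left (ct_mem hT _).2 hβ.le

def phi (A B : Euc d → Matrix (Fin d) (Fin d) ℝ) (β T : ℝ) (F : ℝ → Euc d → Euc d → ℝ)
    (g : BoundedContinuousFunction (ℝ × Euc d) ℝ) (z : ℝ × Euc d) : ℝ :=
  Real.exp (-(β * ct T z.1)) * (Pot (inn (kK A B) (wG β T g)) (ct T z.1) z.2 +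
    F (ct T z.1) z.2 (vec fun i => Pot (inn (kZ1 B i) (wG β T g)) (ct T z.1) z.2)) / II B z.2

lemma fixed_point (h : Coef d A B K c0) (hk : KB A B C c) {T ℓ : ℝ} (hT : 0 < T) (hℓ : 0 ≤ ℓ) :
    ∃ C1 : ℝ, 0 < C1 ∧ ∀ (N : ℝ) (F : ℝ → Euc d → Euc d → ℝ), FOK F N ℓ → ∃ G : ℝ × Euc d → ℝ, BC G (C1 * N) ∧
      (∀ t x, G (t, x) = G (ct T t, x)) ∧ ∀ t ∈ Icc 0 T, ∀ x, II B x * G (t, x) =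
        Pot (inn (kK A B) G) t x + F t x (vec fun i => Pot (inn (kZ1 B i) G) t x) := by
  obtain ⟨c1, hc1, hI⟩ := II_low h
  have hC0 : 0 ≤ C := by linarith [hk.C1]
  have hcp := hk.cpos
  set W := (Real.pi / c) ^ ((d:ℝ) / 2) with hW
  have hW0 : 0 ≤ W := by positivity
  have hΓ : 0 < Real.Gamma (1/2) := Real.Gamma_pos_of_pos (by norm_num)
  set Q : ℝ := (1 + ℓ * d) * (C * W * Real.Gamma (1/2)) / c1 with hQ
  have hQ0 : 0 ≤ Q := by positivity
  set β : ℝ := (2 * Q + 1) ^ 2 with hβ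
  have hβ0 : 0 < β := by positivity
  set J : ℝ := (1 / β) ^ (1/2 : ℝ) * Real.Gamma (1/2) with hJ
  have hJ1 : (1 + ℓ * d) * (C * W * J) ≤ c1 / 2 := by
    have e : (1 / β) ^ (1/2 : ℝ) = 1 / (2 * Q + 1) := by
      rw [← Real.sqrt_eq_rpow, hβ, ← one_div_pow, Real.sqrt_sq (by positivity)]
    have : (1 + ℓ * d) * (C * W * J) = Q * c1 / (2 * Q + 1) := by
      rw [hJ, e, hQ]; field_simp
    rw [this, div_le_iff₀ (by positivity)]
    nlinarith
  have hJ0 : 0 ≤ J := by positivity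
  have hCWJ : 0 ≤ C * W * J := by positivity
  have hIc : Continuous (II B) := lip_cont (II_lip h hk)
  have hcT := ct_cont T
  refine ⟨Real.exp (β * T) * (2 / c1), by positivity, fun N F hF => ?_⟩
  have hN : 0 ≤ N := (abs_nonneg _).trans (hF.bd 0 0 0)
  have e0 : ∀ t, Real.exp (-(β * ct T t)) * Real.exp (β * ct T t) = 1 := fun t => by
    rw [← Real.exp_add]; simp
  -- weighted bound
  have wb : ∀ (κ : ℝ → Euc d → Euc d → ℝ), Kern κ C (1/2) c → ∀ (g : BoundedContinuousFunction (ℝ × Euc d) ℝ) t x,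
      |Pot (inn κ (wG β T g)) (ct T t) x| ≤ C * W * J * ‖g‖ * Real.exp (β * ct T t) := by
    intro κ hκ g t x
    refine Pot_wt hκ hcp hC0 hβ0 (norm_nonneg g) (fun s hs y => ?_) (ct_mem hT.le t) x
    simp only [wG]
    rw [abs_mul, abs_of_pos (Real.exp_pos _), ct_eq hs, mul_comm]
    exact mul_le_mul_of_nonneg_right (g.norm_coe_le_norm _) (Real.exp_pos _).le
  have wd : ∀ (κ : ℝ → Euc d → Euc d → ℝ), Kern κ C (1/2) c → ∀ (g g' : BoundedContinuousFunction (ℝ × Euc d) ℝ) t x,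
      |Pot (inn κ (wG β T g)) (ct T t) x - Pot (inn κ (wG β T g')) (ct T t) x| ≤ C * W * J * ‖g - g'‖ * Real.exp (β * ct T t) := by
    intro κ hκ g g' t x
    rw [Pot_inn_sub hκ hcp (by norm_num) (wG_BC hβ0 hT.le g) (wG_BC hβ0 hT.le g')]
    have := wb κ hκ (g - g') t x
    have e : (fun z => wG β T g z - wG β T g' z) = wG β T (g - g') := by
      ext z; simp only [wG, BoundedContinuousFunction.coe_sub, Pi.sub_apply]; ring
    rw [e]; exact this
  have pc : ∀ g, Continuous (phi A B β T F g) := by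
    intro g
    unfold phi
    have hP : ∀ κ : ℝ → Euc d → Euc d → ℝ, Kern κ C (1/2) c →
        Continuous fun z : ℝ × Euc d => Pot (inn κ (wG β T g)) (ct T z.1) z.2 := fun κ hκ =>
      (Pot_cont (PotOK_kern hκ hcp (wG_BC hβ0 hT.le g)) (by norm_num)).comp (g := fun p : ℝ × Euc d => Pot (inn κ (wG β T g)) p.1 p.2)
        (f := fun z : ℝ × Euc d => (ct T z.1, z.2)) (by fun_prop)
    refine Continuous.div (Continuous.mul (by fun_prop) (Continuous.add (hP _ hk.k) ?_)) (by fun_prop) fun z => ?_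
    · refine hF.cont.comp (f := fun z : ℝ × Euc d => (ct T z.1, z.2, vec fun i => Pot (inn (kZ1 B i) (wG β T g)) (ct T z.1) z.2)) ?_
      have := vec_cont (f := fun z : ℝ × Euc d => fun i => Pot (inn (kZ1 B i) (wG β T g)) (ct T z.1) z.2) fun i => hP _ (hk.z1 i)
      fun_prop
    · have := hI z.2
      linarith
  have divb : ∀ (a b : ℝ) (t : ℝ) (x : Euc d), |a| ≤ b * Real.exp (β * ct T t) →
      |Real.exp (-(β * ct T t)) * a / II B x| ≤ b / c1 := by
    intro a b t x hab
    have hx := hI x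
    have h1 : |Real.exp (-(β * ct T t)) * a| ≤ b := by
      rw [abs_mul, abs_of_pos (Real.exp_pos _)]
      calc _ ≤ Real.exp (-(β * ct T t)) * (b * Real.exp (β * ct T t)) := mul_le_mul_of_nonneg_left hab (Real.exp_pos _).le
        _ = b * (Real.exp (-(β * ct T t)) * Real.exp (β * ct T t)) := by ring
        _ = b := by rw [e0, mul_one]
    rw [abs_div, abs_of_pos (by linarith : 0 < II B x)]
    exact div_le_div₀ ((abs_nonneg _).trans h1) h1 hc1 hx
  have pb : ∀ g z, |phi A B β T F g z| ≤ (C * W * J * ‖g‖ + N) / c1 := by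
    intro g z
    refine divb _ _ z.1 z.2 ?_
    refine (abs_add_le _ _).trans ?_
    rw [add_mul]
    refine add_le_add (wb _ hk.k g z.1 z.2) ((hF.bd _ _ _).trans ?_)
    have : 1 ≤ Real.exp (β * ct T z.1) := Real.one_le_exp (mul_nonneg hβ0.le (ct_mem hT.le _).1)
    nlinarith
  let Φ : BoundedContinuousFunction (ℝ × Euc d) ℝ → BoundedContinuousFunction (ℝ × Euc d) ℝ := fun g =>
    BoundedContinuousFunction.ofNormedAddCommGroup (phi A B β T F g) (pc g) _ (pb g)
  have hΦ : ∀ g z, Φ g z = phi A B β T F g z := fun g z => rfl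
  have hcon : ContractingWith (1/2 : ℝ≥0) Φ := by
    refine ⟨by rw [← NNReal.coe_lt_coe]; push_cast; norm_num, LipschitzWith.of_dist_le_mul fun g g' => ?_⟩
    rw [dist_eq_norm, dist_eq_norm]
    push_cast
    refine (BoundedContinuousFunction.norm_le (by positivity)).2 fun z => ?_
    rw [BoundedContinuousFunction.coe_sub, Pi.sub_apply, hΦ, hΦ, Real.norm_eq_abs]
    have e1 : phi A B β T F g z - phi A B β T F g' z = Real.exp (-(β * ct T z.1)) *
      ((Pot (inn (kK A B) (wG β T g)) (ct T z.1) z.2 - Pot (inn (kK A B) (wG β T g')) (ct T z.1) z.2) +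
      (F (ct T z.1) z.2 (vec fun i => Pot (inn (kZ1 B i) (wG β T g)) (ct T z.1) z.2) -
       F (ct T z.1) z.2 (vec fun i => Pot (inn (kZ1 B i) (wG β T g')) (ct T z.1) z.2))) / II B z.2 := by
      unfold phi; ring
    rw [e1]
    refine (divb _ ((1 + ℓ * d) * (C * W * J) * ‖g - g'‖) z.1 z.2 ?_).trans ?_
    · refine (abs_add_le _ _).trans ?_
      have b1 := wd _ hk.k g g' z.1 z.2
      have b2 := hF.lip (ct T z.1) z.2 (vec fun i => Pot (inn (kZ1 B i) (wG β T g)) (ct T z.1) z.2)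
        (vec fun i => Pot (inn (kZ1 B i) (wG β T g')) (ct T z.1) z.2)
      have b3 := vec_norm_le (vec (fun i => Pot (inn (kZ1 B i) (wG β T g)) (ct T z.1) z.2) -
        vec fun i => Pot (inn (kZ1 B i) (wG β T g')) (ct T z.1) z.2) (b := C * W * J * ‖g - g'‖ * Real.exp (β * ct T z.1))
        fun i => wd _ (hk.z1 i) g g' z.1 z.2
      have b4 := mul_le_mul_of_nonneg_left b3 hℓ
      refine (add_le_add b1 (b2.trans b4)).trans (le_of_eq (by ring))
    · rw [div_le_iff₀ hc1]
      have := norm_nonneg (g - g')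
      nlinarith
  set g := ContractingWith.fixedPoint Φ hcon with hg
  have hfix : Φ g = g := hcon.fixedPoint_isFixedPt
  have hfz : ∀ z, g z = phi A B β T F g z := fun z => by rw [← hΦ, hfix]
  have hgn : ‖g‖ ≤ 2 / c1 * N := by
    have h1 : ‖g‖ ≤ (C * W * J * ‖g‖ + N) / c1 :=
      (BoundedContinuousFunction.norm_le (by positivity)).2 fun z => by rw [hfz z]; exact pb g z
    rw [le_div_iff₀ hc1] at h1
    have h2 : C * W * J ≤ c1 / 2 := by
      have : 0 ≤ ℓ * d * (C * W * J) := by positivity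
      linarith
    rw [div_mul_eq_mul_div, le_div_iff₀ hc1]
    nlinarith [norm_nonneg g]
  have hwz : ∀ t x, wG β T g (t, x) = (Pot (inn (kK A B) (wG β T g)) (ct T t) x +
      F (ct T t) x (vec fun i => Pot (inn (kZ1 B i) (wG β T g)) (ct T t) x)) / II B x := by
    intro t x
    conv_lhs => rw [wG, hfz (t, x)]
    simp only [phi]
    rw [← mul_div_assoc, ← mul_assoc, mul_comm (Real.exp (β * _)), e0, one_mul]
  refine ⟨wG β T g, ?_, fun t x => ?_, fun t ht x => ?_⟩
  · have h1 := wG_BC hβ0 hT.le g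
    refine ⟨h1.cont, fun p => (h1.bd p).trans ?_⟩
    rw [mul_assoc]
    gcongr
  · rw [hwz t x, hwz (ct T t) x, ct_eq (ct_mem hT.le t)]
  · rw [hwz t x, ct_eq ht]
    have hne : II B x ≠ 0 := ne_of_gt (hc1.trans_le (hI x))
    field_simp

end

section
variable {d : ℕ} {A B : Euc d → Matrix (Fin d) (Fin d) ℝ} {K c0 C c : ℝ}

def trA (A : Euc d → Matrix (Fin d) (Fin d) ℝ) (x : Euc d) (X : Fin d → Fin d → ℝ) : ℝ := ∑ i, ∑ j, A x i j * X i j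

set_option maxHeartbeats 800000 in
/-- solvability of semilinear problems with bounded right-hand side -/
theorem thmE (h : Coef d A B K c0) {T ℓ : ℝ} (hT : 0 < T) (hℓ : 0 ≤ ℓ) :
    ∃ C2 : ℝ, 0 < C2 ∧ ∀ (N : ℝ) (F : ℝ → Euc d → Euc d → ℝ), FOK F N ℓ →
      ∃ v p X q, Reg T v p X q ∧ (∀ x, v 0 x = 0) ∧
        (∀ t ∈ Ioo 0 T, ∀ x, q t x - trA A x (X t x) = F t x (vec (p t x))) ∧
        (∀ t ∈ Icc 0 T, ∀ x, |v t x| ≤ C2 * N) ∧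
        (∀ t ∈ Icc 0 T, ∀ x i, |p t x i| ≤ C2 * N) ∧
        (∀ t ∈ Icc 0 T, ∀ x x' i, |p t x i - p t x' i| ≤ C2 * N * Real.sqrt ‖x - x'‖) := by
  obtain ⟨C, hk⟩ := exists_KB h
  set c := c0 / 8
  have hC0 : 0 ≤ C := by linarith [hk.C1]
  have hcp := hk.cpos
  obtain ⟨c1, hc1, hI⟩ := II_low h
  obtain ⟨C1, hC1, hfp⟩ := fixed_point h hk hT hℓ
  set W := (Real.pi / c) ^ ((d:ℝ) / 2) with hW
  have hW0 : 0 ≤ W := by positivity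
  have ip : ∀ θ : ℝ, 0 ≤ ∫ τ in Ioo 0 T, τ ^ (-θ) := fun θ =>
    MeasureTheory.setIntegral_nonneg measurableSet_Ioo fun τ hτ => Real.rpow_nonneg hτ.1.le _
  set J0 := ∫ τ in Ioo 0 T, τ ^ (-(0:ℝ)) with hJ0
  set J1 := ∫ τ in Ioo 0 T, τ ^ (-(1/2:ℝ)) with hJ1
  set J2 := ∫ τ in Ioo 0 T, τ ^ (-(3/4:ℝ)) with hJ2
  have p0 : 0 ≤ J0 := ip 0
  have p1 : 0 ≤ J1 := ip (1/2)
  have p2 : 0 ≤ J2 := ip (3/4)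
  set a0 := C * W * J0 * C1 with ha0
  set a1 := C * W * J1 * C1 with ha1
  set a2 := (2 + d) * (C * W) * J2 * C1 with ha2
  have q0 : 0 ≤ a0 := by positivity
  have q1 : 0 ≤ a1 := by positivity
  have q2 : 0 ≤ a2 := by positivity
  refine ⟨a0 + a1 + a2 + 1, by positivity, fun N F hF => ?_⟩
  have hN : 0 ≤ N := (abs_nonneg _).trans (hF.bd 0 0 0)
  obtain ⟨G, hG, hGc, hGe⟩ := hfp N F hF
  have hz1 : ∀ t ∈ Icc 0 T, ∀ x x' i, |Pot (inn (kZ1 B i) G) t x - Pot (inn (kZ1 B i) G) t x'| ≤ a2 * N * Real.sqrt ‖x - x'‖ := by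
    intro t ht x x' i
    refine (Pot_hol (hk.z1 i) (hk.z2 i) hcp hC0 (fun _ hτ x y => kZ1_deriv h i hτ x y) hG ht.2 x x').trans (le_of_eq ?_)
    rw [ha2]; ring
  have hk1 : ∀ t ∈ Icc 0 T, ∀ x x', |Pot (inn (kK A B) G) t x - Pot (inn (kK A B) G) t x'| ≤ a2 * N * Real.sqrt ‖x - x'‖ := by
    intro t ht x x'
    refine (Pot_hol hk.k hk.k1 hcp hC0 (fun _ hτ x y => kK_deriv h hτ x y) hG ht.2 x x').trans (le_of_eq ?_)
    rw [ha2]; ring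
  have hL : LH G := by
    intro r
    obtain ⟨CF, hCF⟩ := hF.hol r
    have hM : ∃ M, 0 ≤ M ∧ ∀ s x y, ‖x‖ ≤ r → ‖y - x‖ ≤ 1 → |G (s, y) - G (s, x)| ≤ M * Real.sqrt ‖y - x‖ := by
      refine ⟨(a2 * N + (|CF| + ℓ * (d * (a2 * N))) + C * (C1 * N)) / c1, by positivity, fun s x y hx hxy => ?_⟩
      rw [hGc s y, hGc s x]
      set t := ct T s with ht
      have htm : t ∈ Icc 0 T := ct_mem hT.le s
      set n := Real.sqrt ‖y - x‖ with hn
      have hn0 : 0 ≤ n := Real.sqrt_nonneg _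
      have hnn : ‖y - x‖ ≤ n := by
        rw [hn]; exact Real.le_sqrt_of_sq_le (by nlinarith [norm_nonneg (y - x)])
      have e1 := hGe t htm x
      have e2 := hGe t htm y
      have hIx := hI x
      have hIy := hI y
      have key : II B y * (G (t, y) - G (t, x)) = (Pot (inn (kK A B) G) t y - Pot (inn (kK A B) G) t x) +
        ((F t y (vec fun i => Pot (inn (kZ1 B i) G) t y) - F t x (vec fun i => Pot (inn (kZ1 B i) G) t y)) +
        (F t x (vec fun i => Pot (inn (kZ1 B i) G) t y) - F t x (vec fun i => Pot (inn (kZ1 B i) G) t x))) -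
        (II B y - II B x) * G (t, x) := by linarith
      have b1 := hk1 t htm y x
      have b2 : |F t y (vec fun i => Pot (inn (kZ1 B i) G) t y) - F t x (vec fun i => Pot (inn (kZ1 B i) G) t y)| ≤ |CF| * n :=
        (hCF t x y _ hx).trans (mul_le_mul_of_nonneg_right (le_abs_self _) hn0)
      have b3 : |F t x (vec fun i => Pot (inn (kZ1 B i) G) t y) - F t x (vec fun i => Pot (inn (kZ1 B i) G) t x)| ≤ ℓ * (d * (a2 * N * n)) := by
        refine (hF.lip _ _ _ _).trans (mul_le_mul_of_nonneg_left ?_ hℓ)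
        exact vec_norm_le _ fun i => hz1 t htm y x i
      have b4 : |(II B y - II B x) * G (t, x)| ≤ C * n * (C1 * N) := by
        rw [abs_mul]
        refine mul_le_mul ((II_lip h hk y x).trans ?_) (hG.bd _) (abs_nonneg _) (by positivity)
        exact mul_le_mul_of_nonneg_left hnn hC0
      have b5 : II B y * |G (t, y) - G (t, x)| ≤ (a2 * N + (|CF| + ℓ * (d * (a2 * N))) + C * (C1 * N)) * n := by
        rw [← abs_of_pos (by linarith : 0 < II B y), ← abs_mul, key]
        refine (abs_sub _ _).trans ?_
        have := abs_add_le (Pot (inn (kK A B) G) t y - Pot (inn (kK A B) G) t x)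
          ((F t y (vec fun i => Pot (inn (kZ1 B i) G) t y) - F t x (vec fun i => Pot (inn (kZ1 B i) G) t y)) +
          (F t x (vec fun i => Pot (inn (kZ1 B i) G) t y) - F t x (vec fun i => Pot (inn (kZ1 B i) G) t x)))
        have := abs_add_le (F t y (vec fun i => Pot (inn (kZ1 B i) G) t y) - F t x (vec fun i => Pot (inn (kZ1 B i) G) t y))
          (F t x (vec fun i => Pot (inn (kZ1 B i) G) t y) - F t x (vec fun i => Pot (inn (kZ1 B i) G) t x))
        nlinarith
      rw [div_mul_eq_mul_div, le_div_iff₀ hc1]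
      nlinarith [abs_nonneg (G (t, y) - G (t, x))]
    obtain ⟨M, hM0, hM⟩ := hM
    refine ⟨M + 2 * (C1 * N), fun s x y hx => ?_⟩
    have hn0 : 0 ≤ Real.sqrt ‖y - x‖ := Real.sqrt_nonneg _
    have hCN : 0 ≤ C1 * N := by positivity
    rcases le_total ‖y - x‖ 1 with h1 | h1
    · refine (hM s x y hx h1).trans (mul_le_mul_of_nonneg_right (by linarith) hn0)
    · have h2 : 1 ≤ Real.sqrt ‖y - x‖ := Real.one_le_sqrt.2 h1
      have h3 := abs_sub (G (s, y)) (G (s, x))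
      have h4 := hG.bd (s, y)
      have h5 := hG.bd (s, x)
      nlinarith
  have hPc : ∀ (κ : ℝ → Euc d → Euc d → ℝ) (θ : ℝ), θ < 1 → Kern κ C θ c → Continuous fun z : ℝ × Euc d => Pot (inn κ G) z.1 z.2 :=
    fun κ θ hθ hκ => Pot_cont (PotOK_kern hκ hcp hG) hθ
  have hX : ∀ i j, Continuous fun z : ℝ × Euc d => Pot (inn (kZ2 B i j) G) z.1 z.2 :=
    fun i j => Pot_cont (PotOK_z2 h hk hG hL i j) (by norm_num)
  refine ⟨fun t x => Pot (inn (kZ B) G) t x, fun t x i => Pot (inn (kZ1 B i) G) t x,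
    fun t x i j => Pot (inn (kZ2 B i j) G) t x, fun t x => II B x * G (t, x) +
      (∑ i, ∑ j, A x i j * Pot (inn (kZ2 B i j) G) t x - Pot (inn (kK A B) G) t x), ?_, ?_, ?_, ?_, ?_, ?_⟩
  · refine ⟨(hPc _ 0 (by norm_num) hk.z).continuousOn, fun i => (hPc _ (1/2) (by norm_num) (hk.z1 i)).continuousOn,
      fun i j => (hX i j).continuousOn, Continuous.continuousOn ?_, fun t _ x => Pot_d1 h hk hG t x,
      fun t _ x i => Pot_d2 h hk hG hL t x i, fun t ht x => Pot_t h hk hG hL ht.1 x⟩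
    have hIc : Continuous (II B) := lip_cont (II_lip h hk)
    refine Continuous.add (Continuous.mul (by fun_prop) hG.cont) (Continuous.sub ?_ (hPc _ (1/2) (by norm_num) hk.k))
    refine continuous_finsetSum _ fun i _ => continuous_finsetSum _ fun j _ => ?_
    have := h.Acont i j
    exact Continuous.mul (by fun_prop) (hX i j)
  · intro x
    simp [Pot]
  · intro t ht x
    have := hGe t ⟨ht.1.le, ht.2.le⟩ x
    simp only [trA]
    linarith
  · intro t ht x
    refine (Pot_bd hk.z hcp hC0 (by norm_num) hG ht.2 x).trans ?_
    calc _ = a0 * N := by rw [ha0]; ring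
      _ ≤ _ := by gcongr; linarith
  · intro t ht x i
    refine (Pot_bd (hk.z1 i) hcp hC0 (by norm_num) hG ht.2 x).trans ?_
    calc _ = a1 * N := by rw [ha1]; ring
      _ ≤ _ := by gcongr; linarith
  · intro t ht x x' i
    refine (hz1 t ht x x' i).trans ?_
    gcongr
    linarith

end

section
variable {d : ℕ} {A B : Euc d → Matrix (Fin d) (Fin d) ℝ} {K c0 C c : ℝ}

/-- Factorisation of the diffusion matrix. -/
structure Sg {n : ℕ} (A : Euc d → Matrix (Fin d) (Fin d) ℝ) (σ : Euc d → Fin n → Euc d) (S : ℝ) : Prop where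
  S1 : 1 ≤ S
  AS : ∀ x i j, A x i j = ∑ k, σ x k i * σ x k j
  bd : ∀ x, ∑ k, ‖σ x k‖ ^ 2 ≤ S
  lip : ∀ x y, ∑ k, ‖σ x k - σ y k‖ ^ 2 ≤ S * ‖x - y‖ ^ 2

lemma frob_cols {n : ℕ} (M : Matrix (Fin d) (Fin n) ℝ) :
    ∑ k, ‖vec (fun i => M i k)‖ ^ 2 = matFrobNorm M ^ 2 := by
  unfold matFrobNorm
  have h0 : 0 ≤ ∑ i, ∑ j, M i j ^ 2 := Finset.sum_nonneg fun i _ => Finset.sum_nonneg fun j _ => sq_nonneg _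
  rw [Real.sq_sqrt h0, Finset.sum_comm]
  refine Finset.sum_congr rfl fun k _ => ?_
  rw [EuclideanSpace.norm_sq_eq]
  simp [vec_apply]

lemma exists_Sg {ΛA : ℝ} (hΛA : 0 < ΛA) (hA : CondA d ΛA A) :
    ∃ (n : ℕ) (σ : Euc d → Fin n → Euc d) (S : ℝ), Sg A σ S := by
  obtain ⟨n, s, h1, h2, h3⟩ := hA
  refine ⟨n, fun x k => vec fun i => s x i k, ΛA ^ 2 + 1, ?_, ?_, ?_, ?_⟩
  · nlinarith
  · intro x i j
    rw [h1]; simp [Matrix.mul_apply, vec_apply]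
  · intro x
    rw [frob_cols]
    have h0 : 0 ≤ matFrobNorm (s x) := Real.sqrt_nonneg _
    have := pow_le_pow_left₀ h0 (h2 x) 2
    linarith
  · intro x y
    have e : ∀ k, vec (fun i => s x i k) - vec (fun i => s y i k) = vec fun i => (s x - s y) i k := by
      intro k; ext i; simp [vec_apply]
    simp only [e]
    rw [frob_cols]
    have h0 : 0 ≤ matFrobNorm (s x - s y) := Real.sqrt_nonneg _
    have := pow_le_pow_left₀ h0 (h3 x y) 2
    nlinarith [sq_nonneg ‖x - y‖]

structure C2f (u : Euc d → ℝ) (p : Euc d → Fin d → ℝ) (X : Euc d → Fin d → Fin d → ℝ) : Prop where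
  d1 : ∀ x, HasFDerivAt u (gr (p x)) x
  d2 : ∀ x i, HasFDerivAt (fun x => p x i) (gr (X x i)) x

lemma Reg.c2 {T : ℝ} {v p X q} (h : Reg (d := d) T v p X q) {t : ℝ} (ht : t ∈ Ioo 0 T) : C2f (v t) (p t) (X t) :=
  ⟨h.d1 t ⟨ht.1.le, ht.2.le⟩, h.d2 t ht⟩

/-- second directional form -/
def qd (X : Fin d → Fin d → ℝ) (ξ : Euc d) : ℝ := ∑ i, ∑ j, X i j * ξ j * ξ i

lemma line_deriv (x ξ : Euc d) (s : ℝ) : HasDerivAt (fun s : ℝ => x + s • ξ) ξ s := by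
  simpa using ((hasDerivAt_id s).smul_const ξ).const_add x

lemma C2f.line1 {u : Euc d → ℝ} {p X} (h : C2f u p X) (x ξ : Euc d) (s : ℝ) :
    HasDerivAt (fun s : ℝ => u (x + s • ξ)) (∑ i, p (x + s • ξ) i * ξ i) s := by
  have := (h.d1 (x + s • ξ)).comp_hasDerivAt s (line_deriv x ξ s)
  rw [gr_apply] at this
  exact this

lemma C2f.line2 {u : Euc d → ℝ} {p X} (h : C2f u p X) (x ξ : Euc d) :
    HasDerivAt (fun s : ℝ => ∑ i, p (x + s • ξ) i * ξ i) (qd (X x) ξ) 0 := by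
  unfold qd
  refine HasDerivAt.fun_sum fun i _ => ?_
  have h0 : HasFDerivAt (fun x => p x i) (gr (X x i)) (x + (0:ℝ) • ξ) := by simpa using h.d2 x i
  have := h0.comp_hasDerivAt (0:ℝ) (line_deriv x ξ 0)
  rw [gr_apply] at this
  have := this.mul_const (ξ i)
  rw [Finset.sum_mul] at this
  exact this

lemma second_test {f f1 : ℝ → ℝ} {f2 : ℝ} (h1 : ∀ᶠ s in nhds 0, HasDerivAt f (f1 s) s) (h2 : HasDerivAt f1 f2 0)
    (hm : IsLocalMax f 0) : f1 0 = 0 ∧ f2 ≤ 0 := by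
  have h10 := h1.self_of_nhds
  have e0 : f1 0 = 0 := hm.hasDerivAt_eq_zero h10
  refine ⟨e0, ?_⟩
  by_contra hc
  push Not at hc
  have ed : deriv f =ᶠ[nhds 0] f1 := h1.mono fun s hs => hs.deriv
  have edd : deriv (deriv f) 0 = f2 := by rw [ed.deriv_eq, h2.deriv]
  have hmin : IsLocalMin f 0 := isLocalMin_of_deriv_deriv_pos (by rw [edd]; exact hc)
    (by rw [ed.self_of_nhds, e0]) h10.continuousAt
  have hconst : f =ᶠ[nhds 0] fun _ => f 0 := by
    filter_upwards [hm, hmin] with s a b using le_antisymm a b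
  have h3 : deriv f =ᶠ[nhds 0] fun _ => 0 := by
    have := hconst.deriv
    simpa using this
  have : deriv (deriv f) 0 = 0 := by rw [h3.deriv_eq]; simp
  linarith [edd]

lemma trA_cols {n : ℕ} {σ : Euc d → Fin n → Euc d} {S : ℝ} (hS : Sg A σ S) (x : Euc d) (X : Fin d → Fin d → ℝ) :
    trA A x X = ∑ k, qd X (σ x k) := by
  unfold trA qd
  simp only [hS.AS, Finset.sum_mul]
  calc _ = ∑ i, ∑ k, ∑ j, σ x k i * σ x k j * X i j := Finset.sum_congr rfl fun i _ => Finset.sum_comm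
    _ = ∑ k, ∑ i, ∑ j, σ x k i * σ x k j * X i j := Finset.sum_comm
    _ = _ := Finset.sum_congr rfl fun k _ => Finset.sum_congr rfl fun i _ => Finset.sum_congr rfl fun j _ => by ring

lemma deriv_left_max {f : ℝ → ℝ} {f' t : ℝ} (ht : 0 < t) (h : HasDerivAt f f' t) (hm : ∀ s ∈ Ioo 0 t, f s ≤ f t) : 0 ≤ f' := by
  have h1 := hasDerivWithinAt_iff_tendsto_slope'  (s := Iio t) (by simp) |>.1 h.hasDerivWithinAt
  refine ge_of_tendsto h1 ?_
  filter_upwards [Ioo_mem_nhdsLT ht] with s hs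
  rw [slope_def_field]
  exact div_nonneg_of_nonpos (by linarith [hm s hs]) (by linarith [hs.2])

lemma vec_norm_sq (c : Fin d → ℝ) : ‖vec c‖ ^ 2 = ∑ i, c i ^ 2 := by
  rw [EuclideanSpace.norm_sq_eq]; simp [vec_apply]

lemma normsq_line (x ξ : Euc d) (s : ℝ) : HasDerivAt (fun s : ℝ => ‖x + s • ξ‖ ^ 2) (2 * (inner ℝ (x) (ξ)) + 2 * s * ‖ξ‖ ^ 2) s := by
  have e : (fun s : ℝ => ‖x + s • ξ‖ ^ 2) = fun s => ‖x‖ ^ 2 + s * (2 * (inner ℝ (x) (ξ))) + s ^ 2 * ‖ξ‖ ^ 2 := by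
    funext s
    rw [norm_add_sq_real, real_inner_smul_right, norm_smul, mul_pow, Real.norm_eq_abs, sq_abs]; ring
  rw [e]
  have := (((hasDerivAt_id s).mul_const (2 * (inner ℝ (x) (ξ)))).const_add (‖x‖ ^ 2)).add (((hasDerivAt_id s).pow 2).mul_const (‖ξ‖ ^ 2))
  refine this.congr_deriv ?_
  simp
  

/-- Test of a `C²` function against a quadratic at a global maximum. -/
lemma quad_test {n : ℕ} {σ : Euc d → Fin n → Euc d} {S : ℝ} (hS : Sg A σ S)
    {u : Euc d → ℝ} {p X} (h : C2f u p X) (x x0 : Euc d) (b : ℝ) (hb : 0 ≤ b)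
    (hm : ∀ y, u y - b * ‖y - x0‖ ^ 2 ≤ u x - b * ‖x - x0‖ ^ 2) :
    vec (p x) = (2 * b) • (x - x0) ∧ trA A x (X x) ≤ 2 * b * S := by
  have key : ∀ ξ : Euc d, (∑ i, p x i * ξ i) = 2 * b * (inner ℝ (x - x0) (ξ)) ∧ qd (X x) ξ ≤ 2 * b * ‖ξ‖ ^ 2 := by
    intro ξ
    have h1 : ∀ s : ℝ, HasDerivAt (fun s : ℝ => u (x + s • ξ) - b * ‖(x - x0) + s • ξ‖ ^ 2)
        (∑ i, p (x + s • ξ) i * ξ i - b * (2 * (inner ℝ (x - x0) (ξ)) + 2 * s * ‖ξ‖ ^ 2)) s :=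
      fun s => (h.line1 x ξ s).sub ((normsq_line (x - x0) ξ s).const_mul b)
    have h2 : HasDerivAt (fun s : ℝ => ∑ i, p (x + s • ξ) i * ξ i - b * (2 * (inner ℝ (x - x0) (ξ)) + 2 * s * ‖ξ‖ ^ 2))
        (qd (X x) ξ - b * (2 * ‖ξ‖ ^ 2)) 0 := by
      refine (h.line2 x ξ).sub ?_
      have := ((((hasDerivAt_id (0:ℝ)).const_mul 2).mul_const (‖ξ‖ ^ 2)).const_add (2 * (inner ℝ (x - x0) (ξ)))).const_mul b
      refine this.congr_deriv (by simp)
    have := second_test (Eventually.of_forall h1) h2 (Eventually.of_forall fun s => by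
      have := hm (x + s • ξ)
      simp only [zero_smul, add_zero]
      rwa [show x + s • ξ - x0 = (x - x0) + s • ξ by abel] at this)
    simp only [zero_smul, add_zero, mul_zero, zero_mul] at this
    constructor <;> linarith [this.1, this.2]
  constructor
  · ext i
    have := (key (EuclideanSpace.single i 1)).1
    simp [vec_apply, EuclideanSpace.inner_single_right, Pi.single_apply] at this ⊢
    simpa using this
  · rw [trA_cols hS]
    calc ∑ k, qd (X x) (σ x k) ≤ ∑ k, 2 * b * ‖σ x k‖ ^ 2 := Finset.sum_le_sum fun k _ => (key _).2
      _ = 2 * b * ∑ k, ‖σ x k‖ ^ 2 := by rw [Finset.mul_sum]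
      _ ≤ _ := mul_le_mul_of_nonneg_left (hS.bd x) (by positivity)

theorem maxPrin {n : ℕ} {σ : Euc d → Fin n → Euc d} {S : ℝ} (hS : Sg A σ S) {T : ℝ} (hT : 0 < T) {ℓ : ℝ} (hℓ : 0 ≤ ℓ)
    {w : ℝ → Euc d → ℝ} {p : ℝ → Euc d → Fin d → ℝ} {X : ℝ → Euc d → Fin d → Fin d → ℝ} {q : ℝ → Euc d → ℝ}
    (hc : ContinuousOn (fun z : ℝ × Euc d => w z.1 z.2) (Icc 0 T ×ˢ univ))
    (h2 : ∀ t ∈ Ioo 0 T, C2f (w t) (p t) (X t))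
    (ht : ∀ t ∈ Ioo 0 T, ∀ x, HasDerivAt (fun t => w t x) (q t x) t)
    {M : ℝ} (hM : ∀ t ∈ Icc 0 T, ∀ x, w t x ≤ M) (h0 : ∀ x, w 0 x ≤ 0)
    (hsub : ∀ t ∈ Ioo 0 T, ∀ x, 0 < w t x → q t x - trA A x (X t x) ≤ ℓ * ‖vec (p t x)‖) :
    ∀ t ∈ Icc 0 T, ∀ x, w t x ≤ 0 := by
  set κ := 2 * S + ℓ + 1 with hκ
  have hS1 := hS.S1
  have key : ∀ t0 ∈ Ioo 0 T, ∀ x0 : Euc d, ∀ ε > 0, w t0 x0 ≤ ε * (1 + ‖x0‖ ^ 2) * Real.exp (κ * t0) := by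
    intro t0 ht0 x0 ε hε
    by_contra hcon
    push Not at hcon
    obtain ⟨Rb, hR0, hR1, hR2⟩ : ∃ Rb : ℝ, 0 ≤ Rb ∧ ‖x0‖ ≤ Rb ∧ M ≤ ε * Rb ^ 2 := by
      refine ⟨‖x0‖ + |M| / ε + 1, by positivity, by have : 0 ≤ |M| / ε := by positivity
                                                    linarith, ?_⟩
      have h1 : 0 ≤ |M| / ε := by positivity
      have h3 : |M| / ε * ε = |M| := by field_simp
      have := norm_nonneg x0
      have h6 : |M| / ε ≤ (‖x0‖ + |M| / ε + 1) ^ 2 := by nlinarith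
      have h7 := mul_le_mul_of_nonneg_left h6 hε.le
      nlinarith [le_abs_self M]
    set Ψ : ℝ × Euc d → ℝ := fun z => w z.1 z.2 - ε * (1 + ‖z.2‖ ^ 2) * Real.exp (κ * z.1) with hΨ
    have hsubset : Icc 0 t0 ×ˢ closedBall (0 : Euc d) Rb ⊆ Icc 0 T ×ˢ univ :=
      prod_mono (Icc_subset_Icc le_rfl ht0.2.le) (subset_univ _)
    have hΨc : ContinuousOn Ψ (Icc 0 t0 ×ˢ closedBall (0 : Euc d) Rb) := by
      refine (hc.mono hsubset).sub (Continuous.continuousOn (by fun_prop))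
    have hmem0 : (t0, x0) ∈ Icc 0 t0 ×ˢ closedBall (0 : Euc d) Rb :=
      ⟨⟨ht0.1.le, le_rfl⟩, by simpa using hR1⟩
    obtain ⟨⟨t, x⟩, hmem, hmax⟩ := (isCompact_Icc.prod (isCompact_closedBall (0 : Euc d) Rb)).exists_isMaxOn ⟨_, hmem0⟩ hΨc
    have hpos : 0 < Ψ (t, x) := lt_of_lt_of_le (by simp only [hΨ]; linarith) (hmax hmem0)
    have hexp1 : ∀ s, 0 ≤ s → 1 ≤ Real.exp (κ * s) := fun s hs => Real.one_le_exp (by positivity)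
    have hall : ∀ s ∈ Icc 0 t0, ∀ y, Ψ (s, y) ≤ Ψ (t, x) := by
      intro s hs y
      by_cases hy : ‖y‖ ≤ Rb
      · exact hmax ⟨hs, by simpa using hy⟩
      · push Not at hy
        refine le_trans ?_ hpos.le
        simp only [hΨ]
        have h1 := hM s ⟨hs.1, hs.2.trans ht0.2.le⟩ y
        have h3 := hexp1 s hs.1
        have h4 : Rb ^ 2 ≤ ‖y‖ ^ 2 := pow_le_pow_left₀ hR0 hy.le 2
        have h5 : ε * (1 + ‖y‖ ^ 2) * 1 ≤ ε * (1 + ‖y‖ ^ 2) * Real.exp (κ * s) := mul_le_mul_of_nonneg_left h3 (by positivity)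
        nlinarith
    have ht1 : 0 < t := by
      rcases hmem.1.1.lt_or_eq with h | h
      · exact h
      · exfalso
        simp only at h
        simp only [hΨ, ← h] at hpos
        have := h0 x
        have : 0 ≤ ε * (1 + ‖x‖ ^ 2) * Real.exp (κ * 0) := by positivity
        linarith
    have ht2 : t ∈ Ioo 0 T := ⟨ht1, lt_of_le_of_lt hmem.1.2 ht0.2⟩
    set E := Real.exp (κ * t) with hE
    have hEpos : 0 < E := Real.exp_pos _
    have hw : 0 < w t x := by
      have : 0 ≤ ε * (1 + ‖x‖ ^ 2) * E := by positivity
      simp only [hΨ] at hpos; linarith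
    have hq : 0 ≤ q t x - ε * (1 + ‖x‖ ^ 2) * (E * κ) := by
      have hd : HasDerivAt (fun s => Ψ (s, x)) (q t x - ε * (1 + ‖x‖ ^ 2) * (E * κ)) t := by
        have h8 := ((hasDerivAt_id t).const_mul κ).exp
        simp only [id, mul_one] at h8
        exact (ht t ht2 x).sub (h8.const_mul (ε * (1 + ‖x‖ ^ 2)))
      exact deriv_left_max ht1 hd fun s hs => hall s ⟨hs.1.le, hs.2.le.trans hmem.1.2⟩ x
    have hqt := quad_test hS (h2 t ht2) x 0 (ε * E) (by positivity) (by
      intro y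
      have := hall t hmem.1 y
      simp only [hΨ] at this
      simp only [sub_zero]
      rw [← hE] at this
      linarith)
    have hs := hsub t ht2 x hw
    rw [hqt.1, sub_zero, norm_smul, Real.norm_of_nonneg (by positivity)] at hs
    have h3 := hqt.2
    have h4 : ε * E * ((1 + ‖x‖ ^ 2) * κ) ≤ ε * E * (2 * S + ℓ * (2 * ‖x‖)) := by nlinarith
    have h5 := le_of_mul_le_mul_left h4 (by positivity)
    nlinarith [sq_nonneg (‖x‖ - 1), sq_nonneg ‖x‖, mul_nonneg hℓ (sq_nonneg (‖x‖ - 1))]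
  have key2 : ∀ t0 ∈ Ioo 0 T, ∀ x0 : Euc d, w t0 x0 ≤ 0 := by
    intro t0 ht0 x0
    by_contra hcon
    push Not at hcon
    have hp : 0 < (1 + ‖x0‖ ^ 2) * Real.exp (κ * t0) := by positivity
    have := key t0 ht0 x0 (w t0 x0 / (2 * ((1 + ‖x0‖ ^ 2) * Real.exp (κ * t0)))) (by positivity)
    rw [mul_assoc] at this
    have e : w t0 x0 / (2 * ((1 + ‖x0‖ ^ 2) * Real.exp (κ * t0))) * ((1 + ‖x0‖ ^ 2) * Real.exp (κ * t0)) = w t0 x0 / 2 := by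
      field_simp
    linarith
  intro t ht' x
  have hcl : t ∈ closure (Ioo 0 T) := by rw [closure_Ioo hT.ne]; exact ht'
  have hcx : ContinuousOn (fun s => w s x) (Icc 0 T) := by
    have : ContinuousOn (fun s : ℝ => (s, x)) (Icc 0 T) := by fun_prop
    exact hc.comp this fun s hs => ⟨hs, mem_univ _⟩
  rw [← closure_Ioo hT.ne] at hcx
  have := ContinuousWithinAt.closure_le (s := Ioo 0 T) hcl ((hcx t hcl).mono subset_closure) continuousWithinAt_const (fun s hs => key2 s hs x)
  exact this
end

section
variable {d : ℕ} {A B : Euc d → Matrix (Fin d) (Fin d) ℝ} {K c0 C c : ℝ}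

lemma norm_line (z ζ : Euc d) (s : ℝ) (h : z + s • ζ ≠ 0) :
    HasDerivAt (fun s : ℝ => ‖z + s • ζ‖) ((inner ℝ z ζ + s * ‖ζ‖ ^ 2) / ‖z + s • ζ‖) s := by
  have hn : ‖z + s • ζ‖ ≠ 0 := norm_ne_zero_iff.2 h
  have h1 := (normsq_line z ζ s).sqrt (pow_ne_zero 2 hn)
  simp only [Real.sqrt_sq (norm_nonneg _)] at h1
  refine h1.congr_deriv ?_
  field_simp

lemma line_ne {z : Euc d} (ζ : Euc d) (hz : z ≠ 0) : ∀ᶠ s : ℝ in nhds 0, z + s • ζ ≠ 0 := by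
  have : ContinuousAt (fun s : ℝ => z + s • ζ) 0 := by fun_prop
  exact this.eventually_ne (by simpa using hz)

lemma radial_dir {φ φ1 : ℝ → ℝ} {φ2 : ℝ} {z : Euc d} (ζ : Euc d) (hz : z ≠ 0)
    (h1 : ∀ᶠ r in nhds ‖z‖, HasDerivAt φ (φ1 r) r) (h2 : HasDerivAt φ1 φ2 ‖z‖) :
    ∃ f1 : ℝ → ℝ, (∀ᶠ s in nhds 0, HasDerivAt (fun s : ℝ => φ ‖z + s • ζ‖) (f1 s) s) ∧
      f1 0 = φ1 ‖z‖ * (inner ℝ z ζ / ‖z‖) ∧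
      HasDerivAt f1 (φ2 * (inner ℝ z ζ / ‖z‖) ^ 2 + φ1 ‖z‖ * ((‖ζ‖ ^ 2 - (inner ℝ z ζ / ‖z‖) ^ 2) / ‖z‖)) 0 := by
  have hn : ‖z‖ ≠ 0 := norm_ne_zero_iff.2 hz
  refine ⟨fun s => φ1 ‖z + s • ζ‖ * ((inner ℝ z ζ + s * ‖ζ‖ ^ 2) / ‖z + s • ζ‖), ?_, by simp, ?_⟩
  · have hc : Tendsto (fun s : ℝ => ‖z + s • ζ‖) (nhds 0) (nhds ‖z‖) := by
      have : ContinuousAt (fun s : ℝ => ‖z + s • ζ‖) 0 := by fun_prop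
      simpa [ContinuousAt] using this
    filter_upwards [hc.eventually h1, line_ne ζ hz] with s a b
    exact a.comp s (norm_line z ζ s b)
  · have hN : HasDerivAt (fun s : ℝ => ‖z + s • ζ‖) (inner ℝ z ζ / ‖z‖) 0 := by
      simpa using norm_line z ζ 0 (by simpa using hz)
    have h2' : HasDerivAt φ1 φ2 ‖z + (0:ℝ) • ζ‖ := by simpa using h2
    have ha := h2'.comp (0:ℝ) hN
    have hb : HasDerivAt (fun s : ℝ => inner ℝ z ζ + s * ‖ζ‖ ^ 2) (‖ζ‖ ^ 2) 0 := by
      simpa using ((hasDerivAt_id (0:ℝ)).mul_const (‖ζ‖ ^ 2)).const_add (inner ℝ z ζ)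
    have hd := hb.div hN (by simpa using hn)
    refine (ha.mul hd).congr_deriv ?_
    simp
    field_simp

lemma inner_vec (c : Fin d → ℝ) (ξ : Euc d) : inner ℝ (vec c) ξ = ∑ i, c i * ξ i := by
  rw [PiLp.inner_apply]
  exact Finset.sum_congr rfl fun i _ => by simp [vec_apply, mul_comm]

lemma vec_eq_of_inner {c : Fin d → ℝ} {v : Euc d} (h : ∀ ξ : Euc d, ∑ i, c i * ξ i = inner ℝ v ξ) : vec c = v := by
  refine ext_inner_right ℝ fun ξ => ?_
  rw [inner_vec, h]

lemma trA_cols' {n : ℕ} {η : Fin n → Euc d} (y : Euc d) (hη : ∀ i j, A y i j = ∑ k, η k i * η k j) (X : Fin d → Fin d → ℝ) :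
    trA A y X = ∑ k, qd X (η k) := by
  unfold trA qd
  simp only [hη, Finset.sum_mul]
  calc _ = ∑ i, ∑ k, ∑ j, η k i * η k j * X i j := Finset.sum_congr rfl fun i _ => Finset.sum_comm
    _ = ∑ k, ∑ i, ∑ j, η k i * η k j * X i j := Finset.sum_comm
    _ = _ := Finset.sum_congr rfl fun k _ => Finset.sum_congr rfl fun i _ => Finset.sum_congr rfl fun j _ => by ring

/-- Reflected columns. -/
lemma reflect_cols {n : ℕ} {σ : Euc d → Fin n → Euc d} {S lam : ℝ} (hS : Sg A σ S) (h : Coef d A B K c0)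
    (hlam : 0 < lam) (hA4 : CondA4 d lam A) (y e : Euc d) (he : ‖e‖ = 1) :
    ∃ cc : Fin n → ℝ, (∀ i j, A y i j = ∑ k, (σ y k - cc k • e) i * (σ y k - cc k • e) j) ∧ 4 * lam ≤ ∑ k, cc k ^ 2 := by
  set v : Fin d → ℝ := fun i => ∑ j, B y i j * e j with hv
  have hAv : ∀ i, ∑ j, A y i j * v j = e i := by
    intro i
    have h1 : (A y).mulVec ((B y).mulVec (fun j => e j)) = fun j => e j := by
      rw [Matrix.mulVec_mulVec, h.AB, Matrix.one_mulVec]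
    have := congrFun h1 i
    simpa [Matrix.mulVec, dotProduct, hv] using this
  set b : Fin n → ℝ := fun k => ∑ i, σ y k i * v i with hb
  have hbs : ∀ i, ∑ k, b k * σ y k i = e i := by
    intro i
    rw [← hAv i]
    simp only [hb, hS.AS, Finset.sum_mul]
    rw [Finset.sum_comm]
    exact Finset.sum_congr rfl fun j _ => Finset.sum_congr rfl fun k _ => by ring
  set θ := ∑ i, e i * v i with hθ
  have hbb : ∑ k, b k ^ 2 = θ := by
    rw [hθ]
    simp only [← hbs, Finset.sum_mul]
    rw [Finset.sum_comm]
    refine Finset.sum_congr rfl fun k _ => ?_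
    rw [sq]; conv_lhs => rw [hb]
    simp only [Finset.mul_sum, hb]
    exact Finset.sum_congr rfl fun k _ => by ring
  have hq : lam * ‖vec v‖ ^ 2 ≤ θ := by
    refine (hA4 y (vec v)).trans (le_of_eq ?_)
    rw [hθ]
    refine Finset.sum_congr rfl fun i _ => ?_
    simp only [vec_apply]
    rw [← Finset.sum_mul, hAv]
  have hθv : θ ≤ ‖vec v‖ := by
    have h1 : inner ℝ (vec v) e = θ := by rw [inner_vec, hθ]; exact Finset.sum_congr rfl fun i _ => mul_comm _ _
    have := real_inner_le_norm (vec v) e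
    rw [he, mul_one, h1] at this; exact this
  have hθ0 : 0 < θ := by
    have h0 : 0 ≤ θ := hbb ▸ Finset.sum_nonneg fun k _ => sq_nonneg _
    rcases h0.lt_or_eq with h1 | h1
    · exact h1
    · exfalso
      rw [← h1] at hbb
      have hb0 : ∀ k, b k = 0 := fun k => by
        have := (Finset.sum_eq_zero_iff_of_nonneg (fun k _ => sq_nonneg (b k))).1 hbb k (Finset.mem_univ _)
        simpa using this
      have he0 : e = 0 := by ext i; rw [← hbs i]; simp [hb0]
      simp [he0] at he
  have hθl : θ * lam ≤ 1 := by
    by_contra hc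
    push Not at hc
    have h1 : θ ^ 2 ≤ ‖vec v‖ ^ 2 := pow_le_pow_left₀ hθ0.le hθv 2
    have h2 : lam * θ ^ 2 ≤ θ := (mul_le_mul_of_nonneg_left h1 hlam.le).trans hq
    nlinarith
  refine ⟨fun k => 2 * b k / θ, ?_, ?_⟩
  · intro i j
    have e1 : ∀ k, (σ y k - (2 * b k / θ) • e) i * (σ y k - (2 * b k / θ) • e) j
        = σ y k i * σ y k j - (2 / θ) * e j * (b k * σ y k i) - (2 / θ) * e i * (b k * σ y k j) + 4 / θ ^ 2 * (e i * e j) * b k ^ 2 := by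
      intro k
      simp
      field_simp
      ring
    simp only [e1, Finset.sum_add_distrib, Finset.sum_sub_distrib, ← Finset.mul_sum, hbs, hbb, hS.AS]
    field_simp
    ring
  · have e2 : ∑ k, (2 * b k / θ) ^ 2 = 4 / θ := by
      have : ∀ k, (2 * b k / θ) ^ 2 = 4 / θ ^ 2 * b k ^ 2 := fun k => by field_simp; ring
      simp only [this, ← Finset.mul_sum, hbb]
      field_simp
    rw [e2, le_div_iff₀ hθ0]
    linarith

lemma coupled {n : ℕ} {σ : Euc d → Fin n → Euc d} {S lam : ℝ} (hS : Sg A σ S) (h : Coef d A B K c0)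
    (hlam : 0 < lam) (hA4 : CondA4 d lam A) {u : Euc d → ℝ} {p X} (hu : C2f u p X)
    {φ φ1 : ℝ → ℝ} {φ2 : ℝ} {x y : Euc d} (x0 : Euc d) {Q : ℝ} (hQ : 0 ≤ Q) (hxy : x ≠ y)
    (h1 : ∀ᶠ r in nhds ‖x - y‖, HasDerivAt φ (φ1 r) r) (h2 : HasDerivAt φ1 φ2 ‖x - y‖)
    (hφ1 : 0 ≤ φ1 ‖x - y‖) (hφ2 : φ2 ≤ 0)
    (hm : ∀ᶠ z : Euc d × Euc d in nhds (x, y), u z.1 - u z.2 - φ ‖z.1 - z.2‖ - Q * ‖z.1 - x0‖ ^ 2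
      ≤ u x - u y - φ ‖x - y‖ - Q * ‖x - x0‖ ^ 2) :
    ‖vec (p y)‖ = φ1 ‖x - y‖ ∧ vec (p x) = vec (p y) + (2 * Q) • (x - x0) ∧
    trA A x (X x) - trA A y (X y) ≤ φ2 * (2 * lam - S * ‖x - y‖ ^ 2) + φ1 ‖x - y‖ * S * ‖x - y‖ + 2 * Q * S := by
  set r := ‖x - y‖ with hr
  have hz : x - y ≠ 0 := sub_ne_zero.2 hxy
  have hr0 : 0 < r := norm_pos_iff.2 hz
  set e : Euc d := r⁻¹ • (x - y) with he
  have hen : ‖e‖ = 1 := by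
    rw [he, norm_smul, norm_inv, Real.norm_of_nonneg hr0.le, ← hr]; field_simp
  have hie : ∀ ζ, inner ℝ (x - y) ζ / r = inner ℝ e ζ := fun ζ => by
    rw [he, real_inner_smul_left]; field_simp
  have key : ∀ ξ η : Euc d, (∑ i, p x i * ξ i - ∑ i, p y i * η i = φ1 r * inner ℝ e (ξ - η) + 2 * Q * inner ℝ (x - x0) ξ) ∧
      qd (X x) ξ - qd (X y) η ≤ φ2 * inner ℝ e (ξ - η) ^ 2 + φ1 r * ((‖ξ - η‖ ^ 2 - inner ℝ e (ξ - η) ^ 2) / r) + 2 * Q * ‖ξ‖ ^ 2 := by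
    intro ξ η
    obtain ⟨f1, hf, hf0, hf2⟩ := radial_dir (ξ - η) hz h1 h2
    rw [← hr, hie] at hf0 hf2
    have g1 : ∀ᶠ s : ℝ in nhds 0, HasDerivAt (fun s : ℝ => u (x + s • ξ) - u (y + s • η) - φ ‖(x - y) + s • (ξ - η)‖ - Q * ‖(x - x0) + s • ξ‖ ^ 2)
        (∑ i, p (x + s • ξ) i * ξ i - ∑ i, p (y + s • η) i * η i - f1 s - Q * (2 * inner ℝ (x - x0) ξ + 2 * s * ‖ξ‖ ^ 2)) s := by
      filter_upwards [hf] with s hs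
      exact (((hu.line1 x ξ s).sub (hu.line1 y η s)).sub hs).sub ((normsq_line (x - x0) ξ s).const_mul Q)
    have g2 : HasDerivAt (fun s : ℝ => ∑ i, p (x + s • ξ) i * ξ i - ∑ i, p (y + s • η) i * η i - f1 s - Q * (2 * inner ℝ (x - x0) ξ + 2 * s * ‖ξ‖ ^ 2))
        (qd (X x) ξ - qd (X y) η - (φ2 * inner ℝ e (ξ - η) ^ 2 + φ1 r * ((‖ξ - η‖ ^ 2 - inner ℝ e (ξ - η) ^ 2) / r)) - Q * (2 * ‖ξ‖ ^ 2)) 0 := by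
      refine (((hu.line2 x ξ).sub (hu.line2 y η)).sub hf2).sub ?_
      have := ((((hasDerivAt_id (0:ℝ)).const_mul 2).mul_const (‖ξ‖ ^ 2)).const_add (2 * inner ℝ (x - x0) ξ)).const_mul Q
      refine this.congr_deriv (by simp)
    have g3 := second_test g1 g2 (by
      have hc : Tendsto (fun s : ℝ => (x + s • ξ, y + s • η)) (nhds 0) (nhds (x, y)) := by
        have : ContinuousAt (fun s : ℝ => (x + s • ξ, y + s • η)) 0 := by fun_prop
        simpa [ContinuousAt] using this
      filter_upwards [hc.eventually hm] with s hs
      simp only [zero_smul, add_zero]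
      rw [show x + s • ξ - (y + s • η) = (x - y) + s • (ξ - η) by rw [smul_sub]; abel,
        show x + s • ξ - x0 = (x - x0) + s • ξ by abel] at hs
      exact hs)
    simp only [zero_smul, add_zero, mul_zero, zero_mul, hf0] at g3
    constructor <;> linarith [g3.1, g3.2]
  have hpy : vec (p y) = φ1 r • e := vec_eq_of_inner fun η => by
    have := (key 0 η).1
    simp [inner_neg_right] at this
    rw [real_inner_smul_left]; linarith
  have hpx : vec (p x) = φ1 r • e + (2 * Q) • (x - x0) := vec_eq_of_inner fun ξ => by
    have := (key ξ 0).1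
    simp at this
    rw [inner_add_left, real_inner_smul_left e, real_inner_smul_left (x - x0)]; linarith
  refine ⟨by rw [hpy, norm_smul, hen, Real.norm_of_nonneg hφ1, mul_one], by rw [hpx, hpy], ?_⟩
  obtain ⟨cc, hc1, hc2⟩ := reflect_cols hS h hlam hA4 y e hen
  rw [trA_cols hS x, trA_cols' y hc1, ← Finset.sum_sub_distrib]
  have hee : inner ℝ e e = (1:ℝ) := by rw [real_inner_self_eq_norm_sq, hen]; norm_num
  have hlip := hS.lip x y
  have hterm : ∀ k, qd (X x) (σ x k) - qd (X y) (σ y k - cc k • e) ≤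
      φ2 * (cc k ^ 2 / 2 - ‖σ x k - σ y k‖ ^ 2) + φ1 r * (‖σ x k - σ y k‖ ^ 2 / r) + 2 * Q * ‖σ x k‖ ^ 2 := by
    intro k
    refine ((key (σ x k) (σ y k - cc k • e)).2).trans ?_
    set δ := σ x k - σ y k with hδ
    have e1 : σ x k - (σ y k - cc k • e) = δ + cc k • e := by rw [hδ]; abel
    rw [e1]
    have e2 : inner ℝ e (δ + cc k • e) = inner ℝ e δ + cc k := by
      rw [inner_add_right, real_inner_smul_right, hee, mul_one]
    have e3 : ‖δ + cc k • e‖ ^ 2 = ‖δ‖ ^ 2 + 2 * cc k * inner ℝ e δ + cc k ^ 2 := by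
      rw [norm_add_sq_real, real_inner_smul_right, norm_smul, hen, mul_one, Real.norm_eq_abs, sq_abs, real_inner_comm]; ring
    rw [e2, e3]
    have e4 : (inner ℝ e δ) ^ 2 ≤ ‖δ‖ ^ 2 := by
      have := abs_real_inner_le_norm e δ
      rw [hen, one_mul] at this
      rw [← sq_abs]; exact pow_le_pow_left₀ (abs_nonneg _) this 2
    have e5 : φ2 * (inner ℝ e δ + cc k) ^ 2 ≤ φ2 * (cc k ^ 2 / 2 - ‖δ‖ ^ 2) :=
      mul_le_mul_of_nonpos_left (by nlinarith [sq_nonneg (2 * inner ℝ e δ + cc k)]) hφ2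
    have e6 : φ1 r * ((‖δ‖ ^ 2 + 2 * cc k * inner ℝ e δ + cc k ^ 2 - (inner ℝ e δ + cc k) ^ 2) / r) ≤ φ1 r * (‖δ‖ ^ 2 / r) := by
      refine mul_le_mul_of_nonneg_left (div_le_div_of_nonneg_right ?_ hr0.le) hφ1
      nlinarith [sq_nonneg (inner ℝ e δ)]
    linarith
  refine (Finset.sum_le_sum fun k _ => hterm k).trans ?_
  simp only [Finset.sum_add_distrib, Finset.sum_sub_distrib, ← Finset.mul_sum, ← Finset.sum_div]
  have i1 : φ2 * ((∑ k, cc k ^ 2) / 2 - ∑ k, ‖σ x k - σ y k‖ ^ 2) ≤ φ2 * (2 * lam - S * r ^ 2) :=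
    mul_le_mul_of_nonpos_left (by linarith) hφ2
  have i2 : φ1 r * ((∑ k, ‖σ x k - σ y k‖ ^ 2) / r) ≤ φ1 r * (S * r) := by
    refine mul_le_mul_of_nonneg_left ?_ hφ1
    rw [div_le_iff₀ hr0]; nlinarith
  have i3 : 2 * Q * ∑ k, ‖σ x k‖ ^ 2 ≤ 2 * Q * S := mul_le_mul_of_nonneg_left (hS.bd x) (by positivity)
  linarith
end

section
variable {d : ℕ} {A B : Euc d → Matrix (Fin d) (Fin d) ℝ} {K c0 C c : ℝ}

/-- Local structure conditions of the Hamiltonian on the unit ball around `x0`. -/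
structure HLoc (G : Euc d → Euc d → ℝ) (m Λ a M : ℝ) (x0 : Euc d) : Prop where
  hx : ∀ x ∈ closedBall x0 1, ∀ y ∈ closedBall x0 1, ∀ p, |G x p - G y p| ≤ (Λ * ‖p‖ ^ m + M) * ‖x - y‖
  hp : ∀ x p q, |G x p - G x q| ≤ Λ * (‖p‖ + ‖q‖ + 1) ^ (m - 1) * ‖p - q‖
  co : ∀ x ∈ closedBall x0 1, ∀ p, a * ‖p‖ ^ m - M ≤ G x p

lemma grad_of_lip {u : Euc d → ℝ} {p X} (hu : C2f (d := d) u p X) {x0 : Euc d} {L ρ : ℝ} (hL : 0 ≤ L) (hρ : 0 < ρ)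
    (h : ∀ y, ‖x0 - y‖ ≤ ρ → u x0 - u y ≤ L * ‖x0 - y‖) : ‖vec (p x0)‖ ≤ L := by
  by_cases hP : vec (p x0) = 0
  · rw [hP, norm_zero]; exact hL
  · set P := vec (p x0) with hPd
    have hn : 0 < ‖P‖ := norm_pos_iff.2 hP
    have h1 := hu.line1 x0 (-P) 0
    have e0 : ∑ j, p (x0 + (0:ℝ) • (-P)) j * (-P) j = -‖P‖ ^ 2 := by
      rw [← real_inner_self_eq_norm_sq]
      conv_rhs => rw [hPd, inner_vec]
      simp [vec_apply, hPd]
    rw [e0] at h1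
    have h2 := hasDerivWithinAt_iff_tendsto_slope' (s := Ioi (0:ℝ)) (by simp) |>.1 h1.hasDerivWithinAt
    have h3 : -(L * ‖P‖) ≤ -‖P‖ ^ 2 := by
      refine ge_of_tendsto h2 ?_
      filter_upwards [Ioo_mem_nhdsGT (show 0 < ρ / ‖P‖ by positivity)] with s hs
      have hsn : s * ‖P‖ ≤ ρ := by
        have := hs.2.le; rwa [le_div_iff₀ hn] at this
      have := h (x0 + s • (-P)) (by
        simp [norm_smul, abs_of_pos hs.1]; exact hsn)
      rw [slope_def_field]
      simp [norm_smul, abs_of_pos hs.1] at this ⊢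
      rw [le_div_iff₀ hs.1]; nlinarith
    nlinarith

lemma gb_const {S lam m Λ M C K1 Q : ℝ} (hS1 : 1 ≤ S) (hlam : 0 < lam) (hm : 1 < m) (hΛ : 0 < Λ) (hM : 1 ≤ M) (hC : 1 ≤ C)
    (hK1 : 1 ≤ K1) (hQ0 : 0 < Q) : ∃ L : ℝ, 0 < L ∧ 1 + 8 * K1 + Q ≤ L ∧ 2 * K1 * S ≤ lam * L ∧ ∀ ρ, 0 < ρ → ρ ≤ (2 * K1 / L) ^ (m - 1) →
      L / (2 * ρ) * lam ≤ (2 * K1 * S + 2 * Q * S + 2 * C + M) + (Λ * 3 ^ (m - 1) * Q + 2 * K1 * Λ) * L ^ (m - 1) → False := by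
  obtain ⟨E0, hE0⟩ : ∃ E0, E0 = 2 * K1 * S + 2 * Q * S + 2 * C + M := ⟨_, rfl⟩
  obtain ⟨E1, hE1⟩ : ∃ E1, E1 = Λ * 3 ^ (m - 1) * Q + 2 * K1 * Λ := ⟨_, rfl⟩
  have hE0p : 0 < E0 := by rw [hE0]; positivity
  have hE1p : 0 < E1 := by rw [hE1]; positivity
  rw [← hE0, ← hE1]
  have t1 : 0 ≤ 2 * K1 * S / lam := by positivity
  have t2 : 0 ≤ 2 * (E0 + E1) * (2 * K1) ^ (m - 1) / lam := by positivity
  obtain ⟨L, hL⟩ : ∃ L, L = 1 + 8 * K1 + 2 * K1 * S / lam + Q + 2 * (E0 + E1) * (2 * K1) ^ (m - 1) / lam := ⟨_, rfl⟩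
  have hL0 : 0 < L := by linarith
  refine ⟨L, hL0, by linarith, ?_, fun ρ hρ0 hρm hg => ?_⟩
  · have h7 : 2 * K1 * S / lam ≤ L := by linarith
    rw [div_le_iff₀ hlam] at h7; linarith
  have hLm1 : 1 ≤ L ^ (m - 1) := Real.one_le_rpow (by linarith) (by linarith)
  have hg3 : L / (2 * ρ) * lam ≤ (E0 + E1) * L ^ (m - 1) := by
    have := mul_le_mul_of_nonneg_left hLm1 hE0p.le
    linarith
  have hτm : (2 * K1 / L) ^ (m - 1) = (2 * K1) ^ (m - 1) / L ^ (m - 1) := by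
    rw [Real.div_rpow (by positivity) hL0.le]
  have hg4 : L * lam ≤ (E0 + E1) * L ^ (m - 1) * (2 * ρ) := by
    have : L / (2 * ρ) * lam = L * lam / (2 * ρ) := by ring
    rw [this, div_le_iff₀ (by positivity)] at hg3
    exact hg3
  have hg5 : (E0 + E1) * L ^ (m - 1) * (2 * ρ) ≤ 2 * (E0 + E1) * (2 * K1) ^ (m - 1) := by
    have h6 : L ^ (m - 1) * ρ ≤ (2 * K1) ^ (m - 1) := by
      have := mul_le_mul_of_nonneg_left hρm (by positivity : 0 ≤ L ^ (m - 1))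
      rw [hτm, mul_div_cancel₀ _ (by positivity)] at this
      exact this
    have := mul_le_mul_of_nonneg_left h6 (by positivity : 0 ≤ 2 * (E0 + E1))
    linarith
  have hg6 : 2 * (E0 + E1) * (2 * K1) ^ (m - 1) / lam < L := by linarith
  rw [div_lt_iff₀ hlam] at hg6
  linarith

lemma gb_G {G : Euc d → Euc d → ℝ} {m Λ a M L Q K1 : ℝ} {x0 x y px py : Euc d} (hm : 1 < m) (hΛ : 0 < Λ) (hM : 1 ≤ M)
    (hQ0 : 0 < Q) (hL0 : 0 < L) (hLQ : 1 + Q ≤ L) (hG : HLoc G m Λ a M x0)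
    (hx1 : x ∈ closedBall x0 1) (hy1 : y ∈ closedBall x0 1) (hr4 : ‖x - y‖ ≤ 1)
    (hpy : ‖py‖ ≤ L) (hpxy : ‖px - py‖ ≤ Q) (hLr : L * ‖x - y‖ ≤ 2 * K1) :
    G y py - G x px ≤ M + (Λ * 3 ^ (m - 1) * Q + 2 * K1 * Λ) * L ^ (m - 1) := by
  have hpx : ‖px‖ ≤ L + Q := by
    have := norm_sub_norm_le px py; linarith
  have hb1 : |G x px - G x py| ≤ Λ * 3 ^ (m - 1) * Q * L ^ (m - 1) := by
    refine (hG.hp x _ _).trans ?_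
    have h3 : (‖px‖ + ‖py‖ + 1) ^ (m - 1) ≤ (3 * L) ^ (m - 1) :=
      Real.rpow_le_rpow (by positivity) (by linarith) (by linarith)
    rw [Real.mul_rpow (by norm_num) hL0.le] at h3
    calc Λ * (‖px‖ + ‖py‖ + 1) ^ (m - 1) * ‖px - py‖
        ≤ Λ * (3 ^ (m - 1) * L ^ (m - 1)) * Q := by
          refine mul_le_mul (mul_le_mul_of_nonneg_left h3 hΛ.le) hpxy (norm_nonneg _) (by positivity)
      _ = _ := by ring
  have hLm : L ^ m = L ^ (m - 1) * L := by
    rw [← Real.rpow_add_one hL0.ne']; congr 1; ring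
  have hb2 : |G x py - G y py| ≤ 2 * K1 * Λ * L ^ (m - 1) + M := by
    refine (hG.hx x hx1 y hy1 _).trans ?_
    have h3 : ‖py‖ ^ m ≤ L ^ m := Real.rpow_le_rpow (norm_nonneg _) hpy (by linarith)
    have h4 : (Λ * ‖py‖ ^ m + M) * ‖x - y‖ ≤ (Λ * L ^ m + M) * ‖x - y‖ :=
      mul_le_mul_of_nonneg_right (by linarith [mul_le_mul_of_nonneg_left h3 hΛ.le]) (norm_nonneg _)
    refine h4.trans ?_
    rw [hLm]
    have h6 : Λ * L ^ (m - 1) * (L * ‖x - y‖) ≤ Λ * L ^ (m - 1) * (2 * K1) := mul_le_mul_of_nonneg_left hLr (by positivity)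
    have h7 : M * ‖x - y‖ ≤ M * 1 := mul_le_mul_of_nonneg_left hr4 (by linarith)
    linarith
  have e3 := abs_le.1 hb1
  have e4 := abs_le.1 hb2
  linarith

set_option maxHeartbeats 800000 in
lemma grad_b {S lam m Λ M C κ K1 : ℝ} (hS1 : 1 ≤ S) (hlam : 0 < lam) (hm : 1 < m) (hΛ : 0 < Λ) (hM : 1 ≤ M) (hC : 1 ≤ C)
    (hκ1 : 1 ≤ κ) (hκm : m - 1 ≤ κ) (hK1 : 1 ≤ K1) : ∃ L : ℝ, 0 < L ∧
    ∀ {d n : ℕ} {A B : Euc d → Matrix (Fin d) (Fin d) ℝ} {K c0 : ℝ} {σ : Euc d → Fin n → Euc d}, Sg A σ S → Coef d A B K c0 →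
    CondA4 d lam A → ∀ {a : ℝ} {u : Euc d → ℝ} {p X}, C2f u p X → ∀ {G : Euc d → Euc d → ℝ} {x0 : Euc d}, HLoc G m Λ a M x0 →
    (∀ x ∈ closedBall x0 1, |u x| ≤ C) → (∀ x ∈ closedBall x0 1, |trA A x (X x) - G x (vec (p x))| ≤ C) →
    (∀ y ∈ closedBall x0 (1/2), ∀ x, ‖x - y‖ ≤ 1/4 → u x - u y ≤ K1 * ‖x - y‖ ^ (1 - 1 / κ)) → ‖vec (p x0)‖ ≤ L := by
  obtain ⟨Q, hQ⟩ : ∃ Q, Q = 64 * C := ⟨_, rfl⟩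
  have hQ0 : 0 < Q := by linarith
  obtain ⟨L, hL0, hL1, hLS, hLc⟩ := gb_const hS1 hlam hm hΛ hM hC hK1 hQ0
  refine ⟨L, hL0, ?_⟩
  intro d n A B K c0 σ hS h hA4 a u p X hu G x0 hG hub heq hhol
  obtain ⟨τ, hτ⟩ : ∃ τ, τ = 2 * K1 / L := ⟨_, rfl⟩
  rw [← hτ] at hLc
  have hτ0 : 0 < τ := by rw [hτ]; positivity
  have hLτ : L * τ = 2 * K1 := by rw [hτ]; field_simp
  have hτ1 : τ ≤ 1 / 4 := by rw [hτ, div_le_iff₀ hL0]; linarith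
  obtain ⟨ρ, hρ⟩ : ∃ ρ, ρ = τ ^ κ := ⟨_, rfl⟩
  have hρ0 : 0 < ρ := hρ ▸ Real.rpow_pos_of_pos hτ0 _
  have hρτ : ρ ≤ τ := by
    have := Real.rpow_le_rpow_of_exponent_ge hτ0 (by linarith) hκ1
    rwa [Real.rpow_one, ← hρ] at this
  have hρm : ρ ≤ τ ^ (m - 1) := hρ ▸ Real.rpow_le_rpow_of_exponent_ge hτ0 (by linarith) hκm
  have hρκ : ρ ^ (1 - 1 / κ) = ρ / τ := by
    rw [Real.rpow_sub hρ0, Real.rpow_one]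
    congr 1
    rw [hρ, ← Real.rpow_mul hτ0.le, mul_one_div_cancel (by linarith), Real.rpow_one]
  set φ : ℝ → ℝ := fun r => L * (r - r ^ 2 / (4 * ρ)) with hφ
  set φ1 : ℝ → ℝ := fun r => L * (1 - r / (2 * ρ)) with hφ1
  have hd1 : ∀ r, HasDerivAt φ (φ1 r) r := by
    intro r
    have := ((hasDerivAt_id r).sub (((hasDerivAt_id r).pow 2).div_const (4 * ρ))).const_mul L
    refine this.congr_deriv ?_
    simp only [hφ1, id, mul_one]; norm_num; field_simp; left; ring
  have hd2 : ∀ r, HasDerivAt φ1 (-(L / (2 * ρ))) r := by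
    intro r
    have := (((hasDerivAt_id r).div_const (2 * ρ)).const_sub 1).const_mul L
    refine this.congr_deriv ?_
    field_simp
  have hcontu : Continuous u := continuous_iff_continuousAt.2 fun x => (hu.d1 x).continuousAt
  set D : Set (Euc d × Euc d) := (closedBall x0 (1/4) ×ˢ closedBall x0 (1/2)) ∩ {z | ‖z.1 - z.2‖ ≤ ρ} with hD
  have hDc : IsCompact D := ((isCompact_closedBall _ _).prod (isCompact_closedBall _ _)).inter_right
    (isClosed_le (by fun_prop) continuous_const)
  set Φ : Euc d × Euc d → ℝ := fun z => u z.1 - u z.2 - φ ‖z.1 - z.2‖ - Q * ‖z.1 - x0‖ ^ 2 with hΦ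
  have hφc : Continuous φ := by simp only [hφ]; fun_prop
  have hΦc : Continuous Φ := by simp only [hΦ]; fun_prop
  have hmain : ∀ z ∈ D, Φ z ≤ 0 := by
    by_contra hcon
    push Not at hcon
    obtain ⟨z0, hz0, hz0p⟩ := hcon
    obtain ⟨⟨x, y⟩, hxy, hmax⟩ := hDc.exists_isMaxOn ⟨z0, hz0⟩ hΦc.continuousOn
    have hpos : 0 < Φ (x, y) := lt_of_lt_of_le hz0p (hmax hz0)
    simp only [hΦ] at hpos
    obtain ⟨⟨hx, hy⟩, hr⟩ := hxy
    simp only [mem_closedBall, dist_eq_norm, mem_setOf_eq] at hx hy hr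
    set r := ‖x - y‖ with hrd
    have hr0 : 0 ≤ r := norm_nonneg _
    have hr4 : r ≤ 1 / 4 := by linarith
    have hx1 : x ∈ closedBall x0 1 := by rw [mem_closedBall, dist_eq_norm]; linarith
    have hy1 : y ∈ closedBall x0 1 := by rw [mem_closedBall, dist_eq_norm]; linarith
    have hφnn : (3 / 4) * L * r ≤ φ r := by
      simp only [hφ]
      have : r ^ 2 / (4 * ρ) ≤ r / 4 := by rw [div_le_iff₀ (by positivity)]; nlinarith
      nlinarith
    have hφ0 : 0 ≤ φ r := le_trans (by positivity) hφnn
    have hux := abs_le.1 (hub x hx1)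
    have huy := abs_le.1 (hub y hy1)
    have hQx : 0 ≤ Q * ‖x - x0‖ ^ 2 := by positivity
    have hne : x ≠ y := by
      intro e
      rw [e, sub_self] at hpos
      have : 0 ≤ Q * ‖y - x0‖ ^ 2 := by positivity
      have e0 : r = 0 := by rw [hrd, e]; simp
      linarith
    have hxlt : ‖x - x0‖ < 1 / 4 := by
      refine lt_of_le_of_ne hx fun e => ?_
      rw [e] at hpos
      rw [hQ] at hpos
      linarith
    have hrlt : r < ρ := by
      refine lt_of_le_of_ne hr fun e => ?_
      have h1 := hhol y (by rw [mem_closedBall, dist_eq_norm]; exact hy) x hr4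
      rw [← hrd, e, hρκ] at h1
      rw [e] at hφnn
      have h2 : K1 * (ρ / τ) = ρ * L / 2 := by rw [hτ]; field_simp
      have h3 : 0 < L * ρ := by positivity
      rw [e] at hpos
      nlinarith
    have hylt : ‖y - x0‖ < 1 / 2 := by
      have : y - x0 = (x - x0) - (x - y) := by abel
      rw [this]
      have := norm_sub_le (x - x0) (x - y)
      linarith
    have hnb : ∀ᶠ z : Euc d × Euc d in nhds (x, y), Φ z ≤ Φ (x, y) := by
      have o1 : IsOpen {z : Euc d × Euc d | ‖z.1 - x0‖ < 1/4} := isOpen_lt (by fun_prop) continuous_const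
      have o2 : IsOpen {z : Euc d × Euc d | ‖z.2 - x0‖ < 1/2} := isOpen_lt (by fun_prop) continuous_const
      have o3 : IsOpen {z : Euc d × Euc d | ‖z.1 - z.2‖ < ρ} := isOpen_lt (by fun_prop) continuous_const
      filter_upwards [o1.mem_nhds hxlt, o2.mem_nhds hylt, o3.mem_nhds hrlt] with z a1 a2 a3
      refine hmax ⟨⟨?_, ?_⟩, ?_⟩
      · rw [mem_closedBall, dist_eq_norm]; exact a1.le
      · rw [mem_closedBall, dist_eq_norm]; exact a2.le
      · exact a3.le
    have hφ1b : 0 ≤ φ1 r ∧ φ1 r ≤ L := by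
      simp only [hφ1]
      have h1 : r / (2 * ρ) ≤ 1 := by rw [div_le_iff₀ (by positivity)]; linarith
      have h2 : 0 ≤ r / (2 * ρ) := by positivity
      constructor <;> nlinarith
    obtain ⟨c1, c2, c3⟩ := coupled hS h hlam hA4 hu x0 hQ0.le hne (Eventually.of_forall hd1) (hd2 _) hφ1b.1
      (by have : 0 < L / (2 * ρ) := by positivity
          linarith) hnb
    rw [← hrd] at c1 c3
    have hpy : ‖vec (p y)‖ ≤ L := c1 ▸ hφ1b.2
    have hpxy : ‖vec (p x) - vec (p y)‖ ≤ Q := by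
      rw [c2, add_sub_cancel_left, norm_smul, Real.norm_of_nonneg (by positivity)]
      nlinarith only [hQ0, hx]
    have hLr : L * r ≤ 2 * K1 := by
      have : r ≤ τ := by linarith
      rw [← hLτ]; exact mul_le_mul_of_nonneg_left this hL0.le
    have hGG := gb_G hm hΛ hM hQ0 hL0 (by linarith) hG hx1 hy1 (by linarith) hpy hpxy hLr
    have e1 := abs_le.1 (heq x hx1)
    have e2 := abs_le.1 (heq y hy1)
    have hSr : S * r ^ 2 ≤ lam := by
      have h8 : r ^ 2 ≤ τ := by nlinarith only [hr0, hr4, hr, hρτ, hτ0]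
      have h9 : S * r ^ 2 ≤ S * τ := mul_le_mul_of_nonneg_left h8 (by linarith)
      have : S * τ ≤ lam := by
        rw [hτ, mul_div_assoc', div_le_iff₀ hL0]; linarith only [hLS]
      linarith only [h9, this]
    have hLρ : 0 < L / (2 * ρ) := by positivity
    have hg1 : -(L / (2 * ρ)) * (2 * lam - S * r ^ 2) ≤ -(L / (2 * ρ)) * lam :=
      mul_le_mul_of_nonpos_left (by linarith only [hSr]) (by linarith only [hLρ])
    have hg2 : φ1 r * S * r ≤ 2 * K1 * S := by
      have h8 : φ1 r * (S * r) ≤ L * (S * r) := mul_le_mul_of_nonneg_right hφ1b.2 (by positivity)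
      have h9 := mul_le_mul_of_nonneg_left hLr (by linarith only [hS1] : 0 ≤ S)
      linarith only [h8, h9]
    refine hLc ρ hρ0 hρm ?_
    linarith only [hg1, hg2, hGG, e1.1, e1.2, e2.1, e2.2, c3]
  refine grad_of_lip hu hL0.le hρ0 fun y hy => ?_
  have hyb : ‖x0 - y‖ ≤ 1 / 4 := by linarith
  have := hmain (x0, y) ⟨⟨by simp, by rw [mem_closedBall, dist_comm, dist_eq_norm]; linarith⟩, hy⟩
  simp only [hΦ, sub_self, norm_zero] at this
  have h2 : φ ‖x0 - y‖ ≤ L * ‖x0 - y‖ := by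
    simp only [hφ]
    refine mul_le_mul_of_nonneg_left ?_ hL0.le
    have : 0 ≤ ‖x0 - y‖ ^ 2 / (4 * ρ) := by positivity
    linarith
  simp at this
  linarith
end

section
variable {d : ℕ} {A B : Euc d → Matrix (Fin d) (Fin d) ℝ} {K c0 C c : ℝ}

lemma radial_test {n : ℕ} {σ : Euc d → Fin n → Euc d} {S : ℝ} (hS : Sg A σ S)
    {u : Euc d → ℝ} {p X} (hu : C2f u p X)
    {φ φ1 : ℝ → ℝ} {φ2 : ℝ} {x y : Euc d} (hxy : x ≠ y)
    (h1 : ∀ᶠ r in nhds ‖x - y‖, HasDerivAt φ (φ1 r) r) (h2 : HasDerivAt φ1 φ2 ‖x - y‖)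
    (hφ1 : 0 ≤ φ1 ‖x - y‖) (hφ2 : φ2 ≤ 0)
    (hm : ∀ᶠ z : Euc d in nhds x, u z - φ ‖z - y‖ ≤ u x - φ ‖x - y‖) :
    ‖vec (p x)‖ = φ1 ‖x - y‖ ∧ trA A x (X x) ≤ φ1 ‖x - y‖ * S / ‖x - y‖ := by
  set r := ‖x - y‖ with hr
  have hz : x - y ≠ 0 := sub_ne_zero.2 hxy
  have hr0 : 0 < r := norm_pos_iff.2 hz
  set e : Euc d := r⁻¹ • (x - y) with he
  have hen : ‖e‖ = 1 := by
    rw [he, norm_smul, norm_inv, Real.norm_of_nonneg hr0.le, ← hr]; field_simp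
  have hie : ∀ ζ, inner ℝ (x - y) ζ / r = inner ℝ e ζ := fun ζ => by
    rw [he, real_inner_smul_left]; field_simp
  have key : ∀ ξ : Euc d, (∑ i, p x i * ξ i = φ1 r * inner ℝ e ξ) ∧
      qd (X x) ξ ≤ φ2 * inner ℝ e ξ ^ 2 + φ1 r * ((‖ξ‖ ^ 2 - inner ℝ e ξ ^ 2) / r) := by
    intro ξ
    obtain ⟨f1, hf, hf0, hf2⟩ := radial_dir ξ hz h1 h2
    rw [← hr, hie] at hf0 hf2
    have g1 : ∀ᶠ s : ℝ in nhds 0, HasDerivAt (fun s : ℝ => u (x + s • ξ) - φ ‖(x - y) + s • ξ‖)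
        (∑ i, p (x + s • ξ) i * ξ i - f1 s) s := by
      filter_upwards [hf] with s hs
      exact (hu.line1 x ξ s).sub hs
    have g3 := second_test g1 ((hu.line2 x ξ).sub hf2) (by
      have hc : Tendsto (fun s : ℝ => x + s • ξ) (nhds 0) (nhds x) := by
        have : ContinuousAt (fun s : ℝ => x + s • ξ) 0 := by fun_prop
        simpa [ContinuousAt] using this
      filter_upwards [hc.eventually hm] with s hs
      simp only [zero_smul, add_zero]
      rw [show x + s • ξ - y = (x - y) + s • ξ by abel] at hs
      exact hs)
    simp only [zero_smul, add_zero, hf0] at g3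
    constructor <;> linarith [g3.1, g3.2]
  have hpx : vec (p x) = φ1 r • e := vec_eq_of_inner fun η => by
    rw [real_inner_smul_left e]; exact (key η).1
  refine ⟨by rw [hpx, norm_smul, hen, Real.norm_of_nonneg hφ1, mul_one], ?_⟩
  rw [trA_cols hS x]
  have ht : ∀ k, qd (X x) (σ x k) ≤ φ1 r / r * ‖σ x k‖ ^ 2 := by
    intro k
    refine (key _).2.trans ?_
    have a1 : φ2 * inner ℝ e (σ x k) ^ 2 ≤ 0 := mul_nonpos_of_nonpos_of_nonneg hφ2 (sq_nonneg _)
    have a2 : φ1 r * ((‖σ x k‖ ^ 2 - inner ℝ e (σ x k) ^ 2) / r) ≤ φ1 r * (‖σ x k‖ ^ 2 / r) :=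
      mul_le_mul_of_nonneg_left (div_le_div_of_nonneg_right (by linarith [sq_nonneg (inner ℝ e (σ x k))]) hr0.le) hφ1
    have a3 : φ1 r * (‖σ x k‖ ^ 2 / r) = φ1 r / r * ‖σ x k‖ ^ 2 := by ring
    linarith
  refine (Finset.sum_le_sum fun k _ => ht k).trans ?_
  rw [← Finset.mul_sum]
  have := mul_le_mul_of_nonneg_left (hS.bd x) (by positivity : 0 ≤ φ1 r / r)
  linarith [show φ1 r / r * S = φ1 r * S / r by ring]

set_option maxHeartbeats 600000 in
lemma hol_a {S m a Λ M C : ℝ} (hS1 : 1 ≤ S) (hm : 2 < m) (ha : 0 < a) (hM : 1 ≤ M) (hC : 1 ≤ C) :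
    ∃ K1 : ℝ, 1 ≤ K1 ∧
    ∀ {d n : ℕ} {A : Euc d → Matrix (Fin d) (Fin d) ℝ} {σ : Euc d → Fin n → Euc d}, Sg A σ S →
    ∀ {u : Euc d → ℝ} {p X}, C2f u p X → ∀ {G : Euc d → Euc d → ℝ} {x0 : Euc d}, HLoc G m Λ a M x0 →
    (∀ x ∈ closedBall x0 1, |u x| ≤ C) → (∀ x ∈ closedBall x0 1, |trA A x (X x) - G x (vec (p x))| ≤ C) →
    (∀ y ∈ closedBall x0 (1/2), ∀ x, ‖x - y‖ ≤ 1/4 → u x - u y ≤ K1 * ‖x - y‖ ^ (1 - 1 / (m - 1))) := by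
  set γ := 1 - 1 / (m - 1) with hγ
  have hm1 : 0 < m - 1 := by linarith
  have h11 : 1 / (m - 1) < 1 := by rw [div_lt_one hm1]; linarith
  have h12 : 0 < 1 / (m - 1) := by positivity
  have hγ0 : 0 < γ := by linarith
  have hγ1 : γ < 1 := by linarith
  have hγm : (γ - 1) * m = γ - 2 := by rw [hγ]; field_simp; ring
  set Z := 1 + (M + C + S) / a + 8 * C with hZ
  have hZa : 0 ≤ (M + C + S) / a := by positivity
  have hZ1 : 1 ≤ Z := by linarith
  set K1 := Z / γ with hK1
  have hKZ : K1 * γ = Z := by rw [hK1]; field_simp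
  have hKge : Z ≤ K1 := by rw [hK1, le_div_iff₀ hγ0]; nlinarith
  refine ⟨K1, by linarith, ?_⟩
  intro d n A σ hS u p X hu G x0 hG hub heq y hy
  have hK0 : 0 < K1 := by linarith
  have hcontu : Continuous u := continuous_iff_continuousAt.2 fun x => (hu.d1 x).continuousAt
  have hψc : Continuous fun x : Euc d => u x - K1 * ‖x - y‖ ^ γ := by
    refine hcontu.sub (continuous_const.mul ?_)
    exact Continuous.rpow_const (by fun_prop) fun x => Or.inr hγ0.le
  obtain ⟨x, hx, hmax⟩ := (isCompact_closedBall y (1/4)).exists_isMaxOn ⟨y, by simp⟩ hψc.continuousOn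
  rw [mem_closedBall, dist_eq_norm] at hy
  have hin : ∀ z, ‖z - y‖ ≤ 1/4 → z ∈ closedBall x0 1 := by
    intro z hz
    rw [mem_closedBall, dist_eq_norm]
    have : z - x0 = (z - y) + (y - x0) := by abel
    rw [this]; linarith [norm_add_le (z - y) (y - x0)]
  have huy := abs_le.1 (hub y (hin y (by simp)))
  suffices h : u x - K1 * ‖x - y‖ ^ γ ≤ u y by
    intro z hz
    have := hmax (show z ∈ closedBall y (1/4) by rw [mem_closedBall, dist_eq_norm]; exact hz)
    simp only [mem_setOf_eq] at this
    linarith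
  rw [mem_closedBall, dist_eq_norm] at hx
  by_cases hxy : x = y
  · rw [hxy]; simp [Real.zero_rpow hγ0.ne']
  have hr0 : 0 < ‖x - y‖ := norm_pos_iff.2 (sub_ne_zero.2 hxy)
  have hux := abs_le.1 (hub x (hin x hx))
  rcases hx.lt_or_eq with hlt | heq4
  swap
  · rw [heq4]
    have : (1/4 : ℝ) ≤ (1/4) ^ γ := by
      have := Real.rpow_le_rpow_of_exponent_ge (by norm_num : (0:ℝ) < 1/4) (by norm_num) hγ1.le
      rwa [Real.rpow_one] at this
    nlinarith
  exfalso
  set r := ‖x - y‖ with hr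
  have ht := radial_test hS hu (φ := fun r => K1 * r ^ γ) (φ1 := fun r => K1 * (γ * r ^ (γ - 1)))
    (φ2 := K1 * (γ * ((γ - 1) * r ^ (γ - 1 - 1)))) hxy
    (by filter_upwards [lt_mem_nhds hr0] with s hs
        exact (Real.hasDerivAt_rpow_const (Or.inl hs.ne')).const_mul K1)
    ((( Real.hasDerivAt_rpow_const (Or.inl hr0.ne')).const_mul γ).const_mul K1)
    (by positivity)
    (by have h1 : 0 < r ^ (γ - 1 - 1) := Real.rpow_pos_of_pos hr0 _
        have h2 : (γ - 1) * r ^ (γ - 1 - 1) ≤ 0 := mul_nonpos_of_nonpos_of_nonneg (by linarith) h1.le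
        exact mul_nonpos_of_nonneg_of_nonpos hK0.le (mul_nonpos_of_nonneg_of_nonpos hγ0.le h2))
    (by have o : IsOpen {z : Euc d | ‖z - y‖ < 1/4} := isOpen_lt (by fun_prop) continuous_const
        filter_upwards [o.mem_nhds hlt] with z hz
        exact hmax (by rw [mem_closedBall, dist_eq_norm]; exact hz.le))
  rw [← hr] at ht
  obtain ⟨t1, t2⟩ := ht
  have hco := hG.co x (hin x hx) (vec (p x))
  have he := abs_le.1 (heq x (hin x hx))
  have e1 : K1 * (γ * r ^ (γ - 1)) = Z * r ^ (γ - 1) := by rw [← hKZ]; ring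
  rw [e1] at t1 t2
  have e2 : (Z * r ^ (γ - 1)) ^ m = Z ^ m * r ^ (γ - 2) := by
    rw [Real.mul_rpow (by linarith) (by positivity), ← Real.rpow_mul hr0.le, hγm]
  have e3 : Z * r ^ (γ - 1) * S / r = Z * S * r ^ (γ - 2) := by
    have : r ^ (γ - 2) = r ^ (γ - 1) / r := by
      rw [show γ - 2 = γ - 1 - 1 by ring, Real.rpow_sub_one hr0.ne']
    rw [this]; ring
  rw [t1, e2] at hco
  rw [e3] at t2
  have hr1 : 1 ≤ r ^ (γ - 2) := Real.one_le_rpow_of_pos_of_le_one_of_nonpos hr0 (by linarith) (by linarith)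
  have hZm : Z ^ 2 ≤ Z ^ m := by
    have := Real.rpow_le_rpow_of_exponent_le hZ1 hm.le
    rwa [Real.rpow_two] at this
  have hrp : 0 < r ^ (γ - 2) := by linarith
  have f1 : a * Z ^ 2 * r ^ (γ - 2) ≤ (M + C + Z * S) * r ^ (γ - 2) := by
    have g1 : a * Z ^ 2 * r ^ (γ - 2) ≤ a * (Z ^ m * r ^ (γ - 2)) := by
      have := mul_le_mul_of_nonneg_left (mul_le_mul_of_nonneg_right hZm hrp.le) ha.le
      linarith
    have g2 : M + C ≤ (M + C) * r ^ (γ - 2) := le_mul_of_one_le_right (by linarith) hr1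
    linarith only [g1, g2, hco, t2, he.1, he.2]
  have f2 := le_of_mul_le_mul_right f1 hrp
  have f3 : a * Z ≤ M + C + S := by
    have : a * Z * Z ≤ (M + C + S) * Z := by nlinarith only [f2, hZ1, hM, hC]
    exact le_of_mul_le_mul_right this (by linarith)
  have f4 : (M + C + S) / a < Z := by linarith
  rw [div_lt_iff₀ ha] at f4
  linarith

/-- Local gradient bound. -/
theorem staticGrad {S lam m Λ a M C : ℝ} (hS1 : 1 ≤ S) (hlam : 0 < lam) (hm : 1 < m) (hΛ : 0 < Λ) (ha : 0 < a)
    (hM : 1 ≤ M) (hC : 1 ≤ C) : ∃ L : ℝ, 0 < L ∧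
    ∀ {d n : ℕ} {A B : Euc d → Matrix (Fin d) (Fin d) ℝ} {K c0 : ℝ} {σ : Euc d → Fin n → Euc d}, Sg A σ S → Coef d A B K c0 →
    CondA4 d lam A → ∀ {u : Euc d → ℝ} {p X}, C2f u p X → ∀ {G : Euc d → Euc d → ℝ} {x0 : Euc d}, HLoc G m Λ a M x0 →
    (∀ x ∈ closedBall x0 1, |u x| ≤ C) → (∀ x ∈ closedBall x0 1, |trA A x (X x) - G x (vec (p x))| ≤ C) →
    ‖vec (p x0)‖ ≤ L := by
  by_cases h2 : 2 < m
  · obtain ⟨K1, hK1, hK⟩ := hol_a (Λ := Λ) hS1 h2 ha hM hC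
    obtain ⟨L, hL, hb⟩ := grad_b hS1 hlam hm hΛ hM hC (κ := m - 1) (by linarith) le_rfl hK1
    exact ⟨L, hL, fun {d n A B K c0 σ} hS h hA4 {u p X} hu {G x0} hG hub heq => hb hS h hA4 hu hG hub heq (hK hS hu hG hub heq)⟩
  · obtain ⟨L, hL, hb⟩ := grad_b hS1 hlam hm hΛ hM hC (κ := 1) (K1 := 2 * C) le_rfl (by linarith) (by linarith)
    refine ⟨L, hL, fun {d n A B K c0 σ} hS h hA4 {u p X} hu {G x0} hG hub heq => hb hS h hA4 hu hG hub heq fun y hy x hxy => ?_⟩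
    simp only [div_one, sub_self, Real.rpow_zero, mul_one]
    rw [mem_closedBall, dist_eq_norm] at hy
    have h1 := abs_le.1 (hub y (by rw [mem_closedBall, dist_eq_norm]; linarith))
    have h3 := abs_le.1 (hub x (by
      rw [mem_closedBall, dist_eq_norm]
      have : x - x0 = (x - y) + (y - x0) := by abel
      rw [this]; linarith [norm_add_le (x - y) (y - x0)]))
    linarith
end

section
variable {d : ℕ} {A B : Euc d → Matrix (Fin d) (Fin d) ℝ} {K c0 C c : ℝ}


def cl1 (R s : ℝ) : ℝ := max (-R) (min s R)

lemma cl1_abs {R : ℝ} (hR : 0 ≤ R) (s : ℝ) : |cl1 R s| ≤ R := by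
  unfold cl1
  rw [abs_le]
  exact ⟨le_max_left _ _, max_le (by linarith) (min_le_right _ _)⟩

lemma cl1_eq {R s : ℝ} (h : |s| ≤ R) : cl1 R s = s := by
  have := abs_le.1 h
  unfold cl1
  rw [min_eq_left this.2, max_eq_right this.1]

lemma cl1_lip (R s t : ℝ) : |cl1 R s - cl1 R t| ≤ |s - t| := by
  unfold cl1
  have h1 := abs_max_sub_max_le_max (-R) (min s R) (-R) (min t R)
  have h2 := abs_min_sub_min_le_max s R t R
  simp only [sub_self, abs_zero] at h1 h2
  have e1 : max 0 |min s R - min t R| = |min s R - min t R| := max_eq_right (abs_nonneg _)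
  have e2 : max |s - t| 0 = |s - t| := max_eq_left (abs_nonneg _)
  rw [e1] at h1
  rw [e2] at h2
  exact h1.trans h2

def clV (R : ℝ) (x : Euc d) : Euc d := vec fun i => cl1 R (x i)

lemma norm_mono_coord {z w : Euc d} (h : ∀ i, |z i| ≤ |w i|) : ‖z‖ ≤ ‖w‖ := by
  rw [EuclideanSpace.norm_eq, EuclideanSpace.norm_eq]
  refine Real.sqrt_le_sqrt (Finset.sum_le_sum fun i _ => ?_)
  simp only [Real.norm_eq_abs]
  exact pow_le_pow_left₀ (abs_nonneg _) (h i) 2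

lemma clV_eq {R : ℝ} {x : Euc d} (h : ‖x‖ ≤ R) : clV R x = x := by
  ext i
  exact cl1_eq ((abs_coord_le x i).trans h)

lemma clV_norm {R : ℝ} (hR : 0 ≤ R) (x : Euc d) : ‖clV R x‖ ≤ d * R :=
  vec_norm_le _ fun i => cl1_abs hR _

lemma clV_lip (R : ℝ) (x y : Euc d) : ‖clV R x - clV R y‖ ≤ ‖x - y‖ :=
  norm_mono_coord fun i => cl1_lip R (x i) (y i)

lemma clV_cont (R : ℝ) : Continuous (clV (d := d) R) :=
  (LipschitzWith.of_dist_le_mul (K := 1) fun x y => by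
    rw [dist_eq_norm, dist_eq_norm, NNReal.coe_one, one_mul]; exact clV_lip R x y).continuous


def LHf {ι : Type*} (f : ι → Euc d → ℝ) : Prop :=
  ∀ r : ℝ, ∃ C, 0 ≤ C ∧ ∀ i x, ‖x‖ ≤ r → |f i x| ≤ C ∧ ∀ y, ‖y‖ ≤ r → |f i y - f i x| ≤ C * Real.sqrt ‖y - x‖

namespace LHf
variable {ι : Type*} {f g : ι → Euc d → ℝ}

lemma add (hf : LHf f) (hg : LHf g) : LHf fun i x => f i x + g i x := by
  intro r
  obtain ⟨C1, h1, H1⟩ := hf r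
  obtain ⟨C2, h2, H2⟩ := hg r
  refine ⟨C1 + C2, by linarith, fun i x hx => ⟨?_, fun y hy => ?_⟩⟩
  · exact (abs_add_le _ _).trans (add_le_add (H1 i x hx).1 (H2 i x hx).1)
  · have e : f i y + g i y - (f i x + g i x) = (f i y - f i x) + (g i y - g i x) := by ring
    rw [e, add_mul]
    exact (abs_add_le _ _).trans (add_le_add ((H1 i x hx).2 y hy) ((H2 i x hx).2 y hy))

lemma mul (hf : LHf f) (hg : LHf g) : LHf fun i x => f i x * g i x := by
  intro r
  obtain ⟨C1, h1, H1⟩ := hf r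
  obtain ⟨C2, h2, H2⟩ := hg r
  refine ⟨2 * (C1 * C2), by positivity, fun i x hx => ⟨?_, fun y hy => ?_⟩⟩
  · rw [abs_mul]
    have := mul_le_mul (H1 i x hx).1 (H2 i x hx).1 (abs_nonneg _) h1
    nlinarith [mul_nonneg h1 h2]
  · have e : f i y * g i y - f i x * g i x = (f i y - f i x) * g i y + f i x * (g i y - g i x) := by ring
    rw [e]
    refine (abs_add_le _ _).trans ?_
    rw [abs_mul, abs_mul]
    have a1 := mul_le_mul ((H1 i x hx).2 y hy) (H2 i y hy).1 (abs_nonneg _) (by positivity)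
    have a2 := mul_le_mul (H1 i x hx).1 ((H2 i x hx).2 y hy) (abs_nonneg _) h1
    linarith

lemma const (c : ℝ) : LHf (d := d) fun (_ : ι) _ => c := fun r =>
  ⟨|c|, abs_nonneg _, fun i x _ => ⟨le_rfl, fun y _ => by simp; positivity⟩⟩

lemma neg (hf : LHf f) : LHf fun i x => - f i x := by
  have := (const (-1)).mul hf
  simpa using this

lemma sub (hf : LHf f) (hg : LHf g) : LHf fun i x => f i x - g i x := by
  have := hf.add hg.neg
  simpa [sub_eq_add_neg] using this

lemma sum {k : ℕ} {F : Fin k → ι → Euc d → ℝ} (h : ∀ l, LHf (F l)) : LHf fun i x => ∑ l, F l i x := by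
  classical
  have : ∀ s : Finset (Fin k), LHf fun i x => ∑ l ∈ s, F l i x := by
    intro s
    induction s using Finset.induction_on with
    | empty => simpa using const 0
    | insert a s ha ih => simp only [Finset.sum_insert ha]; exact (h a).add ih
  exact this _

lemma of_sqrt (h : ∀ r : ℝ, ∃ C, 0 ≤ C ∧ ∀ i x, ‖x‖ ≤ r → |f i x| ≤ C)
    (h' : ∀ r : ℝ, ∃ C, 0 ≤ C ∧ ∀ i x y, ‖x‖ ≤ r → ‖y‖ ≤ r → |f i y - f i x| ≤ C * Real.sqrt ‖y - x‖) : LHf f := by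
  intro r
  obtain ⟨C1, h1, H1⟩ := h r
  obtain ⟨C2, h2, H2⟩ := h' r
  refine ⟨C1 + C2, by linarith, fun i x hx => ⟨by linarith [H1 i x hx], fun y hy => (H2 i x y hx hy).trans ?_⟩⟩
  exact mul_le_mul_of_nonneg_right (by linarith) (Real.sqrt_nonneg _)

lemma lip_sqrt {r : ℝ} {x y : Euc d} (hx : ‖x‖ ≤ r) (hy : ‖y‖ ≤ r) :
    ‖y - x‖ ≤ Real.sqrt (2 * r) * Real.sqrt ‖y - x‖ := by
  have h1 : ‖y - x‖ ≤ 2 * r := by linarith [norm_sub_le y x]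
  have h2 : ‖y - x‖ = Real.sqrt ‖y - x‖ * Real.sqrt ‖y - x‖ := (Real.mul_self_sqrt (norm_nonneg _)).symm
  conv_lhs => rw [h2]
  exact mul_le_mul_of_nonneg_right (Real.sqrt_le_sqrt h1) (Real.sqrt_nonneg _)

lemma of_lip (h : ∀ r : ℝ, ∃ C, 0 ≤ C ∧ ∀ i x, ‖x‖ ≤ r → |f i x| ≤ C)
    (h' : ∀ r : ℝ, ∃ C, 0 ≤ C ∧ ∀ i x y, ‖x‖ ≤ r → ‖y‖ ≤ r → |f i y - f i x| ≤ C * ‖y - x‖) : LHf f := by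
  refine of_sqrt h fun r => ?_
  obtain ⟨C, h0, H⟩ := h' r
  refine ⟨C * Real.sqrt (2 * r), by positivity, fun i x y hx hy => (H i x y hx hy).trans ?_⟩
  rw [mul_assoc]
  exact mul_le_mul_of_nonneg_left (lip_sqrt hx hy) h0

lemma comap {ι' : Type*} (hf : LHf f) (e : ι' → ι) : LHf fun i x => f (e i) x := fun r => by
  obtain ⟨C, h0, H⟩ := hf r
  exact ⟨C, h0, fun i x hx => H (e i) x hx⟩

lemma of_C1 {u : Euc d → ℝ} {u' : Euc d → Euc d →L[ℝ] ℝ} (h : ∀ x, HasFDerivAt u (u' x) x) (hc : Continuous u') :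
    LHf fun (_ : ι) => u := by
  have hcu : Continuous u := continuous_iff_continuousAt.2 fun x => (h x).continuousAt
  have key : ∀ {E : Type} [NormedAddCommGroup E] (w : Euc d → E), Continuous w → ∀ r : ℝ, ∃ C, 0 ≤ C ∧ ∀ x, ‖x‖ ≤ r → ‖w x‖ ≤ C := by
    intro E _ w hw r
    obtain ⟨C, hC⟩ := (isCompact_closedBall (0 : Euc d) r).exists_bound_of_continuousOn hw.continuousOn
    exact ⟨|C|, abs_nonneg _, fun x hx => (hC x (by simpa using hx)).trans (le_abs_self _)⟩
  refine of_lip (fun r => ?_) fun r => ?_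
  · obtain ⟨C, h0, H⟩ := key u hcu r
    exact ⟨C, h0, fun _ x hx => H x hx⟩
  · obtain ⟨C, h0, H⟩ := key u' hc r
    refine ⟨C, h0, fun _ x y hx hy => ?_⟩
    have := (convex_closedBall (0 : Euc d) r).norm_image_sub_le_of_norm_hasFDerivWithin_le
      (fun z _ => (h z).hasFDerivWithinAt) (fun z hz => H z (by simpa using hz))
      (show x ∈ closedBall 0 r by simpa using hx) (show y ∈ closedBall 0 r by simpa using hy)
    simpa using this

end LHf

lemma FOK_of_LH {F : ℝ → Euc d → Euc d → ℝ} {N ℓ : ℝ} (h1 : Continuous fun z : ℝ × Euc d × Euc d => F z.1 z.2.1 z.2.2)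
    (h2 : ∀ t x p, |F t x p| ≤ N) (h3 : ∀ t x p q, |F t x p - F t x q| ≤ ℓ * ‖p - q‖)
    (h4 : LHf fun (i : ℝ × Euc d) x => F i.1 x i.2) : FOK F N ℓ := by
  refine ⟨h1, h2, h3, fun r => ?_⟩
  obtain ⟨C, h0, H⟩ := h4 (r + 1)
  have hN : 0 ≤ N := (abs_nonneg _).trans (h2 0 0 0)
  refine ⟨C + 2 * N, fun t x y p hx => ?_⟩
  by_cases hy : ‖y - x‖ ≤ 1
  · have hyr : ‖y‖ ≤ r + 1 := by
      have := norm_sub_norm_le y x; linarith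
    refine ((H (t, p) x (by linarith)).2 y hyr).trans ?_
    exact mul_le_mul_of_nonneg_right (by linarith) (Real.sqrt_nonneg _)
  · have h5 : 1 ≤ Real.sqrt ‖y - x‖ := by rw [Real.one_le_sqrt]; linarith
    have h6 := abs_sub (F t y p) (F t x p)
    have h7 := h2 t y p
    have h8 := h2 t x p
    nlinarith

structure C3b (g : Euc d → ℝ) (gp : Euc d → Fin d → ℝ) (gX : Euc d → Fin d → Fin d → ℝ) (Cg : ℝ) : Prop where
  c2 : C2f g gp gX
  b0 : ∀ x, |g x| ≤ Cg
  b1 : ∀ x i, |gp x i| ≤ Cg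
  b2 : ∀ x i j, |gX x i j| ≤ Cg
  cX : ∀ i j, Continuous fun x => gX x i j
  lh : ∀ i j, LHf fun (_ : Unit) x => gX x i j

lemma exists_C3b {g : Euc d → ℝ} (hg : ContDiff ℝ (⊤ : ℕ∞) g)
    (hW : ∃ C : ℝ, ∀ x, |g x| ≤ C ∧ ‖fderiv ℝ g x‖ ≤ C ∧ ‖fderiv ℝ (fderiv ℝ g) x‖ ≤ C) :
    ∃ gp gX Cg, C3b g gp gX Cg := by
  obtain ⟨C, hC⟩ := hW
  have hg1 : ContDiff ℝ (⊤ : ℕ∞) (fderiv ℝ g) := hg.fderiv_right (m := (⊤ : ℕ∞)) (by simp)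
  have hg2 : ContDiff ℝ (⊤ : ℕ∞) (fderiv ℝ (fderiv ℝ g)) := hg1.fderiv_right (m := (⊤ : ℕ∞)) (by simp)
  have s1 : ∀ i : Fin d, ‖(EuclideanSpace.single i (1:ℝ) : Euc d)‖ = 1 := fun i => by simp
  have hpp : ∀ i x, HasFDerivAt (fun x => fderiv ℝ g x (EuclideanSpace.single i 1))
      ((fderiv ℝ (fderiv ℝ g) x).flip (EuclideanSpace.single i 1)) x := by
    intro i x
    have h1 := ((hg1.differentiable (by simp)) x).hasFDerivAt
    refine (h1.clm_apply (hasFDerivAt_const (EuclideanSpace.single i (1:ℝ) : Euc d) x)).congr_fderiv ?_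
    ext v; simp
  refine ⟨fun x i => fderiv ℝ g x (EuclideanSpace.single i 1),
    fun x i j => fderiv ℝ (fderiv ℝ g) x (EuclideanSpace.single j 1) (EuclideanSpace.single i 1), C, ?_, ?_, ?_, ?_, ?_, ?_⟩
  · refine ⟨fun x => gr_fderiv ((hg.differentiable (by simp)) x).hasFDerivAt, fun x i => ?_⟩
    have := gr_fderiv (hpp i x)
    simpa using this
  · exact fun x => (hC x).1
  · intro x i
    have := (fderiv ℝ g x).le_opNorm (EuclideanSpace.single i 1)
    rw [s1, mul_one] at this
    exact this.trans (hC x).2.1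
  · intro x i j
    have := (fderiv ℝ (fderiv ℝ g) x).le_opNorm₂ (EuclideanSpace.single j 1) (EuclideanSpace.single i 1)
    rw [s1, s1, mul_one, mul_one] at this
    exact this.trans (hC x).2.2
  · intro i j
    exact (hg2.continuous.clm_apply continuous_const).clm_apply continuous_const
  · intro i j
    have h3 : ContDiff ℝ (⊤ : ℕ∞) fun x => fderiv ℝ (fderiv ℝ g) x (EuclideanSpace.single j 1) (EuclideanSpace.single i 1) :=
      (hg2.clm_apply contDiff_const).clm_apply contDiff_const
    exact LHf.of_C1 (fun x => ((h3.differentiable (by simp)) x).hasFDerivAt) (h3.continuous_fderiv (by simp))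

namespace C3b
variable {g : Euc d → ℝ} {gp : Euc d → Fin d → ℝ} {gX : Euc d → Fin d → Fin d → ℝ} {Cg : ℝ}

lemma cont (h : C3b g gp gX Cg) : Continuous g := continuous_iff_continuousAt.2 fun x => (h.c2.d1 x).continuousAt
lemma cp (h : C3b g gp gX Cg) (i : Fin d) : Continuous fun x => gp x i :=
  continuous_iff_continuousAt.2 fun x => (h.c2.d2 x i).continuousAt
lemma lh1 (h : C3b g gp gX Cg) (i : Fin d) : LHf fun (_ : Unit) x => gp x i :=
  LHf.of_C1 (fun x => h.c2.d2 x i) (gr_continuous fun j => h.cX i j)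
lemma lh0 (h : C3b g gp gX Cg) : LHf fun (_ : Unit) x => g x :=
  LHf.of_C1 (fun x => h.c2.d1 x) (gr_continuous fun j => h.cp j)
end C3b
end

section
variable {d : ℕ} {A B : Euc d → Matrix (Fin d) (Fin d) ℝ} {K c0 C c : ℝ}

lemma gr_add (a b : Fin d → ℝ) : gr (fun i => a i + b i) = gr a + gr b := by
  ext v; simp [gr_apply, add_mul, Finset.sum_add_distrib]
lemma gr_sub (a b : Fin d → ℝ) : gr (fun i => a i - b i) = gr a - gr b := by
  ext v; simp [gr_apply, sub_mul, Finset.sum_sub_distrib]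
lemma gr_smul (s : ℝ) (a : Fin d → ℝ) : gr (fun i => s * a i) = s • gr a := by
  ext v; simp [gr_apply, mul_assoc, Finset.mul_sum]

lemma trA_add (x : Euc d) (X Y : Fin d → Fin d → ℝ) : trA A x (fun i j => X i j + Y i j) = trA A x X + trA A x Y := by
  simp [trA, mul_add, Finset.sum_add_distrib]
lemma trA_sub (x : Euc d) (X Y : Fin d → Fin d → ℝ) : trA A x (fun i j => X i j - Y i j) = trA A x X - trA A x Y := by
  simp [trA, mul_sub, Finset.sum_sub_distrib]
lemma vec_sub (a b : Fin d → ℝ) : vec (fun i => a i - b i) = vec a - vec b := rfl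
lemma vec_add (a b : Fin d → ℝ) : vec (fun i => a i + b i) = vec a + vec b := rfl

lemma trA_bd (h : Coef d A B K c0) (x : Euc d) {X : Fin d → Fin d → ℝ} {b : ℝ} (hX : ∀ i j, |X i j| ≤ b) :
    |trA A x X| ≤ d * (d * (K * b)) := by
  refine abs_sum_le_card _ _ fun i => abs_sum_le_card _ _ fun j => ?_
  rw [abs_mul]
  exact mul_le_mul (h.Abd x i j) (hX i j) (abs_nonneg _) (by linarith [h.K1])

namespace Reg
variable {T : ℝ} {v v' : ℝ → Euc d → ℝ} {p p' : ℝ → Euc d → Fin d → ℝ} {X X' : ℝ → Euc d → Fin d → Fin d → ℝ}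
  {q q' : ℝ → Euc d → ℝ}

lemma add (h : Reg T v p X q) (h' : Reg T v' p' X' q') :
    Reg T (fun t x => v t x + v' t x) (fun t x i => p t x i + p' t x i) (fun t x i j => X t x i j + X' t x i j)
      (fun t x => q t x + q' t x) where
  cont := h.cont.add h'.cont
  pcont i := (h.pcont i).add (h'.pcont i)
  Xcont i j := (h.Xcont i j).add (h'.Xcont i j)
  qcont := h.qcont.add h'.qcont
  d1 t ht x := by rw [gr_add]; exact (h.d1 t ht x).add (h'.d1 t ht x)
  d2 t ht x i := by rw [gr_add]; exact (h.d2 t ht x i).add (h'.d2 t ht x i)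
  dt t ht x := (h.dt t ht x).add (h'.dt t ht x)

lemma sub (h : Reg T v p X q) (h' : Reg T v' p' X' q') :
    Reg T (fun t x => v t x - v' t x) (fun t x i => p t x i - p' t x i) (fun t x i j => X t x i j - X' t x i j)
      (fun t x => q t x - q' t x) where
  cont := h.cont.sub h'.cont
  pcont i := (h.pcont i).sub (h'.pcont i)
  Xcont i j := (h.Xcont i j).sub (h'.Xcont i j)
  qcont := h.qcont.sub h'.qcont
  d1 t ht x := by rw [gr_sub]; exact (h.d1 t ht x).sub (h'.d1 t ht x)
  d2 t ht x i := by rw [gr_sub]; exact (h.d2 t ht x i).sub (h'.d2 t ht x i)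
  dt t ht x := (h.dt t ht x).sub (h'.dt t ht x)

lemma shift (h : Reg T v p X q) {s : ℝ} (hs : 0 ≤ s) :
    Reg (T - s) (fun t x => v (t + s) x) (fun t x => p (t + s) x) (fun t x => X (t + s) x) (fun t x => q (t + s) x) := by
  have hc : ∀ S, ContinuousOn (fun z : ℝ × Euc d => (z.1 + s, z.2)) S := fun S => by fun_prop
  have m1 : MapsTo (fun z : ℝ × Euc d => (z.1 + s, z.2)) (Icc 0 (T - s) ×ˢ univ) (Icc 0 T ×ˢ univ) := by
    rintro ⟨t, x⟩ ⟨⟨h1, h2⟩, -⟩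
    exact ⟨⟨by simp at *; linarith, by simp at *; linarith⟩, trivial⟩
  have m2 : MapsTo (fun z : ℝ × Euc d => (z.1 + s, z.2)) (Ioo 0 (T - s) ×ˢ univ) (Ioo 0 T ×ˢ univ) := by
    rintro ⟨t, x⟩ ⟨⟨h1, h2⟩, -⟩
    exact ⟨⟨by simp at *; linarith, by simp at *; linarith⟩, trivial⟩
  refine ⟨h.cont.comp (hc _) m1, fun i => (h.pcont i).comp (hc _) m1, fun i j => (h.Xcont i j).comp (hc _) m2,
    h.qcont.comp (hc _) m2, fun t ht x => h.d1 _ ⟨by linarith [ht.1], by linarith [ht.2]⟩ x,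
    fun t ht x i => h.d2 _ ⟨by linarith [ht.1], by linarith [ht.2]⟩ x i, fun t ht x => ?_⟩
  exact (h.dt (t + s) ⟨by linarith [ht.1], by linarith [ht.2]⟩ x).comp_add_const t s

lemma mul {χ : Euc d → ℝ} {χp χX Cχ} (hχ : C3b χ χp χX Cχ) (h : Reg T v p X q) :
    Reg T (fun t x => χ x * v t x) (fun t x i => χ x * p t x i + v t x * χp x i)
      (fun t x i j => (χ x * X t x i j + p t x i * χp x j) + (v t x * χX x i j + χp x i * p t x j))
      (fun t x => χ x * q t x) := by
  have k0 : ∀ S, ContinuousOn (fun z : ℝ × Euc d => χ z.2) S := fun S => (hχ.cont.comp continuous_snd).continuousOn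
  have k1 : ∀ i S, ContinuousOn (fun z : ℝ × Euc d => χp z.2 i) S := fun i S => ((hχ.cp i).comp continuous_snd).continuousOn
  have k2 : ∀ i j S, ContinuousOn (fun z : ℝ × Euc d => χX z.2 i j) S := fun i j S => ((hχ.cX i j).comp continuous_snd).continuousOn
  have hs : (Ioo 0 T ×ˢ univ : Set (ℝ × Euc d)) ⊆ Icc 0 T ×ˢ univ := prod_mono Ioo_subset_Icc_self subset_rfl
  refine ⟨(k0 _).mul h.cont, fun i => ((k0 _).mul (h.pcont i)).add (h.cont.mul (k1 i _)), fun i j => ?_, (k0 _).mul h.qcont,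
    fun t ht x => ?_, fun t ht x i => ?_, fun t ht x => (h.dt t ht x).const_mul _⟩
  · exact (((k0 _).mul (h.Xcont i j)).add (((h.pcont i).mono hs).mul (k1 j _))).add
      (((h.cont.mono hs).mul (k2 i j _)).add ((k1 i _).mul ((h.pcont j).mono hs)))
  · rw [gr_add, gr_smul, gr_smul]
    exact (hχ.c2.d1 x).mul (h.d1 t ht x)
  · have hI : t ∈ Icc 0 T := ⟨ht.1.le, ht.2.le⟩
    rw [gr_add, gr_add, gr_add, gr_smul, gr_smul, gr_smul, gr_smul]
    exact ((hχ.c2.d1 x).mul (h.d2 t ht x i)).add ((h.d1 t hI x).mul (hχ.c2.d2 x i))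

lemma static {g : Euc d → ℝ} {gp gX Cg} (hg : C3b g gp gX Cg) (T : ℝ) :
    Reg T (fun _ x => g x) (fun _ x => gp x) (fun _ x => gX x) (fun _ _ => 0) :=
  ⟨(hg.cont.comp continuous_snd).continuousOn, fun i => ((hg.cp i).comp continuous_snd).continuousOn,
    fun i j => ((hg.cX i j).comp continuous_snd).continuousOn, continuousOn_const,
    fun _ _ x => hg.c2.d1 x, fun _ _ x i => hg.c2.d2 x i, fun t _ _ => hasDerivAt_const t _⟩

lemma cont_t (h : Reg T v p X q) (x : Euc d) : ContinuousOn (fun t => v t x) (Icc 0 T) :=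
  h.cont.comp (f := fun t : ℝ => (t, x)) (by fun_prop) fun t ht => ⟨ht, trivial⟩

lemma p_unique (h : Reg T v p X q) (h' : Reg T v' p' X' q') {t : ℝ} (ht : t ∈ Icc 0 T) {x : Euc d}
    (he : v t =ᶠ[nhds x] v' t) : p t x = p' t x := by
  have := (h.d1 t ht x).unique ((h'.d1 t ht x).congr_of_eventuallyEq he)
  funext i
  rw [← gr_single (p t x) i, this, gr_single]

end Reg

/-- comparison in integrated form -/
lemma cmpP {n : ℕ} {σ : Euc d → Fin n → Euc d} {S : ℝ} (hS : Sg A σ S) {T : ℝ} (hT : 0 < T) {ℓ : ℝ} (hℓ : 0 ≤ ℓ)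
    {v v' : ℝ → Euc d → ℝ} {p p' : ℝ → Euc d → Fin d → ℝ} {X X' : ℝ → Euc d → Fin d → Fin d → ℝ}
    {q q' : ℝ → Euc d → ℝ} (h : Reg T v p X q) (h' : Reg T v' p' X' q') {N N' c C : ℝ} (hC : 0 ≤ C)
    (hN : ∀ t ∈ Icc 0 T, ∀ x, |v t x| ≤ N) (hN' : ∀ t ∈ Icc 0 T, ∀ x, |v' t x| ≤ N')
    (h0 : ∀ x, v 0 x - v' 0 x ≤ c)
    (hs : ∀ t ∈ Ioo 0 T, ∀ x, (q t x - trA A x (X t x)) - (q' t x - trA A x (X' t x)) ≤ C + ℓ * ‖vec (p t x) - vec (p' t x)‖) :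
    ∀ t ∈ Icc 0 T, ∀ x, v t x - v' t x ≤ c + C * t := by
  have hw := h.sub h'
  have hb := maxPrin hS hT hℓ (w := fun t x => v t x - v' t x - (c + C * t)) (p := fun t x i => p t x i - p' t x i)
    (X := fun t x i j => X t x i j - X' t x i j) (q := fun t x => q t x - q' t x - C)
    (hw.cont.sub (by fun_prop)) (fun t ht => ⟨fun x => (hw.d1 t ⟨ht.1.le, ht.2.le⟩ x).sub_const _, hw.d2 t ht⟩)
    (fun t ht x => by
      refine (hw.dt t ht x).sub ?_
      simpa using ((hasDerivAt_id t).const_mul C).const_add c)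
    (M := N + N' + |c|) (fun t ht x => by
      have h1 := abs_le.1 (hN t ht x)
      have h2 := abs_le.1 (hN' t ht x)
      have h3 := neg_abs_le c
      have h4 := mul_nonneg hC ht.1
      linarith) (fun x => by have := h0 x; simp; linarith) (fun t ht x _ => by
      have := hs t ht x
      rw [trA_sub, vec_sub]
      linarith)
  intro t ht x
  have := hb t ht x
  linarith

/-- uniqueness for the linear problem -/
lemma uniqL {n : ℕ} {σ : Euc d → Fin n → Euc d} {S : ℝ} (hS : Sg A σ S) {T : ℝ} (hT : 0 < T)
    {v v' : ℝ → Euc d → ℝ} {p p' : ℝ → Euc d → Fin d → ℝ} {X X' : ℝ → Euc d → Fin d → Fin d → ℝ}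
    {q q' : ℝ → Euc d → ℝ} (h : Reg T v p X q) (h' : Reg T v' p' X' q') {N N' : ℝ}
    (hN : ∀ t ∈ Icc 0 T, ∀ x, |v t x| ≤ N) (hN' : ∀ t ∈ Icc 0 T, ∀ x, |v' t x| ≤ N')
    (h0 : ∀ x, v 0 x = v' 0 x)
    (hs : ∀ t ∈ Ioo 0 T, ∀ x, (q t x - trA A x (X t x)) = (q' t x - trA A x (X' t x))) :
    ∀ t ∈ Icc 0 T, v t = v' t ∧ p t = p' t := by
  have e : ∀ t ∈ Icc 0 T, v t = v' t := by
    intro t ht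
    funext x
    have h1 := cmpP hS hT le_rfl h h' le_rfl hN hN' (c := 0) (fun x => by rw [h0]; simp) (fun t ht x => by rw [hs t ht x]; simp) t ht x
    have h2 := cmpP hS hT le_rfl h' h le_rfl hN' hN (c := 0) (fun x => by rw [h0]; simp) (fun t ht x => by rw [hs t ht x]; simp) t ht x
    linarith
  exact fun t ht => ⟨e t ht, funext fun x => h.p_unique h' ht (by rw [e t ht])⟩

/-- gradient closeness from closeness of values -/
lemma interp {C C' ε : ℝ} (hC : 0 ≤ C) (hC' : 0 ≤ C') (hε : 0 < ε) : ∃ δ > 0, ∀ {d : ℕ} {u1 u2 : Euc d → ℝ}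
    {P1 P2 : Euc d → Fin d → ℝ} {x : Euc d} {i : Fin d} {η : ℝ}, (∀ y, HasFDerivAt u1 (gr (P1 y)) y) →
    (∀ y, HasFDerivAt u2 (gr (P2 y)) y) →
    (∀ y, ‖y - x‖ ≤ 1 → |P1 y i - P1 x i| ≤ C' * Real.sqrt ‖y - x‖) →
    (∀ y, ‖y - x‖ ≤ 1 → |P2 y i - P2 x i| ≤ C' * Real.sqrt ‖y - x‖) →
    (∀ y, ‖y - x‖ ≤ 1 → |u1 y - u2 y| ≤ C * η) → η ≤ δ → |P1 x i - P2 x i| ≤ ε := by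
  obtain ⟨h, hh0, hh1, hhε⟩ : ∃ h : ℝ, 0 < h ∧ h ≤ 1 ∧ 2 * (C' * Real.sqrt h) ≤ ε / 2 := by
    refine ⟨min 1 ((ε / (4 * (C' + 1))) ^ 2), lt_min one_pos (by positivity), min_le_left _ _, ?_⟩
    have h1 : Real.sqrt (min 1 ((ε / (4 * (C' + 1))) ^ 2)) ≤ ε / (4 * (C' + 1)) := by
      refine (Real.sqrt_le_sqrt (min_le_right _ _)).trans ?_
      rw [Real.sqrt_sq (by positivity)]
    have h2 : C' * (ε / (4 * (C' + 1))) ≤ ε / 4 := by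
      rw [mul_div_assoc', div_le_div_iff₀ (by positivity) (by norm_num)]
      nlinarith
    have := mul_le_mul_of_nonneg_left h1 hC'
    linarith
  refine ⟨ε * h / (4 * (C + 1)), by positivity, ?_⟩
  intro d u1 u2 P1 P2 x i η d1 d2 p1 p2 hu hη
  set e : Euc d := EuclideanSpace.single i 1 with he
  have hen : ‖e‖ = 1 := by simp [he]
  have key : ∀ {u : Euc d → ℝ} {P : Euc d → Fin d → ℝ}, (∀ y, HasFDerivAt u (gr (P y)) y) →
      (∀ y, ‖y - x‖ ≤ 1 → |P y i - P x i| ≤ C' * Real.sqrt ‖y - x‖) →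
      |u (x + h • e) - u x - P x i * h| ≤ C' * Real.sqrt h * h := by
    intro u P hd hp
    have hder : ∀ s ∈ Icc (0:ℝ) h, HasDerivWithinAt (fun s : ℝ => u (x + s • e) - P x i * s) (P (x + s • e) i - P x i) (Icc 0 h) s := by
      intro s hs
      have h1 : HasDerivAt (fun s : ℝ => u (x + s • e)) (gr (P (x + s • e)) e) s :=
        (hd (x + s • e)).comp_hasDerivAt s (line_deriv x e s)
      rw [he, gr_single, ← he] at h1
      have := h1.sub ((hasDerivAt_id s).const_mul (P x i))
      simp only [mul_one] at this
      exact this.hasDerivWithinAt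
    have hb : ∀ s ∈ Icc (0:ℝ) h, ‖P (x + s • e) i - P x i‖ ≤ C' * Real.sqrt h := by
      intro s hs
      have hn : ‖x + s • e - x‖ = s := by rw [add_sub_cancel_left, norm_smul, hen, mul_one, Real.norm_of_nonneg hs.1]
      refine (hp _ (by rw [hn]; linarith [hs.2])).trans ?_
      rw [hn]
      exact mul_le_mul_of_nonneg_left (Real.sqrt_le_sqrt hs.2) hC'
    have := (convex_Icc (0:ℝ) h).norm_image_sub_le_of_norm_hasDerivWithin_le hder hb (left_mem_Icc.2 hh0.le) (right_mem_Icc.2 hh0.le)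
    simp only [zero_smul, add_zero, mul_zero, sub_zero, Real.norm_eq_abs, abs_of_pos hh0] at this
    rw [show u (x + h • e) - u x - P x i * h = u (x + h • e) - P x i * h - u x by ring]
    exact this
  have k1 := abs_le.1 (key d1 p1)
  have k2 := abs_le.1 (key d2 p2)
  have a1 := abs_le.1 (hu x (by simp))
  have a2 := abs_le.1 (hu (x + h • e) (by rw [add_sub_cancel_left, norm_smul, hen, mul_one, Real.norm_of_nonneg hh0.le]; exact hh1))
  have hCη : C * η ≤ ε / 4 * h := by
    have h1 := mul_le_mul_of_nonneg_left hη hC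
    have h2 : C * (ε * h / (4 * (C + 1))) ≤ ε / 4 * h := by
      rw [mul_div_assoc', div_le_iff₀ (by positivity)]
      nlinarith [mul_pos hε hh0]
    linarith
  have hle := mul_le_mul_of_nonneg_right hhε hh0.le
  rw [abs_le]
  constructor
  · refine le_of_mul_le_mul_right ?_ hh0
    linarith
  · refine le_of_mul_le_mul_right ?_ hh0
    linarith
end

section
variable {d : ℕ} {A B : Euc d → Matrix (Fin d) (Fin d) ℝ} {K c0 C c : ℝ}

/-- Globally controlled Hamiltonians. -/
structure HGl (G : Euc d → Euc d → ℝ) (m Λ μ a M : ℝ) : Prop where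
  hx : ∀ x y p, |G x p - G y p| ≤ (Λ * ‖p‖ ^ m + M) * ‖x - y‖
  hp : ∀ x p q, |G x p - G x q| ≤ Λ * (‖p‖ + ‖q‖ + 1) ^ (m - 1) * ‖p - q‖
  co : ∀ x p, a * ‖p‖ ^ m - M ≤ G x p
  lo : ∀ x p, -μ ≤ G x p
  up : ∀ x p, G x p ≤ Λ * (‖p‖ ^ m + 1)

variable {G : Euc d → Euc d → ℝ} {m Λ μ a M : ℝ}

lemma HGl.loc (h : HGl G m Λ μ a M) (x0 : Euc d) : HLoc G m Λ a M x0 :=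
  ⟨fun x _ y _ p => h.hx x y p, h.hp, fun x _ p => h.co x p⟩

lemma hp_lip (hm : 1 < m) (hΛ : 0 < Λ) (h : ∀ x p q, |G x p - G x q| ≤ Λ * (‖p‖ + ‖q‖ + 1) ^ (m - 1) * ‖p - q‖)
    {b : ℝ} {x p q : Euc d} (hp : ‖p‖ ≤ b) (hq : ‖q‖ ≤ b) :
    |G x p - G x q| ≤ Λ * (b + b + 1) ^ (m - 1) * ‖p - q‖ := by
  refine (h x p q).trans (mul_le_mul_of_nonneg_right (mul_le_mul_of_nonneg_left ?_ hΛ.le) (norm_nonneg _))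
  exact Real.rpow_le_rpow (by positivity) (by linarith) (by linarith)

lemma HGl.bd (h : HGl G m Λ μ a M) (hm : 1 < m) (hΛ : 0 < Λ) (hμ : 0 < μ) {b : ℝ} {p : Euc d} (hp : ‖p‖ ≤ b) (x : Euc d) :
    |G x p| ≤ μ + Λ * (b ^ m + 1) := by
  have h1 : ‖p‖ ^ m ≤ b ^ m := Real.rpow_le_rpow (norm_nonneg _) hp (by linarith)
  have h2 := mul_le_mul_of_nonneg_left h1 hΛ.le
  have h3 : 0 ≤ Λ * ‖p‖ ^ m := by positivity
  rw [abs_le]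
  constructor
  · linarith [h.lo x p]
  · linarith [h.up x p]

lemma contH (hm : 1 < m) (hΛ : 0 < Λ) (hp : ∀ x p q, |G x p - G x q| ≤ Λ * (‖p‖ + ‖q‖ + 1) ^ (m - 1) * ‖p - q‖)
    (hx : ∀ r : ℝ, ∃ D, ∀ x y p, ‖x‖ ≤ r → ‖y‖ ≤ r → ‖p‖ ≤ r → |G x p - G y p| ≤ D * ‖x - y‖) :
    Continuous fun z : Euc d × Euc d => G z.1 z.2 := by
  rw [continuous_iff_continuousAt]
  rintro ⟨x, p⟩
  obtain ⟨D, hD⟩ := hx (‖x‖ + ‖p‖ + 1)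
  have h1 : Tendsto (fun z : Euc d × Euc d => D * ‖z.1 - x‖ + Λ * ((‖p‖ + 1) + (‖p‖ + 1) + 1) ^ (m - 1) * ‖z.2 - p‖)
      (nhds (x, p)) (nhds 0) := by
    have : ContinuousAt (fun z : Euc d × Euc d => D * ‖z.1 - x‖ + Λ * ((‖p‖ + 1) + (‖p‖ + 1) + 1) ^ (m - 1) * ‖z.2 - p‖) (x, p) := by
      fun_prop
    simpa [ContinuousAt] using this
  have hb : ∀ᶠ z : Euc d × Euc d in nhds (x, p), ‖z.1‖ ≤ ‖x‖ + ‖p‖ + 1 ∧ ‖z.2‖ ≤ ‖p‖ + 1 := by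
    have o1 : IsOpen {z : Euc d × Euc d | ‖z.1‖ < ‖x‖ + ‖p‖ + 1} := isOpen_lt (by fun_prop) continuous_const
    have o2 : IsOpen {z : Euc d × Euc d | ‖z.2‖ < ‖p‖ + 1} := isOpen_lt (by fun_prop) continuous_const
    filter_upwards [o1.mem_nhds (show ‖x‖ < ‖x‖ + ‖p‖ + 1 by linarith [norm_nonneg p]), o2.mem_nhds (show ‖p‖ < ‖p‖ + 1 by linarith)] with z a1 a2
    exact ⟨le_of_lt a1, le_of_lt a2⟩
  rw [ContinuousAt, tendsto_iff_dist_tendsto_zero]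
  refine squeeze_zero' (Eventually.of_forall fun _ => dist_nonneg) ?_ h1
  filter_upwards [hb] with z hz
  rw [Real.dist_eq]
  have e : G z.1 z.2 - G x p = (G z.1 p - G x p) + (G z.1 z.2 - G z.1 p) := by ring
  rw [e]
  refine (abs_add_le _ _).trans (add_le_add ?_ ?_)
  · exact hD _ _ _ hz.1 (by linarith [norm_nonneg p]) (by linarith [norm_nonneg x])
  · exact hp_lip hm hΛ hp hz.2 (by linarith)

lemma HGl.cont (h : HGl G m Λ μ a M) (hm : 1 < m) (hΛ : 0 < Λ) : Continuous fun z : Euc d × Euc d => G z.1 z.2 := by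
  refine contH hm hΛ h.hp fun r => ⟨Λ * r ^ m + M, fun x y p _ _ hp => (h.hx x y p).trans ?_⟩
  refine mul_le_mul_of_nonneg_right ?_ (norm_nonneg _)
  have := mul_le_mul_of_nonneg_left (Real.rpow_le_rpow (norm_nonneg p) hp (by linarith : 0 ≤ m)) hΛ.le
  linarith

lemma Reg.mono {T T' : ℝ} {v p X q} (h : Reg (d := d) T v p X q) (hT : T' ≤ T) : Reg T' v p X q := by
  have i1 : (Icc 0 T' ×ˢ univ : Set (ℝ × Euc d)) ⊆ Icc 0 T ×ˢ univ := prod_mono (Icc_subset_Icc_right hT) subset_rfl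
  have i2 : (Ioo 0 T' ×ˢ univ : Set (ℝ × Euc d)) ⊆ Ioo 0 T ×ˢ univ := prod_mono (Ioo_subset_Ioo_right hT) subset_rfl
  exact ⟨h.cont.mono i1, fun i => (h.pcont i).mono i1, fun i j => (h.Xcont i j).mono i2, h.qcont.mono i2,
    fun t ht => h.d1 t (Icc_subset_Icc_right hT ht), fun t ht => h.d2 t (Ioo_subset_Ioo_right hT ht),
    fun t ht => h.dt t (Ioo_subset_Ioo_right hT ht)⟩

/-- Extension of a bound from the half-open interval to the closed interval. -/
lemma ext_T {T : ℝ} (hT : 0 < T) {f : ℝ → ℝ} {b : ℝ} (hf : ContinuousOn f (Icc 0 T)) (h : ∀ t ∈ Ioo 0 T, f t ≤ b) :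
    ∀ t ∈ Icc 0 T, f t ≤ b := by
  intro t ht
  have hcl : closure (Ioo 0 T) = Icc 0 T := closure_Ioo hT.ne
  rw [← hcl] at ht hf
  exact le_on_closure h hf continuousOn_const ht

variable {g : Euc d → ℝ} {gp : Euc d → Fin d → ℝ} {gX : Euc d → Fin d → Fin d → ℝ} {Cg : ℝ}

/-- constant of the barrier -/
def C00 (d : ℕ) (K Cg m Λ μ : ℝ) : ℝ := d * (d * (K * Cg)) + (μ + Λ * ((d * Cg) ^ m + 1))

set_option maxHeartbeats 800000 in
/-- A priori bounds for truncated problems (`G` globally Lipschitz in `p`). -/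
lemma apriori {n : ℕ} {σ : Euc d → Fin n → Euc d} {S : ℝ} (hS : Sg A σ S) (h : Coef d A B K c0) {T : ℝ} (hT : 0 < T) {ℓ : ℝ} (hℓ : 0 ≤ ℓ)
    (hg : C3b g gp gX Cg) {u p X q} (hu : Reg T u p X q) {N : ℝ} (hN : ∀ t ∈ Icc 0 T, ∀ x, |u t x| ≤ N)
    (h0 : ∀ x, u 0 x = g x) {Γ : Euc d → Euc d → ℝ} (hΓ : ∀ x p q, |Γ x p - Γ x q| ≤ ℓ * ‖p - q‖) {Cb : ℝ} (hCb : 0 ≤ Cb)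
    (hΓ0 : ∀ x, |trA A x (gX x) - Γ x (vec (gp x))| ≤ Cb)
    (heq : ∀ t ∈ Ioo 0 T, ∀ x, q t x - trA A x (X t x) = - Γ x (vec (p t x))) :
    (∀ t ∈ Icc 0 T, ∀ x, |u t x - g x| ≤ Cb * t) ∧ (∀ t ∈ Icc 0 T, ∀ s ∈ Icc 0 T, ∀ x, |u t x - u s x| ≤ Cb * |t - s|) ∧
    (∀ t ∈ Ioo 0 T, ∀ x, |q t x| ≤ Cb) := by
  have hst := Reg.static hg T
  have b1 : ∀ t ∈ Icc 0 T, ∀ x, |u t x - g x| ≤ Cb * t := by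
    intro t ht x
    have u1 := cmpP hS hT hℓ hu hst (c := 0) hCb hN (fun t _ x => hg.b0 x) (fun x => by rw [h0]; simp) (fun t ht x => by
      rw [heq t ht x]
      have h1 := abs_le.1 (hΓ0 x)
      have h2 := abs_le.1 (hΓ x (vec (p t x)) (vec (gp x)))
      linarith) t ht x
    have u2 := cmpP hS hT hℓ hst hu (c := 0) hCb (fun t _ x => hg.b0 x) hN (fun x => by rw [h0]; simp) (fun t ht x => by
      rw [heq t ht x, norm_sub_rev]
      have h1 := abs_le.1 (hΓ0 x)
      have h2 := abs_le.1 (hΓ x (vec (p t x)) (vec (gp x)))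
      linarith) t ht x
    rw [abs_le]; constructor <;> linarith
  have b2 : ∀ t ∈ Icc 0 T, ∀ s, 0 ≤ s → t + s ≤ T → ∀ x, |u (t + s) x - u t x| ≤ Cb * s := by
    intro t ht s hs hts x
    rcases ht.1.eq_or_lt with e | htp
    · rw [← e, zero_add, h0]; exact b1 s ⟨hs, by linarith⟩ x
    have hTs : 0 < T - s := by linarith
    have r1 := hu.shift hs
    have r2 := hu.mono (show T - s ≤ T by linarith)
    have n1 : ∀ t ∈ Icc 0 (T - s), ∀ x, |u (t + s) x| ≤ N := fun t ht x => hN _ ⟨by linarith [ht.1], by linarith [ht.2]⟩ x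
    have n2 : ∀ t ∈ Icc 0 (T - s), ∀ x, |u t x| ≤ N := fun t ht x => hN _ ⟨by linarith [ht.1], by linarith [ht.2]⟩ x
    have i1 : ∀ t ∈ Ioo 0 (T - s), t ∈ Ioo 0 T := fun t ht => ⟨ht.1, by linarith [ht.2]⟩
    have i2 : ∀ t ∈ Ioo 0 (T - s), t + s ∈ Ioo 0 T := fun t ht => ⟨by linarith [ht.1], by linarith [ht.2]⟩
    have hbs : ∀ x, |u s x - g x| ≤ Cb * s := b1 s ⟨hs, by linarith⟩
    have u1 := cmpP hS hTs hℓ r1 r2 (c := Cb * s) le_rfl n1 n2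
      (fun x => by rw [zero_add, h0]; exact (abs_le.1 (hbs x)).2) (fun t ht x => by
      rw [heq t (i1 t ht) x, heq _ (i2 t ht) x]
      have h2 := abs_le.1 (hΓ x (vec (p (t + s) x)) (vec (p t x)))
      linarith) t ⟨ht.1, by linarith⟩ x
    have u2 := cmpP hS hTs hℓ r2 r1 (c := Cb * s) le_rfl n2 n1
      (fun x => by rw [zero_add, h0]; linarith [(abs_le.1 (hbs x)).1]) (fun t ht x => by
      rw [heq t (i1 t ht) x, heq _ (i2 t ht) x, norm_sub_rev]
      have h2 := abs_le.1 (hΓ x (vec (p (t + s) x)) (vec (p t x)))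
      linarith) t ⟨ht.1, by linarith⟩ x
    rw [abs_le]; constructor <;> linarith
  have b3 : ∀ t ∈ Icc 0 T, ∀ s ∈ Icc 0 T, ∀ x, |u t x - u s x| ≤ Cb * |t - s| := by
    intro t ht s hs x
    rcases le_total s t with hl | hl
    · have := b2 s hs (t - s) (by linarith) (by linarith [ht.2]) x
      rw [abs_of_nonneg (show 0 ≤ t - s by linarith)]
      simpa using this
    · have := b2 t ht (s - t) (by linarith) (by linarith [hs.2]) x
      rw [abs_sub_comm t s, abs_of_nonneg (show 0 ≤ s - t by linarith), abs_sub_comm]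
      simpa using this
  refine ⟨b1, b3, fun t ht x => ?_⟩
  have := (hu.dt t ht x).le_of_lip' hCb (by
    filter_upwards [Ioo_mem_nhds ht.1 ht.2] with s hs
    exact b3 s ⟨hs.1.le, hs.2.le⟩ t ⟨ht.1.le, ht.2.le⟩ x)
  exact this

end

section
variable {d : ℕ} {A B : Euc d → Matrix (Fin d) (Fin d) ℝ} {K c0 C c : ℝ}
variable {G : Euc d → Euc d → ℝ} {m Λ μ a M : ℝ}
variable {g : Euc d → ℝ} {gp : Euc d → Fin d → ℝ} {gX : Euc d → Fin d → Fin d → ℝ} {Cg : ℝ}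

lemma lh_A (h : Coef d A B K c0) (i j : Fin d) : LHf fun (_ : Unit) x => A x i j := by
  refine LHf.of_lip (fun r => ⟨K, by linarith [h.K1], fun _ x _ => h.Abd x i j⟩) fun r => ⟨K, by linarith [h.K1], fun _ x y _ _ => h.Alip y x i j⟩

lemma lh_trA (h : Coef d A B K c0) {X : Euc d → Fin d → Fin d → ℝ} (hX : ∀ i j, LHf fun (_ : Unit) x => X x i j) :
    LHf fun (_ : Unit) x => trA A x (X x) :=
  LHf.sum (F := fun i (_ : Unit) x => ∑ j, A x i j * X x i j) fun i =>
    LHf.sum (F := fun j (_ : Unit) x => A x i j * X x i j) fun j => (lh_A h i j).mul (hX i j)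

lemma cont_trA (h : Coef d A B K c0) {X : Euc d → Fin d → Fin d → ℝ} (hX : ∀ i j, Continuous fun x => X x i j) :
    Continuous fun x => trA A x (X x) :=
  continuous_finsetSum _ fun i _ => continuous_finsetSum _ fun j _ => (h.Acont i j).mul (hX i j)

lemma C3b.lipv (hg : C3b g gp gX Cg) (x y : Euc d) : ‖vec (gp y) - vec (gp x)‖ ≤ d * (d * Cg) * ‖y - x‖ := by
  have h1 : ∀ i, |gp y i - gp x i| ≤ d * Cg * ‖y - x‖ := fun i => by
    have := Convex.norm_image_sub_le_of_norm_hasFDerivWithin_le (s := univ) (fun z _ => (hg.c2.d2 z i).hasFDerivWithinAt)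
      (fun z _ => gr_norm_le _ Cg (hg.b2 z i)) convex_univ (mem_univ x) (mem_univ y)
    simpa using this
  have := vec_norm_le (vec (gp y) - vec (gp x)) h1
  linarith

lemma trunc_FOK (h : Coef d A B K c0) (hm : 1 < m) (hΛ : 0 < Λ) (hμ : 0 < μ) (hM : 1 ≤ M) (hg : C3b g gp gX Cg) (hG : HGl G m Λ μ a M) {R : ℝ} (hR : 0 ≤ R) :
    FOK (fun (_ : ℝ) x p => trA A x (gX x) - G x (clV R (vec (gp x) + p)))
      (d * (d * (K * Cg)) + (μ + Λ * ((d * R) ^ m + 1))) (Λ * (d * R + d * R + 1) ^ (m - 1)) := by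
  have hgpc : Continuous fun x => vec (gp x) := vec_cont hg.cp
  have hcl : ∀ x p q, |G x (clV R p) - G x (clV R q)| ≤ Λ * (d * R + d * R + 1) ^ (m - 1) * ‖p - q‖ := fun x p q =>
    (hp_lip hm hΛ hG.hp (clV_norm hR p) (clV_norm hR q)).trans (mul_le_mul_of_nonneg_left (clV_lip R p q) (by positivity))
  have hb : ∀ x p, |G x (clV R p)| ≤ μ + Λ * ((d * R) ^ m + 1) := fun x p => hG.bd hm hΛ hμ (clV_norm hR p) x
  have hCg : 0 ≤ Cg := (abs_nonneg _).trans (hg.b0 0)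
  refine FOK_of_LH ?_ ?_ ?_ ?_
  · refine ((cont_trA h hg.cX).comp (continuous_fst.comp continuous_snd)).sub ?_
    refine (hG.cont hm hΛ).comp (f := fun z : ℝ × Euc d × Euc d => (z.2.1, clV R (vec (gp z.2.1) + z.2.2))) ?_
    refine (continuous_fst.comp continuous_snd).prodMk ((clV_cont R).comp ?_)
    exact (hgpc.comp (continuous_fst.comp continuous_snd)).add (continuous_snd.comp continuous_snd)
  · intro t x p
    exact (abs_sub _ _).trans (add_le_add (trA_bd h x (hg.b2 x)) (hb x _))
  · intro t x p q
    have := hcl x (vec (gp x) + q) (vec (gp x) + p)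
    rw [add_sub_add_left_eq_sub, norm_sub_rev] at this
    rw [show trA A x (gX x) - G x (clV R (vec (gp x) + p)) - (trA A x (gX x) - G x (clV R (vec (gp x) + q)))
      = G x (clV R (vec (gp x) + q)) - G x (clV R (vec (gp x) + p)) by ring]
    exact this
  · refine ((lh_trA h hg.lh).comap fun _ : ℝ × Euc d => ()).sub ?_
    set D := (Λ * (d * R) ^ m + M) + Λ * (d * R + d * R + 1) ^ (m - 1) * (d * (d * Cg)) with hD
    have hD0 : 0 ≤ D := by positivity
    refine LHf.of_lip (fun r => ⟨_, by positivity, fun i x _ => hb x _⟩) fun r => ⟨D, hD0, fun i x y _ _ => ?_⟩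
    have e : G y (clV R (vec (gp y) + i.2)) - G x (clV R (vec (gp x) + i.2)) = (G y (clV R (vec (gp y) + i.2)) - G x (clV R (vec (gp y) + i.2)))
      + (G x (clV R (vec (gp y) + i.2)) - G x (clV R (vec (gp x) + i.2))) := by ring
    rw [e, hD, add_mul]
    refine (abs_add_le _ _).trans (add_le_add ?_ ?_)
    · refine (hG.hx _ _ _).trans (mul_le_mul_of_nonneg_right ?_ (norm_nonneg _))
      have := mul_le_mul_of_nonneg_left (Real.rpow_le_rpow (norm_nonneg _) (clV_norm hR (vec (gp y) + i.2)) (by linarith : 0 ≤ m)) hΛ.le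
      linarith
    · refine (hcl _ _ _).trans ?_
      rw [add_sub_add_right_eq_sub, mul_assoc _ _ ‖y - x‖]
      exact mul_le_mul_of_nonneg_left (hg.lipv x y) (by positivity)

/-- An approximate solution. -/
structure Sol (A : Euc d → Matrix (Fin d) (Fin d) ℝ) (T : ℝ) (G : Euc d → Euc d → ℝ) (g : Euc d → ℝ) (C0 : ℝ) (u : ℝ → Euc d → ℝ) (p : ℝ → Euc d → Fin d → ℝ)
    (X : ℝ → Euc d → Fin d → Fin d → ℝ) (q : ℝ → Euc d → ℝ) : Prop where
  reg : Reg T u p X q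
  ini : ∀ x, u 0 x = g x
  eqn : ∀ t ∈ Ioo 0 T, ∀ x, q t x - trA A x (X t x) = - G x (vec (p t x))
  b1 : ∀ t ∈ Icc 0 T, ∀ x, |u t x - g x| ≤ C0 * t
  b2 : ∀ t ∈ Icc 0 T, ∀ s ∈ Icc 0 T, ∀ x, |u t x - u s x| ≤ C0 * |t - s|
  b3 : ∀ t ∈ Ioo 0 T, ∀ x, |q t x| ≤ C0
  gb : ∃ L, ∀ t ∈ Icc 0 T, ∀ x, ‖vec (p t x)‖ ≤ L
  hol : ∃ C, 0 ≤ C ∧ ∀ t ∈ Icc 0 T, ∀ x y i, |p t x i - p t y i| ≤ C * Real.sqrt ‖x - y‖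

lemma pcont_t {T : ℝ} {u p X q} (h : Reg (d := d) T u p X q) (x : Euc d) : ContinuousOn (fun t => ‖vec (p t x)‖) (Icc 0 T) := by
  refine (vec_contOn fun i => ?_).norm
  exact (h.pcont i).comp (f := fun t : ℝ => (t, x)) (by fun_prop) fun t ht => ⟨ht, trivial⟩

set_option maxHeartbeats 800000 in
theorem approx {n : ℕ} {σ : Euc d → Fin n → Euc d} {S lam : ℝ} (hS : Sg A σ S) (h : Coef d A B K c0) (hlam : 0 < lam) (hA4 : CondA4 d lam A) {T : ℝ} (hT : 0 < T)
    (hm : 1 < m) (hΛ : 0 < Λ) (hμ : 0 < μ) (ha : 0 < a) (hM : 1 ≤ M) (hg : C3b g gp gX Cg) (hG : HGl G m Λ μ a M) :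
    ∃ u p X q, Sol A T G g (C00 d K Cg m Λ μ) u p X q := by
  have hCg : 0 ≤ Cg := (abs_nonneg _).trans (hg.b0 0)
  have hK := h.K1
  obtain ⟨C0, hC0⟩ : ∃ C0, C0 = C00 d K Cg m Λ μ := ⟨_, rfl⟩
  have hC00 : 0 ≤ C0 := by rw [hC0]; unfold C00; positivity
  rw [← hC0]
  obtain ⟨L, hL0, hL⟩ := staticGrad (C := Cg + C0 * T + C0 + 1) hS.S1 hlam hm hΛ ha hM (by have := mul_nonneg hC00 hT.le; linarith)
  obtain ⟨R, hRd⟩ : ∃ R, R = L + d * Cg + d := ⟨_, rfl⟩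
  have hdC : 0 ≤ (d:ℝ) * Cg := by positivity
  have hd0 : (0:ℝ) ≤ d := by positivity
  have hR : 0 ≤ R := by linarith
  have hF := trunc_FOK h hm hΛ hμ hM hg hG hR
  obtain ⟨ℓ, hℓd⟩ : ∃ ℓ, ℓ = Λ * (d * R + d * R + 1) ^ (m - 1) := ⟨_, rfl⟩
  have hℓ : 0 ≤ ℓ := by rw [hℓd]; positivity
  rw [← hℓd] at hF
  obtain ⟨N, hN⟩ : ∃ N, N = d * (d * (K * Cg)) + (μ + Λ * ((d * R) ^ m + 1)) := ⟨_, rfl⟩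
  rw [← hN] at hF
  obtain ⟨C2, hC2, hE⟩ := thmE h hT hℓ
  obtain ⟨v, p, X, q, hv, hv0, hve, hvb, hpb, hph⟩ := hE N _ hF
  have hu := (Reg.static hg T).add hv
  have hNN : 0 ≤ N := (abs_nonneg _).trans (hF.bd 0 0 0)
  obtain ⟨u, hud⟩ : ∃ u : ℝ → Euc d → ℝ, u = fun t x => g x + v t x := ⟨_, rfl⟩
  obtain ⟨P, hPd⟩ : ∃ P : ℝ → Euc d → Fin d → ℝ, P = fun t x i => gp x i + p t x i := ⟨_, rfl⟩
  obtain ⟨Y, hYd⟩ : ∃ Y : ℝ → Euc d → Fin d → Fin d → ℝ, Y = fun t x i j => gX x i j + X t x i j := ⟨_, rfl⟩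
  obtain ⟨w, hwd⟩ : ∃ w : ℝ → Euc d → ℝ, w = fun t x => 0 + q t x := ⟨_, rfl⟩
  rw [← hud, ← hPd, ← hYd, ← hwd] at hu
  have hu0 : ∀ x, u 0 x = g x := fun x => by rw [hud]; simp [hv0]
  have heq : ∀ t ∈ Ioo 0 T, ∀ x, w t x - trA A x (Y t x) = - G x (clV R (vec (P t x))) := by
    intro t ht x
    have := hve t ht x
    rw [hwd, hYd, hPd, trA_add, vec_add]
    simp only
    linarith
  have hgpn : ∀ x, ‖vec (gp x)‖ ≤ d * Cg := fun x => vec_norm_le _ (hg.b1 x)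
  have hub0 : ∀ t ∈ Icc 0 T, ∀ x, |u t x| ≤ Cg + C2 * N := fun t ht x => by
    rw [hud]; exact (abs_add_le _ _).trans (add_le_add (hg.b0 x) (hvb t ht x))
  obtain ⟨b1, b2, b3⟩ := apriori hS h hT hℓ hg hu hub0 hu0 (Γ := fun x p => G x (clV R p)) (Cb := C0) (fun x p q => by
      rw [hℓd]
      exact (hp_lip hm hΛ hG.hp (clV_norm hR p) (clV_norm hR q)).trans (mul_le_mul_of_nonneg_left (clV_lip R p q) (by positivity)))
    hC00 (fun x => by
      rw [clV_eq ((hgpn x).trans (by linarith)), hC0]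
      exact (abs_sub _ _).trans (add_le_add (trA_bd h x (hg.b2 x)) (hG.bd hm hΛ hμ (hgpn x) x))) heq
  have hub : ∀ t ∈ Icc 0 T, ∀ x, |u t x| ≤ Cg + C0 * T := fun t ht x => by
    have h1 := b1 t ht x
    have h2 := hg.b0 x
    have h3 : u t x = (u t x - g x) + g x := by ring
    rw [h3]
    have := abs_add_le (u t x - g x) (g x)
    have := mul_le_mul_of_nonneg_left ht.2 hC00
    linarith
  obtain ⟨Cp, hCpd⟩ : ∃ Cp, Cp = d * Cg + 2 * Cg + C2 * N := ⟨_, rfl⟩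
  have hCp : 0 ≤ Cp := by rw [hCpd]; positivity
  have hhol : ∀ t ∈ Icc 0 T, ∀ x y i, |P t x i - P t y i| ≤ Cp * Real.sqrt ‖x - y‖ := by
    intro t ht x y i
    have h1 : |gp x i - gp y i| ≤ (d * Cg + 2 * Cg) * Real.sqrt ‖x - y‖ := by
      by_cases hxy : ‖x - y‖ ≤ 1
      · have := Convex.norm_image_sub_le_of_norm_hasFDerivWithin_le (s := univ) (fun z _ => (hg.c2.d2 z i).hasFDerivWithinAt)
          (fun z _ => gr_norm_le _ Cg (hg.b2 z i)) convex_univ (mem_univ y) (mem_univ x)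
        rw [Real.norm_eq_abs] at this
        have h5 : ‖x - y‖ ≤ Real.sqrt ‖x - y‖ := Real.le_sqrt_of_sq_le (by nlinarith [norm_nonneg (x - y)])
        have h6 := mul_le_mul_of_nonneg_left h5 hdC
        have h7 : 0 ≤ 2 * Cg * Real.sqrt ‖x - y‖ := by positivity
        linarith
      · have h5 : 1 ≤ Real.sqrt ‖x - y‖ := by rw [Real.one_le_sqrt]; linarith
        have h6 := (abs_sub (gp x i) (gp y i)).trans (add_le_add (hg.b1 x i) (hg.b1 y i))
        have h7 := mul_le_mul_of_nonneg_left h5 (by positivity : 0 ≤ d * Cg + 2 * Cg)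
        linarith
    have e : P t x i - P t y i = (gp x i - gp y i) + (p t x i - p t y i) := by rw [hPd]; ring
    rw [e, hCpd, add_mul _ (C2 * N)]
    exact (abs_add_le _ _).trans (add_le_add h1 (hph t ht x y i))
  -- stepping in time
  obtain ⟨δ, hδ, hI⟩ := interp hC00 hCp one_pos
  have step : ∀ k : ℕ, ∀ t ∈ Ico 0 T, t ≤ k * δ → ∀ x, ‖vec (P t x)‖ ≤ L + d * Cg := by
    intro k
    induction k with
    | zero =>
      intro t ht htk x
      have e : t = 0 := le_antisymm (by simpa using htk) ht.1
      have := hu.p_unique (Reg.static hg T) (t := 0) ⟨le_rfl, hT.le⟩ (x := x) (Eventually.of_forall hu0)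
      rw [e, this]
      linarith [hgpn x]
    | succ k ih =>
      intro t ht htk x
      rcases ht.1.eq_or_lt with e | htp
      · exact ih t ht (by rw [← e]; positivity) x
      have htI : t ∈ Icc 0 T := ⟨ht.1, ht.2.le⟩
      obtain ⟨s, hs1, hs2, hs3, hs4⟩ : ∃ s, 0 ≤ s ∧ s ≤ t ∧ s ≤ k * δ ∧ t - s ≤ δ := by
        refine ⟨max 0 (t - δ), le_max_left _ _, max_le ht.1 (by linarith), max_le (by positivity) ?_, ?_⟩
        · push_cast at htk; linarith
        · linarith [le_max_right 0 (t - δ)]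
      have hsI : s ∈ Icc 0 T := ⟨hs1, by linarith [ht.2]⟩
      have hPR : ∀ y, ‖vec (P t y)‖ ≤ R := by
        intro y
        have h1 := ih s ⟨hs1, lt_of_le_of_lt hs2 ht.2⟩ hs3 y
        have h2 : ‖vec (P t y) - vec (P s y)‖ ≤ d * 1 := by
          refine vec_norm_le _ fun i => ?_
          refine hI (u1 := u t) (u2 := u s) (x := y) (η := |t - s|) (hu.d1 t htI) (hu.d1 s hsI) (fun z _ => hhol t htI z y i) (fun z _ => hhol s hsI z y i)
            (fun z _ => b2 t htI s hsI z) ?_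
          rw [abs_of_nonneg (by linarith)]; exact hs4
        have h3 := norm_sub_norm_le (vec (P t y)) (vec (P s y))
        linarith
      have htO : t ∈ Ioo 0 T := ⟨htp, ht.2⟩
      have := hL hS h hA4 (hu.c2 htO) (hG.loc x) (fun y _ => by have := hub t htI y; linarith) (fun y _ => by
        have h1 := heq t htO y
        rw [clV_eq (hPR y)] at h1
        have h2 := b3 t htO y
        rw [show trA A y (Y t y) - G y (vec (P t y)) = w t y by linarith]
        have := mul_nonneg hC00 hT.le
        linarith)
      linarith
  have hall : ∀ t ∈ Icc 0 T, ∀ x, ‖vec (P t x)‖ ≤ L + d * Cg := by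
    intro t ht x
    refine ext_T hT (pcont_t hu x) (fun t ht => ?_) t ht
    obtain ⟨k, hk⟩ := exists_nat_ge (t / δ)
    rw [div_le_iff₀ hδ] at hk
    exact step k t ⟨ht.1.le, ht.2⟩ hk x
  refine ⟨u, P, Y, w, hu, hu0, fun t ht x => ?_, b1, b2, b3, ⟨_, hall⟩, ⟨Cp, hCp, hhol⟩⟩
  rw [heq t ht x, clV_eq ((hall t ⟨ht.1.le, ht.2.le⟩ x).trans (by linarith))]

/-- comparison of approximate solutions -/
theorem sol_cmp {n : ℕ} {σ : Euc d → Fin n → Euc d} {S : ℝ} (hS : Sg A σ S) {T : ℝ} (hT : 0 < T)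
    (hm : 1 < m) (hΛ : 0 < Λ) (hp : ∀ x p q, |G x p - G x q| ≤ Λ * (‖p‖ + ‖q‖ + 1) ^ (m - 1) * ‖p - q‖)
    {g1 g2 : Euc d → ℝ} {C1 C2 N1 N2 : ℝ} {u1 p1 X1 q1 u2 p2 X2 q2}
    (h1 : Sol A T G g1 C1 u1 p1 X1 q1) (h2 : Sol A T G g2 C2 u2 p2 X2 q2)
    (hN1 : ∀ t ∈ Icc 0 T, ∀ x, |u1 t x| ≤ N1) (hN2 : ∀ t ∈ Icc 0 T, ∀ x, |u2 t x| ≤ N2)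
    {c : ℝ} (hc : ∀ x, |g1 x - g2 x| ≤ c) :
    ∀ t ∈ Icc 0 T, ∀ x, |u1 t x - u2 t x| ≤ c := by
  obtain ⟨L1, hL1⟩ := h1.gb
  obtain ⟨L2, hL2⟩ := h2.gb
  obtain ⟨L, hL⟩ : ∃ L, L = |L1| + |L2| := ⟨_, rfl⟩
  have hL0 : 0 ≤ L := by rw [hL]; positivity
  have l1 : ∀ t ∈ Ioo 0 T, ∀ x, ‖vec (p1 t x)‖ ≤ L := fun t ht x => by
    have := hL1 t ⟨ht.1.le, ht.2.le⟩ x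
    linarith [le_abs_self L1, abs_nonneg L2]
  have l2 : ∀ t ∈ Ioo 0 T, ∀ x, ‖vec (p2 t x)‖ ≤ L := fun t ht x => by
    have := hL2 t ⟨ht.1.le, ht.2.le⟩ x
    linarith [le_abs_self L2, abs_nonneg L1]
  intro t ht x
  have hℓ : 0 ≤ Λ * (L + L + 1) ^ (m - 1) := by positivity
  have k1 := cmpP hS hT hℓ h1.reg h2.reg (c := c) le_rfl hN1 hN2 (fun x => by
      rw [h1.ini, h2.ini]; exact (abs_le.1 (hc x)).2) (fun t ht x => by
      rw [h1.eqn t ht x, h2.eqn t ht x]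
      have := abs_le.1 (hp_lip hm hΛ hp (x := x) (l1 t ht x) (l2 t ht x))
      linarith) t ht x
  have k2 := cmpP hS hT hℓ h2.reg h1.reg (c := c) le_rfl hN2 hN1 (fun x => by
      rw [h1.ini, h2.ini]; linarith [(abs_le.1 (hc x)).1]) (fun t ht x => by
      rw [h1.eqn t ht x, h2.eqn t ht x, norm_sub_rev]
      have := abs_le.1 (hp_lip hm hΛ hp (x := x) (l1 t ht x) (l2 t ht x))
      linarith) t ht x
  rw [abs_le]; constructor <;> linarith
end

section
variable {d : ℕ} {A B : Euc d → Matrix (Fin d) (Fin d) ℝ} {K c0 C c : ℝ}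
variable {G H : Euc d → Euc d → ℝ} {m Λ μ : ℝ}
variable {g : Euc d → ℝ} {gp : Euc d → Fin d → ℝ} {gX : Euc d → Fin d → Fin d → ℝ} {Cg : ℝ}

/-- Hamiltonians with local control in the space variable. -/
structure GLo (G : Euc d → Euc d → ℝ) (m Λ μ : ℝ) : Prop where
  hp : ∀ x p q, |G x p - G x q| ≤ Λ * (‖p‖ + ‖q‖ + 1) ^ (m - 1) * ‖p - q‖
  hx : ∀ r : ℝ, ∃ D, 0 ≤ D ∧ ∀ x y p, ‖x‖ ≤ r → ‖y‖ ≤ r → ‖p‖ ≤ r → |G x p - G y p| ≤ D * ‖x - y‖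
  bd : ∀ b, ∀ x p, ‖p‖ ≤ b → |G x p| ≤ μ + Λ * (b ^ m + 1)

/-- Space truncation of the Hamiltonian. -/
def Gn (H : Euc d → Euc d → ℝ) (n : ℕ) : Euc d → Euc d → ℝ := fun x p => H (clV (n : ℝ) x) p

lemma Gn_eq {n : ℕ} {x : Euc d} (h : ‖x‖ ≤ n) (p : Euc d) : Gn H n x p = H x p := by
  unfold Gn; rw [clV_eq h]

lemma Gn_HGl {a M : ℝ → ℝ} (hm : 1 < m) (hΛ : 0 < Λ) (h3 : CondH3 d m Λ H) (h4 : CondH4 d m Λ μ a M H) (n : ℕ) :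
    HGl (Gn H n) m Λ μ (a (d * n + 1)) (M (d * n + 1)) := by
  have hb : ∀ x : Euc d, clV (n:ℝ) x ∈ ball (0 : Euc d) (d * n + 1) := fun x => by
    rw [mem_ball_zero_iff]
    have := clV_norm (Nat.cast_nonneg n) x
    linarith
  obtain ⟨⟨h1, h2⟩, h5, h6⟩ := h4 (d * n + 1) (by positivity)
  refine ⟨fun x y p => ?_, fun x p q => h3 _ p q, fun x p => ?_, fun x p => ?_, fun x p => (h5 _ (hb x) p).2⟩
  · refine (h6 _ (hb x) _ (hb y) p).trans (mul_le_mul_of_nonneg_left (clV_lip _ x y) ?_)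
    positivity
  · exact (le_max_right _ _).trans (h5 _ (hb x) p).1
  · exact (le_max_left _ _).trans (h5 _ (hb x) p).1

lemma HGl.gl {a M : ℝ} (hm : 1 < m) (hΛ : 0 < Λ) (hμ : 0 < μ) (hM : 1 ≤ M) (h : HGl G m Λ μ a M) : GLo G m Λ μ := by
  refine ⟨h.hp, fun r => ⟨Λ * |r| ^ m + M, by positivity, fun x y p _ _ hp => (h.hx x y p).trans ?_⟩, fun b x p hp => h.bd hm hΛ hμ hp x⟩
  refine mul_le_mul_of_nonneg_right ?_ (norm_nonneg _)
  have := mul_le_mul_of_nonneg_left (Real.rpow_le_rpow (norm_nonneg p) (hp.trans (le_abs_self r)) (by linarith : 0 ≤ m)) hΛ.le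
  linarith

lemma H_GLo {a M : ℝ → ℝ} (hm : 1 < m) (hΛ : 0 < Λ) (hμ : 0 < μ) (h3 : CondH3 d m Λ H) (h4 : CondH4 d m Λ μ a M H) : GLo H m Λ μ := by
  have key : ∀ r : ℝ, ∃ n : ℕ, r ≤ n := fun r => exists_nat_ge r
  have hM : ∀ n : ℕ, 1 ≤ M (d * n + 1) := fun n => (h4 (d * n + 1) (by positivity)).1.2
  have hgl : ∀ n, GLo (Gn H n) m Λ μ := fun n => (Gn_HGl hm hΛ h3 h4 n).gl hm hΛ hμ (hM n)
  refine ⟨h3, fun r => ?_, fun b x p hp => ?_⟩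
  · obtain ⟨n, hn⟩ := key r
    obtain ⟨D, hD, h⟩ := (hgl n).hx r
    refine ⟨D, hD, fun x y p h1 h2 h3 => ?_⟩
    have := h x y p h1 h2 h3
    rwa [Gn_eq (h1.trans hn), Gn_eq (h2.trans hn)] at this
  · obtain ⟨n, hn⟩ := key ‖x‖
    have := (hgl n).bd b x p hp
    rwa [Gn_eq hn] at this

lemma GLo.cont (h : GLo G m Λ μ) (hm : 1 < m) (hΛ : 0 < Λ) : Continuous fun z : Euc d × Euc d => G z.1 z.2 :=
  contH hm hΛ h.hp fun r => by
    obtain ⟨D, _, hD⟩ := h.hx r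
    exact ⟨D, hD⟩

/-- Cutoff functions. -/
structure Cut (χ : Euc d → ℝ) (χp : Euc d → Fin d → ℝ) (χX : Euc d → Fin d → Fin d → ℝ) (Cχ r R : ℝ) : Prop where
  c3 : C3b χ χp χX Cχ
  one : ∀ x, ‖x‖ < r → χ x = 1 ∧ ∀ i, χp x i = 0
  zero : ∀ x, R < ‖x‖ → χ x = 0 ∧ (∀ i, χp x i = 0) ∧ ∀ i j, χX x i j = 0

lemma gr_zero_of {c : Fin d → ℝ} {f : Euc d → ℝ} {x : Euc d} {a : ℝ} (h : HasFDerivAt f (gr c) x) (h0 : f =ᶠ[nhds x] fun _ => a) (i : Fin d) : c i = 0 := by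
  have := h.unique ((hasFDerivAt_const a x).congr_of_eventuallyEq h0)
  rw [← gr_single c i, this]; rfl

lemma exists_bump (d : ℕ) {r : ℝ} (hr : 0 < r) : ∃ f : Euc d → ℝ, ContDiff ℝ (⊤ : ℕ∞) f ∧ HasCompactSupport f ∧ (∀ y : Euc d, ‖y‖ < r → f y = 1) ∧
      ∀ y : Euc d, r + 1 < ‖y‖ → f y = 0 := by
  obtain ⟨f, h1, h2⟩ : ∃ f : ContDiffBump (0 : Euc d), f.rIn = r ∧ f.rOut = r + 1 := ⟨⟨r, r + 1, hr, by linarith⟩, rfl, rfl⟩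
  refine ⟨f, f.contDiff, f.hasCompactSupport, fun y hy => f.one_of_mem_closedBall ?_, fun y hy => f.zero_of_le_dist ?_⟩
  · rw [mem_closedBall_zero_iff, h1]; exact hy.le
  · rw [dist_zero_right, h2]; exact hy.le

lemma cs_bd0 {V : Type*} [NormedAddCommGroup V] {f : Euc d → V} (h : Continuous f) (hc : HasCompactSupport f) : ∃ C : ℝ, ∀ x, ‖f x‖ ≤ C :=
  hc.exists_bound_of_continuous h

lemma cs_bd {f : Euc d → ℝ} (hf : ContDiff ℝ (⊤ : ℕ∞) f) (hc : HasCompactSupport f) :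
    ∃ C : ℝ, ∀ x, |f x| ≤ C ∧ ‖fderiv ℝ f x‖ ≤ C ∧ ‖fderiv ℝ (fderiv ℝ f) x‖ ≤ C := by
  have hf1 : ContDiff ℝ (⊤ : ℕ∞) (fderiv ℝ f) := hf.fderiv_right (m := (⊤ : ℕ∞)) (by simp)
  have hf2 : ContDiff ℝ (⊤ : ℕ∞) (fderiv ℝ (fderiv ℝ f)) := hf1.fderiv_right (m := (⊤ : ℕ∞)) (by simp)
  have hc1 : HasCompactSupport (fderiv ℝ f) := HasCompactSupport.fderiv ℝ hc
  have hc2 : HasCompactSupport (fderiv ℝ (fderiv ℝ f)) := HasCompactSupport.fderiv ℝ hc1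
  obtain ⟨C0, h0⟩ := cs_bd0 hf.continuous hc
  obtain ⟨C1, h1⟩ := cs_bd0 hf1.continuous hc1
  obtain ⟨C2, h2⟩ := cs_bd0 hf2.continuous hc2
  exact ⟨max C0 (max C1 C2), fun x => ⟨(h0 x).trans (le_max_left _ _),
    (h1 x).trans ((le_max_left _ _).trans (le_max_right _ _)), (h2 x).trans ((le_max_right _ _).trans (le_max_right _ _))⟩⟩

lemma exists_cut (d : ℕ) {r : ℝ} (hr : 0 < r) : ∃ χ χp χX Cχ, Cut (d := d) χ χp χX Cχ r (r + 1) := by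
  obtain ⟨f, hf, hc, o1, o2⟩ := exists_bump d hr
  obtain ⟨χp, χX, Cχ, h⟩ := exists_C3b hf (cs_bd hf hc)
  refine ⟨f, χp, χX, Cχ, h, fun x hx => ?_, fun x hx => ?_⟩
  · have k1 : ∀ y : Euc d, ‖y‖ < r → f y = 1 := o1
    have o : IsOpen {y : Euc d | ‖y‖ < r} := isOpen_lt continuous_norm continuous_const
    refine ⟨k1 x hx, gr_zero_of (a := 1) (h.c2.d1 x) ?_⟩
    filter_upwards [o.mem_nhds hx] with y hy using k1 y hy
  · have k1 : ∀ y : Euc d, r + 1 < ‖y‖ → f y = 0 := o2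
    have o : IsOpen {y : Euc d | r + 1 < ‖y‖} := isOpen_lt continuous_const continuous_norm
    have k2 : ∀ y : Euc d, r + 1 < ‖y‖ → ∀ i, χp y i = 0 := fun y hy => gr_zero_of (a := 0) (h.c2.d1 y) (by
      filter_upwards [o.mem_nhds hy] with z hz using k1 z hz)
    refine ⟨k1 x hx, k2 x hx, fun i => gr_zero_of (a := 0) (h.c2.d2 x i) ?_⟩
    filter_upwards [o.mem_nhds hx] with y hy using k2 y hy i

/-- Commutator forcing term. -/
def Fl (A : Euc d → Matrix (Fin d) (Fin d) ℝ) (χ : Euc d → ℝ) (χp : Euc d → Fin d → ℝ) (χX : Euc d → Fin d → Fin d → ℝ)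
    (x : Euc d) (s v : ℝ) (p : Fin d → ℝ) : ℝ :=
  χ x * s - trA A x fun i j => p i * χp x j + (v * χX x i j + χp x i * p j)

variable {χ : Euc d → ℝ} {χp : Euc d → Fin d → ℝ} {χX : Euc d → Fin d → Fin d → ℝ} {Cχ r R : ℝ}

lemma Fl_sub (x : Euc d) (s v s' v' : ℝ) (p p' : Fin d → ℝ) :
    Fl A χ χp χX x s v p - Fl A χ χp χX x s' v' p' = Fl A χ χp χX x (s - s') (v - v') (fun i => p i - p' i) := by
  unfold Fl
  have : trA A x (fun i j => (p i - p' i) * χp x j + ((v - v') * χX x i j + χp x i * (p j - p' j))) =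
    trA A x (fun i j => p i * χp x j + (v * χX x i j + χp x i * p j)) - trA A x (fun i j => p' i * χp x j + (v' * χX x i j + χp x i * p' j)) := by
    rw [← trA_sub]; congr 1; funext i j; ring
  rw [this]; ring

lemma Fl_bd (h : Coef d A B K c0) (hχ : Cut χ χp χX Cχ r R) {x : Euc d} {s v b : ℝ} {p : Fin d → ℝ} (hb : 0 ≤ b)
    (h1 : ‖x‖ ≤ R → |s| ≤ b ∧ |v| ≤ b ∧ ∀ i, |p i| ≤ b) :
    |Fl A χ χp χX x s v p| ≤ (Cχ + d * (d * (K * (3 * Cχ)))) * b := by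
  have hC : 0 ≤ Cχ := (abs_nonneg _).trans (hχ.c3.b0 x)
  have hK := h.K1
  by_cases hx : ‖x‖ ≤ R
  · obtain ⟨hs, hv, hp⟩ := h1 hx
    unfold Fl
    refine (abs_sub _ _).trans ?_
    have k1 : |χ x * s| ≤ Cχ * b := by
      rw [abs_mul]; exact mul_le_mul (hχ.c3.b0 x) hs (abs_nonneg _) hC
    have k2 := trA_bd h x (X := fun i j => p i * χp x j + (v * χX x i j + χp x i * p j)) (b := 3 * Cχ * b) (fun i j => by
      have e1 : |p i * χp x j| ≤ b * Cχ := by rw [abs_mul]; exact mul_le_mul (hp i) (hχ.c3.b1 x j) (abs_nonneg _) hb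
      have e2 : |v * χX x i j| ≤ b * Cχ := by rw [abs_mul]; exact mul_le_mul hv (hχ.c3.b2 x i j) (abs_nonneg _) hb
      have e3 : |χp x i * p j| ≤ Cχ * b := by rw [abs_mul]; exact mul_le_mul (hχ.c3.b1 x i) (hp j) (abs_nonneg _) hC
      have e4 := abs_add_le (p i * χp x j) (v * χX x i j + χp x i * p j)
      have e5 := abs_add_le (v * χX x i j) (χp x i * p j)
      linarith)
    calc _ ≤ _ := add_le_add k1 k2
      _ = _ := by ring
  · obtain ⟨z1, z2, z3⟩ := hχ.zero x (by linarith)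
    have : Fl A χ χp χX x s v p = 0 := by unfold Fl; simp [z1, z2, z3, trA]
    rw [this, abs_zero]; positivity

/-- Local data. -/
structure LD (T : ℝ) (u : ℝ → Euc d → ℝ) (p : ℝ → Euc d → Fin d → ℝ) : Prop where
  uc : ContinuousOn (fun z : ℝ × Euc d => u z.1 z.2) (Icc 0 T ×ˢ univ)
  pc : ∀ i, ContinuousOn (fun z : ℝ × Euc d => p z.1 z.2 i) (Icc 0 T ×ˢ univ)
  ul : LHf fun (t : ℝ) x => u (ct T t) x
  pl : ∀ i, LHf fun (t : ℝ) x => p (ct T t) x i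

variable {T : ℝ} {u : ℝ → Euc d → ℝ} {p : ℝ → Euc d → Fin d → ℝ}

lemma LHf.unif {k : ℕ} {ι : Type*} {f : Fin k → ι → Euc d → ℝ} (h : ∀ l, LHf (f l)) (r : ℝ) :
    ∃ C, 0 ≤ C ∧ ∀ l i x, ‖x‖ ≤ r → |f l i x| ≤ C ∧ ∀ y, ‖y‖ ≤ r → |f l i y - f l i x| ≤ C * Real.sqrt ‖y - x‖ := by
  choose D hD H using fun l => h l r
  refine ⟨∑ l, D l, Finset.sum_nonneg fun l _ => hD l, fun l i x hx => ?_⟩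
  have hl : D l ≤ ∑ l, D l := Finset.single_le_sum (f := D) (fun l _ => hD l) (Finset.mem_univ l)
  exact ⟨(H l i x hx).1.trans hl, fun y hy => ((H l i x hx).2 y hy).trans (mul_le_mul_of_nonneg_right hl (Real.sqrt_nonneg _))⟩

lemma LD.lG (hm : 1 < m) (hΛ : 0 < Λ) (hμ : 0 < μ) (hG : GLo G m Λ μ) (h : LD T u p) : LHf fun (t : ℝ) x => G x (vec (p (ct T t) x)) := by
  have hb : ∀ r : ℝ, ∃ b, 0 ≤ b ∧ ∀ (t : ℝ) x, ‖x‖ ≤ r → ‖vec (p (ct T t) x)‖ ≤ b ∧ ∀ y, ‖y‖ ≤ r →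
      ‖vec (p (ct T t) y) - vec (p (ct T t) x)‖ ≤ b * Real.sqrt ‖y - x‖ := fun r => by
    obtain ⟨C, hC, H⟩ := LHf.unif h.pl r
    refine ⟨d * C, by positivity, fun t x hx => ⟨vec_norm_le _ fun i => (H i t x hx).1, fun y hy => ?_⟩⟩
    rw [mul_assoc]
    exact vec_norm_le _ fun i => (H i t x hx).2 y hy
  refine LHf.of_sqrt (fun r => ?_) fun r => ?_
  · obtain ⟨b, hb0, H⟩ := hb r
    exact ⟨_, by positivity, fun t x hx => hG.bd b x _ (H t x hx).1⟩
  · obtain ⟨b, hb0, H⟩ := hb r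
    obtain ⟨D, hD, hx'⟩ := hG.hx (max r b)
    refine ⟨D * Real.sqrt (2 * r) + Λ * (b + b + 1) ^ (m - 1) * b, by positivity, fun t x y hx hy => ?_⟩
    have e : G y (vec (p (ct T t) y)) - G x (vec (p (ct T t) x)) = (G y (vec (p (ct T t) y)) - G x (vec (p (ct T t) y)))
      + (G x (vec (p (ct T t) y)) - G x (vec (p (ct T t) x))) := by ring
    rw [e, add_mul]
    refine (abs_add_le _ _).trans (add_le_add ?_ ?_)
    · refine (hx' y x _ (hy.trans (le_max_left _ _)) (hx.trans (le_max_left _ _)) ((H t y hy).1.trans (le_max_right _ _))).trans ?_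
      rw [mul_assoc]
      exact mul_le_mul_of_nonneg_left (LHf.lip_sqrt hx hy) hD
    · refine (hp_lip hm hΛ hG.hp (H t y hy).1 (H t x hx).1).trans ?_
      rw [mul_assoc _ b]
      exact mul_le_mul_of_nonneg_left ((H t x hx).2 y hy) (by positivity)

/-- The localised forcing. -/
def Fr (A : Euc d → Matrix (Fin d) (Fin d) ℝ) (χ : Euc d → ℝ) (χp : Euc d → Fin d → ℝ) (χX : Euc d → Fin d → Fin d → ℝ)
    (g : Euc d → ℝ) (gp : Euc d → Fin d → ℝ) (gX : Euc d → Fin d → Fin d → ℝ) (T : ℝ) (G : Euc d → Euc d → ℝ)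
    (u : ℝ → Euc d → ℝ) (p : ℝ → Euc d → Fin d → ℝ) (t : ℝ) (x : Euc d) (_ : Euc d) : ℝ :=
  Fl A χ χp χX x (trA A x (gX x) - G x (vec (p (ct T t) x))) (u (ct T t) x - g x) fun i => p (ct T t) x i - gp x i

lemma Fr_FOK (h : Coef d A B K c0) (hT : 0 < T) (hm : 1 < m) (hΛ : 0 < Λ) (hμ : 0 < μ) (hg : C3b g gp gX Cg) (hχ : Cut χ χp χX Cχ r R) (hG : GLo G m Λ μ) (hl : LD T u p)
    {N : ℝ} (hN : ∀ t x y, |Fr A χ χp χX g gp gX T G u p t x y| ≤ N) : FOK (Fr A χ χp χX g gp gX T G u p) N 0 := by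
  have hct : Continuous fun z : ℝ × Euc d × Euc d => (ct T z.1, z.2.1) :=
    ((ct_cont T).comp continuous_fst).prodMk (continuous_fst.comp continuous_snd)
  have hx : Continuous fun z : ℝ × Euc d × Euc d => z.2.1 := continuous_fst.comp continuous_snd
  have hcu : Continuous fun z : ℝ × Euc d × Euc d => u (ct T z.1) z.2.1 :=
    hl.uc.comp_continuous (f := fun z : ℝ × Euc d × Euc d => (ct T z.1, z.2.1)) hct fun z => ⟨ct_mem hT.le _, trivial⟩
  have hcp : ∀ i, Continuous fun z : ℝ × Euc d × Euc d => p (ct T z.1) z.2.1 i := fun i =>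
    (hl.pc i).comp_continuous (f := fun z : ℝ × Euc d × Euc d => (ct T z.1, z.2.1)) hct fun z => ⟨ct_mem hT.le _, trivial⟩
  have hcG : Continuous fun z : ℝ × Euc d × Euc d => G z.2.1 (vec (p (ct T z.1) z.2.1)) :=
    (hG.cont hm hΛ).comp (f := fun z : ℝ × Euc d × Euc d => (z.2.1, vec (p (ct T z.1) z.2.1))) (hx.prodMk (vec_cont hcp))
  refine FOK_of_LH ?_ hN (fun t x p q => ?_) ?_
  · unfold Fr Fl
    refine ((hχ.c3.cont.comp hx).mul (((cont_trA h hg.cX).comp hx).sub hcG)).sub ?_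
    refine continuous_finsetSum _ fun i _ => continuous_finsetSum _ fun j _ => ((h.Acont i j).comp hx).mul ?_
    have e1 : ∀ i, Continuous fun z : ℝ × Euc d × Euc d => p (ct T z.1) z.2.1 i - gp z.2.1 i := fun i => (hcp i).sub ((hg.cp i).comp hx)
    exact ((e1 i).mul ((hχ.c3.cp j).comp hx)).add (((hcu.sub (hg.cont.comp hx)).mul ((hχ.c3.cX i j).comp hx)).add
      (((hχ.c3.cp i).comp hx).mul (e1 j)))
  · simp [Fr]
  · suffices hh : LHf fun (t : ℝ) x => Fr A χ χp χX g gp gX T G u p t x 0 from hh.comap Prod.fst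
    let e : ℝ → Unit := fun _ => ()
    unfold Fr Fl
    refine LHf.sub ((hχ.c3.lh0.comap e).mul (((lh_trA h hg.lh).comap e).sub (hl.lG hm hΛ hμ hG))) ?_
    refine LHf.sum fun i => LHf.sum fun j => ((lh_A h i j).comap e).mul ?_
    have e1 : ∀ i, LHf fun (t : ℝ) x => p (ct T t) x i - gp x i := fun i => (hl.pl i).sub ((hg.lh1 i).comap e)
    exact ((e1 i).mul ((hχ.c3.lh1 j).comap e)).add (((hl.ul.sub (hg.lh0.comap e)).mul ((hχ.c3.lh i j).comap e)).add
      (((hχ.c3.lh1 i).comap e).mul (e1 j)))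
end

section
variable {d k : ℕ} {A B : Euc d → Matrix (Fin d) (Fin d) ℝ} {K c0 C c : ℝ}
variable {G H : Euc d → Euc d → ℝ} {m Λ μ S lam T : ℝ} {a M : ℝ → ℝ} {σ : Euc d → Fin k → Euc d}
variable {g : Euc d → ℝ} {gp : Euc d → Fin d → ℝ} {gX : Euc d → Fin d → Fin d → ℝ} {Cg : ℝ}
variable {χ : Euc d → ℝ} {χp : Euc d → Fin d → ℝ} {χX : Euc d → Fin d → Fin d → ℝ} {Cχ r R C0 : ℝ}
variable {u : ℝ → Euc d → ℝ} {p : ℝ → Euc d → Fin d → ℝ} {X : ℝ → Euc d → Fin d → Fin d → ℝ} {q : ℝ → Euc d → ℝ}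

/-- All standing assumptions. -/
structure Setup (A B : Euc d → Matrix (Fin d) (Fin d) ℝ) (K c0 : ℝ) (σ : Euc d → Fin k → Euc d) (S lam T m Λ μ : ℝ) (a M : ℝ → ℝ)
    (H : Euc d → Euc d → ℝ) : Prop where
  hS : Sg A σ S
  h : Coef d A B K c0
  hlam : 0 < lam
  hA4 : CondA4 d lam A
  hT : 0 < T
  hm : 1 < m
  hΛ : 0 < Λ
  hμ : 0 < μ
  h3 : CondH3 d m Λ H
  h4 : CondH4 d m Λ μ a M H

lemma Setup.gn (s : Setup A B K c0 σ S lam T m Λ μ a M H) (n : ℕ) : GLo (Gn H n) m Λ μ :=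
  (Gn_HGl s.hm s.hΛ s.h3 s.h4 n).gl s.hm s.hΛ s.hμ (s.h4 (d * n + 1) (by positivity)).1.2

lemma Sol.C0n (hT : 0 < T) (h : Sol A T G g C0 u p X q) : 0 ≤ C0 :=
  (abs_nonneg _).trans (h.b3 (T / 2) ⟨by linarith, by linarith⟩ 0)

lemma Sol.vb (hT : 0 < T) (h : Sol A T G g C0 u p X q) : ∀ t ∈ Icc 0 T, ∀ x, |u t x - g x| ≤ C0 * T := fun t ht x =>
  (h.b1 t ht x).trans (mul_le_mul_of_nonneg_left ht.2 (h.C0n hT))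

lemma Sol.ub (hT : 0 < T) (hg : C3b g gp gX Cg) (h : Sol A T G g C0 u p X q) : ∀ t ∈ Icc 0 T, ∀ x, |u t x| ≤ Cg + C0 * T := fun t ht x => by
  have h1 := h.vb hT t ht x
  have h2 := hg.b0 x
  have h3 := abs_add_le (u t x - g x) (g x)
  rw [sub_add_cancel] at h3
  linarith

lemma p_le (p : Fin d → ℝ) (i : Fin d) : |p i| ≤ ‖vec p‖ := abs_coord_le (vec p) i

lemma Sol.ld (hT : 0 < T) (hg : C3b g gp gX Cg) (h : Sol A T G g C0 u p X q) : LD T u p := by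
  obtain ⟨L, hL⟩ := h.gb
  obtain ⟨D, hD, hh⟩ := h.hol
  have hL0 : 0 ≤ L := (norm_nonneg _).trans (hL 0 ⟨le_rfl, hT.le⟩ 0)
  have hCg : 0 ≤ Cg := (abs_nonneg _).trans (hg.b0 0)
  have hC0 := h.C0n hT
  refine ⟨h.reg.cont, h.reg.pcont, ?_, fun i => ?_⟩
  · refine LHf.of_lip (fun r => ⟨Cg + C0 * T, by positivity, fun t x _ => h.ub hT hg _ (ct_mem hT.le t) x⟩) fun r =>
      ⟨d * L, by positivity, fun t x y _ _ => ?_⟩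
    have := Convex.norm_image_sub_le_of_norm_hasFDerivWithin_le (s := univ) (fun z _ => (h.reg.d1 _ (ct_mem hT.le t) z).hasFDerivWithinAt)
          (fun z _ => gr_norm_le _ L fun i => (p_le _ i).trans (hL _ (ct_mem hT.le t) z)) convex_univ (mem_univ x) (mem_univ y)
    rwa [Real.norm_eq_abs] at this
  · exact LHf.of_sqrt (fun r => ⟨L, hL0, fun t x _ => (p_le _ i).trans (hL _ (ct_mem hT.le t) x)⟩) fun r =>
      ⟨D, hD, fun t x y _ _ => hh _ (ct_mem hT.le t) y x i⟩

/-- The localised equation. -/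
lemma loc_eq (h : Sol A T G g C0 u p X q) {t : ℝ} (ht : t ∈ Ioo 0 T) (x y : Euc d) :
    χ x * (q t x - 0) - trA A x (fun i j => (χ x * (X t x i j - gX x i j) + (p t x i - gp x i) * χp x j) +
      ((u t x - g x) * χX x i j + χp x i * (p t x j - gp x j))) = Fr A χ χp χX g gp gX T G u p t x y := by
  unfold Fr Fl
  rw [ct_eq ⟨ht.1.le, ht.2.le⟩]
  have e : trA A x (fun i j => (χ x * (X t x i j - gX x i j) + (p t x i - gp x i) * χp x j) +
      ((u t x - g x) * χX x i j + χp x i * (p t x j - gp x j))) = χ x * (trA A x (X t x) - trA A x (gX x)) +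
      trA A x (fun i j => (p t x i - gp x i) * χp x j + ((u t x - g x) * χX x i j + χp x i * (p t x j - gp x j))) := by
    unfold trA
    rw [← Finset.sum_sub_distrib, Finset.mul_sum, ← Finset.sum_add_distrib]
    refine Finset.sum_congr rfl fun i _ => ?_
    rw [← Finset.sum_sub_distrib, Finset.mul_sum, ← Finset.sum_add_distrib]
    exact Finset.sum_congr rfl fun j _ => by ring
  rw [e]
  have := h.eqn t ht x
  linear_combination χ x * this

/-- Representation of the localised solution. -/
lemma loc_rep (hS : Sg A σ S) (hT : 0 < T) (hg : C3b g gp gX Cg) (hχ : Cut χ χp χX Cχ r R) (h : Sol A T G g C0 u p X q)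
    {W Wp WX Wq} {N' : ℝ} (hW : Reg (d := d) T W Wp WX Wq) (hW0 : ∀ x, W 0 x = 0)
    (hWe : ∀ t ∈ Ioo 0 T, ∀ x, Wq t x - trA A x (WX t x) = Fr A χ χp χX g gp gX T G u p t x (vec (Wp t x)))
    (hWb : ∀ t ∈ Icc 0 T, ∀ x, |W t x| ≤ N') :
    ∀ t ∈ Icc 0 T, ∀ x, ‖x‖ < r → u t x - g x = W t x ∧ ∀ i, p t x i - gp x i = Wp t x i := by
  have hw := (h.reg.sub (Reg.static hg T)).mul hχ.c3
  have hC : 0 ≤ Cχ := (abs_nonneg _).trans (hχ.c3.b0 0)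
  have hC0 := h.C0n hT
  have key := uniqL hS hT hw hW (N := Cχ * (C0 * T)) (N' := N') (fun t ht x => by
    rw [abs_mul]; exact mul_le_mul (hχ.c3.b0 x) (h.vb hT t ht x) (abs_nonneg _) hC) hWb (fun x => by rw [h.ini, hW0]; ring)
    (fun t ht x => by rw [hWe t ht x]; exact loc_eq h ht x _)
  intro t ht x hx
  obtain ⟨k1, k2⟩ := key t ht
  obtain ⟨o1, o2⟩ := hχ.one x hx
  have k3 := congrFun k1 x
  have k4 := fun i => congrFun (congrFun k2 x) i
  simp only [o1, o2, one_mul, mul_zero, add_zero] at k3 k4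
  exact ⟨k3, k4⟩

/-- Local gradient bound, uniform in the truncation. -/
lemma grad_loc (s : Setup A B K c0 σ S lam T m Λ μ a M H) (hg : C3b g gp gX Cg) (hC0 : 0 ≤ C0) {r : ℝ} (hr : 0 < r) :
    ∃ L, 0 < L ∧ ∀ n : ℕ, r + 2 ≤ n → ∀ {u p X q}, Sol A T (Gn H n) g C0 u p X q → ∀ t ∈ Icc 0 T, ∀ x, ‖x‖ ≤ r → ‖vec (p t x)‖ ≤ L := by
  obtain ⟨⟨ha, hM⟩, h5, h6⟩ := s.h4 (r + 2) (by linarith)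
  have hCg : 0 ≤ Cg := (abs_nonneg _).trans (hg.b0 0)
  have hCT := mul_nonneg hC0 s.hT.le
  obtain ⟨L, hL0, hL⟩ := staticGrad (C := Cg + C0 * T + C0 + 1) s.hS.S1 s.hlam s.hm s.hΛ ha.1 hM (by linarith)
  refine ⟨L, hL0, fun n hn u p X q h t ht x hx => ?_⟩
  refine ext_T s.hT (pcont_t h.reg x) (fun t ht => ?_) t ht
  have hin : ∀ y ∈ closedBall x 1, y ∈ ball (0 : Euc d) (r + 2) ∧ ‖y‖ ≤ n := fun y hy => by
    rw [mem_closedBall, dist_eq_norm] at hy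
    rw [mem_ball_zero_iff]
    have := norm_sub_norm_le y x
    constructor <;> linarith
  refine hL s.hS s.h s.hA4 (h.reg.c2 ht) (G := Gn H n) ⟨fun y hy z hz P => ?_, fun y P Q => s.h3 _ P Q, fun y hy P => ?_⟩ (fun y _ => ?_) (fun y _ => ?_)
  · rw [Gn_eq (hin y hy).2, Gn_eq (hin z hz).2]; exact h6 _ (hin y hy).1 _ (hin z hz).1 P
  · rw [Gn_eq (hin y hy).2]; exact (le_max_right _ _).trans (h5 _ (hin y hy).1 P).1
  · have := h.ub s.hT hg t ⟨ht.1.le, ht.2.le⟩ y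
    linarith
  · have h1 := h.eqn t ht y
    have h2 := h.b3 t ht y
    rw [show trA A y (X t y) - Gn H n y (vec (p t y)) = q t y by linarith]
    linarith

lemma Fr_bd (s : Setup A B K c0 σ S lam T m Λ μ a M H) (hg : C3b g gp gX Cg) (hχ : Cut χ χp χX Cχ r R) (hG : GLo G m Λ μ) {L V : ℝ} (hL : 0 ≤ L) (hV : 0 ≤ V)
    (hb : ∀ t ∈ Icc 0 T, ∀ x, ‖x‖ ≤ R → |u t x - g x| ≤ V ∧ ‖vec (p t x)‖ ≤ L) (t : ℝ) (x y : Euc d) :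
    |Fr A χ χp χX g gp gX T G u p t x y| ≤
      (Cχ + d * (d * (K * (3 * Cχ)))) * ((d * (d * (K * Cg)) + (μ + Λ * (L ^ m + 1))) + V + (L + Cg)) := by
  have hCg : 0 ≤ Cg := (abs_nonneg _).trans (hg.b0 0)
  have hK := s.h.K1
  have := s.hΛ
  have := s.hμ
  have i1 : 0 ≤ d * (d * (K * Cg)) + (μ + Λ * (L ^ m + 1)) := by positivity
  refine Fl_bd s.h hχ (by linarith) fun hx => ?_
  obtain ⟨h1, h2⟩ := hb _ (ct_mem s.hT.le t) x hx
  refine ⟨?_, by linarith, fun i => ?_⟩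
  · have := (abs_sub (trA A x (gX x)) (G x (vec (p (ct T t) x)))).trans (add_le_add (trA_bd s.h x (hg.b2 x)) (hG.bd L x _ h2))
    linarith
  · have := (abs_sub (p (ct T t) x i) (gp x i)).trans (add_le_add ((p_le _ i).trans h2) (hg.b1 x i))
    linarith

/-- Local Hölder bound of the gradient, uniform in the truncation. -/
lemma hol_loc (s : Setup A B K c0 σ S lam T m Λ μ a M H) (hg : C3b g gp gX Cg) (hC0 : 0 ≤ C0) {r : ℝ} (hr : 0 < r) :
    ∃ D, 0 ≤ D ∧ ∀ n : ℕ, r + 3 ≤ n → ∀ {u p X q}, Sol A T (Gn H n) g C0 u p X q → ∀ t ∈ Icc 0 T, ∀ x y i, ‖x‖ < r → ‖y‖ < r →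
      |p t x i - p t y i| ≤ D * Real.sqrt ‖x - y‖ := by
  obtain ⟨χ, χp, χX, Cχ, hχ⟩ := exists_cut d hr
  obtain ⟨L, hL0, hL⟩ := grad_loc s hg hC0 (r := r + 1) (by linarith)
  obtain ⟨C2, hC2, hE⟩ := thmE s.h s.hT le_rfl
  obtain ⟨Dg, hDg, hg1⟩ := LHf.unif (f := fun i (_ : Unit) x => gp x i) hg.lh1 r
  have hCT := mul_nonneg hC0 s.hT.le
  obtain ⟨N, hN⟩ : ∃ N, N = (Cχ + d * (d * (K * (3 * Cχ)))) * ((d * (d * (K * Cg)) + (μ + Λ * (L ^ m + 1))) + C0 * T + (L + Cg)) := ⟨_, rfl⟩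
  have hCg : 0 ≤ Cg := (abs_nonneg _).trans (hg.b0 0)
  have hC : 0 ≤ Cχ := (abs_nonneg _).trans (hχ.c3.b0 0)
  have hK := s.h.K1
  have hN0 : 0 ≤ N := by
    have := s.hΛ
    have := s.hμ
    rw [hN]; positivity
  refine ⟨Dg + C2 * N, by positivity, fun n hn u p X q h t ht x y i hx hy => ?_⟩
  have hF := Fr_FOK s.h s.hT s.hm s.hΛ s.hμ hg hχ (s.gn n) (h.ld s.hT hg) (N := N) (fun t x y => by
    rw [hN]
    exact Fr_bd s hg hχ (s.gn n) hL0.le hCT (fun t ht x hx => ⟨h.vb s.hT t ht x, hL n (by linarith) h t ht x hx⟩) t x y)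
  obtain ⟨W, Wp, WX, Wq, hW, hW0, hWe, hWb, -, hWh⟩ := hE N _ hF
  have rep := loc_rep s.hS s.hT hg hχ h hW hW0 hWe hWb t ht
  have e1 := (rep x hx).2 i
  have e2 := (rep y hy).2 i
  have e : p t x i - p t y i = (gp x i - gp y i) + (Wp t x i - Wp t y i) := by rw [← e1, ← e2]; ring
  rw [e, add_mul]
  exact (abs_add_le _ _).trans (add_le_add ((hg1 i () y hy.le).2 x hx.le) (hWh t ht x y i))
end

section
variable {d k : ℕ} {A B : Euc d → Matrix (Fin d) (Fin d) ℝ} {K c0 C c : ℝ}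
variable {G H : Euc d → Euc d → ℝ} {m Λ μ S lam T : ℝ} {a M : ℝ → ℝ} {σ : Euc d → Fin k → Euc d}
variable {g : Euc d → ℝ} {gp : Euc d → Fin d → ℝ} {gX : Euc d → Fin d → Fin d → ℝ} {Cg : ℝ}
variable {χ : Euc d → ℝ} {χp : Euc d → Fin d → ℝ} {χX : Euc d → Fin d → Fin d → ℝ} {Cχ r R C0 : ℝ}

lemma ulim (U : Ultrafilter ℕ) {f : ℕ → ℝ} {b : ℝ} (h : ∀ᶠ n in (U : Filter ℕ), |f n| ≤ b) : ∃ l, Tendsto f U (nhds l) := by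
  have hc : IsCompact (Icc (-b) b) := isCompact_Icc
  rw [isCompact_iff_ultrafilter_le_nhds] at hc
  obtain ⟨l, -, hl⟩ := hc (U.map f) (by
    rw [le_principal_iff]
    show f ⁻¹' (Icc (-b) b) ∈ (U : Filter ℕ)
    filter_upwards [h] with n hn using abs_le.1 hn)
  exact ⟨l, hl⟩

lemma unif_of_equi {Z : Type*} [PseudoMetricSpace Z] {Kc : Set Z} (hK : IsCompact Kc) {U : Filter ℕ} [U.NeBot] {f : ℕ → Z → ℝ} {fl : Z → ℝ}
    {D : ℝ} (hD : 0 ≤ D) (h : ∀ᶠ n in U, ∀ z ∈ Kc, ∀ w ∈ Kc, |f n z - f n w| ≤ D * dist z w)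
    (hl : ∀ z ∈ Kc, Tendsto (fun n => f n z) U (nhds (fl z))) {ε : ℝ} (hε : 0 < ε) :
    ∀ᶠ n in U, ∀ z ∈ Kc, |f n z - fl z| ≤ ε := by
  have hlip : ∀ z ∈ Kc, ∀ w ∈ Kc, |fl z - fl w| ≤ D * dist z w := fun z hz w hw =>
    le_of_tendsto ((hl z hz).sub (hl w hw)).abs (h.mono fun n hn => hn z hz w hw)
  obtain ⟨δ, hδ, hδε⟩ : ∃ δ > 0, D * δ ≤ ε / 3 := by
    refine ⟨ε / (3 * (D + 1)), by positivity, ?_⟩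
    rw [mul_div_assoc', div_le_div_iff₀ (by positivity) (by norm_num)]
    nlinarith
  obtain ⟨t, ht1, ht2, ht3⟩ := hK.finite_cover_balls hδ
  have hev : ∀ᶠ n in U, ∀ z ∈ t, |f n z - fl z| ≤ ε / 3 := by
    rw [eventually_all_finite ht2]
    intro z hz
    have h0 := ((hl z (ht1 hz)).sub_const (fl z)).abs
    rw [sub_self, abs_zero] at h0
    exact (h0.eventually_lt_const (by positivity : (0:ℝ) < ε / 3)).mono fun n hn => hn.le
  filter_upwards [hev, h] with n h1 h2 z hz
  obtain ⟨w, hw, hzw⟩ := mem_iUnion₂.1 (ht3 hz)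
  have hw' := ht1 hw
  have k1 := h1 w hw
  have k2 := h2 z hz w hw'
  have k3 := hlip z hz w hw'
  have k4 : D * dist z w ≤ D * δ := mul_le_mul_of_nonneg_left (le_of_lt hzw) hD
  rw [abs_le] at *
  constructor <;> linarith [k1.1, k1.2, k2.1, k2.2, k3.1, k3.2]

lemma contOn_of_unif {U : Filter ℕ} [U.NeBot] {f : ℕ → ℝ → Euc d → ℝ} {fl : ℝ → Euc d → ℝ}
    (hc : ∀ n, ContinuousOn (fun z : ℝ × Euc d => f n z.1 z.2) (Icc 0 T ×ˢ univ))
    (h : ∀ r : ℝ, 0 < r → ∀ ε : ℝ, 0 < ε → ∀ᶠ n in U, ∀ t ∈ Icc 0 T, ∀ x : Euc d, ‖x‖ ≤ r → |f n t x - fl t x| ≤ ε) :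
    ContinuousOn (fun z : ℝ × Euc d => fl z.1 z.2) (Icc 0 T ×ˢ univ) := by
  rintro ⟨t, x⟩ ⟨ht, -⟩
  have hr : 0 < ‖x‖ + 1 := by positivity
  have h1 : ContinuousOn (fun z : ℝ × Euc d => fl z.1 z.2) (Icc 0 T ×ˢ ball 0 (‖x‖ + 1)) := by
    refine TendstoUniformlyOn.continuousOn (p := U) (F := fun n (z : ℝ × Euc d) => f n z.1 z.2) ?_
      (Eventually.of_forall fun n => (hc n).mono (prod_mono subset_rfl (subset_univ _))).frequently
    rw [Metric.tendstoUniformlyOn_iff]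
    intro ε hε
    filter_upwards [h _ hr (ε / 2) (by positivity)] with n hn z hz
    rw [dist_comm, Real.dist_eq]
    have := hn z.1 hz.1 z.2 (by have := hz.2; rw [mem_ball_zero_iff] at this; exact this.le)
    linarith
  refine (h1 (t, x) ⟨ht, by rw [mem_ball_zero_iff]; linarith⟩).mono_of_mem_nhdsWithin ?_
  refine mem_nhdsWithin.2 ⟨univ ×ˢ ball 0 (‖x‖ + 1), isOpen_univ.prod isOpen_ball, ⟨trivial, by rw [mem_ball_zero_iff]; linarith⟩, ?_⟩
  rintro ⟨s, y⟩ ⟨⟨-, hy⟩, hs, -⟩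
  exact ⟨hs, hy⟩

lemma Cut.oneX (hχ : Cut χ χp χX Cχ r R) {x : Euc d} (hx : ‖x‖ < r) (i j : Fin d) : χX x i j = 0 := by
  have o : IsOpen {y : Euc d | ‖y‖ < r} := isOpen_lt continuous_norm continuous_const
  refine gr_zero_of (a := 0) (hχ.c3.c2.d2 x i) ?_ j
  filter_upwards [o.mem_nhds hx] with y hy using (hχ.one y hy).2 i

lemma FOK.sub {F F' : ℝ → Euc d → Euc d → ℝ} {N N' N'' : ℝ} (h : FOK F N 0) (h' : FOK F' N' 0) (hb : ∀ t x p, |F t x p - F' t x p| ≤ N'') :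
    FOK (fun t x p => F t x p - F' t x p) N'' 0 := by
  refine ⟨h.cont.sub h'.cont, hb, fun t x p q => ?_, fun r => ?_⟩
  · have h1 := h.lip t x p q
    have h2 := h'.lip t x p q
    rw [zero_mul, abs_nonpos_iff] at *
    linarith
  · obtain ⟨C1, h1⟩ := h.hol r
    obtain ⟨C2, h2⟩ := h'.hol r
    refine ⟨C1 + C2, fun t x y p hx => ?_⟩
    rw [show F t y p - F' t y p - (F t x p - F' t x p) = (F t y p - F t x p) - (F' t y p - F' t x p) by ring, add_mul]
    exact (abs_sub _ _).trans (add_le_add (h1 t x y p hx) (h2 t x y p hx))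

lemma le_all_eps {x D : ℝ} (h : ∀ ε > 0, |x| ≤ D * ε) : x = 0 := by
  by_contra hx
  have hp := abs_pos.2 hx
  have h1 := h 1 one_pos
  have hD : 0 < D := by linarith
  have := h (|x| / (2 * D)) (by positivity)
  rw [show D * (|x| / (2 * D)) = |x| / 2 by field_simp] at this
  linarith

/-- The localised limit. -/
lemma loc_limit (s : Setup A B K c0 σ S lam T m Λ μ a M H) (hg : C3b g gp gX Cg) {U : Filter ℕ} [U.NeBot] (hU : U ≤ atTop)
    {u : ℕ → ℝ → Euc d → ℝ} {p : ℕ → ℝ → Euc d → Fin d → ℝ} {X : ℕ → ℝ → Euc d → Fin d → Fin d → ℝ} {q : ℕ → ℝ → Euc d → ℝ} (hs : ∀ n, Sol A T (Gn H n) g C0 (u n) (p n) (X n) (q n))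
    {ul : ℝ → Euc d → ℝ} {pl : ℝ → Euc d → Fin d → ℝ} (hl : LD T ul pl)
    (cu : ∀ r : ℝ, 0 < r → ∀ ε : ℝ, 0 < ε → ∀ᶠ n in U, ∀ t ∈ Icc 0 T, ∀ x : Euc d, ‖x‖ ≤ r → |u n t x - ul t x| ≤ ε)
    (cp : ∀ r : ℝ, 0 < r → ∀ ε : ℝ, 0 < ε → ∀ᶠ n in U, ∀ t ∈ Icc 0 T, ∀ x : Euc d, ‖x‖ ≤ r → ∀ i, |p n t x i - pl t x i| ≤ ε)
    (hLu : ∀ r : ℝ, 0 < r → ∃ L, 0 ≤ L ∧ ∀ᶠ n in U, ∀ t ∈ Icc 0 T, ∀ x : Euc d, ‖x‖ ≤ r → ‖vec (p n t x)‖ ≤ L)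
    (hLl : ∀ r : ℝ, 0 < r → ∃ L, 0 ≤ L ∧ ∀ t ∈ Icc 0 T, ∀ x : Euc d, ‖x‖ ≤ r → ‖vec (pl t x)‖ ≤ L)
    (hv : ∀ t ∈ Icc 0 T, ∀ x, |ul t x - g x| ≤ C0 * T) {r : ℝ} (hr : 0 < r) :
    ∃ w P Y Q, Reg T w P Y Q ∧ (∀ t ∈ Icc 0 T, ∀ x : Euc d, ‖x‖ < r → ul t x = w t x) ∧
      ∀ t ∈ Ioo 0 T, ∀ x, ‖x‖ < r → Q t x - trA A x (Y t x) = - H x (vec (P t x)) := by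
  have hC0 : 0 ≤ C0 := (hs 0).C0n s.hT
  have hCT := mul_nonneg hC0 s.hT.le
  obtain ⟨χ, χp, χX, Cχ, hχ⟩ := exists_cut d hr
  obtain ⟨L1, hL10, hL1⟩ := hLu (r + 1) (by linarith)
  obtain ⟨L2, hL20, hL2⟩ := hLl (r + 1) (by linarith)
  obtain ⟨C2, hC2, hE⟩ := thmE s.h s.hT le_rfl
  have hHG := H_GLo s.hm s.hΛ s.hμ s.h3 s.h4
  obtain ⟨N, hN⟩ : ∃ N : ℝ, ∀ t x y, |Fr A χ χp χX g gp gX T H ul pl t x y| ≤ N :=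
    ⟨_, fun t x y => Fr_bd s hg hχ hHG hL20 hCT (fun t ht x hx => ⟨hv t ht x, hL2 t ht x hx⟩) t x y⟩
  have hF := Fr_FOK s.h s.hT s.hm s.hΛ s.hμ hg hχ hHG hl hN
  obtain ⟨W, Wp, WX, Wq, hW, hW0, hWe, hWb, -, -⟩ := hE N _ hF
  obtain ⟨Lm, hLm⟩ : ∃ Lm, Lm = L1 + L2 := ⟨_, rfl⟩
  obtain ⟨E, hEd⟩ : ∃ E, E = Λ * (Lm + Lm + 1) ^ (m - 1) * d + 1 := ⟨_, rfl⟩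
  have hLm0 : 0 ≤ Lm := by linarith
  have hE1 : 1 ≤ E := by
    have := s.hΛ
    have : 0 ≤ Λ * (Lm + Lm + 1) ^ (m - 1) * d := by positivity
    linarith
  obtain ⟨Q1, hQ1⟩ : ∃ Q1, Q1 = (Cχ + d * (d * (K * (3 * Cχ)))) * E := ⟨_, rfl⟩
  have key : ∀ ε > 0, ∀ᶠ n in U, ∀ t ∈ Icc 0 T, ∀ x : Euc d, ‖x‖ < r → |u n t x - g x - W t x| ≤ C2 * Q1 * ε ∧
      ∀ i, |p n t x i - gp x i - Wp t x i| ≤ C2 * Q1 * ε := by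
    intro ε hε
    filter_upwards [cu (r + 1) (by linarith) ε hε, cp (r + 1) (by linarith) ε hε, hL1, hU (eventually_ge_atTop ⌈r + 1⌉₊)] with n k1 k2 k3 k4
    have hn : r + 1 ≤ n := (Nat.le_ceil _).trans (by exact_mod_cast k4)
    have hFn := Fr_FOK s.h s.hT s.hm s.hΛ s.hμ hg hχ (s.gn n) ((hs n).ld s.hT hg)
      (fun t x y => Fr_bd s hg hχ (s.gn n) hL10 hCT (fun t ht x hx => ⟨(hs n).vb s.hT t ht x, k3 t ht x hx⟩) t x y)
    have hdiff : ∀ t x y, |Fr A χ χp χX g gp gX T (Gn H n) (u n) (p n) t x y - Fr A χ χp χX g gp gX T H ul pl t x y| ≤ Q1 * ε := by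
      intro t x y
      unfold Fr
      rw [Fl_sub, hQ1, mul_assoc]
      refine Fl_bd s.h hχ (by positivity) fun hx => ?_
      have ht := ct_mem s.hT.le t
      have hεE : ε ≤ E * ε := by nlinarith
      refine ⟨?_, ?_, fun i => ?_⟩
      · rw [sub_sub_sub_cancel_left, Gn_eq (hx.trans hn), abs_sub_comm]
        refine (hp_lip s.hm s.hΛ s.h3 (b := Lm) ((k3 _ ht x hx).trans (by linarith)) ((hL2 _ ht x hx).trans (by linarith))).trans ?_
        have e1 : ‖vec (p n (ct T t) x) - vec (pl (ct T t) x)‖ ≤ d * ε := vec_norm_le _ fun i => k2 _ ht x hx i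
        have := s.hΛ
        refine (mul_le_mul_of_nonneg_left e1 (by positivity)).trans ?_
        rw [hEd, add_mul, mul_assoc _ _ ε, one_mul]
        linarith
      · rw [sub_sub_sub_cancel_right]; exact (k1 _ ht x hx).trans hεE
      · rw [sub_sub_sub_cancel_right]; exact (k2 _ ht x hx i).trans hεE
    obtain ⟨Z, Zp, ZX, Zq, hZ, hZ0, hZe, hZb, hZp, -⟩ := hE (Q1 * ε) _ (hFn.sub hF hdiff)
    have rep := loc_rep s.hS s.hT hg hχ (hs n) (hW.add hZ) (fun x => by rw [hW0, hZ0, add_zero]) (fun t ht x => by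
        have e1 := hWe t ht x
        have e2 := hZe t ht x
        rw [trA_add]
        simp only [Fr] at e1 e2 ⊢
        linarith) (N' := C2 * N + C2 * (Q1 * ε)) (fun t ht x => (abs_add_le _ _).trans (add_le_add (hWb t ht x) (hZb t ht x)))
    intro t ht x hx
    obtain ⟨r1, r2⟩ := rep t ht x hx
    refine ⟨?_, fun i => ?_⟩
    · rw [r1, add_sub_cancel_left, mul_assoc]; exact hZb t ht x
    · rw [r2 i, add_sub_cancel_left, mul_assoc]; exact hZp t ht x i
  have hd0 : ∀ x : Euc d, ‖x‖ < r → ‖x‖ ≤ r := fun x hx => hx.le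
  have e1 : ∀ t ∈ Icc 0 T, ∀ x : Euc d, ‖x‖ < r → ul t x - g x - W t x = 0 := fun t ht x hx => le_all_eps (D := 1 + C2 * Q1) fun ε hε => by
    obtain ⟨n, n1, n2⟩ := ((cu r hr ε hε).and (key ε hε)).exists
    have a1 := n1 t ht x hx.le
    have a2 := (n2 t ht x hx).1
    rw [abs_le] at *
    constructor <;> linarith [a1.1, a1.2, a2.1, a2.2]
  have e2 : ∀ t ∈ Icc 0 T, ∀ x : Euc d, ‖x‖ < r → ∀ i, pl t x i - gp x i - Wp t x i = 0 := fun t ht x hx i => le_all_eps (D := 1 + C2 * Q1) fun ε hε => by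
    obtain ⟨n, n1, n2⟩ := ((cp r hr ε hε).and (key ε hε)).exists
    have a1 := n1 t ht x hx.le i
    have a2 := (n2 t ht x hx).2 i
    rw [abs_le] at *
    constructor <;> linarith [a1.1, a1.2, a2.1, a2.2]
  refine ⟨_, _, _, _, (Reg.static hg T).add hW, fun t ht x hx => by linarith [e1 t ht x hx], fun t ht x hx => ?_⟩
  have ht' : t ∈ Icc 0 T := ⟨ht.1.le, ht.2.le⟩
  have w1 := hWe t ht x
  have w2 : (fun i => gp x i + Wp t x i) = pl t x := funext fun i => by linarith [e2 t ht' x hx i]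
  simp only [Fr, Fl, ct_eq ht', (hχ.one x hx).1, (hχ.one x hx).2, hχ.oneX hx] at w1
  have w3 : trA A x (fun _ _ => (0:ℝ)) = 0 := by simp [trA]
  simp only [mul_zero, zero_mul, add_zero, one_mul, w3, sub_zero] at w1
  rw [w2, trA_add]
  linarith
end

section
variable {d k : ℕ} {A B : Euc d → Matrix (Fin d) (Fin d) ℝ} {K c0 C c : ℝ}
variable {G H : Euc d → Euc d → ℝ} {m Λ μ S lam T : ℝ} {a M : ℝ → ℝ} {σ : Euc d → Fin k → Euc d}
variable {g : Euc d → ℝ} {gp : Euc d → Fin d → ℝ} {gX : Euc d → Fin d → Fin d → ℝ} {Cg C0 : ℝ}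

lemma ev_ge {U : Filter ℕ} (hU : U ≤ atTop) (b : ℝ) : ∀ᶠ n : ℕ in U, b ≤ n :=
  hU ((eventually_ge_atTop ⌈b⌉₊).mono fun n hn => (Nat.le_ceil _).trans (by exact_mod_cast hn))

theorem limit_sol (s : Setup A B K c0 σ S lam T m Λ μ a M H) (hg : C3b g gp gX Cg) (U : Ultrafilter ℕ) (hU : (U : Filter ℕ) ≤ atTop)
    {u : ℕ → ℝ → Euc d → ℝ} {p : ℕ → ℝ → Euc d → Fin d → ℝ} {X : ℕ → ℝ → Euc d → Fin d → Fin d → ℝ} {q : ℕ → ℝ → Euc d → ℝ}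
    (hs : ∀ n, Sol A T (Gn H n) g C0 (u n) (p n) (X n) (q n)) :
    ∃ ul : ℝ → Euc d → ℝ, (∀ t ∈ Icc 0 T, ∀ x, Tendsto (fun n => u n t x) U (nhds (ul t x))) ∧
      ContinuousOn (fun z : ℝ × Euc d => ul z.1 z.2) (Icc 0 T ×ˢ univ) ∧
      ∀ r : ℝ, 0 < r → ∃ w P Y Q, Reg T w P Y Q ∧ (∀ t ∈ Icc 0 T, ∀ x : Euc d, ‖x‖ < r → ul t x = w t x) ∧
      ∀ t ∈ Ioo 0 T, ∀ x, ‖x‖ < r → Q t x - trA A x (Y t x) = - H x (vec (P t x)) := by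
  have hC0 : 0 ≤ C0 := (hs 0).C0n s.hT
  have hT0 := s.hT.le
  choose Lf hLf0 hLf using fun (r : {r : ℝ // 0 < r}) => grad_loc (C0 := C0) s hg hC0 r.2
  choose Df hDf0 hDf using fun (r : {r : ℝ // 0 < r}) => hol_loc (C0 := C0) s hg hC0 r.2
  -- pointwise limits
  have l1 : ∀ t x, ∃ l, Tendsto (fun n => u n (ct T t) x) U (nhds l) := fun t x =>
    ulim U (b := Cg + C0 * T) (Eventually.of_forall fun n => (hs n).ub s.hT hg _ (ct_mem hT0 t) x)
  choose ul hul using l1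
  have hx1 : ∀ x : Euc d, 0 < ‖x‖ + 1 := fun x => by positivity
  have l2 : ∀ t x i, ∃ l, Tendsto (fun n => p n (ct T t) x i) U (nhds l) := fun t x i =>
    ulim U (b := Lf ⟨_, hx1 x⟩) (by
      filter_upwards [ev_ge hU (‖x‖ + 1 + 2)] with n hn
      exact (p_le _ i).trans (hLf ⟨_, hx1 x⟩ n hn (hs n) _ (ct_mem hT0 t) x (by simp)))
  choose pl hpl using l2
  have hul' : ∀ t ∈ Icc 0 T, ∀ x, Tendsto (fun n => u n t x) U (nhds (ul t x)) := fun t ht x => by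
    have := hul t x; rwa [ct_eq ht] at this
  have hpl' : ∀ t ∈ Icc 0 T, ∀ x i, Tendsto (fun n => p n t x i) U (nhds (pl t x i)) := fun t ht x i => by
    have := hpl t x i; rwa [ct_eq ht] at this
  -- Lipschitz estimates
  have lip : ∀ r : ℝ, 0 < r → ∃ D, 0 ≤ D ∧ ∀ᶠ n in (U : Filter ℕ), ∀ t ∈ Icc 0 T, ∀ t' ∈ Icc 0 T, ∀ x y : Euc d, ‖x‖ ≤ r → ‖y‖ ≤ r →
      |u n t x - u n t' y| ≤ C0 * |t - t'| + D * ‖x - y‖ := by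
    intro r hr
    have hL0 := hLf0 ⟨r, hr⟩
    refine ⟨d * Lf ⟨r, hr⟩, by positivity, ?_⟩
    filter_upwards [ev_ge hU (r + 2)] with n hn t ht t' ht' x y hx hy
    have k1 := (hs n).b2 t ht t' ht' x
    have k2 := Convex.norm_image_sub_le_of_norm_hasFDerivWithin_le (s := closedBall 0 r) (fun z _ => ((hs n).reg.d1 t' ht' z).hasFDerivWithinAt)
          (fun z hz => gr_norm_le _ (Lf ⟨r, hr⟩) fun i => (p_le _ i).trans (hLf ⟨r, hr⟩ n hn (hs n) t' ht' z (by simpa using hz)))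
          (convex_closedBall _ _) (by simpa using hy) (by simpa using hx)
    rw [Real.norm_eq_abs] at k2
    have k3 := abs_add_le (u n t x - u n t' x) (u n t' x - u n t' y)
    rw [sub_add_sub_cancel] at k3
    linarith
  have cu : ∀ r : ℝ, 0 < r → ∀ ε : ℝ, 0 < ε → ∀ᶠ n in (U : Filter ℕ), ∀ t ∈ Icc 0 T, ∀ x : Euc d, ‖x‖ ≤ r → |u n t x - ul t x| ≤ ε := by
    intro r hr ε hε
    obtain ⟨D, hD, hl⟩ := lip r hr
    have := unif_of_equi (Kc := Icc 0 T ×ˢ closedBall (0 : Euc d) r) (isCompact_Icc.prod (isCompact_closedBall _ _)) (U := (U : Filter ℕ))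
      (f := fun n z => u n z.1 z.2) (fl := fun z => ul z.1 z.2) (D := C0 + D) (by linarith) (by
        filter_upwards [hl] with n hn z hz w hw
        refine (hn z.1 hz.1 w.1 hw.1 z.2 w.2 (by simpa using hz.2) (by simpa using hw.2)).trans ?_
        rw [add_mul, ← Real.dist_eq, ← dist_eq_norm]
        exact add_le_add (mul_le_mul_of_nonneg_left (le_max_left _ _) hC0) (mul_le_mul_of_nonneg_left (le_max_right _ _) hD))
      (fun z hz => hul' z.1 hz.1 z.2) hε
    filter_upwards [this] with n hn t ht x hx
    exact hn (t, x) ⟨ht, by simpa using hx⟩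
  have cp : ∀ r : ℝ, 0 < r → ∀ ε : ℝ, 0 < ε → ∀ᶠ n in (U : Filter ℕ), ∀ t ∈ Icc 0 T, ∀ x : Euc d, ‖x‖ ≤ r → ∀ i, |p n t x i - pl t x i| ≤ ε := by
    intro r hr ε hε
    have hr2 : 0 < r + 2 := by linarith
    obtain ⟨δ, hδ, hI⟩ := interp zero_le_one (hDf0 ⟨_, hr2⟩) hε
    have hev : ∀ᶠ n : ℕ in (U : Filter ℕ), r + 2 + 3 ≤ (n:ℝ) ∧ ∀ t ∈ Icc 0 T, ∀ x : Euc d, ‖x‖ ≤ r + 1 → |u n t x - ul t x| ≤ δ / 2 :=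
      (ev_ge hU _).and (cu (r + 1) (by linarith) (δ / 2) (by linarith))
    filter_upwards [hev] with n hn t ht x hx i
    refine le_of_tendsto ((tendsto_const_nhds (x := p n t x i)).sub (hpl' t ht x i)).abs ?_
    filter_upwards [hev] with j hj
    have hy : ∀ y : Euc d, ‖y - x‖ ≤ 1 → ‖y‖ ≤ r + 1 := fun y hy => by
      have := norm_sub_norm_le y x; linarith
    refine hI (u1 := u n t) (u2 := u j t) (P1 := p n t) (P2 := p j t) (η := δ) ((hs n).reg.d1 t ht) ((hs j).reg.d1 t ht) (fun y h1 => ?_) (fun y h1 => ?_) (fun y h1 => ?_) le_rfl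
    · have := hy y h1
      exact hDf ⟨_, hr2⟩ n hn.1 (hs n) t ht y x i (by linarith) (by linarith)
    · have := hy y h1
      exact hDf ⟨_, hr2⟩ j hj.1 (hs j) t ht y x i (by linarith) (by linarith)
    · have e1 := hn.2 t ht y (hy y h1)
      have e2 := hj.2 t ht y (hy y h1)
      rw [abs_le] at *
      constructor <;> linarith [e1.1, e1.2, e2.1, e2.2]
  have hLu : ∀ r : ℝ, 0 < r → ∃ L, 0 ≤ L ∧ ∀ᶠ n in (U : Filter ℕ), ∀ t ∈ Icc 0 T, ∀ x : Euc d, ‖x‖ ≤ r → ‖vec (p n t x)‖ ≤ L := fun r hr =>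
    ⟨Lf ⟨r, hr⟩, (hLf0 _).le, by filter_upwards [ev_ge hU (r + 2)] with n hn t ht x hx using hLf ⟨r, hr⟩ n hn (hs n) t ht x hx⟩
  have hLp : ∀ r : ℝ, 0 < r → ∃ L, 0 ≤ L ∧ ∀ t ∈ Icc 0 T, ∀ x : Euc d, ‖x‖ ≤ r → ∀ i, |pl t x i| ≤ L := fun r hr => by
    obtain ⟨L, hL0, hL⟩ := hLu r hr
    refine ⟨L, hL0, fun t ht x hx i => le_of_tendsto (hpl' t ht x i).abs ?_⟩
    filter_upwards [hL] with n hn using (p_le _ i).trans (hn t ht x hx)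
  have hLl : ∀ r : ℝ, 0 < r → ∃ L, 0 ≤ L ∧ ∀ t ∈ Icc 0 T, ∀ x : Euc d, ‖x‖ ≤ r → ‖vec (pl t x)‖ ≤ L := fun r hr => by
    obtain ⟨L, hL0, hL⟩ := hLp r hr
    exact ⟨d * L, by positivity, fun t ht x hx => vec_norm_le _ fun i => hL t ht x hx i⟩
  have hub : ∀ t ∈ Icc 0 T, ∀ x, |ul t x| ≤ Cg + C0 * T := fun t ht x =>
    le_of_tendsto (hul' t ht x).abs (Eventually.of_forall fun n => (hs n).ub s.hT hg t ht x)
  have hv : ∀ t ∈ Icc 0 T, ∀ x, |ul t x - g x| ≤ C0 * T := fun t ht x =>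
    le_of_tendsto ((hul' t ht x).sub_const (g x)).abs (Eventually.of_forall fun n => (hs n).vb s.hT t ht x)
  have huc := contOn_of_unif (fun n => (hs n).reg.cont) cu
  have hnn : 0 ≤ Cg + C0 * T := (abs_nonneg _).trans (hub 0 ⟨le_rfl, hT0⟩ 0)
  have hab : ∀ r : ℝ, 0 < |r| + 1 := fun r => by positivity
  have hra : ∀ r : ℝ, r ≤ |r| + 1 := fun r => by linarith [le_abs_self r]
  have hld : LD T ul pl := by
    refine ⟨huc, fun i => ?_, ?_, fun i => ?_⟩
    · refine contOn_of_unif (U := (U : Filter ℕ)) (f := fun n t x => p n t x i) (fl := fun t x => pl t x i) (fun n => (hs n).reg.pcont i) fun r hr ε hε => ?_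
      filter_upwards [cp r hr ε hε] with n hn t ht x hx using hn t ht x hx i
    · refine LHf.of_lip (fun r => ⟨_, hnn, fun t x _ => hub _ (ct_mem hT0 t) x⟩) fun r => ?_
      obtain ⟨D, hD, hl⟩ := lip (|r| + 1) (hab r)
      refine ⟨D, hD, fun t x y hx hy => ?_⟩
      have htm := ct_mem hT0 t
      refine le_of_tendsto ((hul' _ htm y).sub (hul' _ htm x)).abs ?_
      filter_upwards [hl] with n hn
      have := hn _ htm _ htm y x (hy.trans (hra r)) (hx.trans (hra r))
      simpa using this
    · refine LHf.of_sqrt (fun r => ?_) fun r => ?_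
      · obtain ⟨L, hL0, hL⟩ := hLp (|r| + 1) (hab r)
        exact ⟨L, hL0, fun t x hx => hL _ (ct_mem hT0 t) x (hx.trans (hra r)) i⟩
      · refine ⟨Df ⟨_, hab r⟩, hDf0 _, fun t x y hx hy => ?_⟩
        have htm := ct_mem hT0 t
        refine le_of_tendsto ((hpl' _ htm y i).sub (hpl' _ htm x i)).abs ?_
        have hlt : r < |r| + 1 := by linarith [le_abs_self r]
        filter_upwards [ev_ge hU (|r| + 1 + 3)] with n hn
        exact hDf ⟨_, hab r⟩ n hn (hs n) _ htm y x i (by simp only; linarith) (by simp only; linarith)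
  exact ⟨ul, hul', huc, fun r hr => loc_limit s hg hU hs hld cu cp hLu hLl hv hr⟩
end

section
variable {d : ℕ} {A : Euc d → Matrix (Fin d) (Fin d) ℝ} {H : Euc d → Euc d → ℝ} {T : ℝ}

/-- identification of the derivatives of a function represented locally by a regular one -/
lemma local_derivs {ul w : ℝ → Euc d → ℝ} {P Y Q} {r : ℝ} (hR : Reg T w P Y Q)
    (he : ∀ t ∈ Icc 0 T, ∀ x : Euc d, ‖x‖ < r → ul t x = w t x) :
    ∀ t ∈ Ioo 0 T, ∀ x : Euc d, ‖x‖ < r →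
      HasDerivAt (fun s => ul s x) (Q t x) t ∧ HasFDerivAt (fun y => ul t y) (gr (P t x)) x ∧
      (∀ i, spacePartial d i (fun z => ul z.1 z.2) t x = P t x i) ∧
      (∀ i, HasFDerivAt (fun y => spacePartial d i (fun z => ul z.1 z.2) t y) (gr (Y t x i)) x) := by
  intro t ht x hx
  have hball : ∀ x : Euc d, ‖x‖ < r → ∀ᶠ y in nhds x, ‖y‖ < r := fun x hx =>
    (isOpen_lt continuous_norm continuous_const).mem_nhds hx
  have htc : t ∈ Icc 0 T := ⟨ht.1.le, ht.2.le⟩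
  have hf : ∀ x : Euc d, ‖x‖ < r → HasFDerivAt (fun y => ul t y) (gr (P t x)) x := fun x hx =>
    (hR.d1 t htc x).congr_of_eventuallyEq ((hball x hx).mono fun y hy => he t htc y hy)
  have hsp : ∀ x : Euc d, ‖x‖ < r → ∀ i, spacePartial d i (fun z => ul z.1 z.2) t x = P t x i := fun x hx i => by
    unfold spacePartial
    simp only
    rw [(hf x hx).fderiv, gr_single]
  refine ⟨(hR.dt t ht x).congr_of_eventuallyEq ?_, hf x hx, hsp x hx, fun i => ?_⟩
  · filter_upwards [isOpen_Ioo.mem_nhds ht] with s hs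
    exact he s ⟨hs.1.le, hs.2.le⟩ x hx
  · exact (hR.d2 t ht x i).congr_of_eventuallyEq ((hball x hx).mono fun y hy => hsp y hy i)

lemma contOn_local {f : ℝ × Euc d → ℝ} (h : ∀ r : ℝ, 0 < r → ∃ F : ℝ × Euc d → ℝ, ContinuousOn F (Ioo 0 T ×ˢ univ) ∧
    ∀ t ∈ Ioo 0 T, ∀ x : Euc d, ‖x‖ < r → f (t, x) = F (t, x)) : ContinuousOn f (Ioo 0 T ×ˢ univ) := by
  rintro ⟨t, x⟩ ⟨ht, -⟩
  obtain ⟨F, hF, he⟩ := h (‖x‖ + 1) (by positivity)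
  have hop : IsOpen (Ioo 0 T ×ˢ (univ : Set (Euc d))) := isOpen_Ioo.prod isOpen_univ
  have h1 : ContinuousAt F (t, x) := hF.continuousAt (hop.mem_nhds ⟨ht, mem_univ _⟩)
  refine (h1.congr ?_).continuousWithinAt
  have h2 : IsOpen {z : ℝ × Euc d | z.1 ∈ Ioo 0 T ∧ ‖z.2‖ < ‖x‖ + 1} :=
    (isOpen_Ioo.preimage continuous_fst).inter (isOpen_lt continuous_snd.norm continuous_const)
  have h3 : (t, x) ∈ {z : ℝ × Euc d | z.1 ∈ Ioo 0 T ∧ ‖z.2‖ < ‖x‖ + 1} := ⟨ht, by simp⟩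
  filter_upwards [h2.mem_nhds h3] with z hz
  exact (he z.1 hz.1 z.2 hz.2).symm

theorem classical_of_local {ul : ℝ → Euc d → ℝ} (hc : ContinuousOn (fun z : ℝ × Euc d => ul z.1 z.2) (Icc 0 T ×ˢ univ))
    (hl : ∀ r : ℝ, 0 < r → ∃ w P Y Q, Reg T w P Y Q ∧ (∀ t ∈ Icc 0 T, ∀ x : Euc d, ‖x‖ < r → ul t x = w t x) ∧
      ∀ t ∈ Ioo 0 T, ∀ x, ‖x‖ < r → Q t x - trA A x (Y t x) = - H x (vec (P t x))) :
    IsClassicalSolution d A H T (fun z => ul z.1 z.2) := by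
  have hess : ∀ {w P Y Q} {r : ℝ}, Reg T w P Y Q → (∀ t ∈ Icc 0 T, ∀ x : Euc d, ‖x‖ < r → ul t x = w t x) →
      ∀ t ∈ Ioo 0 T, ∀ x : Euc d, ‖x‖ < r → ∀ i j, spaceHessian d (fun z => ul z.1 z.2) t x i j = Y t x j i := by
    intro w P Y Q r hR he t ht x hx i j
    obtain ⟨h1, h2, h3, h4⟩ := local_derivs hR he t ht x hx
    have e : spaceHessian d (fun z => ul z.1 z.2) t x i j =
      fderiv ℝ (fun y => spacePartial d j (fun z => ul z.1 z.2) t y) x (EuclideanSpace.single i 1) := rfl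
    rw [e, (h4 j).fderiv, gr_single]
  refine ⟨hc, fun t ht x => ?_, contOn_local fun r hr => ?_, fun i => contOn_local fun r hr => ?_, fun i j => contOn_local fun r hr => ?_⟩
  · obtain ⟨w, P, Y, Q, hR, he, hq⟩ := hl (‖x‖ + 1) (by positivity)
    have hx : ‖x‖ < ‖x‖ + 1 := by simp
    obtain ⟨h1, h2, h3, h4⟩ := local_derivs hR he t ht x hx
    refine ⟨h1.differentiableAt, h2.differentiableAt, fun j => (h4 j).differentiableAt, ?_⟩
    have e1 : timeDeriv d (fun z => ul z.1 z.2) t x = Q t x := h1.deriv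
    have e2 : spaceGrad d (fun z => ul z.1 z.2) t x = vec (P t x) := by
      unfold spaceGrad
      simp only [h3]
      rfl
    have e3 : Matrix.trace (A x * spaceHessian d (fun z => ul z.1 z.2) t x) = trA A x (Y t x) := by
      unfold trA
      simp only [Matrix.trace, Matrix.diag, Matrix.mul_apply, hess hR he t ht x hx]
    unfold parabolicOp
    rw [e1, e2, e3, hq t ht x hx]
    ring
  · obtain ⟨w, P, Y, Q, hR, he, hq⟩ := hl r hr
    exact ⟨_, hR.qcont, fun t ht x hx => (local_derivs hR he t ht x hx).1.deriv⟩
  · obtain ⟨w, P, Y, Q, hR, he, hq⟩ := hl r hr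
    exact ⟨_, (hR.pcont i).mono (prod_mono Ioo_subset_Icc_self le_rfl), fun t ht x hx => (local_derivs hR he t ht x hx).2.2.1 i⟩
  · obtain ⟨w, P, Y, Q, hR, he, hq⟩ := hl r hr
    exact ⟨_, hR.Xcont j i, fun t ht x hx => hess hR he t ht x hx i j⟩
end

/-- **Comparison-type result for approximated classical solutions** (Proposition
`prop comparison-type`): under (A1)–(A4) and (H3)–(H4), for smooth initial data
`g¹, g² ∈ C^∞(ℝ^d) ∩ W^{2,∞}(ℝ^d)` there is a pair of bounded classical solutions
`u¹, u²` of the Cauchy problems with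
`‖u¹ - u²‖_{L^∞([0,T]×ℝ^d)} ≤ ‖g¹ - g²‖_{L^∞(ℝ^d)}`. -/
theorem statement9 (d : ℕ) (hd : 0 < d) (T : ℝ) (hT : 0 < T)
    (ΛA lam : ℝ) (hΛA : 0 < ΛA) (hlam : 0 < lam)
    (A : Euc d → Matrix (Fin d) (Fin d) ℝ)
    (hA : CondA d ΛA A) (hA3 : CondA3 d A) (hA4 : CondA4 d lam A)
    (m Λ μ : ℝ) (hm : 1 < m) (hΛ : 0 < Λ) (hμ : 0 < μ)
    (a M : ℝ → ℝ) (H : Euc d → Euc d → ℝ)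
    (hH3 : CondH3 d m Λ H) (hH4 : CondH4 d m Λ μ a M H)
    (g1 g2 : Euc d → ℝ) (hg1 : ContDiff ℝ (⊤ : ℕ∞) g1) (hg2 : ContDiff ℝ (⊤ : ℕ∞) g2)
    (hg1W : ∃ C : ℝ, ∀ x, |g1 x| ≤ C ∧ ‖fderiv ℝ g1 x‖ ≤ C ∧ ‖fderiv ℝ (fderiv ℝ g1) x‖ ≤ C)
    (hg2W : ∃ C : ℝ, ∀ x, |g2 x| ≤ C ∧ ‖fderiv ℝ g2 x‖ ≤ C ∧ ‖fderiv ℝ (fderiv ℝ g2) x‖ ≤ C) :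
    ∃ u1 u2 : ℝ × Euc d → ℝ,
      IsClassicalSolution d A H T u1 ∧ IsClassicalSolution d A H T u2 ∧
      (∃ C : ℝ, ∀ t ∈ Icc (0 : ℝ) T, ∀ x : Euc d, |u1 (t, x)| ≤ C ∧ |u2 (t, x)| ≤ C) ∧
      (∀ x, u1 (0, x) = g1 x) ∧ (∀ x, u2 (0, x) = g2 x) ∧
      ∀ c : ℝ, (∀ x, |g1 x - g2 x| ≤ c) →
        ∀ t ∈ Icc (0 : ℝ) T, ∀ x : Euc d, |u1 (t, x) - u2 (t, x)| ≤ c := by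
  obtain ⟨B, K, c0, h⟩ := exists_coef hd hΛA hlam hA hA3 hA4
  obtain ⟨k, σ, S, hS⟩ := exists_Sg hΛA hA
  obtain ⟨gp1, gX1, Cg1, hc1⟩ := exists_C3b hg1 hg1W
  obtain ⟨gp2, gX2, Cg2, hc2⟩ := exists_C3b hg2 hg2W
  have s : Setup A B K c0 σ S lam T m Λ μ a M H := ⟨hS, h, hlam, hA4, hT, hm, hΛ, hμ, hH3, hH4⟩
  have hr : ∀ n : ℕ, (0:ℝ) < d * n + 1 := fun n => by positivity
  choose v1 p1 X1 q1 s1 using fun n : ℕ => approx hS h hlam hA4 hT hm hΛ hμ (hH4 _ (hr n)).1.1.1 (hH4 _ (hr n)).1.2 hc1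
    (Gn_HGl hm hΛ hH3 hH4 n)
  choose v2 p2 X2 q2 s2 using fun n : ℕ => approx hS h hlam hA4 hT hm hΛ hμ (hH4 _ (hr n)).1.1.1 (hH4 _ (hr n)).1.2 hc2
    (Gn_HGl hm hΛ hH3 hH4 n)
  obtain ⟨u1, t1, cu1, l1⟩ := limit_sol s hc1 (hyperfilter ℕ) Nat.hyperfilter_le_atTop s1
  obtain ⟨u2, t2, cu2, l2⟩ := limit_sol s hc2 (hyperfilter ℕ) Nat.hyperfilter_le_atTop s2
  have h0 : (0:ℝ) ∈ Icc 0 T := ⟨le_rfl, hT.le⟩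
  refine ⟨fun z => u1 z.1 z.2, fun z => u2 z.1 z.2, classical_of_local cu1 l1, classical_of_local cu2 l2, ?_, fun x => ?_, fun x => ?_, ?_⟩
  · refine ⟨max (Cg1 + C00 d K Cg1 m Λ μ * T) (Cg2 + C00 d K Cg2 m Λ μ * T), fun t ht x => ⟨?_, ?_⟩⟩
    · exact (le_of_tendsto (t1 t ht x).abs (Eventually.of_forall fun n => (s1 n).ub hT hc1 t ht x)).trans (le_max_left _ _)
    · exact (le_of_tendsto (t2 t ht x).abs (Eventually.of_forall fun n => (s2 n).ub hT hc2 t ht x)).trans (le_max_right _ _)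
  · exact tendsto_nhds_unique (t1 0 h0 x) (by simp only [(s1 _).ini]; exact tendsto_const_nhds)
  · exact tendsto_nhds_unique (t2 0 h0 x) (by simp only [(s2 _).ini]; exact tendsto_const_nhds)
  · intro c hc t ht x
    refine le_of_tendsto ((t1 t ht x).sub (t2 t ht x)).abs (Eventually.of_forall fun n => ?_)
    exact sol_cmp hS hT hm hΛ (Gn_HGl hm hΛ hH3 hH4 n).hp (s1 n) (s2 n) ((s1 n).ub hT hc1) ((s2 n).ub hT hc2) hc t ht x
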